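/- Let Γ ⊂ ℂ be a bounded quasicircle with interior Ω and let f : 𝔻 → Ω be a conformal bijection. Then ∬_𝔻 |f''(z)/f'(z)|² dA(z) < ∞ (Γ is a Weil–Petersson quasicircle) if and only if Γ is rectifiable, say of length ℓ, and there exists a 2π-periodic measurable function b : ℝ → ℝ with finite Ḣ^{1/2}(S¹) seminorm such that a positively oriented arclength parametrization w of Γ satisfies w'(θ) = (ℓ/2π)·i·e^{iθ}·e^{i b(θ)} for almost every θ (equivalently, the derivative z'(ζ) with respect to ζ = e^{iθ} ∈ S¹ satisfies z'(ζ) = (ℓ/2π)e^{ib(ζ)}) (Shen–Liu). -/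

import Mathlib

/-!
STATEMENT 6 (Shen–Liu): a bounded quasicircle `Γ` is Weil–Petersson
(`∬_𝔻 |f''/f'|² dA < ∞` for the interior Riemann map `f`) if and only if `Γ` is rectifiable,
of some length `ℓ`, and there is a `2π`-periodic measurable real function `b` with finite
`Ḣ^{1/2}(S¹)` seminorm such that a positively oriented arclength parametrization `w` of `Γ`
satisfies `w'(θ) = (ℓ/2π)·i·e^{iθ}·e^{i b(θ)}` a.e.
-/

open MeasureTheory Metric Real

/-- The homogeneous `Ḣ^s(S¹)` seminorm (squared) of a `2π`-periodic function of the angle: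
`∬ |u(θ)−u(σ)|²/|e^{iθ}−e^{iσ}|^{1+2s} dθ dσ` over one period in each variable. -/
noncomputable def sobolevSeminorm (s : ℝ) (u : ℝ → ℂ) : ENNReal :=
  ∫⁻ θ in Set.Ioc 0 (2 * π), ∫⁻ σ in Set.Ioc 0 (2 * π),
    ENNReal.ofReal
      (‖u θ - u σ‖ ^ 2 /
        ‖Complex.exp (θ * Complex.I) - Complex.exp (σ * Complex.I)‖ ^ (1 + 2 * s))

section

open Filter Set Topology
open ENNReal (ofReal ofReal_mul ofReal_ne_top ofReal_le_ofReal ofReal_lt_top ofReal_pow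
  ofReal_natCast ofReal_add ofReal_one ofReal_ofNat ofReal_toReal ofReal_sum_of_nonneg
  ofReal_inv_of_pos mul_lt_top ofReal_pos ofReal_le_ofReal_iff mul_ne_top
  tsum_comp_le_tsum_of_injective)
open Complex (I I_ne_zero norm_I norm_real norm_exp_ofReal_mul_I norm_mul_exp_arg_mul_I
  normSq_eq_norm_sq real_smul norm_exp exp_eq_exp_iff_exists_int exp_periodic measurable_ofReal
  ofRealCLM normSq_apply mul_conj conj_ofReal norm_conj exp_two_pi_mul_I)
open intervalIntegral (integral_of_le integral_congr integral_interval_sub_left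
  integral_eq_sub_of_hasDerivAt continuous_primitive intervalIntegral_pos_of_pos
  norm_integral_le_of_norm_le tendsto_integral_filter_of_dominated_convergence integral_mono_on
  integral_same)
open Function (Periodic Injective Surjective uncurry)
open Bornology (IsBounded)
open Finset (sum_congr mul_sum sum_mul sum_le_sum)
open Finset.HasAntidiagonal (antidiagonal)
open ContinuousLinearMap (toSpanSingleton smulRight_apply le_opNorm integral_apply)

local notation "cexp" => Complex.exp
local notation "cis" θ:max => Complex.exp (θ * I)
local notation "𝔻" => ball (0 : ℂ) 1

lemma exp_add_two_pi_mul_I (t : ℝ) : cexp ((t + 2 * π : ℝ) * I) = cis t := by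
  push_cast; rw [add_mul]; exact exp_periodic _

lemma exp_neg_int_mul_add_two_pi (n : ℤ) (t : ℝ) :
    cexp (-(n * (t + 2 * π : ℝ) * I)) = cexp (-(n * t * I)) :=
  exp_eq_exp_iff_exists_int.2 ⟨-n, by push_cast; ring⟩

/-- `f` has a continuous logarithm on `K`. -/
def HasLog {X : Type*} [TopologicalSpace X] (f : X → ℂ) (K : Set X) : Prop :=
  ∃ h : X → ℂ, ContinuousOn h K ∧ ∀ z ∈ K, cexp (h z) = f z

namespace HasLog
variable {X Y : Type*} [TopologicalSpace X] [TopologicalSpace Y] {f g : X → ℂ} {K L : Set X}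

lemma mono (h : HasLog f K) (hL : L ⊆ K) : HasLog f L := by
  obtain ⟨u, hu, he⟩ := h
  exact ⟨u, hu.mono hL, fun z hz => he z (hL hz)⟩

lemma congr (h : HasLog f K) (hfg : ∀ z ∈ K, f z = g z) : HasLog g K := by
  obtain ⟨u, hu, he⟩ := h
  exact ⟨u, hu, fun z hz => (he z hz).trans (hfg z hz)⟩

lemma mul (hf : HasLog f K) (hg : HasLog g K) : HasLog (fun z => f z * g z) K := by
  obtain ⟨u, hu, he⟩ := hf
  obtain ⟨v, hv, he'⟩ := hg
  exact ⟨fun z => u z + v z, hu.add hv, fun z hz => by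
    rw [Complex.exp_add, he z hz, he' z hz]⟩

lemma div (hf : HasLog f K) (hg : HasLog g K) : HasLog (fun z => f z / g z) K := by
  obtain ⟨u, hu, he⟩ := hf
  obtain ⟨v, hv, he'⟩ := hg
  exact ⟨fun z => u z - v z, hu.sub hv, fun z hz => by
    rw [Complex.exp_sub, he z hz, he' z hz]⟩

lemma comp (hf : HasLog f K) {k : Y → X} {M : Set Y} (hk : ContinuousOn k M)
    (hm : MapsTo k M K) : HasLog (fun y => f (k y)) M := by
  obtain ⟨u, hu, he⟩ := hf
  exact ⟨fun y => u (k y), hu.comp hk hm, fun y hy => he _ (hm hy)⟩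

lemma of_slitPlane (hf : ContinuousOn f K) (hs : ∀ z ∈ K, f z ∈ Complex.slitPlane) : HasLog f K :=
  ⟨fun z => Complex.log (f z), hf.clog hs, fun z hz =>
    Complex.exp_log (Complex.slitPlane_ne_zero (hs z hz))⟩

lemma of_re_pos (hf : ContinuousOn f K) (hs : ∀ z ∈ K, 0 < (f z).re) : HasLog f K :=
  of_slitPlane hf fun z hz => Or.inl (hs z hz)

lemma const {c : ℂ} (hc : c ≠ 0) : HasLog (fun _ : X => c) K :=
  ⟨fun _ => Complex.log c, continuousOn_const, fun _ _ => Complex.exp_log hc⟩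

end HasLog

lemma IsPreconnected.eq_of_exp_eq {X : Type*} [TopologicalSpace X] {S : Set X}
    (hS : IsPreconnected S) {d : X → ℂ} (hd : ContinuousOn d S) {c : ℂ}
    (he : ∀ x ∈ S, cexp (d x) = c) {x y : X} (hx : x ∈ S) (hy : y ∈ S) : d x = d y := by
  refine hS.induction₂ (fun x y => d x = d y) ?_ (fun _ _ _ _ _ _ h h' => h.trans h')
    (fun _ _ _ _ h => h.symm) hx hy
  intro x hx
  have h1 := (hd x hx).tendsto
  filter_upwards [h1 (ball_mem_nhds (d x) one_pos), self_mem_nhdsWithin] with y h2 hy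
  have h3 := (he x hx).trans (he y hy).symm
  obtain ⟨n, hn⟩ := exp_eq_exp_iff_exists_int.1 h3
  have h4 : ‖d y - d x‖ < 1 := by simpa [dist_eq_norm] using h2
  have h5 : d y - d x = -((n : ℂ) * (2 * π * I)) := by rw [hn]; ring
  rw [h5, norm_neg] at h4
  have h6 : ‖(n : ℂ) * (2 * π * I)‖ = |(n : ℝ)| * (2 * π) := by
    simp [abs_of_pos pi_pos]
  rw [h6] at h4
  have h7 : n = 0 := by
    by_contra h
    have : (1 : ℝ) ≤ |(n : ℝ)| := by exact_mod_cast Int.one_le_abs h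
    nlinarith [Real.pi_gt_three]
  rw [hn, h7]; simp

lemma HasLog.union {X : Type*} [TopologicalSpace X] {f : X → ℂ} {A B : Set X}
    (hA : HasLog f A) (hB : HasLog f B) (hAc : IsClosed A) (hBc : IsClosed B)
    (hAB : IsPreconnected (A ∩ B)) : HasLog f (A ∪ B) := by
  classical
  obtain ⟨u, hu, hue⟩ := hA
  obtain ⟨v, hv, hve⟩ := hB
  obtain ⟨c, hc, hcu⟩ : ∃ c : ℂ, cexp c = 1 ∧ ∀ x ∈ A ∩ B, u x = v x + c := by
    by_cases hne : (A ∩ B).Nonempty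
    · obtain ⟨x, hx⟩ := hne
      have key : ∀ y ∈ A ∩ B, cexp (u y - v y) = 1 := by
        intro y hy
        have h0 : cexp (u y) ≠ 0 := Complex.exp_ne_zero _
        rw [Complex.exp_sub, hue y hy.1, hve y hy.2, div_self]
        rwa [← hue y hy.1]
      refine ⟨u x - v x, key x hx, fun y hy => ?_⟩
      have := hAB.eq_of_exp_eq (d := fun y => u y - v y)
        ((hu.mono inter_subset_left).sub (hv.mono inter_subset_right)) key hx hy
      rw [this]; ring
    · exact ⟨0, by simp, fun x hx => (hne ⟨x, hx⟩).elim⟩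
  have e1 : EqOn (A.piecewise u (fun x => v x + c)) u A := piecewise_eqOn _ _ _
  have e2 : EqOn (A.piecewise u (fun x => v x + c)) (fun x => v x + c) B := by
    intro x hx
    by_cases hxA : x ∈ A
    · simp [piecewise, hxA, hcu x ⟨hxA, hx⟩]
    · simp [piecewise, hxA]
  refine ⟨A.piecewise u (fun x => v x + c), ?_, ?_⟩
  · exact (hu.congr e1).union_of_isClosed ((hv.add continuousOn_const).congr e2) hAc hBc
  · rintro x (hx | hx)
    · rw [e1 hx, hue x hx]
    · rw [e2 hx, Complex.exp_add, hc, mul_one, hve x hx]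

lemma hasLog_of_simplyConnected {U : Set ℂ} (hU : Convex ℝ U) (hUo : IsOpen U)
    {f : ℂ → ℂ} (hf : ContinuousOn f U) (h0 : ∀ z ∈ U, f z ≠ 0) : HasLog f U := by
  rcases U.eq_empty_or_nonempty with rfl | hne
  · exact ⟨0, continuousOn_empty _, by simp⟩
  have : ContractibleSpace U := hU.contractibleSpace hne
  have hs : IsSimplyConnected U := by
    unfold IsSimplyConnected; infer_instance
  obtain ⟨h, hh, he⟩ := Complex.exists_continuousOn_eqOn_exp_comp hs hUo hf
    (by rintro ⟨z, hz, hz0⟩; exact h0 z hz hz0)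
  exact ⟨h, hh, fun z hz => he hz⟩

lemma hasLog_univ {f : ℂ → ℂ} (hf : Continuous f) (h0 : ∀ z, f z ≠ 0) : HasLog f univ :=
  hasLog_of_simplyConnected convex_univ isOpen_univ hf.continuousOn fun z _ => h0 z

lemma not_hasLog_sphere {R : ℝ} (hR : 0 < R) (p : ℂ) : ¬ HasLog (fun z => z - p) (sphere p R) := by
  intro h
  have hk : Continuous fun t : ℝ => p + R * cis t := by fun_prop
  have hm : ∀ t : ℝ, p + R * cis t ∈ sphere p R := by
    intro t
    simp [norm_exp_ofReal_mul_I, abs_of_pos hR]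
  obtain ⟨u, hu, he⟩ := h
  have huc : Continuous fun t : ℝ => u (p + R * cis t) := hu.comp_continuous hk hm
  have key := isPreconnected_univ.eq_of_exp_eq
    (d := fun t : ℝ => u (p + R * cis t) - t * I)
    (c := R) (huc.sub (by fun_prop)).continuousOn (fun t _ => by
      rw [Complex.exp_sub, he _ (hm t)]
      simp only
      rw [add_sub_cancel_left,
        mul_div_cancel_right₀ _ (Complex.exp_ne_zero _)]) (mem_univ 0) (mem_univ (2 * π))
  have e : cexp (((2 * π : ℝ) : ℂ) * I) = 1 := by
    push_cast; exact exp_two_pi_mul_I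
  simp only [e] at key
  have := congrArg Complex.im key
  simp at this
  linarith [pi_pos]

lemma ContinuousOn.exists_continuous_extension {X : Type*} [TopologicalSpace X] [NormalSpace X]
    {h : X → ℂ} {K : Set X} (hK : IsClosed K) (hh : ContinuousOn h K) :
    ∃ g : X → ℂ, Continuous g ∧ EqOn g h K := by
  obtain ⟨g, hg⟩ := ContinuousMap.exists_restrict_eq hK ⟨K.domRestrict h, hh.domRestrict⟩
  exact ⟨g, g.continuous, fun x hx => by
    have := congrArg (fun f => f ⟨x, hx⟩) hg
    exact this⟩

lemma not_hasLog_frontier {U : Set ℂ} (hUb : IsBounded U) {p : ℂ}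
    (hp : p ∈ U) : ¬ HasLog (fun z => z - p) (frontier U) := by
  classical
  rintro ⟨h, hh, he⟩
  obtain ⟨g, hg, hgh⟩ := hh.exists_continuous_extension isClosed_frontier
  obtain ⟨R, hR⟩ := hUb.subset_ball p
  have hRpos : 0 < R := by
    by_contra hc
    have := hR hp
    simp at this; linarith
  have hf : Continuous (U.piecewise (fun z => cexp (g z)) (fun z => z - p)) := by
    refine Continuous.piecewise ?_ (by fun_prop) (by fun_prop)
    intro a ha
    rw [hgh ha, he a ha]
  have hl := hasLog_univ hf (fun z => by
    by_cases hz : z ∈ U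
    · simp [hz]
    · simp only [hz, piecewise, if_false]
      intro h0
      exact hz (by rwa [sub_eq_zero.1 h0]))
  refine not_hasLog_sphere hRpos p ((hl.mono (subset_univ _)).congr fun z hz => ?_)
  have : z ∉ U := fun hzU => by
    have := hR hzU
    rw [mem_sphere] at hz; rw [mem_ball] at this; linarith
  simp [this]

lemma hasLog_ratio_of_isPreconnected {S C : Set ℂ} (hS : IsPreconnected S) (hC : IsClosed C)
    (hSC : Disjoint S C) {p q : ℂ} (hp : p ∈ S) (hq : q ∈ S) :
    HasLog (fun z => (z - p) / (z - q)) C := by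
  have hne : ∀ x ∈ S, ∀ z ∈ C, z - x ≠ 0 := fun x hx z hz h =>
    disjoint_left.1 hSC hx (by rwa [← sub_eq_zero.1 h])
  refine hS.induction₂ (fun p q => HasLog (fun z => (z - p) / (z - q)) C) ?_ ?_ ?_ hp hq
  · intro x hx
    have hxC : x ∈ Cᶜ := fun h => disjoint_left.1 hSC hx h
    obtain ⟨δ, hδ, hb⟩ := isOpen_iff.1 hC.isOpen_compl x hxC
    filter_upwards [mem_nhdsWithin_of_mem_nhds (ball_mem_nhds x hδ),
      self_mem_nhdsWithin] with y hy hyS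
    have h1 : HasLog (fun z => (z - y) / (z - x)) C := by
      refine HasLog.of_re_pos (ContinuousOn.div (by fun_prop) (by fun_prop) (hne x hx)) ?_
      intro z hz
      have h2 : (z - y) / (z - x) = 1 - (y - x) / (z - x) := by
        rw [eq_sub_iff_add_eq, ← add_div, div_eq_one_iff_eq (hne x hx z hz)]; ring
      have h3 : ‖(y - x) / (z - x)‖ < 1 := by
        rw [norm_div, div_lt_one (norm_pos_iff.2 (hne x hx z hz))]
        have h4 : ‖y - x‖ < δ := by simpa [dist_eq_norm] using hy
        have h5 : δ ≤ ‖z - x‖ := by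
          by_contra hc
          exact hb (by simpa [dist_eq_norm] using hc) hz
        linarith
      rw [h2, Complex.sub_re, Complex.one_re]
      have := Complex.re_le_norm ((y - x) / (z - x))
      linarith
    exact ((HasLog.const one_ne_zero).div h1).congr fun z _ => by rw [one_div, inv_div]
  · intro x y z _ hy _ h1 h2
    exact (h1.mul h2).congr fun w hw => by
      rw [div_mul_div_cancel₀ (hne y hy w hw)]
  · intro x y _ _ h1
    exact ((HasLog.const one_ne_zero).div h1).congr fun z _ => by rw [one_div, inv_div]

lemma hasLog_sub_of_convex {N : Set ℂ} (hN : Convex ℝ N) (hNo : IsOpen N) {p : ℂ} (hp : p ∉ N) :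
    HasLog (fun z => z - p) N :=
  hasLog_of_simplyConnected hN hNo (by fun_prop) fun z hz h => hp (by rwa [← sub_eq_zero.1 h])

lemma hasLog_sub_closure_of_convex {N : Set ℂ} (hN : Convex ℝ N) {p : ℂ} (hp : p ∉ closure N) :
    HasLog (fun z => z - p) (closure N) := by
  obtain ⟨δ, hδ, hd⟩ : ∃ δ > 0, p ∉ thickening δ (closure N) := by
    obtain ⟨δ, hδ, hb⟩ := isOpen_iff.1 isClosed_closure.isOpen_compl p hp
    refine ⟨δ, hδ, fun h => ?_⟩
    obtain ⟨z, hz, hzp⟩ := mem_thickening_iff.1 h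
    exact hb (by rw [mem_ball, dist_comm]; exact hzp) hz
  exact (hasLog_sub_of_convex (hN.closure.thickening δ) isOpen_thickening hd).mono
    (self_subset_thickening hδ _)

lemma AnalyticAt.deriv_ne_zero_of_injOn {f : ℂ → ℂ} {z₀ : ℂ} {U : Set ℂ} (hU : U ∈ nhds z₀)
    (hf : AnalyticAt ℂ f z₀) (hinj : InjOn f U) : deriv f z₀ ≠ 0 := by
  intro hd
  have hnc : ¬ ∀ᶠ z in nhds z₀, f z - f z₀ = 0 := by
    intro h
    obtain ⟨ε, hε, hb⟩ := Metric.eventually_nhds_iff.1 (h.and hU)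
    have h1 : dist (z₀ + (ε / 2 : ℝ)) z₀ < ε := by
      simp [abs_of_pos hε]; linarith
    have h2 := hb h1
    have h3 := hb (y := z₀) (by simpa using hε)
    have := hinj h2.2 h3.2 (sub_eq_zero.1 h2.1)
    simp at this
    linarith
  obtain ⟨n, g, hg, hg0, he⟩ :=
    (AnalyticAt.exists_eventuallyEq_pow_smul_nonzero_iff (hf.sub analyticAt_const)).2 hnc
  have hn0 : n ≠ 0 := by
    rintro rfl
    have := he.self_of_nhds
    simp at this
    exact hg0 this.symm
  set k : ℂ → ℂ := fun z => (g z / g z₀) ^ (1 / n : ℂ) with hk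
  have hka : AnalyticAt ℂ k z₀ := (hg.div analyticAt_const hg0).cpow analyticAt_const (by
    simp [div_self hg0])
  have hk1 : k z₀ = 1 := by simp [hk, div_self hg0]
  have hkn : ∀ z, k z ^ n = g z / g z₀ := fun z => by
    simp only [hk, one_div]; exact Complex.cpow_nat_inv_pow _ hn0
  have hψ : HasStrictDerivAt (fun z => (z - z₀) * k z) 1 z₀ := by
    have h1 : HasStrictDerivAt (fun z => z - z₀) 1 z₀ := (hasStrictDerivAt_id z₀).sub_const z₀
    have := HasStrictDerivAt.fun_mul h1 hka.hasStrictDerivAt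
    simpa [hk1] using this
  have he' : ∀ᶠ z in nhds z₀, f z - f z₀ = g z₀ * ((z - z₀) * k z) ^ n := by
    filter_upwards [he] with z hz
    simp only [Pi.sub_apply] at hz
    rw [hz, mul_pow, hkn, smul_eq_mul]; field_simp
  have hn1 : n ≠ 1 := by
    rintro rfl
    have h1 : HasDerivAt (fun z => g z₀ * ((z - z₀) * k z) ^ 1 + f z₀) (g z₀ * 1) z₀ := by
      simpa using ((hψ.hasDerivAt.const_mul (g z₀)).add_const (f z₀))
    have h2 : HasDerivAt f (g z₀ * 1) z₀ := h1.congr_of_eventuallyEq (by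
      filter_upwards [he'] with z hz
      rw [← hz]; ring)
    rw [h2.deriv] at hd
    simp [hg0] at hd
  set ω := cexp (2 * π * I / n) with hω
  have hprim : IsPrimitiveRoot ω n := Complex.isPrimitiveRoot_exp n hn0
  have hω1 : ω ≠ 1 := hprim.ne_one (by omega)
  have hmap := hψ.map_nhds_eq one_ne_zero
  have hset : (fun z => (z - z₀) * k z) '' (U ∩ {z | f z - f z₀ = g z₀ * ((z - z₀) * k z) ^ n}) ∈
      nhds (0 : ℂ) := by
    have h2 := image_mem_map (m := fun z => (z - z₀) * k z) (inter_mem hU he')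
    rw [hmap] at h2
    simpa using h2
  have hset2 : (fun w => ω * w) ⁻¹' ((fun z => (z - z₀) * k z) ''
      (U ∩ {z | f z - f z₀ = g z₀ * ((z - z₀) * k z) ^ n})) ∈ nhds (0 : ℂ) := by
    have : Continuous fun w : ℂ => ω * w := by fun_prop
    exact this.continuousAt.preimage_mem_nhds (by simpa using hset)
  obtain ⟨ε, hε, hb⟩ := Metric.mem_nhds_iff.1 (inter_mem hset hset2)
  obtain ⟨⟨z, ⟨hzU, hz⟩, hzw⟩, ⟨z', ⟨hzU', hz'⟩, hzw'⟩⟩ := hb (a := ((ε / 2 : ℝ) : ℂ)) (by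
    simp [abs_of_pos hε]; linarith)
  simp only [mem_ofPred_eq] at hz hz' hzw hzw'
  have h5 : f z = f z' := by
    rw [hzw] at hz
    rw [hzw', mul_pow, hprim.pow_eq_one, one_mul, ← hz] at hz'
    exact (sub_left_inj.1 hz').symm
  have h6 := hinj hzU hzU' h5
  rw [← h6, hzw] at hzw'
  have h7 : ((ε / 2 : ℝ) : ℂ) ≠ 0 := by exact_mod_cast (by positivity)
  exact hω1 (mul_right_cancel₀ h7 (by rw [one_mul, ← hzw']))

section Conformal
variable {F : ℂ → ℂ} (hF : DifferentiableOn ℂ F 𝔻)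
  (hinj : InjOn F 𝔻)
include hF hinj

lemma deriv_ne_zero_of_conformal {z : ℂ} (hz : z ∈ 𝔻) : deriv F z ≠ 0 :=
  AnalyticAt.deriv_ne_zero_of_injOn (isOpen_ball.mem_nhds hz)
    (hF.analyticAt (isOpen_ball.mem_nhds hz)) hinj

lemma isOpen_image_of_conformal {s : Set ℂ} (hs : s ⊆ 𝔻) (hso : IsOpen s) : IsOpen (F '' s) := by
  rcases (hF.analyticOnNhd isOpen_ball).is_constant_or_isOpen
    (convex_ball 0 1).isPreconnected with ⟨w, hw⟩ | h
  · have h0 : (0 : ℂ) ∈ 𝔻 := by simp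
    have h1 : (1 / 2 : ℂ) ∈ 𝔻 := by simp; norm_num
    have := hinj h0 h1 ((hw _ h0).trans (hw _ h1).symm)
    norm_num at this
  · exact h s hs hso

lemma exists_radius_mapsTo (hb : IsBounded (F '' 𝔻)) {V : Set ℂ} (hV : IsOpen V)
    (hfr : frontier (F '' 𝔻) ⊆ V) : ∃ r < 1, 0 < r ∧ ∀ z ∈ 𝔻, r ≤ ‖z‖ → F z ∈ V := by
  have hc : IsCompact (closure (F '' 𝔻) \ V) := hb.isCompact_closure.diff hV
  have hΩo := isOpen_image_of_conformal hF hinj subset_rfl isOpen_ball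
  have hsub : closure (F '' 𝔻) \ V ⊆ F '' 𝔻 := by
    rintro w ⟨hw, hwV⟩
    by_contra h
    exact hwV (hfr (by rw [hΩo.frontier_eq]; exact ⟨hw, h⟩))
  obtain ⟨r, hr⟩ := hc.elim_directed_cover (fun r : Ioo (0 : ℝ) 1 => F '' ball 0 r.1)
    (hι := ⟨⟨1 / 2, by norm_num⟩⟩)
    (fun r => isOpen_image_of_conformal hF hinj (ball_subset_ball r.2.2.le) isOpen_ball) (by
      intro w hw
      obtain ⟨z, hz, rfl⟩ := hsub hw
      have hz1 : ‖z‖ < 1 := by simpa using hz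
      have hz0 := norm_nonneg z
      refine mem_iUnion.2 ⟨⟨(‖z‖ + 1) / 2, by constructor <;> linarith⟩, z, ?_, rfl⟩
      simp; linarith) (by
      intro a b
      refine ⟨⟨max a.1 b.1, by
        constructor
        · exact lt_max_of_lt_left a.2.1
        · exact max_lt a.2.2 b.2.2⟩, ?_, ?_⟩
      · exact image_mono (ball_subset_ball (le_max_left _ _))
      · exact image_mono (ball_subset_ball (le_max_right _ _)))
  refine ⟨r.1, r.2.2, r.2.1, fun z hz hrz => ?_⟩
  by_contra h
  obtain ⟨z', hz', he⟩ := hr ⟨subset_closure ⟨z, hz, rfl⟩, h⟩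
  have := hinj (ball_subset_ball r.2.2.le hz') hz he
  rw [this] at hz'
  simp at hz'
  linarith

lemma hasLog_dslope {z₀ : ℂ} (hz₀ : z₀ ∈ 𝔻) : HasLog (dslope F z₀) 𝔻 := by
  have h1 : DifferentiableOn ℂ (dslope F z₀) 𝔻 :=
    (Complex.differentiableOn_dslope (isOpen_ball.mem_nhds hz₀)).2 hF
  refine hasLog_of_simplyConnected (convex_ball _ _) isOpen_ball h1.continuousOn ?_
  intro z hz
  by_cases h : z = z₀
  · rw [h, dslope_same]; exact deriv_ne_zero_of_conformal hF hinj hz₀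
  · rw [dslope_of_ne _ h, slope_def_field]
    exact div_ne_zero (sub_ne_zero.2 fun he => h (hinj hz hz₀ he)) (sub_ne_zero.2 h)

/-- A cut `K` along which `(w - F z₁) / (w - F z₂)` has a logarithm cannot separate
`z₁` from `z₂`. -/
lemma not_hasLog_ratio (hb : IsBounded (F '' 𝔻)) {K N : Set ℂ}
    (hK : IsClosed K) (hfr : frontier (F '' 𝔻) ⊆ K) {z₁ z₂ : ℂ}
    (hNc : Convex ℝ N) (hNo : IsOpen N) (hN : N ⊆ 𝔻)
    (hz₁ : z₁ ∈ N) (hz₂ : z₂ ∈ 𝔻) (hz₂N : z₂ ∉ closure N) (hp₁ : F z₁ ∉ K) (hp₂ : F z₂ ∉ K)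
    (hNK : ∀ z ∈ frontier N, z ∈ 𝔻 → F z ∈ K) : ¬ HasLog (fun w => (w - F z₁) / (w - F z₂)) K := by
  rintro ⟨h, hh, he⟩
  obtain ⟨g, hg, hgh⟩ := hh.exists_continuous_extension hK
  set V : Set ℂ := {w | w ≠ F z₁ ∧ w ≠ F z₂} ∩
    {w | 0 < ((w - F z₁) / (w - F z₂) * cexp (-g w)).re} with hV
  have hW : IsOpen {w | w ≠ F z₁ ∧ w ≠ F z₂} := isOpen_ne.inter isOpen_ne
  have hVcont : ContinuousOn (fun w => (w - F z₁) / (w - F z₂) * cexp (-g w))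
      {w | w ≠ F z₁ ∧ w ≠ F z₂} := by
    refine ContinuousOn.mul (ContinuousOn.div (by fun_prop) (by fun_prop) ?_) (by fun_prop)
    exact fun w hw => sub_ne_zero.2 hw.2
  have hVo : IsOpen V :=
    (Complex.continuous_re.comp_continuousOn hVcont).isOpen_inter_preimage hW isOpen_Ioi
  have hKV : K ⊆ V := by
    intro w hw
    refine ⟨⟨fun h => hp₁ (h ▸ hw), fun h => hp₂ (h ▸ hw)⟩, ?_⟩
    have h1 := he w hw
    simp only at h1
    rw [mem_ofPred_eq, ← h1, hgh hw, ← Complex.exp_add]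
    simp
  have hVlog : HasLog (fun w => (w - F z₁) / (w - F z₂)) V := by
    have h1 : HasLog (fun w => (w - F z₁) / (w - F z₂) * cexp (-g w)) V :=
      HasLog.of_re_pos (hVcont.mono inter_subset_left) fun w hw => hw.2
    have h2 : HasLog (fun w => cexp (g w)) V := ⟨g, hg.continuousOn, fun _ _ => rfl⟩
    refine (h1.mul h2).congr fun w _ => ?_
    rw [mul_assoc, ← Complex.exp_add]; simp
  obtain ⟨r₀, hr₀1, hr₀, hr⟩ := exists_radius_mapsTo hF hinj hb hVo (hfr.trans hKV)
  have hz₁b := hN hz₁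
  have hz₁n : ‖z₁‖ < 1 := by simpa using hz₁b
  obtain ⟨r, hrr, hr1⟩ := exists_between (max_lt hr₀1 hz₁n)
  have hrr0 : r₀ < r := (le_max_left _ _).trans_lt hrr
  have hrz : ‖z₁‖ < r := (le_max_right _ _).trans_lt hrr
  have hrpos : 0 < r := hr₀.trans hrr0
  set M := N ∩ ball 0 r with hM
  have hMb : IsBounded M := isBounded_ball.subset inter_subset_right
  have hz₁M : z₁ ∈ M := ⟨hz₁, by simpa using hrz⟩
  have hMcl : closure M ⊆ closedBall 0 r ∩ closure N := by
    rw [← closure_ball _ hrpos.ne']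
    exact subset_inter (closure_mono inter_subset_right) (closure_mono inter_subset_left)
  have hball : ∀ z ∈ closure M, z ∈ 𝔻 := fun z hz =>
    closedBall_subset_ball hr1 (hMcl hz).1
  have hmaps : MapsTo F (frontier M) V := by
    intro z hz
    have hzb := hball z (frontier_subset_closure hz)
    rcases frontier_inter_subset _ _ hz with h | h
    · exact hKV (hNK z h.1 hzb)
    · rw [frontier_ball _ hrpos.ne'] at h
      have h3 : ‖z‖ = r := by simpa using h.2
      exact hr z hzb (by rw [h3]; exact hrr0.le)
  have hFc : ContinuousOn F (frontier M) := hF.continuousOn.mono fun z hz =>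
    hball z (frontier_subset_closure hz)
  have hfb : frontier M ⊆ 𝔻 := fun z hz => hball z (frontier_subset_closure hz)
  have l1 := hVlog.comp hFc hmaps
  have l2 := ((hasLog_dslope hF hinj hz₂).div (hasLog_dslope hF hinj hz₁b)).mono hfb
  have l3 := (hasLog_sub_closure_of_convex hNc hz₂N).mono (L := frontier M)
    fun z hz => (hMcl (frontier_subset_closure hz)).2
  refine not_hasLog_frontier hMb hz₁M (((l1.mul l2).mul l3).congr fun z hz => ?_)
  have hzb := hfb hz
  have hMo : IsOpen M := hNo.inter isOpen_ball
  have hne1 : z ≠ z₁ := fun h => by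
    rw [hMo.frontier_eq] at hz
    exact hz.2 (h ▸ hz₁M)
  have hne2 : z ≠ z₂ := fun h => hz₂N (h ▸ (hMcl (frontier_subset_closure hz)).2)
  have a1 : F z - F z₁ ≠ 0 := sub_ne_zero.2 fun he => hne1 (hinj hzb hz₁b he)
  have a2 : F z - F z₂ ≠ 0 := sub_ne_zero.2 fun he => hne2 (hinj hzb hz₂ he)
  have b1 := sub_ne_zero.2 hne1
  have b2 := sub_ne_zero.2 hne2
  rw [dslope_of_ne _ hne1, dslope_of_ne _ hne2, slope_def_field, slope_def_field]
  field_simp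

end Conformal

lemma lintegral_mul_sq_le {α : Type*} [MeasurableSpace α] (μ : Measure α) {f g : α → ENNReal}
    (hf : AEMeasurable f μ) (hg : AEMeasurable g μ) :
    (∫⁻ a, f a * g a ∂μ) ^ 2 ≤ (∫⁻ a, f a ^ 2 ∂μ) * ∫⁻ a, g a ^ 2 ∂μ := by
  have h := ENNReal.lintegral_mul_le_Lp_mul_Lq μ Real.HolderConjugate.two_two hf hg
  have h2 : ∀ x : ENNReal, (x ^ (1 / 2 : ℝ)) ^ 2 = x := fun x => by
    rw [← ENNReal.rpow_natCast, ← ENNReal.rpow_mul]; norm_num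
  calc (∫⁻ a, f a * g a ∂μ) ^ 2 ≤ _ := pow_le_pow_left' h 2
    _ = _ := by rw [mul_pow, h2, h2]; norm_cast

lemma lintegral_sq_le {α : Type*} [MeasurableSpace α] (μ : Measure α) {f : α → ENNReal}
    (hf : AEMeasurable f μ) : (∫⁻ a, f a ∂μ) ^ 2 ≤ μ univ * ∫⁻ a, f a ^ 2 ∂μ := by
  have h := lintegral_mul_sq_le μ (aemeasurable_const (b := (1 : ENNReal))) hf
  simpa using h

lemma Complex.det_toSpanSingleton_real (c : ℂ) :
    ((toSpanSingleton ℂ c).restrictScalars ℝ).det = ‖c‖ ^ 2 := by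
  rw [← normSq_eq_norm_sq, ← Algebra.norm_complex_apply, Algebra.norm_apply]
  change LinearMap.det _ = _
  congr 1
  ext
  simp [mul_comm]

lemma lintegral_image_holomorphic {f : ℂ → ℂ} {s : Set ℂ} (hs : IsOpen s)
    (hf : DifferentiableOn ℂ f s) (hinj : InjOn f s) (g : ℂ → ENNReal) :
    ∫⁻ w in f '' s, g w = ∫⁻ z in s, ‖deriv f z‖ₑ ^ 2 * g (f z) := by
  rw [lintegral_image_eq_lintegral_abs_det_fderiv_mul volume hs.measurableSet
    (f' := fun z => (toSpanSingleton ℂ (deriv f z)).restrictScalars ℝ)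
    (fun z hz => ?_) hinj g]
  · refine lintegral_congr fun z => ?_
    rw [Complex.det_toSpanSingleton_real, abs_of_nonneg (by positivity),
      ofReal_pow (norm_nonneg _), ofReal_norm]
  · have := (hf.differentiableAt (hs.mem_nhds hz)).hasDerivAt
    exact (this.hasFDerivAt.restrictScalars ℝ).hasFDerivWithinAt

lemma lintegral_sq_deriv_eq_volume_image {f : ℂ → ℂ} {s : Set ℂ} (hs : IsOpen s)
    (hf : DifferentiableOn ℂ f s) (hinj : InjOn f s) :
    ∫⁻ z in s, ‖deriv f z‖ₑ ^ 2 = volume (f '' s) := by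
  have := lintegral_image_holomorphic hs hf hinj (fun _ => 1)
  simpa using this.symm

lemma lintegral_polar {g : ℂ → ENNReal} (hg : Measurable g) :
    ∫⁻ z, g z = ∫⁻ r in Ioi (0 : ℝ), ∫⁻ θ in Ioo (-π) π, ofReal r * g (r * cis θ) := by
  rw [← Complex.lintegral_comp_polarCoord_symm, polarCoord_target, Measure.volume_eq_prod,
    ← Measure.prod_restrict, lintegral_prod]
  · refine lintegral_congr fun r => lintegral_congr fun θ => ?_
    rw [Complex.polarCoord_symm_apply, smul_eq_mul, Complex.exp_mul_I]
    simp
  · refine Measurable.aemeasurable ?_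
    refine Measurable.mul (by fun_prop) (hg.comp ?_)
    have : ∀ p, Complex.polarCoord.symm p = p.1 * (Complex.cos p.2 + Complex.sin p.2 * I) :=
      fun p => by simp [Complex.polarCoord_symm_apply]
    rw [funext this]
    fun_prop

lemma Function.Periodic.lintegral_Ioc_eq {g : ℝ → ENNReal} {T : ℝ} (hT : 0 < T)
    (hp : Periodic g T) (a b : ℝ) : ∫⁻ θ in Ioc a (a + T), g θ = ∫⁻ θ in Ioc b (b + T), g θ := by
  have : VAddInvariantMeasure (AddSubgroup.zmultiples T) ℝ volume :=
    ⟨fun c s _ => measure_preimage_add _ _ _⟩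
  exact (isAddFundamentalDomain_Ioc hT a).setLIntegral_eq (isAddFundamentalDomain_Ioc hT b) g
    hp.map_vadd_zmultiples

lemma lintegral_image_translate_rotate (g : ℂ → ENNReal) {ζ : ℂ} (hζ : ‖ζ‖ = 1) :
    ∫⁻ z, g (ζ * (1 - z)) = ∫⁻ z, g z := by
  have h1 : MeasurePreserving (fun z : ℂ => 1 - z) := volume.measurePreserving_sub_left 1
  set c : Circle := ⟨ζ, by simp [Submonoid.unitSphere, hζ]⟩
  have h2 := (rotation c).measurePreserving
  have e1 : MeasurableEmbedding (rotation c) := (rotation c).toHomeomorph.measurableEmbedding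
  have e2 : MeasurableEmbedding (fun z : ℂ => 1 - z) := (Homeomorph.subLeft (1 : ℂ)).measurableEmbedding
  exact (h2.comp h1).lintegral_comp_emb (e1.comp e2) g

lemma lintegral_inv_Ioo {a b : ℝ} (ha : 0 < a) (hab : a ≤ b) :
    ∫⁻ r in Ioo a b, ofReal (1 / r) = ofReal (log (b / a)) := by
  rw [← integral_one_div_of_pos ha (ha.trans_le hab), integral_of_le hab,
    integral_Ioc_eq_integral_Ioo, ofReal_integral_eq_lintegral_ofReal]
  · have : IntervalIntegrable (fun x : ℝ => 1 / x) volume a b := by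
      refine ContinuousOn.intervalIntegrable ?_
      rw [uIcc_of_le hab]
      exact ContinuousOn.div (by fun_prop) (by fun_prop) fun x hx => (ha.trans_le hx.1).ne'
    exact ((intervalIntegrable_iff_integrableOn_Ioo_of_le hab).1 this)
  · filter_upwards [ae_restrict_mem measurableSet_Ioo] with x hx
    exact (one_div_pos.2 (ha.trans hx.1)).le

lemma exists_short_arc {G : ℂ → ENNReal} (hG : Measurable G) {A : ℝ}
    (hA : ∫⁻ z, G z ^ 2 ≤ ofReal A) {ζ : ℂ} (hζ : ‖ζ‖ = 1) {δ L : ℝ} (hδ : 0 < δ)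
    (hδ1 : δ < 1) (hL : 0 < L) (hAL : 2 * π * A < L ^ 2 * (log (1 / δ) / 2)) :
    ∃ ρ ∈ Ioo δ (√δ), ofReal ρ * (∫⁻ θ in Ioo (-π) π, G (ζ * (1 - ρ * cis θ))) ≤ ofReal L := by
  by_contra! hc
  have hsq : δ ≤ √δ := Real.le_sqrt_of_sq_le (by nlinarith)
  have h1 : ∫⁻ r in Ioo δ (√δ), ofReal (L ^ 2 / (2 * π)) * ofReal (1 / r) ≤ ofReal A := by
    calc _ ≤ ∫⁻ r in Ioo δ (√δ), ∫⁻ θ in Ioo (-π) π,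
        ofReal r * G (ζ * (1 - r * cis θ)) ^ 2 := by
          refine setLIntegral_mono' measurableSet_Ioo fun r hr => ?_
          have hr0 : 0 < r := hδ.trans hr.1
          have hm : Measurable fun θ : ℝ => G (ζ * (1 - r * cis θ)) := hG.comp (by fun_prop)
          rw [lintegral_const_mul _ (hm.pow_const 2)]
          have h2 := lintegral_sq_le (volume.restrict (Ioo (-π) π)) hm.aemeasurable
          rw [Measure.restrict_apply_univ, Real.volume_Ioo, show π - -π = 2 * π by ring] at h2
          have h3 := (hc r hr).le
          have h4 : ofReal (L ^ 2) ≤ ofReal r ^ 2 * (ofReal (2 * π) *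
              ∫⁻ θ in Ioo (-π) π, G (ζ * (1 - r * cis θ)) ^ 2) := by
            calc ofReal (L ^ 2) = ofReal L ^ 2 := ofReal_pow hL.le 2
              _ ≤ _ := pow_le_pow_left' h3 2
              _ = _ := mul_pow _ _ _
              _ ≤ _ := by gcongr
          calc ofReal (L ^ 2 / (2 * π)) * ofReal (1 / r)
              = ofReal (1 / (2 * π * r)) * ofReal (L ^ 2) := by
                rw [← ofReal_mul (by positivity), ← ofReal_mul (by positivity)]
                congr 1; field_simp
            _ ≤ ofReal (1 / (2 * π * r)) * (ofReal r ^ 2 * (ofReal (2 * π) *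
              ∫⁻ θ in Ioo (-π) π, G (ζ * (1 - r * cis θ)) ^ 2)) := by
                gcongr
            _ = _ := by
              rw [← mul_assoc, ← mul_assoc, ← ofReal_pow hr0.le,
                ← ofReal_mul (by positivity), ← ofReal_mul (by positivity)]
              congr 2; field_simp
      _ ≤ ∫⁻ r in Ioi (0 : ℝ), ∫⁻ θ in Ioo (-π) π,
        ofReal r * G (ζ * (1 - r * cis θ)) ^ 2 :=
          lintegral_mono_set fun r hr => hδ.trans hr.1
      _ = ∫⁻ z, G (ζ * (1 - z)) ^ 2 := by
          rw [lintegral_polar (g := fun z => G (ζ * (1 - z)) ^ 2)]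
          exact (hG.comp (by fun_prop)).pow_const 2
      _ = ∫⁻ z, G z ^ 2 := lintegral_image_translate_rotate (fun z => G z ^ 2) hζ
      _ ≤ _ := hA
  rw [lintegral_const_mul _ (by fun_prop), lintegral_inv_Ioo hδ hsq,
    ← ofReal_mul (by positivity)] at h1
  have hlog : log (√δ / δ) = log (1 / δ) / 2 := by
    rw [Real.log_div (by positivity) hδ.ne', Real.log_sqrt hδ.le, one_div, Real.log_inv]; ring
  rw [hlog] at h1
  have h5 : 0 < log (1 / δ) := Real.log_pos (by rw [one_div]; exact (one_lt_inv₀ hδ).2 hδ1)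
  have h6 := (ENNReal.ofReal_le_ofReal_iff' (p := L ^ 2 / (2 * π) * (log (1 / δ) / 2))).1 h1
  rcases h6 with h6 | h6
  · have : L ^ 2 * (log (1 / δ) / 2) ≤ 2 * π * A := by
      have := mul_le_mul_of_nonneg_left h6 (show 0 ≤ 2 * π by positivity)
      calc _ = _ := by field_simp
        _ ≤ _ := this
    linarith
  · have : 0 < L ^ 2 / (2 * π) * (log (1 / δ) / 2) := by positivity
    linarith

lemma norm_one_sub_mul_exp_lt_one_iff {ρ θ : ℝ} (hρ : 0 < ρ) :
    ‖(1 : ℂ) - ρ * cis θ‖ < 1 ↔ ρ / 2 < cos θ := by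
  have h : ‖(1 : ℂ) - ρ * cis θ‖ ^ 2 = 1 - 2 * ρ * cos θ + ρ ^ 2 := by
    rw [← normSq_eq_norm_sq, normSq_apply]
    simp [Complex.exp_ofReal_mul_I_re, Complex.exp_ofReal_mul_I_im]
    nlinarith [Real.sin_sq_add_cos_sq θ]
  rw [← sq_lt_one_iff₀ (norm_nonneg _), h]
  constructor <;> intro h <;> nlinarith

section
variable {F : ℂ → ℂ} (hF : DifferentiableOn ℂ F 𝔻)
include hF

lemma norm_sub_le_of_short_arc {ζ : ℂ} (hζ : ‖ζ‖ = 1) {ρ L : ℝ} (hρ : 0 < ρ) (hL : 0 ≤ L)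
    (hs : ofReal ρ * (∫⁻ θ in Ioo (-π) π, (𝔻).indicator (fun z => ‖deriv F z‖ₑ)
        (ζ * (1 - ρ * cis θ))) ≤ ofReal L)
    {z z' : ℂ} (hz : z ∈ 𝔻) (hz' : z' ∈ 𝔻) (hzζ : ‖z - ζ‖ = ρ)
    (hzζ' : ‖z' - ζ‖ = ρ) : ‖F z - F z'‖ ≤ L := by
  have hζ0 : ζ ≠ 0 := by intro h; simp [h] at hζ
  set P : ℝ → ℂ := fun θ => ζ * (1 - ρ * cis θ) with hP
  have hPn : ∀ θ, P θ ∈ 𝔻 ↔ ρ / 2 < cos θ := fun θ => by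
    rw [← norm_one_sub_mul_exp_lt_one_iff hρ, mem_ball_zero_iff, hP, norm_mul, hζ, one_mul]
  have key : ∀ w ∈ 𝔻, ‖w - ζ‖ = ρ → ∃ θ ∈ Ioo (-π) π, P θ = w := by
    intro w hw hwζ
    set u := (ζ - w) / ζ with hu
    have hun : ‖u‖ = ρ := by rw [hu, norm_div, hζ, div_one, ← norm_neg, neg_sub, hwζ]
    have h1 : P (Complex.arg u) = w := by
      rw [hP]
      simp only
      rw [← hun, norm_mul_exp_arg_mul_I, hu]
      field_simp
      ring
    refine ⟨Complex.arg u, ⟨Complex.neg_pi_lt_arg u, lt_of_le_of_ne (Complex.arg_le_pi u) ?_⟩, h1⟩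
    intro h
    have := (hPn _).1 (h1 ▸ hw)
    rw [h, Real.cos_pi] at this
    linarith
  obtain ⟨θ, hθ, rfl⟩ := key z hz hzζ
  obtain ⟨θ', hθ', rfl⟩ := key z' hz' hzζ'
  wlog hle : θ' ≤ θ generalizing θ θ'
  · rw [norm_sub_rev]
    exact this θ' hθ' hz' hzζ' θ hθ hz hzζ (not_le.1 hle).le
  have hcos : ∀ t ∈ Icc θ' θ, P t ∈ 𝔻 := by
    intro t ht
    rw [hPn] at hz hz' ⊢
    rcases le_total 0 t with h | h
    · exact hz.trans_le (cos_le_cos_of_nonneg_of_le_pi h hθ.2.le ht.2)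
    · rw [← Real.cos_neg] at hz' ⊢
      refine hz'.trans_le (cos_le_cos_of_nonneg_of_le_pi (by linarith) (by linarith [hθ'.1])
        (by linarith [ht.1]))
  have hPd : ∀ t : ℝ, HasDerivAt P (ζ * (-(ρ * (cis t * I)))) t := by
    intro t
    have h1 : HasDerivAt (fun t : ℝ => (t : ℂ) * I) I t := by
      simpa using (ofRealCLM.hasDerivAt (x := t)).mul_const I
    have h2 := ((h1.cexp.const_mul (ρ : ℂ)).const_sub 1).const_mul ζ
    exact h2
  have hFd : ∀ t ∈ uIcc θ' θ, HasDerivAt (fun t => F (P t))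
      (deriv F (P t) * (ζ * (-(ρ * (cis t * I))))) t := by
    intro t ht
    rw [uIcc_of_le hle] at ht
    have h1 := (hF.differentiableAt (isOpen_ball.mem_nhds (hcos t ht))).hasDerivAt
    exact h1.comp t (hPd t)
  have hcont : ContinuousOn (fun t : ℝ => deriv F (P t) *
      (ζ * (-(ρ * (cis t * I))))) (uIcc θ' θ) := by
    rw [uIcc_of_le hle]
    refine ContinuousOn.mul ?_ (by fun_prop)
    refine (hF.deriv isOpen_ball).continuousOn.comp (t := 𝔻) ?_ hcos
    exact (by fun_prop : Continuous P).continuousOn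
  have hInt := integral_eq_sub_of_hasDerivAt hFd hcont.intervalIntegrable
  have hG : Measurable ((𝔻).indicator (fun z => ‖deriv F z‖ₑ)) :=
    (measurable_deriv F).enorm.indicator measurableSet_ball
  have : ‖F (P θ) - F (P θ')‖ₑ ≤ ofReal L := by
    rw [← hInt, integral_of_le hle]
    calc _ ≤ _ := enorm_integral_le_lintegral_enorm _
      _ ≤ ∫⁻ t in Ioc θ' θ, ofReal ρ * (𝔻).indicator
            (fun z => ‖deriv F z‖ₑ) (P t) := by
          refine setLIntegral_mono' measurableSet_Ioc fun t ht => ?_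
          rw [indicator_of_mem (hcos t ⟨ht.1.le, ht.2⟩), enorm_mul, enorm_mul, enorm_neg,
            enorm_mul, enorm_mul]
          have e1 : ‖ζ‖ₑ = 1 := by rw [← ofReal_norm, hζ]; simp
          have e2 : ‖cis t‖ₑ = 1 := by
            rw [← ofReal_norm, norm_exp_ofReal_mul_I]; simp
          have e3 : ‖I‖ₑ = 1 := by rw [← ofReal_norm]; simp
          have e4 : ‖(ρ : ℂ)‖ₑ = ofReal ρ := by
            rw [← ofReal_norm]; simp [abs_of_pos hρ]
          rw [e1, e2, e3, e4]
          simp [mul_comm]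
      _ ≤ ∫⁻ t in Ioo (-π) π, ofReal ρ * (𝔻).indicator
            (fun z => ‖deriv F z‖ₑ) (P t) :=
          lintegral_mono_set fun t ht => ⟨hθ'.1.trans ht.1, ht.2.trans_lt hθ.2⟩
      _ ≤ _ := by rwa [lintegral_const_mul]; exact hG.comp (by fun_prop)
  rw [← ofReal_norm] at this
  exact (ofReal_le_ofReal_iff hL).1 this

end

/-- Ahlfors' bounded turning condition, for a plane set. -/
def BoundedTurning (Γ : Set ℂ) (C : ℝ) : Prop :=
  ∀ a ∈ Γ, ∀ b ∈ Γ, ∃ S ⊆ Γ, IsPreconnected S ∧ a ∈ S ∧ b ∈ S ∧ S ⊆ closedBall a (C * ‖a - b‖)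

section
variable {F : ℂ → ℂ} (hF : DifferentiableOn ℂ F 𝔻)
  (hinj : InjOn F 𝔻) (hb : IsBounded (F '' 𝔻))
  {Γ : Set ℂ} (hΓ : IsClosed Γ) (hfr : frontier (F '' 𝔻) ⊆ Γ)
  (hdisj : Disjoint (F '' 𝔻) Γ)
include hF hinj hb hΓ hfr hdisj

/-- A closed set `K` meeting `Γ` in a connected set cannot separate a convex piece of the disc. -/
lemma not_hasLog_ratio_of_inter {K N : Set ℂ} (hK : IsClosed K) (hKΓ : IsPreconnected (Γ ∩ K))
    {z₁ z₂ : ℂ} (hNc : Convex ℝ N) (hNo : IsOpen N) (hN : N ⊆ 𝔻)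
    (hz₁ : z₁ ∈ N) (hz₂ : z₂ ∈ 𝔻) (hz₂N : z₂ ∉ closure N) (hp₁ : F z₁ ∉ K) (hp₂ : F z₂ ∉ K)
    (hNK : ∀ z ∈ frontier N, z ∈ 𝔻 → F z ∈ K) : ¬ HasLog (fun w => (w - F z₁) / (w - F z₂)) K := by
  intro hl
  have h1 : HasLog (fun w => (w - F z₁) / (w - F z₂)) Γ :=
    hasLog_ratio_of_isPreconnected ((convex_ball 0 1).isPreconnected.image F hF.continuousOn) hΓ hdisj
      ⟨z₁, hN hz₁, rfl⟩ ⟨z₂, hz₂, rfl⟩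
  have hnot : ∀ z ∈ 𝔻, F z ∉ Γ := fun z hz h =>
    disjoint_left.1 hdisj ⟨z, hz, rfl⟩ h
  exact not_hasLog_ratio hF hinj hb (hΓ.union hK) (hfr.trans subset_union_left) hNc hNo hN
    hz₁ hz₂ hz₂N (fun h => h.elim (hnot _ (hN hz₁)) hp₁) (fun h => h.elim (hnot _ hz₂) hp₂)
    (fun z hz hzb => Or.inr (hNK z hz hzb)) (h1.union hl hΓ hK hKΓ)

lemma mem_closedBall_of_short_crosscut {C : ℝ} (hC : 0 < C) (hbt : BoundedTurning Γ C) {ζ : ℂ}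
    {ρ L : ℝ} (hρ : 0 < ρ) (hL : 0 < L) (hs : ∀ z ∈ 𝔻, ∀ z' ∈ 𝔻, ‖z - ζ‖ = ρ → ‖z' - ζ‖ = ρ →
      ‖F z - F z'‖ ≤ L) : ∃ c : ℂ, ∀ z₁ ∈ 𝔻, ∀ z₂ ∈ 𝔻, ‖z₁ - ζ‖ < ρ → ρ < ‖z₂ - ζ‖ →
      F z₁ ∈ closedBall c ((2 * C + 1) * L) ∨ F z₂ ∈ closedBall c ((2 * C + 1) * L) := by
  set A : Set ℂ := F '' {z | z ∈ 𝔻 ∧ ‖z - ζ‖ = ρ} with hA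
  obtain ⟨c, hAc⟩ : ∃ c, closure A ⊆ closedBall c L := by
    rcases A.eq_empty_or_nonempty with h | ⟨c, z, ⟨hz, hzρ⟩, rfl⟩
    · exact ⟨0, by simp [h]⟩
    · refine ⟨F z, closure_minimal ?_ isClosed_closedBall⟩
      rintro _ ⟨z', ⟨hz', hzρ'⟩, rfl⟩
      rw [mem_closedBall, dist_eq_norm]
      exact hs _ hz' _ hz hzρ' hzρ
  refine ⟨c, fun z₁ hz₁ z₂ hz₂ h1 h2 => ?_⟩
  obtain ⟨σ, hσΓ, hσc, hσ, hσb⟩ : ∃ σ ⊆ Γ, IsPreconnected σ ∧ closure A ∩ Γ ⊆ σ ∧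
      closure σ ⊆ closedBall c ((2 * C + 1) * L) := by
    rcases (closure A ∩ Γ).eq_empty_or_nonempty with h | ⟨a, ha⟩
    · exact ⟨∅, by simp, isPreconnected_empty, by simp [h], by simp⟩
    · choose! S hS using hbt a ha.2
      refine ⟨⋃ b ∈ closure A ∩ Γ, S b, ?_, ?_, ?_, ?_⟩
      · exact iUnion₂_subset fun b hb => (hS b hb.2).1
      · rw [← sUnion_image]
        refine isPreconnected_sUnion a _ ?_ ?_ <;> rintro _ ⟨b, hb, rfl⟩
        exacts [(hS b hb.2).2.2.1, (hS b hb.2).2.1]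
      · exact fun b hb => mem_biUnion hb (hS b hb.2).2.2.2.1
      · refine closure_minimal (iUnion₂_subset fun b hb => ?_) isClosed_closedBall
        refine (hS b hb.2).2.2.2.2.trans (closedBall_subset_closedBall' ?_)
        have h3 : dist a c ≤ L := hAc ha.1
        have h4 : dist b c ≤ L := hAc hb.1
        have h5 : ‖a - b‖ ≤ 2 * L := by
          rw [← dist_eq_norm]; linarith [dist_triangle_right a b c]
        nlinarith
  by_contra! hcon
  set K := closure A ∪ closure σ with hK
  have hKb : K ⊆ closedBall c ((2 * C + 1) * L) :=
    union_subset (hAc.trans (closedBall_subset_closedBall (by nlinarith))) hσb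
  have hσcl : closure σ ⊆ Γ := closure_minimal hσΓ hΓ
  have hKΓ : Γ ∩ K = closure σ := by
    ext w
    constructor
    · rintro ⟨hw, hw' | hw'⟩
      · exact subset_closure (hσ ⟨hw', hw⟩)
      · exact hw'
    · exact fun hw => ⟨hσcl hw, Or.inr hw⟩
  refine not_hasLog_ratio_of_inter hF hinj hb hΓ hfr hdisj (N := 𝔻 ∩ ball ζ ρ)
    (isClosed_closure.union isClosed_closure) (by rw [hKΓ]; exact hσc.closure)
    ((convex_ball _ _).inter (convex_ball _ _)) (isOpen_ball.inter isOpen_ball)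
    inter_subset_left ⟨hz₁, by rwa [mem_ball, dist_eq_norm]⟩ hz₂ ?_
    (fun h => hcon.1 (hKb h)) (fun h => hcon.2 (hKb h)) ?_ ?_
  · intro h
    have := closure_mono inter_subset_right h
    rw [closure_ball _ hρ.ne', mem_closedBall, dist_eq_norm] at this
    linarith
  · intro z hz hzb
    refine Or.inl (subset_closure ⟨z, ⟨hzb, ?_⟩, rfl⟩)
    rcases frontier_inter_subset _ _ hz with h | h
    · rw [isOpen_ball.frontier_eq] at h
      exact (h.1.2 hzb).elim
    · rw [frontier_ball _ hρ.ne'] at h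
      simpa [dist_eq_norm] using h.2
  · have h3 : ∀ p ∉ closedBall c ((2 * C + 1) * L),
        HasLog (fun z => z - p) (closure (closedBall c ((2 * C + 1) * L))) := fun p hp =>
      hasLog_sub_closure_of_convex (convex_closedBall _ _) (by rwa [isClosed_closedBall.closure_eq])
    exact ((h3 _ hcon.1).div (h3 _ hcon.2)).mono (hKb.trans subset_closure)

/-- Uniform continuity up to the boundary. -/
lemma exists_dist_le_near_boundary {C : ℝ} (hC : 0 < C) (hbt : BoundedTurning Γ C) {ε : ℝ}
    (hε : 0 < ε) : ∃ δ > 0, ∀ ζ : ℂ, ‖ζ‖ = 1 → ∀ z ∈ 𝔻, ∀ z' ∈ 𝔻,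
      ‖z - ζ‖ < δ → ‖z' - ζ‖ < δ → ‖F z - F z'‖ ≤ ε := by
  have hne : F 0 ≠ F (1 / 4) := fun h => by
    have := hinj (by simp) (by simp; norm_num) h
    norm_num at this
  set d := ‖F 0 - F (1 / 4)‖ with hd
  have hdpos : 0 < d := norm_pos_iff.2 (sub_ne_zero.2 hne)
  set L := min ε d / (4 * (2 * C + 1)) with hL
  have hLpos : 0 < L := by positivity
  have hRL : (2 * C + 1) * L = min ε d / 4 := by rw [hL]; field_simp
  set A := (volume (F '' 𝔻)).toReal with hA
  have hAe : ∫⁻ z, (𝔻).indicator (fun z => ‖deriv F z‖ₑ) z ^ 2 ≤ ofReal A := by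
    rw [hA, ofReal_toReal hb.measure_lt_top.ne,
      ← lintegral_sq_deriv_eq_volume_image isOpen_ball hF hinj,
      ← lintegral_indicator measurableSet_ball]
    refine lintegral_mono fun z => ?_
    by_cases hz : z ∈ 𝔻 <;> simp [hz]
  have hlim : Tendsto (fun δ : ℝ => L ^ 2 * (log (1 / δ) / 2))
      (𝓝[>] 0) atTop := by
    refine Tendsto.const_mul_atTop (by positivity) (Tendsto.atTop_div_const two_pos ?_)
    simp only [one_div]
    exact Real.tendsto_log_atTop.comp tendsto_inv_nhdsGT_zero
  obtain ⟨δ, hδA, hδ0, hδ1⟩ := ((hlim.eventually_gt_atTop (2 * π * A)).and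
    (Ioo_mem_nhdsGT (show (0 : ℝ) < 1 / 4 by norm_num))).exists
  have hsqrt : √δ < 1 / 2 := by rw [Real.sqrt_lt' (by norm_num)]; linarith
  refine ⟨δ, hδ0, fun ζ hζ => ?_⟩
  obtain ⟨ρ, ⟨hρ1, hρ2⟩, hρ⟩ := exists_short_arc
    ((measurable_deriv F).enorm.indicator measurableSet_ball) hAe hζ hδ0 (by linarith) hLpos hδA
  have hρ0 : 0 < ρ := hδ0.trans hρ1
  obtain ⟨c, hc⟩ := mem_closedBall_of_short_crosscut hF hinj hb hΓ hfr hdisj hC hbt hρ0 hLpos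
    (fun z hz z' hz' h h' => norm_sub_le_of_short_arc hF hζ hρ0 hLpos.le hρ hz hz' h h')
  obtain ⟨z₂, hz₂, hz₂ρ, hz₂c⟩ : ∃ z₂ ∈ 𝔻, ρ < ‖z₂ - ζ‖ ∧
      F z₂ ∉ closedBall c ((2 * C + 1) * L) := by
    by_contra! hcon
    have h1 := hcon 0 (by simp) (by simp [hζ]; linarith)
    have h2 := hcon (1 / 4) (by simp; norm_num) (by
      have := norm_sub_norm_le ζ (1 / 4)
      rw [norm_sub_rev ζ, hζ] at this
      norm_num at this ⊢
      linarith)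
    rw [mem_closedBall, hRL] at h1 h2
    have h3 := dist_triangle_right (F 0) (F (1 / 4)) c
    rw [dist_eq_norm, ← hd] at h3
    linarith [min_le_right ε d]
  intro z hz z' hz' h h'
  have h1 := (hc z hz z₂ hz₂ (h.trans hρ1) hz₂ρ).resolve_right hz₂c
  have h2 := (hc z' hz' z₂ hz₂ (h'.trans hρ1) hz₂ρ).resolve_right hz₂c
  rw [mem_closedBall, hRL] at h1 h2
  have h3 := dist_triangle_right (F z) (F z') c
  rw [dist_eq_norm] at h3
  linarith [min_le_left ε d]

/-- Carathéodory extension. -/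
lemma exists_continuousOn_closedBall {C : ℝ} (hC : 0 < C) (hbt : BoundedTurning Γ C) :
    ∃ E : ℂ → ℂ, ContinuousOn E (closedBall 0 1) ∧ EqOn E F 𝔻 ∧
      ∀ ζ ∈ sphere (0 : ℂ) 1, E ζ ∈ Γ := by
  have hcl : closure 𝔻 = closedBall 0 1 := closure_ball _ one_ne_zero
  have hlim : ∀ x ∈ closedBall (0 : ℂ) 1, ∃ y, Tendsto F (nhdsWithin x 𝔻) (nhds y) := by
    intro x hx
    by_cases hxb : x ∈ 𝔻
    · exact ⟨F x, hF.continuousOn x hxb⟩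
    have hx1 : ‖x‖ = 1 := by
      simp at hx hxb; linarith
    have : (nhdsWithin x 𝔻).NeBot := mem_closure_iff_nhdsWithin_neBot.1 (hcl ▸ hx)
    refine cauchy_map_iff_exists_tendsto.1 (Metric.cauchy_iff.2 ⟨inferInstance, fun ε hε => ?_⟩)
    obtain ⟨δ, hδ, h⟩ := exists_dist_le_near_boundary hF hinj hb hΓ hfr hdisj hC hbt (half_pos hε)
    refine ⟨F '' (ball x δ ∩ 𝔻), image_mem_map
      (inter_mem (mem_nhdsWithin_of_mem_nhds (ball_mem_nhds x hδ)) self_mem_nhdsWithin), ?_⟩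
    rintro _ ⟨z, ⟨hz, hz1⟩, rfl⟩ _ ⟨z', ⟨hz', hz1'⟩, rfl⟩
    rw [dist_eq_norm]
    rw [mem_ball, dist_eq_norm] at hz hz'
    linarith [h x hx1 z hz1 z' hz1' hz hz']
  have hE : ContinuousOn (extendFrom 𝔻 F) (closedBall 0 1) := continuousOn_extendFrom hcl.ge hlim
  have hEF : EqOn (extendFrom 𝔻 F) F 𝔻 := fun z hz =>
    extendFrom_eq (subset_closure hz) (hF.continuousOn z hz)
  refine ⟨_, hE, hEF, fun ζ hζ => ?_⟩
  have hζc : ζ ∈ closedBall (0 : ℂ) 1 := sphere_subset_closedBall hζ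
  have hnb : (nhdsWithin ζ 𝔻).NeBot := mem_closure_iff_nhdsWithin_neBot.1 (hcl ▸ hζc)
  have ht : Tendsto F (nhdsWithin ζ 𝔻) (nhds (extendFrom 𝔻 F ζ)) := tendsto_extendFrom (hlim ζ hζc)
  by_contra hcon
  obtain ⟨ε, hε, hεΓ⟩ := isOpen_iff.1 hΓ.isOpen_compl _ hcon
  obtain ⟨r, hr1, hr0, hr⟩ := exists_radius_mapsTo hF hinj hb
    (V := (closedBall (extendFrom 𝔻 F ζ) (ε / 2))ᶜ) isClosed_closedBall.isOpen_compl
    (fun w hw h => hεΓ (closedBall_subset_ball (half_lt_self hε) h) (hfr hw))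
  have h1 : ∀ᶠ z in nhdsWithin ζ 𝔻, r < ‖z‖ := by
    refine mem_nhdsWithin_of_mem_nhds (continuous_norm.continuousAt.eventually_const_lt ?_)
    simpa [mem_sphere_zero_iff_norm.1 hζ] using hr1
  have h2 := ht.eventually (closedBall_mem_nhds _ (half_pos hε))
  obtain ⟨z, ⟨hz1, hz2⟩, hz3⟩ := ((h1.and h2).and self_mem_nhdsWithin).exists
  exact hr z hz3 hz1.le hz2
end

lemma exp_mul_I_mem_sphere (θ : ℝ) : cis θ ∈ sphere (0 : ℂ) 1 := by
  simp [norm_exp_ofReal_mul_I]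

/-- A function holomorphic in the disc cannot be constant on a boundary arc without taking that
value at the centre. -/
lemma eq_center_of_eq_on_arc {E : ℂ → ℂ} (hE : DiffContOnCl ℂ E 𝔻) {a b : ℝ} (hab : a < b)
    {c : ℂ} (h : ∀ θ ∈ Ioo a b, E (cis θ) = c) : E 0 = c := by
  obtain ⟨n, hn⟩ := exists_nat_gt (2 * π / (b - a))
  have hba : 0 < b - a := sub_pos.2 hab
  have hn0 : (0 : ℝ) < n := lt_of_le_of_lt (by positivity) hn
  set ω : ℝ := 2 * π / n with hω
  have hω0 : 0 < ω := by positivity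
  have hωba : ω < b - a := by
    rw [hω, div_lt_iff₀ hn0, mul_comm (b - a)]; rwa [div_lt_iff₀ hba] at hn
  set u : ℕ → ℂ := fun k => cexp ((ω * k : ℝ) * I) with hu
  have hun : ∀ k, ‖u k‖ = 1 := fun k => norm_exp_ofReal_mul_I _
  have hG : DiffContOnCl ℂ (fun z => ∏ k ∈ Finset.range n, (E (z * u k) - c)) 𝔻 := by
    have h1 : ∀ k, DiffContOnCl ℂ (fun z => E (z * u k) - c) 𝔻 := by
      intro k
      refine DiffContOnCl.sub_const ?_ c
      refine hE.comp (g := fun z => z * u k) ⟨by fun_prop, by fun_prop⟩ ?_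
      intro z hz
      simpa [hun] using hz
    refine ⟨?_, ?_⟩
    · exact DifferentiableOn.fun_finsetProd fun k _ => (h1 k).1
    · exact continuousOn_finsetProd _ fun k _ => (h1 k).2
  have h0 : ∀ z ∈ frontier 𝔻,
      ‖∏ k ∈ Finset.range n, (E (z * u k) - c)‖ ≤ 0 := by
    intro z hz
    rw [frontier_ball _ one_ne_zero] at hz
    have hz1 : z = cis z.arg := by
      have := norm_mul_exp_arg_mul_I z
      rw [mem_sphere_zero_iff_norm.1 hz] at this
      simpa using this.symm
    obtain ⟨m, hm1, hm2⟩ : ∃ m : ℤ, a < z.arg + ω * m ∧ z.arg + ω * m < b := by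
      refine ⟨⌊(a - z.arg) / ω⌋ + 1, ?_, ?_⟩
      · have := Int.lt_floor_add_one ((a - z.arg) / ω)
        rw [div_lt_iff₀ hω0] at this
        push_cast; linarith
      · have := Int.floor_le ((a - z.arg) / ω)
        rw [le_div_iff₀ hω0] at this
        push_cast; linarith
    have hnz : (n : ℤ) ≠ 0 := by
      intro h; simp at h; simp [h] at hn0
    set k := (m % n).toNat with hk
    have hk0 : 0 ≤ m % n := Int.emod_nonneg _ hnz
    have hkn : k ∈ Finset.range n := by
      rw [Finset.mem_range, hk]
      have := Int.emod_lt_of_pos m (show (0 : ℤ) < n by positivity)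
      omega
    have hkm : (k : ℝ) = m - n * (m / n : ℤ) := by
      have h1 : (k : ℤ) = m - n * (m / n) := by
        rw [hk, Int.toNat_of_nonneg hk0, Int.emod_def]
      exact_mod_cast h1
    have : E (z * u k) = c := by
      have h2 : z * u k = cexp (((z.arg + ω * m : ℝ) : ℂ) * I) := by
        rw [hz1, hu]
        simp only
        rw [← Complex.exp_add, exp_eq_exp_iff_exists_int]
        refine ⟨-(m / n : ℤ), ?_⟩
        have h3 : ω * k = ω * m - 2 * π * (m / n : ℤ) := by
          rw [hkm, hω]; field_simp
        rw [h3]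
        simp only [← hz1]
        push_cast
        ring
      rw [h2]
      exact h _ ⟨hm1, hm2⟩
    rw [Finset.prod_eq_zero hkn (by rw [this, sub_self]), norm_zero]
  have := Complex.norm_le_of_forall_mem_frontier_norm_le isBounded_ball hG h0
    (subset_closure (mem_ball_self one_pos))
  simp only [zero_mul, Finset.prod_const, Finset.card_range, norm_pow] at this
  have h3 : ‖E 0 - c‖ = 0 := eq_zero_of_pow_eq_zero (le_antisymm this (by positivity))
  exact sub_eq_zero.1 (norm_eq_zero.1 h3)

section
variable {F : ℂ → ℂ} (hF : DifferentiableOn ℂ F 𝔻)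
  (hinj : InjOn F 𝔻) (hb : IsBounded (F '' 𝔻))
  {Γ : Set ℂ} (hΓ : IsClosed Γ) (hfr : frontier (F '' 𝔻) ⊆ Γ)
  (hdisj : Disjoint (F '' 𝔻) Γ) (hcut : ∀ p, IsPreconnected (Γ \ {p}))
  {E : ℂ → ℂ} (hE : ContinuousOn E (closedBall 0 1)) (hEF : EqOn E F 𝔻)
  (hEΓ : ∀ ζ ∈ sphere (0 : ℂ) 1, E ζ ∈ Γ)
include hF hdisj hE hEF

lemma exists_ne_on_arc {a b : ℝ} (hab : a < b) {c : ℂ} (hc : c ∈ Γ) :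
    ∃ θ ∈ Ioo a b, E (cis θ) ≠ c := by
  by_contra! h
  have hd : DiffContOnCl ℂ E 𝔻 := ⟨hF.congr hEF, by rwa [closure_ball _ one_ne_zero]⟩
  have := eq_center_of_eq_on_arc hd hab h
  rw [hEF (mem_ball_self one_pos)] at this
  exact disjoint_left.1 hdisj ⟨0, mem_ball_self one_pos, this⟩ hc

include hinj hb hΓ hfr hcut hEΓ

lemma boundary_ne_of_lt_of_le {a b : ℝ} (hab : a < b) (hba : b ≤ a + π) :
    E (cis a) ≠ E (cis b) := by
  intro heq
  set p := E (cis a) with hp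
  have hpΓ : p ∈ Γ := hEΓ _ (exp_mul_I_mem_sphere a)
  obtain ⟨θ₁, ⟨h1a, h1b⟩, h1⟩ := exists_ne_on_arc hF hdisj hE hEF hab hpΓ
  obtain ⟨θ₂, ⟨h2a, h2b⟩, h2⟩ := exists_ne_on_arc hF hdisj hE hEF
    (show b < a + 2 * π by linarith [pi_pos]) hpΓ
  have him : ∀ r x y : ℝ, (cexp (-(y : ℂ) * I) * (r * cis x)).im
      = r * sin (x - y) := by
    intro r x y
    rw [mul_left_comm, ← Complex.exp_add, Complex.im_ofReal_mul, ← Complex.exp_ofReal_mul_I_im]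
    congr 3; push_cast; ring
  set N : Set ℂ := 𝔻 ∩ ({z | 0 < (cexp (-(a : ℂ) * I) * z).im} ∩
    {z | (cexp (-(b : ℂ) * I) * z).im < 0}) with hN
  have hlin : ∀ y : ℝ, IsLinearMap ℝ fun z : ℂ => (cexp (-(y : ℂ) * I) * z).im :=
    fun y => ⟨fun z w => by rw [mul_add, Complex.add_im], fun c z => by
      rw [real_smul, mul_left_comm, Complex.im_ofReal_mul, smul_eq_mul]⟩
  have hcont : ∀ y : ℝ, Continuous fun z : ℂ => (cexp (-(y : ℂ) * I) * z).im := fun y => by fun_prop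
  have hNc : Convex ℝ N := (convex_ball _ _).inter
    ((convex_halfSpace_gt (hlin a) 0).inter (convex_halfSpace_lt (hlin b) 0))
  have hNo : IsOpen N := isOpen_ball.inter
    ((isOpen_lt continuous_const (hcont a)).inter (isOpen_lt (hcont b) continuous_const))
  have hNcl : closure N ⊆ {z | 0 ≤ (cexp (-(a : ℂ) * I) * z).im} ∩
      {z | (cexp (-(b : ℂ) * I) * z).im ≤ 0} :=
    closure_minimal (fun z hz => by
      obtain ⟨-, h1, h2⟩ := hz
      simp only [mem_ofPred_eq, mem_inter_iff] at h1 h2 ⊢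
      exact ⟨h1.le, h2.le⟩)
      ((isClosed_le continuous_const (hcont a)).inter (isClosed_le (hcont b) continuous_const))
  set ray : ℝ → Set ℂ := fun y => (fun r : ℝ => (r : ℂ) * cis y) ''
    Icc 0 1 with hray
  have hraycl : ∀ y, ray y ⊆ closedBall 0 1 := by
    rintro y _ ⟨r, hr, rfl⟩
    simpa [norm_exp_ofReal_mul_I, abs_of_nonneg hr.1] using hr.2
  have hrayc : ∀ y, IsCompact (ray y) := fun y => isCompact_Icc.image (by fun_prop)
  set K := E '' (ray a ∪ ray b) with hK
  have hKcl : IsClosed K := by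
    refine (((hrayc a).union (hrayc b)).image_of_continuousOn (hE.mono ?_)).isClosed
    exact union_subset (hraycl a) (hraycl b)
  have hrb : ∀ r : ℝ, 0 ≤ r → r < 1 → ∀ y : ℝ, (r : ℂ) * cis y ∈ 𝔻 := by
    intro r hr hr1 y
    simpa [norm_exp_ofReal_mul_I, abs_of_nonneg hr] using hr1
  have hΓK : Γ ∩ K = {p} := by
    apply eq_singleton_iff_unique_mem.2
    refine ⟨⟨hpΓ, cis a, Or.inl ⟨1, by simp, by simp⟩, rfl⟩, ?_⟩
    have hend : ∀ y r : ℝ, r ∈ Icc (0 : ℝ) 1 → E (r * cis y) ∈ Γ → r = 1 := by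
      intro y r hr h
      by_contra hne
      have hb := hrb r hr.1 (lt_of_le_of_ne hr.2 hne) y
      rw [hEF hb] at h
      exact disjoint_left.1 hdisj ⟨_, hb, rfl⟩ h
    rintro _ ⟨hw, _, ⟨r, hr, rfl⟩ | ⟨r, hr, rfl⟩, rfl⟩
    · simp [hend a r hr hw, hp]
    · simp [hend b r hr hw, heq]
  -- points on other radii are not in `K`
  have hoff : ∀ θ : ℝ, θ ∈ Ioo a b ∨ θ ∈ Ioo b (a + 2 * π) → ∀ r : ℝ, 0 < r → r < 1 →
      E (r * cis θ) ∉ K := by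
    rintro θ hθ r hr hr1 ⟨z, hz, hze⟩
    have hzb : z ∈ 𝔻 := by
      rcases mem_closedBall.1 (union_subset (hraycl a) (hraycl b) hz) |>.lt_or_eq with h | h
      · exact h
      · have := hEΓ z h
        rw [hze, hEF (hrb r hr.le hr1 θ)] at this
        exact (disjoint_left.1 hdisj ⟨_, hrb r hr.le hr1 θ, rfl⟩ this).elim
    rw [hEF hzb, hEF (hrb r hr.le hr1 θ)] at hze
    have hzeq := hinj hzb (hrb r hr.le hr1 θ) hze
    have key : ∀ y s : ℝ, s ∈ Icc (0 : ℝ) 1 → (s : ℂ) * cis y = r * cis θ →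
        ∃ k : ℤ, θ = y + k * (2 * π) := by
      intro y s hs h
      have hn := congrArg norm h
      simp only [norm_mul, norm_exp_ofReal_mul_I, norm_real, mul_one,
        norm_eq_abs, abs_of_nonneg hs.1, abs_of_pos hr] at hn
      subst hn
      have h' := mul_left_cancel₀ (by exact_mod_cast hr.ne') h
      obtain ⟨k, hk⟩ := exp_eq_exp_iff_exists_int.1 h'
      refine ⟨-k, ?_⟩
      have h4 : ((y : ℂ)) = θ + k * (2 * π) := by
        have := I_ne_zero
        apply mul_right_cancel₀ this
        rw [hk]; ring
      have : y = θ + k * (2 * π) := by exact_mod_cast h4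
      push_cast; linarith
    have hbad : ∀ y, (y = a ∨ y = b) → ¬ ∃ k : ℤ, θ = y + k * (2 * π) := by
      rintro y hy ⟨k, hk⟩
      have hpi := pi_pos
      have hk1 : (-1 : ℝ) < k := by
        rcases hy with rfl | rfl <;> rcases hθ with ⟨h, h'⟩ | ⟨h, h'⟩ <;> nlinarith
      have hk2 : (k : ℝ) < 1 := by
        rcases hy with rfl | rfl <;> rcases hθ with ⟨h, h'⟩ | ⟨h, h'⟩ <;> nlinarith
      have : k = 0 := by
        have h1 : (-1 : ℤ) < k := by exact_mod_cast hk1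
        have h2 : k < 1 := by exact_mod_cast hk2
        omega
      subst this
      simp at hk
      rcases hy with rfl | rfl <;> rcases hθ with ⟨h, h'⟩ | ⟨h, h'⟩ <;> linarith
    rcases hz with ⟨s, hs, hsz⟩ | ⟨s, hs, hsz⟩
    · exact hbad a (Or.inl rfl) (key a s hs (hsz.trans hzeq))
    · exact hbad b (Or.inr rfl) (key b s hs (hsz.trans hzeq))
  set z₁ : ℂ := ((1 / 2 : ℝ) : ℂ) * cis θ₁ with hz₁
  set z₂ : ℂ := ((1 / 2 : ℝ) : ℂ) * cis θ₂ with hz₂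
  have hz₁b : z₁ ∈ 𝔻 := hrb _ (by norm_num) (by norm_num) _
  have hz₂b : z₂ ∈ 𝔻 := hrb _ (by norm_num) (by norm_num) _
  have hz₁K : F z₁ ∉ K := hEF hz₁b ▸ hoff θ₁ (Or.inl ⟨h1a, h1b⟩) _ (by norm_num) (by norm_num)
  have hz₂K : F z₂ ∉ K := hEF hz₂b ▸ hoff θ₂ (Or.inr ⟨h2a, h2b⟩) _ (by norm_num) (by norm_num)
  refine not_hasLog_ratio_of_inter hF hinj hb hΓ hfr hdisj (N := N) (z₁ := z₁) (z₂ := z₂) hKcl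
    (by rw [hΓK]; exact isPreconnected_singleton) hNc hNo inter_subset_left ?_ hz₂b ?_
    hz₁K hz₂K ?_ ?_
  · refine ⟨hz₁b, ?_, ?_⟩
    · simp only [mem_ofPred_eq]
      rw [hz₁, him]
      have := sin_pos_of_pos_of_lt_pi (x := θ₁ - a) (by linarith) (by linarith)
      positivity
    · simp only [mem_ofPred_eq]
      rw [hz₁, him]
      have := Real.sin_neg_of_neg_of_neg_pi_lt (x := θ₁ - b) (by linarith) (by linarith)
      linarith
  · intro h
    have h := hNcl h
    simp only [mem_inter_iff, mem_ofPred_eq] at h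
    rw [hz₂, him, him] at h
    rcases le_or_gt θ₂ (a + π) with hc | hc
    · have h3 := sin_pos_of_pos_of_lt_pi (x := θ₂ - b) (by linarith) (by linarith)
      linarith [h.2]
    · have h3 := sin_pos_of_pos_of_lt_pi (x := θ₂ - a - π) (by linarith) (by linarith)
      rw [Real.sin_sub_pi] at h3
      linarith [h.1]
  · intro z hz hzb
    rw [hNo.frontier_eq] at hz
    obtain ⟨h1, h2⟩ := hNcl hz.1
    simp only [mem_ofPred_eq] at h1 h2
    rw [← hEF hzb]
    refine ⟨z, ?_, rfl⟩
    have hex : ∀ y : ℝ, (cexp (-(y : ℂ) * I) * z).im = 0 → ∃ s : ℝ, z = s * cis y := by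
      intro y hy
      refine ⟨(cexp (-(y : ℂ) * I) * z).re, ?_⟩
      have h3 : cexp (-(y : ℂ) * I) * z =
          ((cexp (-(y : ℂ) * I) * z).re : ℂ) := Complex.ext rfl (by simpa using hy)
      rw [← h3, mul_right_comm, ← Complex.exp_add]
      simp
    have hnorm : ∀ s y : ℝ, z = s * cis y → |s| ≤ 1 := by
      intro s y h
      have := mem_ball_zero_iff.1 hzb
      rw [h, norm_mul, norm_exp_ofReal_mul_I, mul_one, norm_real] at this
      exact this.le
    have hπ : sin (b - a) ≤ 0 → b = a + π := by
      intro h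
      by_contra hne
      have := sin_pos_of_pos_of_lt_pi (x := b - a) (by linarith)
        (by rcases hba.lt_or_eq with h | h; · linarith
            · exact (hne h).elim)
      linarith
    have hflip : b = a + π → cis b = -cis a := by
      rintro rfl
      push_cast
      rw [add_mul, Complex.exp_add, Complex.exp_pi_mul_I, mul_neg_one]
    have hcase : (cexp (-(a : ℂ) * I) * z).im = 0 ∨ (cexp (-(b : ℂ) * I) * z).im = 0 := by
      by_contra! hcon
      exact hz.2 ⟨hzb, lt_of_le_of_ne h1 hcon.1.symm, lt_of_le_of_ne h2 hcon.2⟩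
    rcases hcase with h | h
    · obtain ⟨s, hs⟩ := hex a h
      have hs1 := abs_le.1 (hnorm s a hs)
      rcases le_or_gt 0 s with h0 | h0
      · exact Or.inl ⟨s, ⟨h0, hs1.2⟩, hs.symm⟩
      · rw [hs, him, ← neg_sub b a, Real.sin_neg] at h2
        have h3 := hflip (hπ (by nlinarith))
        refine Or.inr ⟨-s, ⟨by linarith, by linarith⟩, ?_⟩
        simp only
        rw [h3, hs]; push_cast; ring
    · obtain ⟨s, hs⟩ := hex b h
      have hs1 := abs_le.1 (hnorm s b hs)
      rcases le_or_gt 0 s with h0 | h0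
      · exact Or.inr ⟨s, ⟨h0, hs1.2⟩, hs.symm⟩
      · rw [hs, him] at h1
        have h3 := hflip (hπ (by nlinarith))
        refine Or.inl ⟨-s, ⟨by linarith, by linarith⟩, ?_⟩
        simp only
        rw [hs, h3]; push_cast; ring
  · set seg : ℝ → Set ℂ := fun θ => (fun r : ℝ => E (r * cis θ)) ''
      Icc (1 / 2) 1 with hseg
    have hsegp : ∀ θ, IsPreconnected (seg θ) := by
      intro θ
      refine isPreconnected_Icc.image _ (hE.comp (by fun_prop) ?_)
      intro r hr
      have h0 : (0 : ℝ) ≤ r := by linarith [hr.1]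
      simpa [norm_exp_ofReal_mul_I, abs_of_nonneg h0] using hr.2
    have hsegK : ∀ θ : ℝ, θ ∈ Ioo a b ∨ θ ∈ Ioo b (a + 2 * π) →
        E (cis θ) ≠ p → Disjoint (seg θ) K := by
      intro θ hθ hne
      refine disjoint_left.2 ?_
      rintro _ ⟨r, hr, rfl⟩
      rcases hr.2.lt_or_eq with h | rfl
      · exact hoff θ hθ r (by linarith [hr.1]) h
      · intro hK
        simp only [Complex.ofReal_one, one_mul] at hK
        have := hΓK.subset ⟨hEΓ _ (exp_mul_I_mem_sphere θ), hK⟩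
        exact hne this
    have hmem : ∀ θ : ℝ, E (cis θ) ∈ seg θ := fun θ =>
      ⟨1, by norm_num, by simp⟩
    have hpre : IsPreconnected (Γ \ {p} ∪ seg θ₁ ∪ seg θ₂) := by
      refine IsPreconnected.union _ (Or.inl ⟨hEΓ _ (exp_mul_I_mem_sphere θ₂), h2⟩) (hmem θ₂) ?_
        (hsegp _)
      exact IsPreconnected.union _ ⟨hEΓ _ (exp_mul_I_mem_sphere θ₁), h1⟩ (hmem θ₁) (hcut p)
        (hsegp _)
    refine hasLog_ratio_of_isPreconnected hpre hKcl ?_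
      (Or.inl (Or.inr ⟨1 / 2, by norm_num, hEF hz₁b⟩)) (Or.inr ⟨1 / 2, by norm_num, hEF hz₂b⟩)
    rw [disjoint_union_left, disjoint_union_left]
    refine ⟨⟨?_, hsegK _ (Or.inl ⟨h1a, h1b⟩) h1⟩, hsegK _ (Or.inr ⟨h2a, h2b⟩) h2⟩
    refine disjoint_left.2 fun w hw hwK => hw.2 (hΓK.subset ⟨hw.1, hwK⟩)

/-- The boundary extension is injective. -/
lemma boundary_injOn : InjOn (fun θ : ℝ => E (cis θ)) (Ico 0 (2 * π)) := by
  have main : ∀ a b : ℝ, a < b → b < a + 2 * π → E (cis a) ≠ E (cis b) := by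
    intro a b hab hba
    rcases le_or_gt b (a + π) with h | h
    · exact boundary_ne_of_lt_of_le hF hinj hb hΓ hfr hdisj hcut hE hEF hEΓ hab h
    · have h1 := boundary_ne_of_lt_of_le hF hinj hb hΓ hfr hdisj hcut hE hEF hEΓ hba
        (by linarith)
      rw [exp_add_two_pi_mul_I] at h1
      exact h1.symm
  intro x hx y hy hxy
  rcases lt_trichotomy x y with h | h | h
  · exact (main x y h (by linarith [hx.1, hy.2]) hxy).elim
  · exact h
  · exact (main y x h (by linarith [hy.1, hx.2]) hxy.symm).elim
end

lemma two_pi_periodic_eq {γ : ℝ → ℂ} (hγp : ∀ θ, γ (θ + 2 * π) = γ θ) (θ : ℝ) (k : ℤ) :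
    γ (θ + k * (2 * π)) = γ θ := by
  have h : Periodic γ (2 * π) := hγp
  simpa using h.int_mul k θ

lemma exists_int_add_mem_Ico (a t : ℝ) : ∃ k : ℤ, t + k * (2 * π) ∈ Ico a (a + 2 * π) := by
  refine ⟨-toIcoDiv two_pi_pos a t, ?_⟩
  have := toIcoMod_mem_Ico two_pi_pos a t
  rw [← self_sub_toIcoDiv_zsmul] at this
  simpa [sub_eq_add_neg] using this

lemma exp_mul_I_eq_iff {s t : ℝ} : cis s = cis t ↔ ∃ k : ℤ, s = t + k * (2 * π) := by
  rw [exp_eq_exp_iff_exists_int]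
  refine exists_congr fun k => ⟨fun h => ?_, fun h => by rw [h]; push_cast; ring⟩
  have h1 : (s : ℂ) = t + k * (2 * π) := by
    apply mul_right_cancel₀ I_ne_zero
    rw [h]; ring
  exact_mod_cast h1

section
variable {γ : ℝ → ℂ} (hγc : Continuous γ) (hγp : ∀ θ, γ (θ + 2 * π) = γ θ)
  (hγi : InjOn γ (Ico 0 (2 * π)))
include hγp

lemma image_Ico_eq_range (a : ℝ) : γ '' Ico a (a + 2 * π) = range γ := by
  refine Subset.antisymm (image_subset_range _ _) ?_
  rintro _ ⟨t, rfl⟩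
  obtain ⟨k, hk⟩ := exists_int_add_mem_Ico a t
  exact ⟨_, hk, two_pi_periodic_eq hγp t k⟩

include hγc in
lemma isCompact_range_of_periodic : IsCompact (range γ) := by
  have : range γ = γ '' Icc 0 (2 * π) := by
    refine Subset.antisymm ?_ (image_subset_range _ _)
    rw [← image_Ico_eq_range hγp 0, zero_add]
    exact image_mono Ico_subset_Icc_self
  rw [this]
  exact isCompact_Icc.image hγc

include hγi in
lemma eq_iff_exp_eq {s t : ℝ} : γ s = γ t ↔ cis s = cis t := by
  rw [exp_mul_I_eq_iff]
  constructor
  · intro h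
    obtain ⟨k, hk⟩ := exists_int_add_mem_Ico 0 s
    obtain ⟨l, hl⟩ := exists_int_add_mem_Ico 0 t
    rw [zero_add] at hk hl
    have := hγi hk hl (by rw [two_pi_periodic_eq hγp, two_pi_periodic_eq hγp, h])
    refine ⟨l - k, ?_⟩
    push_cast; linarith
  · rintro ⟨k, rfl⟩
    exact two_pi_periodic_eq hγp t k

include hγc hγi

lemma isPreconnected_range_diff_singleton (p : ℂ) : IsPreconnected (range γ \ {p}) := by
  by_cases hp : p ∈ range γ
  · obtain ⟨s, rfl⟩ := hp
    have : range γ \ {γ s} = γ '' Ioo s (s + 2 * π) := by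
      ext w
      constructor
      · rintro ⟨⟨t, rfl⟩, ht⟩
        obtain ⟨k, hk⟩ := exists_int_add_mem_Ico s t
        refine ⟨_, ⟨lt_of_le_of_ne hk.1 ?_, hk.2⟩, two_pi_periodic_eq hγp t k⟩
        intro h
        apply ht
        rw [h, two_pi_periodic_eq hγp]; rfl
      · rintro ⟨t, ht, rfl⟩
        refine ⟨⟨t, rfl⟩, fun h => ?_⟩
        obtain ⟨k, hk⟩ := exp_mul_I_eq_iff.1 ((eq_iff_exp_eq hγp hγi).1 h)
        have hpi := pi_pos
        have h1 : (0 : ℝ) < k := by nlinarith [ht.1]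
        have h2 : (k : ℝ) < 1 := by nlinarith [ht.2]
        have h1' : (0 : ℤ) < k := by exact_mod_cast h1
        have h2' : k < 1 := by exact_mod_cast h2
        omega
    rw [this]
    exact isPreconnected_Ioo.image _ hγc.continuousOn
  · rw [sdiff_singleton_eq_self hp]
    exact isPreconnected_range hγc

omit hγi in
lemma boundedTurning_of_min_diam {C : ℝ} (hqc : ∀ s t : ℝ, s ≤ t → t ≤ s + 2 * π →
      min (diam (γ '' Icc s t)) (diam (γ '' Icc t (s + 2 * π)))
        ≤ C * ‖γ s - γ t‖) : BoundedTurning (range γ) C := by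
  have key : ∀ s t : ℝ, s ≤ t → t ≤ s + 2 * π → ∃ S ⊆ range γ, IsPreconnected S ∧ γ s ∈ S ∧
      γ t ∈ S ∧ S ⊆ closedBall (γ s) (C * ‖γ s - γ t‖) ∧
      S ⊆ closedBall (γ t) (C * ‖γ s - γ t‖) := by
    intro s t hst hts
    have hball : ∀ a b u : ℝ, u ∈ Icc a b → diam (γ '' Icc a b) ≤ C * ‖γ s - γ t‖ →
        γ '' Icc a b ⊆ closedBall (γ u) (C * ‖γ s - γ t‖) := fun a b u hu h w hw =>
      (dist_le_diam_of_mem (isCompact_Icc.image hγc).isBounded hw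
        (mem_image_of_mem γ hu)).trans h
    rcases min_le_iff.1 (hqc s t hst hts) with h | h
    · exact ⟨_, image_subset_range _ _, isPreconnected_Icc.image _ hγc.continuousOn,
        ⟨s, ⟨le_rfl, hst⟩, rfl⟩, ⟨t, ⟨hst, le_rfl⟩, rfl⟩, hball _ _ s ⟨le_rfl, hst⟩ h,
        hball _ _ t ⟨hst, le_rfl⟩ h⟩
    · refine ⟨_, image_subset_range _ _, isPreconnected_Icc.image _ hγc.continuousOn,
        ⟨s + 2 * π, ⟨hts, le_rfl⟩, hγp s⟩, ⟨t, ⟨le_rfl, hts⟩, rfl⟩, ?_,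
        hball _ _ t ⟨le_rfl, hts⟩ h⟩
      have := hball _ _ (s + 2 * π) ⟨hts, le_rfl⟩ h
      rwa [hγp] at this
  rw [BoundedTurning, ← image_Ico_eq_range hγp 0]
  rintro _ ⟨s, hs, rfl⟩ _ ⟨t, ht, rfl⟩
  rw [image_Ico_eq_range hγp 0]
  rcases le_total s t with h | h
  · obtain ⟨S, h1, h2, h3, h4, h5, h6⟩ := key s t h (by linarith [hs.1, ht.2])
    exact ⟨S, h1, h2, h3, h4, h5⟩
  · obtain ⟨S, h1, h2, h3, h4, h5, h6⟩ := key t s h (by linarith [ht.1, hs.2])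
    rw [norm_sub_rev] at h6
    exact ⟨S, h1, h2, h4, h3, h6⟩

/-- The inverse of a Jordan parametrization, as a map to the unit circle. -/
lemma exists_circle_coordinate : ∃ G : ℂ → ℂ, ContinuousOn G (range γ) ∧
    ∀ t : ℝ, G (γ t) = cis t := by
  classical
  have hinv : ∀ p ∈ range γ, ∃ s, γ s = p := fun p hp => hp
  choose! g hg using hinv
  have hG : ∀ t : ℝ, cexp (g (γ t) * I) = cis t := fun t =>
    (eq_iff_exp_eq hγp hγi).1 (hg _ ⟨t, rfl⟩)
  refine ⟨fun p => cexp (g p * I), ?_, hG⟩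
  set k : Icc (0 : ℝ) (2 * π) → range γ := fun t => ⟨γ t, t, rfl⟩ with hk
  have hkc : Continuous k := (hγc.comp continuous_subtype_val).subtype_mk _
  have hks : Surjective k := by
    rintro ⟨p, hp⟩
    have := image_Ico_eq_range hγp 0 ▸ hp
    rw [zero_add] at this
    obtain ⟨t, ht, rfl⟩ := this
    exact ⟨⟨t, Ico_subset_Icc_self ht⟩, rfl⟩
  have hq : Topology.IsQuotientMap k := hkc.isClosedMap.isQuotientMap hkc hks
  rw [continuousOn_iff_continuous_domRestrict, hq.continuous_iff]
  refine Continuous.congr (f := fun t : Icc (0 : ℝ) (2 * π) =>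
    cexp ((t : ℝ) * I)) (by fun_prop) fun t => (hG t).symm

lemma exists_lift {e : ℝ → ℂ} (hec : Continuous e) (hep : ∀ θ, e (θ + 2 * π) = e θ)
    (hei : InjOn e (Ico 0 (2 * π))) (her : ∀ θ, e θ ∈ range γ) :
    ∃ φ : ℝ → ℝ, Continuous φ ∧ (∀ θ, e θ = γ (φ θ)) ∧ Injective φ ∧
      ((∀ θ, φ (θ + 2 * π) = φ θ + 2 * π) ∨ (∀ θ, φ (θ + 2 * π) = φ θ - 2 * π)) := by
  obtain ⟨G, hGc, hG⟩ := exists_circle_coordinate hγc hγp hγi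
  have hn : ∀ θ, ‖G (e θ)‖ = 1 := by
    intro θ
    obtain ⟨t, ht⟩ := her θ
    rw [← ht, hG, norm_exp_ofReal_mul_I]
  have hGe : Continuous fun θ => G (e θ) := hGc.comp_continuous hec her
  obtain ⟨L, hL, hLe⟩ := hasLog_univ (f := fun z => G (e z.re)) (hGe.comp Complex.continuous_re)
    (fun z h => by have := hn z.re; rw [h] at this; simp at this)
  set φ : ℝ → ℝ := fun θ => (L θ).im with hφ
  have hφc : Continuous φ := Complex.continuous_im.comp
    ((continuousOn_univ.1 hL).comp Complex.continuous_ofReal)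
  have hφe : ∀ θ, cexp (φ θ * I) = G (e θ) := by
    intro θ
    have h1 := hLe θ (mem_univ _)
    simp only [Complex.ofReal_re] at h1
    have h2 := congrArg norm h1
    rw [hn, norm_exp, Real.exp_eq_one_iff] at h2
    rw [← h1]
    congr 1
    apply Complex.ext <;> simp [h2, hφ]
  have heφ : ∀ θ, e θ = γ (φ θ) := by
    intro θ
    obtain ⟨t, ht⟩ := her θ
    rw [← ht, eq_iff_exp_eq hγp hγi, hφe, ← ht, hG]
  obtain ⟨m, hm⟩ : ∃ m : ℤ, ∀ θ, φ (θ + 2 * π) = φ θ + m * (2 * π) := by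
    have h1 : ∀ θ, ∃ k : ℤ, φ (θ + 2 * π) = φ θ + k * (2 * π) := fun θ =>
      exp_mul_I_eq_iff.1 (by rw [hφe, hφe, hep])
    obtain ⟨m, hm⟩ := h1 0
    refine ⟨m, fun θ => ?_⟩
    have h2 := isPreconnected_univ.eq_of_exp_eq (X := ℝ)
      (d := fun θ : ℝ => (((φ (θ + 2 * π) - φ θ : ℝ) : ℂ) * I)) (c := 1) (by fun_prop)
      (fun x _ => by
        obtain ⟨k, hk⟩ := h1 x
        rw [hk, Complex.exp_eq_one_iff]
        exact ⟨k, by push_cast; ring⟩) (mem_univ θ) (mem_univ 0)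
    have h3 := mul_right_cancel₀ I_ne_zero h2
    have h4 : φ (θ + 2 * π) - φ θ = φ (0 + 2 * π) - φ 0 := by exact_mod_cast h3
    linarith
  have hmz : ∀ (k : ℤ) θ, φ (θ + k * (2 * π)) = φ θ + k * (m * (2 * π)) := by
    intro k θ
    have hper : Periodic (fun θ => φ θ - m * θ) (2 * π) := fun θ => by
      simp only [hm]; ring
    have := hper.int_mul k θ
    linarith
  have hei' : ∀ {s t : ℝ}, e s = e t → ∃ k : ℤ, s = t + k * (2 * π) := fun h =>
    exp_mul_I_eq_iff.1 ((eq_iff_exp_eq hep hei).1 h)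
  have hpi := pi_pos
  have hm0 : m ≠ 0 := by
    rintro rfl
    have hinj : InjOn φ (Ico 0 (2 * π)) := fun s hs t ht h =>
      hei hs ht (by rw [heφ, heφ, h])
    have h0 : φ (2 * π) = φ 0 := by simpa using hm 0
    -- the value at `π` differs from the common end value; use the intermediate value theorem
    have hπ0 : φ π ≠ φ 0 := fun h => by
      have := hinj ⟨hpi.le, by linarith⟩ ⟨le_rfl, by linarith⟩ h
      linarith
    set v := (φ π + φ 0) / 2 with hv
    have hv1 : v ∈ uIcc (φ 0) (φ π) := by
      rw [mem_uIcc]; rcases le_total (φ 0) (φ π) with h | h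
      · left; constructor <;> linarith
      · right; constructor <;> linarith
    have hv2 : v ∈ uIcc (φ π) (φ (2 * π)) := by rw [h0, uIcc_comm]; exact hv1
    obtain ⟨s, hs, hsv⟩ := intermediate_value_uIcc hφc.continuousOn hv1
    obtain ⟨t, ht, htv⟩ := intermediate_value_uIcc hφc.continuousOn hv2
    rw [uIcc_of_le hpi.le] at hs
    rw [uIcc_of_le (by linarith)] at ht
    have ht2 : t ≠ 2 * π := by
      rintro rfl
      rw [h0] at htv
      apply hπ0; linarith
    have hsp : s ≠ π := by
      rintro rfl
      apply hπ0; linarith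
    have := hinj ⟨hs.1, by linarith [hs.2]⟩ ⟨by linarith [ht.1], lt_of_le_of_ne ht.2 ht2⟩
      (hsv.trans htv.symm)
    exact hsp (le_antisymm hs.2 (by linarith [ht.1]))
  have hφi : Injective φ := by
    intro s t h
    obtain ⟨k, rfl⟩ := hei' (s := s) (t := t) (by rw [heφ, heφ, h])
    rw [hmz] at h
    have h1 : (k : ℝ) * (m * (2 * π)) = 0 := by linarith
    have h2 : (k : ℝ) = 0 := by
      rcases mul_eq_zero.1 h1 with h | h
      · exact h
      · exfalso
        rcases mul_eq_zero.1 h with h | h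
        · exact hm0 (by exact_mod_cast h)
        · linarith
    simp [h2]
  -- `φ` takes the value `φ 0 ± 2π` first at `2π`
  have hstep : ∀ c : ℝ, c ∈ uIcc (φ 0) (φ (2 * π)) → c ≠ φ 0 →
      (∃ k : ℤ, c = φ 0 + k * (2 * π)) → c = φ (2 * π) := by
    rintro c hc hc0 ⟨k, hk⟩
    obtain ⟨s, hs, hsc⟩ := intermediate_value_uIcc hφc.continuousOn hc
    rw [uIcc_of_le (by linarith)] at hs
    rcases hs.2.lt_or_eq with h | rfl
    · exfalso
      have h1 : e s = e 0 := by
        rw [heφ, heφ, hsc, hk, two_pi_periodic_eq hγp]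
      have := hei ⟨hs.1, h⟩ ⟨le_rfl, by linarith⟩ h1
      rw [this] at hsc
      exact hc0 hsc.symm
    · exact hsc.symm
  have h2π : φ (2 * π) = φ 0 + m * (2 * π) := by simpa using hm 0
  refine ⟨φ, hφc, heφ, hφi, ?_⟩
  rcases lt_or_gt_of_ne hm0 with h | h
  · right
    have hm' : (m : ℝ) ≤ -1 := by exact_mod_cast Int.le_sub_one_of_lt h
    have := hstep (φ 0 - 2 * π) (by
      rw [mem_uIcc]; right; constructor <;> nlinarith) (by linarith) ⟨-1, by push_cast; ring⟩
    intro θ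
    rw [hm]
    have h5 : m * (2 * π) = -(2 * π) := by linarith
    linarith
  · left
    have hm' : (1 : ℝ) ≤ m := by exact_mod_cast h
    have := hstep (φ 0 + 2 * π) (by
      rw [mem_uIcc]; left; constructor <;> nlinarith) (by linarith) ⟨1, by push_cast; ring⟩
    intro θ
    rw [hm]
    have h5 : m * (2 * π) = 2 * π := by linarith
    linarith
end

/-- Carathéodory's theorem for a quasicircle parametrized by `γ`, with the boundary map lifted to
the line. -/
theorem exists_boundary_lift {γ : ℝ → ℂ} (hγc : Continuous γ)
    (hγp : ∀ θ, γ (θ + 2 * π) = γ θ) (hγi : InjOn γ (Ico 0 (2 * π)))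
    (hqc : ∃ C : ℝ, 0 < C ∧ ∀ s t : ℝ, s ≤ t → t ≤ s + 2 * π →
      min (diam (γ '' Icc s t)) (diam (γ '' Icc t (s + 2 * π))) ≤ C * ‖γ s - γ t‖)
    {F : ℂ → ℂ} (hF : DifferentiableOn ℂ F 𝔻) (hinj : InjOn F 𝔻) (hb : IsBounded (F '' 𝔻))
    (hfr : frontier (F '' 𝔻) ⊆ range γ) (hdisj : Disjoint (F '' 𝔻) (range γ)) :
    ∃ E : ℂ → ℂ, ContinuousOn E (closedBall 0 1) ∧ EqOn E F 𝔻 ∧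
      InjOn (fun θ : ℝ => E (cis θ)) (Ico 0 (2 * π)) ∧
      ∃ φ : ℝ → ℝ, Continuous φ ∧ (∀ θ : ℝ, E (cis θ) = γ (φ θ)) ∧ Injective φ ∧
        ((∀ θ, φ (θ + 2 * π) = φ θ + 2 * π) ∨ (∀ θ, φ (θ + 2 * π) = φ θ - 2 * π)) := by
  obtain ⟨C, hC, hqc⟩ := hqc
  have hΓ : IsClosed (range γ) := (isCompact_range_of_periodic hγc hγp).isClosed
  obtain ⟨E, hE, hEF, hEΓ⟩ := exists_continuousOn_closedBall hF hinj hb hΓ hfr hdisj hC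
    (boundedTurning_of_min_diam hγc hγp hqc)
  have hEi := boundary_injOn hF hinj hb hΓ hfr hdisj
    (isPreconnected_range_diff_singleton hγc hγp hγi) hE hEF hEΓ
  refine ⟨E, hE, hEF, hEi, exists_lift hγc hγp hγi (hE.comp_continuous (by fun_prop)
    fun θ => sphere_subset_closedBall (exp_mul_I_mem_sphere θ)) (fun θ => ?_) hEi
    fun θ => hEΓ _ (exp_mul_I_mem_sphere θ)⟩
  rw [exp_add_two_pi_mul_I]

/-- Lebesgue measure on one period. -/
noncomputable abbrev circ : Measure ℝ := volume.restrict (Ioc 0 (2 * π))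

/-- Fourier coefficients of a `2π`-periodic function. -/
noncomputable def fc (u : ℝ → ℂ) (n : ℤ) : ℂ :=
  (1 / (2 * π) : ℂ) * ∫ t in (0 : ℝ)..2 * π, cexp (-(n * t * I)) * u t

lemma fourierCoeffOn_eq_fc (u : ℝ → ℂ) (n : ℤ) : fourierCoeffOn two_pi_pos u n = fc u n := by
  rw [fourierCoeffOn_eq_integral, fc, real_smul]
  congr 1
  · push_cast; simp
  · refine integral_congr fun t _ => ?_
    simp only [fourier_coe_apply, smul_eq_mul]
    congr 2
    have : (π : ℂ) ≠ 0 := by exact_mod_cast pi_ne_zero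
    push_cast
    rw [sub_zero]
    field_simp

lemma parseval_hasSum {u : ℝ → ℂ} (hu : MemLp u 2 circ) :
    HasSum (fun n => ‖fc u n‖ ^ 2) ((2 * π)⁻¹ * ∫ t, ‖u t‖ ^ 2 ∂circ) := by
  have := hasSum_sq_fourierCoeffOn two_pi_pos hu
  simpa only [fourierCoeffOn_eq_fc, sub_zero, smul_eq_mul, integral_of_le two_pi_pos.le] using this

lemma ofReal_norm_sq (z : ℂ) : ofReal (‖z‖ ^ 2) = ‖z‖ₑ ^ 2 := by
  rw [ofReal_pow (norm_nonneg _), ofReal_norm]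

lemma parseval {u : ℝ → ℂ} (hu : MemLp u 2 circ) :
    ∫⁻ t, ‖u t‖ₑ ^ 2 ∂circ = ofReal (2 * π) * ∑' n, ‖fc u n‖ₑ ^ 2 := by
  have h1 := parseval_hasSum hu
  have h2 : Integrable (fun t => ‖u t‖ ^ 2) circ :=
    (memLp_two_iff_integrable_sq_norm hu.aestronglyMeasurable).1 hu
  have h3 : ∫⁻ t, ‖u t‖ₑ ^ 2 ∂circ = ofReal (∫ t, ‖u t‖ ^ 2 ∂circ) := by
    rw [ofReal_integral_eq_lintegral_ofReal h2 (Eventually.of_forall fun t => by positivity)]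
    simp only [ofReal_norm_sq]
  rw [h3]
  simp only [← ofReal_norm_sq]
  rw [← ENNReal.ofReal_tsum_of_nonneg (fun n => by positivity) h1.summable, h1.tsum_eq,
    ← ofReal_mul two_pi_pos.le, mul_inv_cancel_left₀ two_pi_pos.ne']

lemma norm_exp_neg_mul_I (n : ℤ) (t : ℝ) : ‖cexp (-(n * t * I))‖ = 1 := by
  have : -((n : ℂ) * t * I) = ((-(n * t) : ℝ) : ℂ) * I := by push_cast; ring
  rw [this, norm_exp_ofReal_mul_I]

lemma intervalIntegrable_iff_circ {u : ℝ → ℂ} :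
    IntervalIntegrable u volume 0 (2 * π) ↔ Integrable u circ :=
  intervalIntegrable_iff_integrableOn_Ioc_of_le two_pi_pos.le

lemma MeasureTheory.Integrable.exp_mul_circ {u : ℝ → ℂ} (hu : Integrable u circ) (n : ℤ) :
    IntervalIntegrable (fun t : ℝ => cexp (-(n * t * I)) * u t) volume 0 (2 * π) :=
  (intervalIntegrable_iff_circ.2 hu).continuousOn_mul (by fun_prop)

lemma fc_add {u v : ℝ → ℂ} (hu : Integrable u circ) (hv : Integrable v circ) (n : ℤ) :
    fc (fun t => u t + v t) n = fc u n + fc v n := by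
  simp only [fc, mul_add]
  rw [intervalIntegral.integral_add (hu.exp_mul_circ n) (hv.exp_mul_circ n), mul_add]

lemma fc_const_mul (c : ℂ) (u : ℝ → ℂ) (n : ℤ) : fc (fun t => c * u t) n = c * fc u n := by
  simp only [fc, mul_left_comm _ c, intervalIntegral.integral_const_mul]

lemma fc_neg (u : ℝ → ℂ) (n : ℤ) : fc (fun t => -u t) n = -fc u n := by
  simpa using fc_const_mul (-1) u n

lemma fc_sub {u v : ℝ → ℂ} (hu : Integrable u circ) (hv : Integrable v circ) (n : ℤ) :
    fc (fun t => u t - v t) n = fc u n - fc v n := by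
  have := fc_add hu hv.neg n
  have h2 := fc_neg v n
  simp only [sub_eq_add_neg]
  rw [← h2]
  exact this

lemma fc_congr {u v : ℝ → ℂ} (h : u =ᵐ[circ] v) (n : ℤ) : fc u n = fc v n := by
  simp only [fc, integral_of_le two_pi_pos.le]
  congr 1
  exact integral_congr_ae (h.mono fun t ht => by simp only [ht])

lemma fc_exp (k n : ℤ) : fc (fun t => cexp (k * t * I)) n = if n = k then 1 else 0 := by
  simp only [fc, ← Complex.exp_add]
  have hpi : (π : ℂ) ≠ 0 := by exact_mod_cast pi_ne_zero
  split_ifs with h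
  · subst h
    simp; field_simp
  · have hc : ((k : ℂ) - n) * I ≠ 0 :=
      mul_ne_zero (sub_ne_zero.2 (by exact_mod_cast Ne.symm h)) I_ne_zero
    have : ∀ t : ℝ, -(n * t * I) + k * t * I = ((k - n) * I) * t := by
      intro t; ring
    simp only [this]
    rw [integral_exp_mul_complex hc]
    have h1 : ((k : ℂ) - n) * I * ((2 * π : ℝ) : ℂ) = ((k - n : ℤ) : ℂ) * (2 * π * I) := by
      push_cast; ring
    rw [h1, Complex.exp_int_mul_two_pi_mul_I]
    simp

lemma MeasureTheory.MemLp.integrable_circ {u : ℝ → ℂ} (hu : MemLp u 2 circ) : Integrable u circ :=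
  hu.integrable (by norm_num)

lemma continuous_memLp_circ {u : ℝ → ℂ} (hu : Continuous u) (p : ENNReal) : MemLp u p circ := by
  obtain ⟨C, hC⟩ := isCompact_Icc.exists_bound_of_continuousOn (s := Icc 0 (2 * π))
    hu.continuousOn
  refine MemLp.of_bound hu.aestronglyMeasurable C ?_
  filter_upwards [ae_restrict_mem measurableSet_Ioc] with t ht
  exact hC t (Ioc_subset_Icc_self ht)

section periodic
variable {u : ℝ → ℂ} (hp : Periodic u (2 * π))
include hp

lemma fc_shift (t : ℝ) (n : ℤ) : fc (fun x => u (x + t)) n = cexp (n * t * I) * fc u n := by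
  have hper : Periodic (fun x : ℝ => cexp (-(n * x * I)) * u x) (2 * π) := by
    intro x
    simp only [hp x, exp_neg_int_mul_add_two_pi]
  have h1 : ∫ x in (0 : ℝ)..2 * π, cexp (-(n * x * I)) * u (x + t) = cexp (n * t * I) *
        ∫ x in (0 : ℝ)..2 * π, cexp (-(n * x * I)) * u x := by
    have h2 : ∫ x in (0 : ℝ)..2 * π, cexp (-(n * x * I)) * u x =
        ∫ x in (0 + t)..(2 * π + t), cexp (-(n * x * I)) * u x := by
      have := hper.intervalIntegral_add_eq 0 t
      simpa [add_comm] using this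
    rw [h2, ← intervalIntegral.integral_comp_add_right (fun x : ℝ => cexp (-(n * x * I)) * u x),
      ← intervalIntegral.integral_const_mul]
    refine integral_congr fun x _ => ?_
    simp only [← mul_assoc, ← Complex.exp_add]
    congr 2
    push_cast; ring
  simp only [fc, h1]
  ring

end periodic

lemma lintegral_shift {g : ℝ → ENNReal} (hg : Periodic g (2 * π)) (t : ℝ) :
    ∫⁻ x, g (x + t) ∂circ = ∫⁻ x, g x ∂circ := by
  have h1 := hg.lintegral_Ioc_eq two_pi_pos 0 t
  rw [zero_add] at h1
  have h2 := (measurePreserving_add_right volume t).setLIntegral_comp_preimage_emb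
    (measurableEmbedding_addRight t) g (Ioc t (t + 2 * π))
  rw [h1, ← h2]
  simp

/-- Square integrable periodic functions. -/
structure CircL2 (u : ℝ → ℂ) : Prop where
  meas : Measurable u
  per : Periodic u (2 * π)
  fin : ∫⁻ t, ‖u t‖ₑ ^ 2 ∂circ < ⊤

lemma memLp_two_iff_lintegral {u : ℝ → ℂ} {μ : Measure ℝ} (hu : AEStronglyMeasurable u μ) :
    MemLp u 2 μ ↔ ∫⁻ t, ‖u t‖ₑ ^ 2 ∂μ < ⊤ := by
  rw [MemLp, and_iff_right hu, eLpNorm_lt_top_iff_lintegral_rpow_enorm_lt_top (by norm_num)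
    (by norm_num)]
  simp

namespace CircL2
variable {u v : ℝ → ℂ}

lemma memLp (hu : CircL2 u) : MemLp u 2 circ :=
  (memLp_two_iff_lintegral hu.meas.aestronglyMeasurable).2 hu.fin

lemma of_memLp (hm : Measurable u) (hp : Periodic u (2 * π)) (h : MemLp u 2 circ) :
    CircL2 u := ⟨hm, hp, (memLp_two_iff_lintegral h.1).1 h⟩

lemma of_continuous (hc : Continuous u) (hp : Periodic u (2 * π)) : CircL2 u :=
  of_memLp hc.measurable hp (continuous_memLp_circ hc 2)

lemma integrable (hu : CircL2 u) : Integrable u circ := hu.memLp.integrable_circ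

lemma sub (hu : CircL2 u) (hv : CircL2 v) : CircL2 fun t => u t - v t :=
  of_memLp (hu.meas.sub hv.meas) (hu.per.sub hv.per) (hu.memLp.sub hv.memLp)

lemma add (hu : CircL2 u) (hv : CircL2 v) : CircL2 fun t => u t + v t :=
  of_memLp (hu.meas.add hv.meas) (hu.per.add hv.per) (hu.memLp.add hv.memLp)

lemma const_mul (hu : CircL2 u) (c : ℂ) : CircL2 fun t => c * u t :=
  of_memLp (hu.meas.const_mul c) (fun t => by simp only [hu.per t]) (hu.memLp.const_mul c)

lemma shift (hu : CircL2 u) (t : ℝ) : CircL2 fun x => u (x + t) := by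
  refine ⟨hu.meas.comp (measurable_add_const t), fun x => ?_, ?_⟩
  · simp only [add_right_comm x (2 * π) t, hu.per (x + t)]
  · have := lintegral_shift (g := fun x => ‖u x‖ₑ ^ 2) (fun x => by simp only [hu.per x]) t
    rw [this]; exact hu.fin

lemma ae_eq_of_fc_eq (hu : CircL2 u) (hv : CircL2 v) (h : ∀ n, fc u n = fc v n) : u =ᵐ[circ] v := by
  have h1 := parseval (hu.sub hv).memLp
  simp only [fc_sub hu.integrable hv.integrable, h, sub_self, enorm_zero, ne_eq, OfNat.ofNat_ne_zero,
    not_false_eq_true, zero_pow, tsum_zero, mul_zero] at h1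
  rw [lintegral_eq_zero_iff ((hu.sub hv).meas.enorm.pow_const 2)] at h1
  filter_upwards [h1] with t ht
  simpa [sub_eq_zero] using ht

end CircL2

/-- The Douglas energy. -/
noncomputable def douglas (u : ℝ → ℂ) : ENNReal :=
  ∫⁻ x, ∫⁻ y, ofReal (‖u x - u y‖ ^ 2 / ‖cis x - cis y‖ ^ 2) ∂circ ∂circ

lemma ae_circ_exp_ne_one : ∀ᵐ t ∂circ, cexp ((t : ℝ) * I) ≠ 1 := by
  have h1 : ∀ᵐ t ∂circ, t ≠ 2 * π := Measure.ae_ne _ _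
  filter_upwards [h1, ae_restrict_mem measurableSet_Ioc] with t ht ht' h
  rw [Complex.exp_eq_one_iff] at h
  obtain ⟨n, hn⟩ := h
  have h2 : (t : ℂ) = n * (2 * π) := by
    apply mul_right_cancel₀ I_ne_zero
    rw [hn]; ring
  have h3 : t = n * (2 * π) := by exact_mod_cast h2
  have hpi := pi_pos
  have h4 : (0 : ℝ) < n := by by_contra hc; nlinarith [ht'.1]
  have h5 : (n : ℝ) ≤ 1 := by by_contra hc; nlinarith [ht'.2]
  have h6 : (0 : ℤ) < n := by exact_mod_cast h4
  have h7 : n ≤ 1 := by exact_mod_cast h5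
  have : n = 1 := by omega
  subst this
  apply ht; rw [h3]; simp

lemma lintegral_fejer_nat (n : ℕ) : ∫⁻ t : ℝ, ofReal (‖cexp (n * t * I) - 1‖ ^ 2 /
      ‖cis t - 1‖ ^ 2) ∂circ = ofReal (2 * π) * n := by
  set D : ℝ → ℂ := fun t => ∑ k ∈ Finset.range n, cexp (((k : ℤ) : ℂ) * t * I) with hD
  have hDc : Continuous D := by fun_prop
  have h1 : ∫⁻ t : ℝ, ofReal (‖cexp (n * t * I) - 1‖ ^ 2 /
      ‖cis t - 1‖ ^ 2) ∂circ = ∫⁻ t, ‖D t‖ₑ ^ 2 ∂circ := by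
    refine lintegral_congr_ae ?_
    filter_upwards [ae_circ_exp_ne_one] with t ht
    have h2 : D t = (cexp (n * t * I) - 1) / (cis t - 1) := by
      have : ∀ k : ℕ, cexp (((k : ℤ) : ℂ) * t * I) = cis t ^ k := fun k => by
        rw [← Complex.exp_nat_mul]; push_cast; congr 1; ring
      simp only [hD, this]
      rw [geom_sum_eq ht, ← Complex.exp_nat_mul, mul_assoc]
    rw [h2, ← ofReal_norm_sq, norm_div, div_pow]
  have hfc : ∀ (s : Finset ℕ) (m : ℤ), fc (fun t : ℝ => ∑ k ∈ s, cexp (((k : ℤ) : ℂ) * t * I)) m =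
      ∑ k ∈ s, if m = (k : ℤ) then 1 else 0 := by
    intro s m
    classical
    induction s using Finset.induction_on with
    | empty => simp [fc]
    | insert a s ha ih =>
      simp only [Finset.sum_insert ha]
      rw [fc_add ((continuous_memLp_circ (by fun_prop) 2).integrable_circ)
        ((continuous_memLp_circ (by fun_prop) 2).integrable_circ), ih, fc_exp]
  have hm : ∀ m : ℤ, ‖fc D m‖ₑ ^ 2 =
      if m ∈ (Finset.range n).map ⟨Int.ofNat, Int.ofNat_injective⟩ then 1 else 0 := by
    intro m
    rw [hD, hfc]
    split_ifs with h
    · simp only [Finset.mem_map, Function.Embedding.coeFn_mk] at h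
      obtain ⟨k, hk, rfl⟩ := h
      rw [Finset.sum_eq_single k]
      · simp
      · intro j _ hj
        rw [if_neg]; simpa using hj.symm
      · exact fun h => (h hk).elim
    · rw [Finset.sum_eq_zero]
      · simp
      · intro k hk
        rw [if_neg]
        rintro rfl
        exact h (by simpa using hk)
  rw [h1, parseval (continuous_memLp_circ hDc 2)]
  congr 1
  simp only [hm]
  rw [tsum_eq_sum (s := (Finset.range n).map ⟨Int.ofNat, Int.ofNat_injective⟩)
    (fun m hm => if_neg hm), Finset.sum_ite_mem, Finset.inter_self]
  simp

lemma lintegral_fejer (n : ℤ) : ∫⁻ t : ℝ, ofReal (‖cexp (n * t * I) - 1‖ ^ 2 /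
      ‖cis t - 1‖ ^ 2) ∂circ = ofReal (2 * π) * n.natAbs := by
  rw [← lintegral_fejer_nat]
  refine lintegral_congr fun t => ?_
  congr 3
  generalize hN : n.natAbs = N
  rcases Int.natAbs_eq_iff.1 hN with rfl | rfl
  · simp
  · have h3 : ((-(N : ℤ) : ℤ) : ℂ) * t * I = -(((N : ℤ) : ℂ) * t * I) := by
      push_cast; ring
    have h1 : cexp (((-(N : ℤ) : ℤ) : ℂ) * t * I) - 1 =
        -(cexp (-(((N : ℤ) : ℂ) * t * I)) * (cexp (N * t * I) - 1)) := by
      rw [h3, mul_sub, ← Complex.exp_add]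
      simp
    rw [h1, norm_neg, norm_mul, norm_exp_neg_mul_I, one_mul]

/-- Douglas' formula. -/
theorem douglas_eq_tsum {u : ℝ → ℂ} (hu : CircL2 u) :
    douglas u = ofReal (4 * π ^ 2) * ∑' n : ℤ, n.natAbs * ‖fc u n‖ₑ ^ 2 := by
  have hexp : ∀ x t : ℝ, ‖cis x - cexp (((x + t : ℝ) : ℂ) * I)‖ = ‖cis t - 1‖ := by
    intro x t
    push_cast
    rw [add_mul, Complex.exp_add, ← mul_one_sub, norm_mul, norm_exp_ofReal_mul_I, one_mul,
      norm_sub_rev]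
  set κ : ℝ → ENNReal := fun t => ofReal (1 / ‖cis t - 1‖ ^ 2) with hκ
  have hκm : Measurable κ := by
    have : Measurable fun t : ℝ => cis t := by fun_prop
    fun_prop
  have h1 : douglas u = ∫⁻ x, ∫⁻ t, κ t * ‖u (x + t) - u x‖ₑ ^ 2 ∂circ ∂circ := by
    refine lintegral_congr fun x => ?_
    have hper : Periodic (fun y => ofReal (‖u x - u y‖ ^ 2 / ‖cis x - cis y‖ ^ 2)) (2 * π) := by
      intro y
      simp only [hu.per y, exp_add_two_pi_mul_I]
    rw [← lintegral_shift hper x]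
    refine lintegral_congr fun t => ?_
    rw [add_comm t x, hexp, ← ofReal_norm_sq, ← ofReal_mul (by positivity),
      norm_sub_rev]
    congr 1; ring
  have hm2 : Measurable fun p : ℝ × ℝ => κ p.2 * ‖u (p.1 + p.2) - u p.1‖ₑ ^ 2 := by
    have := hu.meas
    fun_prop
  rw [h1, lintegral_lintegral_swap hm2.aemeasurable]
  have h2 : ∀ t : ℝ, ∫⁻ x, κ t * ‖u (x + t) - u x‖ₑ ^ 2 ∂circ =
      ∑' n : ℤ, ofReal (2 * π) * ‖fc u n‖ₑ ^ 2 * ofReal (‖cexp (n * t * I) - 1‖ ^ 2 /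
          ‖cis t - 1‖ ^ 2) := by
    intro t
    have hm : Measurable fun x => ‖u (x + t) - u x‖ₑ ^ 2 :=
      (((hu.shift t).sub hu).meas.enorm.pow_const 2)
    rw [lintegral_const_mul _ hm, parseval ((hu.shift t).sub hu).memLp, mul_left_comm,
      ← ENNReal.tsum_mul_left, ← ENNReal.tsum_mul_left]
    refine tsum_congr fun n => ?_
    rw [fc_sub (hu.shift t).integrable hu.integrable, fc_shift hu.per, ← sub_one_mul, enorm_mul,
      mul_pow, ← ofReal_norm_sq (_ - 1),
      div_eq_mul_one_div (‖cexp (n * t * I) - 1‖ ^ 2),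
      ofReal_mul (p := ‖cexp (n * t * I) - 1‖ ^ 2) (by positivity)]
    simp only [hκ]
    ring
  simp only [h2]
  rw [lintegral_tsum]
  · rw [← ENNReal.tsum_mul_left]
    refine tsum_congr fun n => ?_
    rw [lintegral_const_mul, lintegral_fejer]
    · have : ofReal (4 * π ^ 2) = ofReal (2 * π) * ofReal (2 * π) := by
        rw [← ofReal_mul two_pi_pos.le]; congr 1; ring
      rw [this]; ring
    · have : Measurable fun t : ℝ => cis t := by fun_prop
      have : Measurable fun t : ℝ => cexp (n * t * I) := by fun_prop
      fun_prop
  · intro n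
    have : Measurable fun t : ℝ => cis t := by fun_prop
    have : Measurable fun t : ℝ => cexp (n * t * I) := by fun_prop
    fun_prop

/-- `f` is the sum of the power series with coefficients `a` in the unit disc. -/
def PS (a : ℕ → ℂ) (f : ℂ → ℂ) : Prop :=
  ∀ z ∈ 𝔻, HasSum (fun n => a n * z ^ n) (f z)

/-- Extension by zero of a sequence to negative indices. -/
def zc (a : ℕ → ℂ) : ℤ → ℂ
  | .ofNat n => a n
  | .negSucc _ => 0

@[simp] lemma zc_natCast (a : ℕ → ℂ) (n : ℕ) : zc a (n : ℤ) = a n := rfl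

lemma zc_of_notMem_range (a : ℕ → ℂ) {n : ℤ} (hn : n ∉ range ((↑) : ℕ → ℤ)) : zc a n = 0 := by
  cases n with
  | ofNat n => exact (hn ⟨n, rfl⟩).elim
  | negSucc n => rfl

lemma tsum_zc (φ : ℤ → ℂ → ENNReal) (hφ : ∀ n, φ n 0 = 0) (a : ℕ → ℂ) :
    ∑' n : ℤ, φ n (zc a n) = ∑' n : ℕ, φ n (a n) := by
  have := Injective.tsum_eq (g := ((↑) : ℕ → ℤ)) Nat.cast_injective
    (f := fun n : ℤ => φ n (zc a n)) (by
      intro n hn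
      by_contra h
      exact hn (by simp [zc_of_notMem_range a h, hφ]))
  rw [← this]
  rfl

lemma fc_eq_zc_of_hasSum {u : ℝ → ℂ} {b : ℕ → ℂ} (hb : Summable fun n => ‖b n‖)
    (hu : ∀ t : ℝ, HasSum (fun n : ℕ => b n * cexp ((n : ℤ) * t * I)) (u t)) (n : ℤ) :
    fc u n = zc b n := by
  have h1 : HasSum (fun k : ℕ => ∫ t in (0 : ℝ)..2 * π, cexp (-(n * t * I)) *
      (b k * cexp ((k : ℤ) * t * I)))
      (∫ t in (0 : ℝ)..2 * π, cexp (-(n * t * I)) * u t) := by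
    refine intervalIntegral.hasSum_integral_of_dominated_convergence (fun k _ => ‖b k‖) ?_ ?_ ?_ ?_ ?_
    · intro k
      exact (Continuous.aestronglyMeasurable (by fun_prop))
    · intro k
      refine Eventually.of_forall fun t _ => ?_
      rw [norm_mul, norm_mul, norm_exp_neg_mul_I, one_mul, mul_assoc]
      have : ((k : ℤ) : ℂ) * (t * I) = ((k * t : ℝ) : ℂ) * I := by push_cast; ring
      rw [this, norm_exp_ofReal_mul_I, mul_one]
    · exact Eventually.of_forall fun t _ => hb
    · exact intervalIntegrable_const
    · exact Eventually.of_forall fun t _ => (hu t).mul_left _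
  have h2 := h1.mul_left (1 / (2 * π) : ℂ)
  have h3 : ∀ k : ℕ, (1 / (2 * π) : ℂ) * (∫ t in (0 : ℝ)..2 * π, cexp (-(n * t * I)) *
      (b k * cexp ((k : ℤ) * t * I))) = if n = (k : ℤ) then b k else 0 := by
    intro k
    have : (1 / (2 * π) : ℂ) * (∫ t in (0 : ℝ)..2 * π, cexp (-(n * t * I)) *
      (b k * cexp ((k : ℤ) * t * I))) =
      fc (fun t : ℝ => b k * cexp (((k : ℤ) : ℂ) * t * I)) n := rfl
    rw [this, fc_const_mul, fc_exp]
    simp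
  simp only [h3] at h2
  refine h2.unique ?_
  cases n with
  | ofNat m =>
    have := hasSum_single (f := fun k : ℕ => if (Int.ofNat m) = (k : ℤ) then b k else 0) m (by
      intro k hk
      rw [if_neg]
      simpa using hk.symm)
    simpa [zc] using this
  | negSucc m =>
    have : ∀ k : ℕ, (Int.negSucc m) ≠ (k : ℤ) := by intro k; omega
    simp only [this, if_false]
    exact hasSum_zero

lemma circle_mem_ball {r : ℝ} (hr0 : 0 ≤ r) (hr1 : r < 1) (θ : ℝ) : (r : ℂ) * cis θ ∈ 𝔻 := by
  rw [mem_ball_zero_iff, norm_mul, norm_exp_ofReal_mul_I, mul_one, norm_real, norm_of_nonneg hr0]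
  exact hr1

lemma circle_periodic (f : ℂ → ℂ) (r : ℝ) : Periodic (fun θ : ℝ => f (r * cis θ)) (2 * π) := by
  intro θ
  simp only [exp_add_two_pi_mul_I]

namespace PS
variable {a b : ℕ → ℂ} {f g : ℂ → ℂ}

lemma summable_norm (h : PS a f) {r : ℝ} (hr0 : 0 ≤ r) (hr1 : r < 1) :
    Summable fun n => ‖a n‖ * r ^ n := by
  have := (h r (by simpa [abs_of_nonneg hr0] using hr1)).summable.norm
  simpa [abs_of_nonneg hr0] using this

lemma fc_circle (h : PS a f) {r : ℝ} (hr0 : 0 ≤ r) (hr1 : r < 1) (n : ℤ) :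
    fc (fun θ : ℝ => f (r * cis θ)) n = zc (fun k => a k * r ^ k) n := by
  refine fc_eq_zc_of_hasSum ?_ ?_ n
  · simpa [abs_of_nonneg hr0] using h.summable_norm hr0 hr1
  · intro t
    have := h _ (circle_mem_ball hr0 hr1 t)
    convert this using 2 with k
    rw [mul_pow, ← Complex.exp_nat_mul, mul_assoc]
    push_cast
    rw [mul_assoc (k : ℂ)]

lemma coeff_unique (h : PS a f) (h' : PS b g) (hfg : EqOn f g 𝔻) : a = b := by
  funext n
  have h0 : (0 : ℝ) ≤ 1 / 2 := by norm_num
  have h1 : (1 / 2 : ℝ) < 1 := by norm_num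
  have e1 := h.fc_circle h0 h1 n
  have e2 := h'.fc_circle h0 h1 n
  have : (fun θ : ℝ => f (((1 / 2 : ℝ) : ℂ) * cis θ)) =
      fun θ : ℝ => g (((1 / 2 : ℝ) : ℂ) * cis θ) :=
    funext fun θ => hfg (circle_mem_ball h0 h1 θ)
  rw [this, e2] at e1
  rw [zc_natCast, zc_natCast] at e1
  exact mul_right_cancel₀ (by norm_num) e1.symm

lemma of_differentiableOn (hf : DifferentiableOn ℂ f 𝔻) :
    PS (fun n => (n.factorial : ℂ)⁻¹ * iteratedDeriv n f 0) f := by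
  intro z hz
  have := Complex.hasSum_taylorSeries_on_ball hf hz
  simp only [sub_zero, smul_eq_mul] at this
  have h4 : (fun n : ℕ => (n.factorial : ℂ)⁻¹ * iteratedDeriv n f 0 * z ^ n) =
      fun n : ℕ => (n.factorial : ℂ)⁻¹ * (z ^ n * iteratedDeriv n f 0) := by
    funext n; ring
  beta_reduce
  rw [h4]
  exact this

lemma differentiableOn (h : PS a f) : DifferentiableOn ℂ f 𝔻 := by
  intro z hz
  obtain ⟨r, hr, hr1⟩ := exists_between (mem_ball_zero_iff.1 hz)
  have hr0 : 0 ≤ r := (norm_nonneg _).trans hr.le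
  have h1 : DifferentiableOn ℂ (fun z => ∑' n, a n * z ^ n) (ball 0 r) := by
    refine Complex.differentiableOn_tsum_of_summable_norm (h.summable_norm hr0 hr1)
      (fun n => by fun_prop) isOpen_ball fun n w hw => ?_
    rw [norm_mul, norm_pow]
    have := (mem_ball_zero_iff.1 hw).le
    gcongr
  have h2 := (h1 z (mem_ball_zero_iff.2 hr)).differentiableAt (isOpen_ball.mem_nhds (mem_ball_zero_iff.2 hr))
  refine (h2.congr_of_eventuallyEq ?_).differentiableWithinAt
  filter_upwards [isOpen_ball.mem_nhds hz] with w hw using (h w hw).tsum_eq.symm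

lemma deriv (h : PS a f) : PS (fun n => (n + 1) * a (n + 1)) (deriv f) := by
  have h1 := of_differentiableOn h.differentiableOn
  have h2 : DifferentiableOn ℂ (_root_.deriv f) 𝔻 := h.differentiableOn.deriv isOpen_ball
  have h3 := of_differentiableOn h2
  have h4 := h.coeff_unique h1 fun _ _ => rfl
  convert h3 using 2 with n
  rw [h4]
  simp only [iteratedDeriv_succ', Nat.factorial_succ]
  push_cast
  have : (n : ℂ) + 1 ≠ 0 := by exact_mod_cast Nat.succ_ne_zero n
  have : (n.factorial : ℂ) ≠ 0 := by exact_mod_cast n.factorial_ne_zero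
  field_simp

lemma coeff_zero (h : PS a f) : a 0 = f 0 := by
  have := h 0 (by simp)
  have h2 := hasSum_single (f := fun n => a n * (0 : ℂ) ^ n) 0 (by intro n hn; simp [hn])
  simpa using h2.unique this

lemma of_summable (h : ∀ r : ℝ, 0 ≤ r → r < 1 → Summable fun n => ‖a n‖ * r ^ n) :
    PS a fun z => ∑' n, a n * z ^ n := by
  intro z hz
  refine Summable.hasSum (Summable.of_norm ?_)
  simpa using h ‖z‖ (norm_nonneg _) (mem_ball_zero_iff.1 hz)

lemma continuous_circle (h : PS a f) {r : ℝ} (hr0 : 0 ≤ r) (hr1 : r < 1) :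
    Continuous fun θ : ℝ => f (r * cis θ) :=
  h.differentiableOn.continuousOn.comp_continuous (by fun_prop) (circle_mem_ball hr0 hr1)

lemma circL2_circle (h : PS a f) {r : ℝ} (hr0 : 0 ≤ r) (hr1 : r < 1) :
    CircL2 fun θ : ℝ => f (r * cis θ) :=
  .of_continuous (h.continuous_circle hr0 hr1) (circle_periodic f r)

lemma lintegral_circle (h : PS a f) {r : ℝ} (hr0 : 0 ≤ r) (hr1 : r < 1) :
    ∫⁻ θ : ℝ, ‖f (r * cis θ)‖ₑ ^ 2 ∂circ = ofReal (2 * π) * ∑' n, ‖a n * r ^ n‖ₑ ^ 2 := by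
  rw [parseval (h.circL2_circle hr0 hr1).memLp]
  simp only [h.fc_circle hr0 hr1]
  rw [tsum_zc (fun _ z => ‖z‖ₑ ^ 2) (by simp)]

lemma mul (h : PS a f) (h' : PS b g) :
    PS (fun n => ∑ p ∈ antidiagonal n, a p.1 * b p.2) fun z => f z * g z := by
  intro z hz
  have h1 := h z hz
  have h2 := h' z hz
  have h3 := (summable_norm_sum_mul_antidiagonal_of_summable_norm h1.summable.norm
    h2.summable.norm).of_norm.hasSum
  rw [← tsum_mul_tsum_eq_tsum_sum_antidiagonal_of_summable_norm h1.summable.norm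
    h2.summable.norm, h1.tsum_eq, h2.tsum_eq] at h3
  have h4 : (fun n => (∑ p ∈ antidiagonal n, a p.1 * b p.2) * z ^ n) = fun n =>
      ∑ p ∈ antidiagonal n, a p.1 * z ^ p.1 * (b p.2 * z ^ p.2) := ?_
  · beta_reduce; rw [h4]; exact h3
  funext n
  rw [sum_mul]
  refine sum_congr rfl fun p hp => ?_
  rw [← Finset.HasAntidiagonal.mem_antidiagonal.1 hp, pow_add]
  ring

end PS

lemma lintegral_ball_polar {g : ℂ → ENNReal} (hg : Measurable g) :
    ∫⁻ z in 𝔻, g z = ∫⁻ r in Ioo (0 : ℝ) 1, ofReal r * ∫⁻ θ : ℝ, g (r * cis θ) ∂circ := by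
  rw [← lintegral_indicator measurableSet_ball, lintegral_polar (hg.indicator measurableSet_ball)]
  have h1 : Ioo (0 : ℝ) 1 = Ioi 0 ∩ Iio 1 := rfl
  have h2 : ∀ r ∈ Ioi (0 : ℝ), (∫⁻ θ in Ioo (-π) π, ofReal r * (𝔻).indicator g (r * cis θ)) =
      (Iio (1 : ℝ)).indicator (fun r : ℝ => ofReal r * ∫⁻ θ : ℝ, g (r * cis θ) ∂circ) r := by
    intro r hr
    have hn : ∀ θ : ℝ, ‖(r : ℂ) * cis θ‖ = r := fun θ => by
      rw [norm_mul, norm_exp_ofReal_mul_I, mul_one, norm_real, norm_of_nonneg (le_of_lt hr)]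
    by_cases h : r < 1
    · rw [indicator_of_mem (show r ∈ Iio 1 from h)]
      have : ∀ θ : ℝ, (𝔻).indicator g (r * cis θ) = g (r * cis θ) := fun θ =>
        indicator_of_mem (by rw [mem_ball_zero_iff, hn]; exact h) g
      simp only [this]
      rw [lintegral_const_mul _ (by fun_prop), restrict_Ioo_eq_restrict_Ioc]
      congr 1
      have hper := circle_periodic (fun z => (0 : ℂ)) r
      have := Periodic.lintegral_Ioc_eq (g := fun θ : ℝ => g (r * cis θ))
        two_pi_pos (fun θ => by simp only [exp_add_two_pi_mul_I]) (-π) 0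
      rw [show -π + 2 * π = π by ring, zero_add] at this
      exact this
    · rw [indicator_of_notMem (show r ∉ Iio 1 from h)]
      have : ∀ θ : ℝ, (𝔻).indicator g (r * cis θ) = 0 := fun θ =>
        indicator_of_notMem (by rw [mem_ball_zero_iff, hn]; exact h) g
      simp [this]
  rw [setLIntegral_congr_fun measurableSet_Ioi h2, lintegral_indicator measurableSet_Iio,
    Measure.restrict_restrict measurableSet_Iio, inter_comm, ← h1]

lemma lintegral_radial (n : ℕ) (c : ENNReal) :
    ∫⁻ r in Ioo (0 : ℝ) 1, ofReal r * (c * ‖((r : ℂ) ^ n)‖ₑ ^ 2) =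
      c * ofReal (1 / (2 * n + 2)) := by
  have h1 : ∀ r ∈ Ioo (0 : ℝ) 1, ofReal r * (c * ‖((r : ℂ) ^ n)‖ₑ ^ 2) =
      c * ofReal (r ^ (2 * n + 1)) := by
    intro r hr
    rw [← ofReal_norm_sq, mul_left_comm, ← ofReal_mul hr.1.le, norm_pow,
      norm_real, norm_of_nonneg hr.1.le]
    congr 2; ring
  rw [setLIntegral_congr_fun measurableSet_Ioo h1, lintegral_const_mul _ (by fun_prop)]
  congr 1
  rw [restrict_Ioo_eq_restrict_Ioc, ← ofReal_integral_eq_lintegral_ofReal,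
    ← integral_of_le zero_le_one, integral_pow]
  · congr 1; push_cast; simp; ring
  · exact ((continuous_pow _).integrableOn_Icc (a := (0 : ℝ)) (b := 1)).mono_set Ioc_subset_Icc_self
  · filter_upwards [ae_restrict_mem measurableSet_Ioc] with r hr
    exact pow_nonneg hr.1.le _

lemma PS.lintegral_sq {a : ℕ → ℂ} {f : ℂ → ℂ} (h : PS a f) (hm : Measurable f) :
    ∫⁻ z in 𝔻, ‖f z‖ₑ ^ 2 = ofReal π * ∑' n : ℕ, ‖a n‖ₑ ^ 2 * ofReal (1 / (n + 1)) := by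
  rw [lintegral_ball_polar (by fun_prop)]
  have h1 : ∀ r ∈ Ioo (0 : ℝ) 1, (ofReal r * ∫⁻ θ : ℝ, ‖f (r * cis θ)‖ₑ ^ 2 ∂circ) =
      ∑' n : ℕ, ofReal r * ((ofReal (2 * π) * ‖a n‖ₑ ^ 2) * ‖((r : ℂ) ^ n)‖ₑ ^ 2) := by
    intro r hr
    rw [h.lintegral_circle hr.1.le hr.2, ENNReal.tsum_mul_left, ← ENNReal.tsum_mul_left]
    congr 1
    refine tsum_congr fun n => ?_
    rw [enorm_mul, mul_pow]; ring
  rw [setLIntegral_congr_fun measurableSet_Ioo h1, lintegral_tsum (fun n => by fun_prop),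
    ← ENNReal.tsum_mul_left]
  refine tsum_congr fun n => ?_
  rw [lintegral_radial, mul_right_comm, ← ofReal_mul two_pi_pos.le, mul_comm (‖a n‖ₑ ^ 2),
    ← mul_assoc, ← ofReal_mul pi_pos.le]
  congr 2
  have : (n : ℝ) + 1 ≠ 0 := by positivity
  field_simp

/-- The Dirichlet integral in terms of power series coefficients. -/
lemma PS.lintegral_deriv_sq {a : ℕ → ℂ} {f : ℂ → ℂ} (h : PS a f) :
    ∫⁻ z in 𝔻, ‖_root_.deriv f z‖ₑ ^ 2 = ofReal π * ∑' n : ℕ, n * ‖a n‖ₑ ^ 2 := by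
  rw [h.deriv.lintegral_sq (measurable_deriv f)]
  congr 1
  rw [tsum_eq_zero_add' (f := fun n : ℕ => (n : ENNReal) * ‖a n‖ₑ ^ 2) ENNReal.summable]
  simp only [Nat.cast_zero, zero_mul, zero_add]
  refine tsum_congr fun n => ?_
  have h1 : ‖((n : ℂ) + 1)‖ₑ = ((n + 1 : ℕ) : ENNReal) := by
    rw [← ofReal_norm, show (n : ℂ) + 1 = ((n + 1 : ℕ) : ℂ) by push_cast; rfl,
      Complex.norm_natCast, ofReal_natCast]
  rw [enorm_mul, mul_pow, h1, mul_right_comm]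
  congr 1
  rw [sq, mul_assoc, ← ofReal_natCast, ← ofReal_mul (by positivity)]
  push_cast
  rw [mul_one_div_cancel (by positivity)]
  simp

lemma lebedevMilin_real {a b : ℕ → ℝ} (ha : ∀ n, 0 ≤ a n) (ha0 : a 0 = 0) (hb : ∀ n, 0 ≤ b n)
    (hb0 : b 0 = 1) (h : ∀ n, (n + 1) * b (n + 1) ≤ ∑ p ∈ antidiagonal n,
      (p.1 + 1) * a (p.1 + 1) * b p.2) (N : ℕ) :
    ∑ n ∈ Finset.range (N + 1), b n ≤ exp (∑ n ∈ Finset.range (N + 1), a n) := by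
  set P : ℝ → ℝ := fun x => ∑ n ∈ Finset.range (N + 1), b n * x ^ n with hP
  set A : ℝ → ℝ := fun x => ∑ n ∈ Finset.range (N + 1), a n * x ^ n with hA
  have hder : ∀ (c : ℕ → ℝ) (x : ℝ), HasDerivAt (fun x : ℝ => ∑ n ∈ Finset.range (N + 1), c n * x ^ n)
      (∑ n ∈ Finset.range N, (n + 1) * c (n + 1) * x ^ n) x := by
    intro c x
    have h1 : HasDerivAt (fun x : ℝ => ∑ n ∈ Finset.range (N + 1), c n * x ^ n)
        (∑ n ∈ Finset.range (N + 1), c n * (n * x ^ (n - 1))) x :=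
      HasDerivAt.fun_sum fun n _ => (hasDerivAt_pow n x).const_mul (c n)
    convert h1 using 1
    rw [Finset.sum_range_succ']
    simp only [Nat.cast_zero, zero_mul, mul_zero, add_zero]
    refine sum_congr rfl fun n _ => ?_
    push_cast; ring
  have hle : ∀ x ∈ Icc (0 : ℝ) 1, ∑ n ∈ Finset.range N, (n + 1) * b (n + 1) * x ^ n ≤
      (∑ n ∈ Finset.range N, (n + 1) * a (n + 1) * x ^ n) * P x := by
    intro x hx
    calc ∑ n ∈ Finset.range N, (n + 1) * b (n + 1) * x ^ n
        ≤ ∑ n ∈ Finset.range N, ∑ p ∈ antidiagonal n,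
          ((p.1 + 1) * a (p.1 + 1) * x ^ p.1) * (b p.2 * x ^ p.2) := by
          refine sum_le_sum fun n _ => ?_
          calc _ ≤ (∑ p ∈ antidiagonal n, (p.1 + 1) * a (p.1 + 1) * b p.2) * x ^ n :=
                mul_le_mul_of_nonneg_right (h n) (pow_nonneg hx.1 _)
            _ = _ := by
              rw [sum_mul]
              refine sum_congr rfl fun p hp => ?_
              rw [← Finset.HasAntidiagonal.mem_antidiagonal.1 hp, pow_add]; ring
      _ = ∑ s ∈ (Finset.range N).sigma fun n => antidiagonal n,
          ((s.2.1 + 1) * a (s.2.1 + 1) * x ^ s.2.1) * (b s.2.2 * x ^ s.2.2) := by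
          rw [Finset.sum_sigma]
      _ ≤ ∑ p ∈ Finset.range N ×ˢ Finset.range (N + 1),
          ((p.1 + 1) * a (p.1 + 1) * x ^ p.1) * (b p.2 * x ^ p.2) := by
          have hinj : InjOn (fun s : (_ : ℕ) × ℕ × ℕ => s.2)
              ((Finset.range N).sigma fun n => antidiagonal n) := by
            rintro ⟨n, p⟩ hs ⟨m, q⟩ hs' (h : p = q)
            simp only [Finset.coe_sigma, mem_sigma_iff, Finset.mem_coe,
              Finset.HasAntidiagonal.mem_antidiagonal] at hs hs'
            subst h
            obtain rfl : n = m := hs.2.symm.trans hs'.2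
            rfl
          rw [← Finset.sum_image (f := fun p : ℕ × ℕ =>
            ((p.1 + 1) * a (p.1 + 1) * x ^ p.1) * (b p.2 * x ^ p.2)) hinj]
          refine Finset.sum_le_sum_of_subset_of_nonneg ?_ fun p _ _ => ?_
          · intro p hp
            simp only [Finset.mem_image, Finset.mem_sigma, Finset.mem_range,
              Finset.HasAntidiagonal.mem_antidiagonal] at hp
            obtain ⟨⟨n, q⟩, ⟨h1, h2⟩, rfl⟩ := hp
            simp only [Finset.mem_product, Finset.mem_range]
            dsimp only at h1 h2 ⊢
            omega
          · have := ha (p.1 + 1)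
            have := hb p.2
            have := hx.1
            positivity
      _ = _ := by rw [Finset.sum_product, hP, Finset.sum_mul_sum]
  have hQ : ∀ x, HasDerivAt (fun x => P x * exp (-A x))
      ((∑ n ∈ Finset.range N, (n + 1) * b (n + 1) * x ^ n) * exp (-A x) + P x * (exp (-A x) *
        -(∑ n ∈ Finset.range N, (n + 1) * a (n + 1) * x ^ n))) x := fun x =>
    (hder b x).mul ((hder a x).neg.exp)
  have hanti : AntitoneOn (fun x => P x * exp (-A x)) (Icc 0 1) := by
    refine antitoneOn_of_deriv_nonpos (convex_Icc _ _)
      (fun x _ => (hQ x).continuousAt.continuousWithinAt)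
      (fun x _ => (hQ x).differentiableAt.differentiableWithinAt) fun x hx => ?_
    rw [interior_Icc] at hx
    rw [(hQ x).deriv]
    have := hle x (Ioo_subset_Icc_self hx)
    have := mul_le_mul_of_nonneg_right this (exp_pos (-A x)).le
    linarith
  have h01 := hanti (left_mem_Icc.2 zero_le_one) (right_mem_Icc.2 zero_le_one) zero_le_one
  have hz : ∀ c : ℕ → ℝ, ∑ n ∈ Finset.range (N + 1), c n * (0 : ℝ) ^ n = c 0 := by
    intro c
    rw [Finset.sum_range_succ']
    simp
  simp only [hP, hA, hz, ha0, hb0, one_pow, mul_one, neg_zero, exp_zero] at h01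
  rw [exp_neg, ← div_eq_mul_inv, div_le_one (exp_pos _)] at h01
  exact h01

/-- The (second) Lebedev–Milin inequality. -/
theorem PS.lebedevMilin {α β : ℕ → ℂ} {f : ℂ → ℂ} (hf : PS α f) (hα : α 0 = 0)
    (hβ : PS β fun z => cexp (f z)) {A : ℝ}
    (hA : ∑' n : ℕ, n * ‖α n‖ₑ ^ 2 ≤ ofReal A) (hA0 : 0 ≤ A) :
    ∑' n, ‖β n‖ₑ ^ 2 ≤ ofReal (exp A) := by
  have hβ0 : β 0 = 1 := by rw [hβ.coeff_zero, ← hf.coeff_zero, hα, Complex.exp_zero]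
  have hrec : ∀ n : ℕ, ((n : ℂ) + 1) * β (n + 1) = ∑ p ∈ antidiagonal n,
      ((p.1 + 1) * α (p.1 + 1)) * β p.2 := by
    have h1 := hβ.deriv
    have h2 := hf.deriv.mul hβ
    have := h1.coeff_unique h2 fun z hz => by
      have := (hf.differentiableOn.differentiableAt (isOpen_ball.mem_nhds hz)).hasDerivAt.cexp
      rw [this.deriv, mul_comm]
    exact fun n => congrFun this n
  have hreal : ∀ N, ∑ n ∈ Finset.range (N + 1), ‖β n‖ ^ 2 ≤
      exp (∑ n ∈ Finset.range (N + 1), n * ‖α n‖ ^ 2) := by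
    refine lebedevMilin_real (fun n => by positivity) (by simp) (fun n => by positivity)
      (by simp [hβ0]) fun n => ?_
    have h1 : (((n : ℝ) + 1) * ‖β (n + 1)‖) ^ 2 ≤ (n + 1) *
        ∑ p ∈ antidiagonal n, (((p.1 : ℝ) + 1) * ‖α (p.1 + 1)‖ * ‖β p.2‖) ^ 2 := by
      have h2 : ((n : ℝ) + 1) * ‖β (n + 1)‖ ≤ ∑ p ∈ antidiagonal n,
          ((p.1 : ℝ) + 1) * ‖α (p.1 + 1)‖ * ‖β p.2‖ := by
        have hn : ∀ k : ℕ, ‖(k : ℂ) + 1‖ = (k : ℝ) + 1 := fun k => by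
          rw [show (k : ℂ) + 1 = ((k + 1 : ℕ) : ℂ) by push_cast; rfl, Complex.norm_natCast]
          push_cast; rfl
        have := congrArg norm (hrec n)
        rw [norm_mul, hn] at this
        rw [this]
        refine (norm_sum_le _ _).trans (le_of_eq (sum_congr rfl fun p _ => ?_))
        rw [norm_mul, norm_mul, hn]
      refine (pow_le_pow_left₀ (by positivity) h2 2).trans ?_
      have := sq_sum_le_card_mul_sum_sq (s := antidiagonal n)
        (f := fun p : ℕ × ℕ => ((p.1 : ℝ) + 1) * ‖α (p.1 + 1)‖ * ‖β p.2‖)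
      rw [Finset.Nat.card_antidiagonal] at this
      push_cast at this
      exact this
    have hpos : (0 : ℝ) < n + 1 := by positivity
    rw [← mul_le_mul_iff_right₀ hpos]
    calc _ = (((n : ℝ) + 1) * ‖β (n + 1)‖) ^ 2 := by ring
      _ ≤ _ := h1
      _ = _ := by
        congr 1
        refine sum_congr rfl fun p _ => ?_
        push_cast; ring
  refine ENNReal.tsum_le_of_sum_range_le fun N => ?_
  have h1 : ∑ n ∈ Finset.range N, ‖β n‖ₑ ^ 2 ≤ ∑ n ∈ Finset.range (N + 1), ‖β n‖ₑ ^ 2 :=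
    Finset.sum_le_sum_of_subset (Finset.range_mono (Nat.le_succ N))
  refine h1.trans ?_
  simp only [← ofReal_norm_sq]
  rw [← ofReal_sum_of_nonneg (fun n _ => by positivity)]
  refine ofReal_le_ofReal ((hreal N).trans (exp_le_exp.2 ?_))
  rw [← ofReal_le_ofReal_iff hA0, ofReal_sum_of_nonneg (fun n _ => by positivity)]
  refine le_trans (le_trans (le_of_eq ?_) (ENNReal.sum_le_tsum (Finset.range (N + 1)))) hA
  refine sum_congr rfl fun n _ => ?_
  rw [ofReal_mul (by positivity), ofReal_natCast, ofReal_norm_sq]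

lemma exists_seq_tendsto_zero_ae {α ι : Type*} [MeasurableSpace α] {μ : Measure α} {l : Filter ι}
    [l.NeBot] [l.IsCountablyGenerated] {h : ι → α → ENNReal} (hm : ∀ᶠ i in l, Measurable (h i))
    (h0 : Tendsto (fun i => ∫⁻ x, h i x ∂μ) l (nhds 0)) : ∃ ns : ℕ → ι, Tendsto ns atTop l ∧
      ∀ᵐ x ∂μ, Tendsto (fun k => h (ns k) x) atTop (nhds 0) := by
  obtain ⟨x, hx⟩ := Filter.exists_seq_tendsto l
  have h1 : ∀ k : ℕ, ∀ᶠ n in atTop, ∫⁻ y, h (x n) y ∂μ < (1 / 2 : ENNReal) ^ k ∧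
      Measurable (h (x n)) := fun k =>
    ((h0.comp hx).eventually (gt_mem_nhds (ENNReal.pow_pos (by simp) k))).and (hx.eventually hm)
  obtain ⟨φ, hφ, hφ'⟩ := Filter.extraction_forall_of_eventually h1
  refine ⟨x ∘ φ, hx.comp hφ.tendsto_atTop, ?_⟩
  have h2 : ∫⁻ y, ∑' k, h (x (φ k)) y ∂μ ≠ ⊤ := by
    rw [lintegral_tsum fun k => (hφ' k).2.aemeasurable]
    refine ne_top_of_le_ne_top ?_ (ENNReal.tsum_le_tsum fun k => (hφ' k).1.le)
    rw [ENNReal.tsum_geometric]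
    simp
  filter_upwards [ae_lt_top' (AEMeasurable.tsum fun k => (hφ' k).2.aemeasurable) h2] with y hy
  exact ENNReal.tendsto_atTop_zero_of_tsum_ne_top hy.ne

/-- Riesz–Fischer. -/
theorem exists_circL2_fc_eq {c : ℤ → ℂ} (hc : ∑' n, ‖c n‖ₑ ^ 2 < ⊤) :
    ∃ u, CircL2 u ∧ ∀ n, fc u n = c n := by
  have : Fact (0 < 2 * π) := ⟨two_pi_pos⟩
  have hmem : Memℓp c 2 := by
    rw [memℓp_gen_iff (by norm_num)]
    have h1 : Summable fun n => ‖c n‖₊ ^ 2 := by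
      rw [← ENNReal.tsum_coe_ne_top_iff_summable]
      simpa [enorm] using hc.ne
    have := NNReal.summable_coe.2 h1
    simpa using this
  set U : Lp ℂ 2 (AddCircle.haarAddCircle (T := 2 * π)) := fourierBasis.repr.symm ⟨c, hmem⟩ with hU
  have hUc : ∀ n, fourierCoeff U n = c n := by
    intro n
    rw [← fourierBasis_repr, hU, LinearIsometryEquiv.apply_symm_apply]
  have hUm : Measurable (U : AddCircle (2 * π) → ℂ) := (Lp.stronglyMeasurable U).measurable
  refine ⟨fun t => U (t : AddCircle (2 * π)), ⟨hUm.comp AddCircle.measurable_mk', fun t => ?_, ?_⟩,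
    fun n => ?_⟩
  · simp only [AddCircle.coe_add_period]
  · have h1 := AddCircle.lintegral_preimage (2 * π) 0 fun b => ‖U b‖ₑ ^ 2
    rw [zero_add] at h1
    rw [circ, h1, AddCircle.volume_eq_smul_haarAddCircle, lintegral_smul_measure]
    refine mul_lt_top ofReal_lt_top ?_
    have := (Lp.memLp U).eLpNorm_lt_top
    rw [eLpNorm_lt_top_iff_lintegral_rpow_enorm_lt_top (by norm_num) (by norm_num)] at this
    simpa using this
  · rw [← hUc, fourierCoeff_eq_intervalIntegral _ _ 0, zero_add, fc, real_smul]
    congr 1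
    · push_cast; simp
    · refine integral_congr fun t _ => ?_
      simp only [fourier_coe_apply, smul_eq_mul]
      congr 2
      have : (π : ℂ) ≠ 0 := by exact_mod_cast pi_ne_zero
      push_cast
      field_simp

/-- `u` is the `L²` boundary function of the holomorphic function `f` on the unit disc. -/
structure IsBdry (f : ℂ → ℂ) (u : ℝ → ℂ) : Prop where
  diff : DifferentiableOn ℂ f 𝔻
  circL2 : CircL2 u
  tendsto : Tendsto (fun r : ℝ => ∫⁻ θ : ℝ, ‖f (r * cis θ) - u θ‖ₑ ^ 2 ∂circ)
    (𝓝[<] 1) (nhds 0)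

lemma eventually_mem_Ico_one : ∀ᶠ r : ℝ in 𝓝[<] 1, 0 ≤ r ∧ r < 1 := by
  filter_upwards [Ico_mem_nhdsLT (zero_lt_one (α := ℝ))] with r hr using hr

lemma PS.exists_isBdry {a : ℕ → ℂ} {f : ℂ → ℂ} (h : PS a f) (ha : ∑' n, ‖a n‖ₑ ^ 2 < ⊤) :
    ∃ u, IsBdry f u ∧ ∀ n, fc u n = zc a n := by
  obtain ⟨u, hu, huc⟩ := exists_circL2_fc_eq (c := zc a) (by
    rwa [tsum_zc (fun _ z => ‖z‖ₑ ^ 2) (by simp)])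
  refine ⟨u, ⟨h.differentiableOn, hu, ?_⟩, huc⟩
  have h1 : ∀ᶠ r : ℝ in 𝓝[<] 1,
      ofReal (2 * π) * ∫⁻ n, ‖a n * r ^ n - a n‖ₑ ^ 2 ∂(Measure.count : Measure ℕ) =
      ∫⁻ θ : ℝ, ‖f (r * cis θ) - u θ‖ₑ ^ 2 ∂circ := by
    filter_upwards [eventually_mem_Ico_one] with r hr
    have h2 := h.circL2_circle hr.1 hr.2
    rw [parseval (h2.sub hu).memLp, lintegral_count]
    congr 1
    have : ∀ n : ℤ, ‖fc (fun t : ℝ => f (r * cis t) - u t) n‖ₑ ^ 2 =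
        ‖zc (fun k => a k * r ^ k - a k) n‖ₑ ^ 2 := by
      intro n
      rw [fc_sub h2.integrable hu.integrable, h.fc_circle hr.1 hr.2, huc]
      cases n with
      | ofNat n => rfl
      | negSucc n => simp [zc]
    simp only [this]
    rw [tsum_zc (fun _ z => ‖z‖ₑ ^ 2) (by simp)]
  refine Tendsto.congr' h1 ?_
  rw [show (0 : ENNReal) = ofReal (2 * π) * ∫⁻ n, 0 ∂(Measure.count : Measure ℕ) by simp]
  refine ENNReal.Tendsto.const_mul ?_ (Or.inr ofReal_ne_top)
  refine tendsto_lintegral_filter_of_dominated_convergence (fun n => ‖a n‖ₑ ^ 2) ?_ ?_ ?_ ?_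
  · exact Eventually.of_forall fun r => measurable_of_countable _
  · filter_upwards [eventually_mem_Ico_one] with r hr
    refine Eventually.of_forall fun n => ?_
    refine pow_le_pow_left' ?_ 2
    rw [← mul_sub_one, enorm_mul]
    refine mul_le_of_le_one_right' ?_
    rw [← ofReal_norm, ENNReal.ofReal_le_one]
    have h3 : (r : ℂ) ^ n - 1 = ((r ^ n - 1 : ℝ) : ℂ) := by push_cast; rfl
    rw [h3, norm_real, norm_eq_abs, abs_le]
    have := pow_nonneg hr.1 n
    have := pow_le_one₀ (n := n) hr.1 hr.2.le
    constructor <;> linarith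
  · rw [lintegral_count]; exact ha.ne
  · refine Eventually.of_forall fun n => ?_
    have h3 : Continuous fun r : ℝ => ‖a n * (r : ℂ) ^ n - a n‖ₑ ^ 2 := by fun_prop
    have := (h3.tendsto 1).mono_left (nhdsWithin_le_nhds (s := Iio 1))
    simpa using this

lemma summable_of_tsum_sq {a : ℕ → ℂ} (ha : ∑' n, ‖a n‖ₑ ^ 2 < ⊤) : Summable fun n => ‖a n‖ ^ 2 := by
  have h1 : Summable fun n => ‖a n‖₊ ^ 2 := by
    rw [← ENNReal.tsum_coe_ne_top_iff_summable]
    simpa [enorm] using ha.ne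
  have := NNReal.summable_coe.2 h1
  simpa using this

lemma PS.of_tsum_sq {a : ℕ → ℂ} (ha : ∑' n, ‖a n‖ₑ ^ 2 < ⊤) : PS a fun z => ∑' n, a n * z ^ n := by
  refine PS.of_summable fun r hr0 hr1 => ?_
  have h1 := summable_of_tsum_sq ha
  have h2 := summable_geometric_of_lt_one (r := r ^ 2) (sq_nonneg r) (by nlinarith)
  refine Summable.of_nonneg_of_le (fun n => by positivity) (fun n => ?_) (h1.add h2)
  rw [← pow_mul, mul_comm 2 n, pow_mul]
  nlinarith [sq_nonneg (‖a n‖ - r ^ n), sq_nonneg (‖a n‖), sq_nonneg (r ^ n)]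

namespace IsBdry
variable {f g h : ℂ → ℂ} {u v w : ℝ → ℂ}

lemma continuous_circle (hu : IsBdry f u) {r : ℝ} (hr0 : 0 ≤ r) (hr1 : r < 1) :
    Continuous fun θ : ℝ => f (r * cis θ) :=
  hu.diff.continuousOn.comp_continuous (by fun_prop) (circle_mem_ball hr0 hr1)

lemma measurable_sub (hu : IsBdry f u) : ∀ᶠ r : ℝ in 𝓝[<] 1,
    Measurable fun θ : ℝ => ‖f (r * cis θ) - u θ‖ₑ ^ 2 := by
  filter_upwards [eventually_mem_Ico_one] with r hr
  have := (hu.continuous_circle hr.1 hr.2).measurable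
  exact (this.sub hu.circL2.meas).enorm.pow_const 2

/-- Along a suitable sequence of radii, three functions converge to their boundary functions a.e. -/
lemma exists_seq (hu : IsBdry f u) (hv : IsBdry g v) (hw : IsBdry h w) :
    ∃ ns : ℕ → ℝ, Tendsto ns atTop (𝓝[<] 1) ∧ (∀ k, 0 ≤ ns k ∧ ns k < 1) ∧
      ∀ᵐ θ : ℝ ∂circ, Tendsto (fun k => f (ns k * cis θ)) atTop (nhds (u θ)) ∧
        Tendsto (fun k => g (ns k * cis θ)) atTop (nhds (v θ)) ∧
        Tendsto (fun k => h (ns k * cis θ)) atTop (nhds (w θ)) := by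
  have hsum := (hu.tendsto.add hv.tendsto).add hw.tendsto
  rw [add_zero, add_zero] at hsum
  obtain ⟨ns, hns, hae⟩ := exists_seq_tendsto_zero_ae (μ := circ) (l := nhdsWithin (1 : ℝ) (Iio 1))
    (h := fun r θ => ‖f (r * cis θ) - u θ‖ₑ ^ 2 + ‖g (r * cis θ) - v θ‖ₑ ^ 2 +
      ‖h (r * cis θ) - w θ‖ₑ ^ 2) (by
      filter_upwards [hu.measurable_sub, hv.measurable_sub, hw.measurable_sub] with r h1 h2 h3
      exact (h1.add h2).add h3) (by
      refine hsum.congr' ?_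
      filter_upwards [hu.measurable_sub, hv.measurable_sub] with r h1 h2
      have e1 := lintegral_add_left (μ := circ) h1 fun θ =>
        ‖g (r * cis θ) - v θ‖ₑ ^ 2
      rw [← e1]
      exact (lintegral_add_left (h1.add h2) _).symm)
  obtain ⟨N, hN⟩ := Filter.eventually_atTop.1 (hns.eventually eventually_mem_Ico_one)
  have hshift := Filter.tendsto_add_atTop_nat N
  refine ⟨fun k => ns (k + N), hns.comp hshift, fun k => hN _ (Nat.le_add_left _ _), ?_⟩
  filter_upwards [hae] with θ hθ
  have key : ∀ (F : ℝ → ℂ) (z : ℂ), (∀ k, ‖F (ns k) - z‖ₑ ^ 2 ≤ ‖f (ns k * cis θ) - u θ‖ₑ ^ 2 +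
      ‖g (ns k * cis θ) - v θ‖ₑ ^ 2 + ‖h (ns k * cis θ) - w θ‖ₑ ^ 2) →
      Tendsto (fun k => F (ns (k + N))) atTop (nhds z) := by
    intro F z hF
    have h1 : Tendsto (fun k => ‖F (ns k) - z‖ₑ ^ 2) atTop (nhds 0) :=
      tendsto_of_tendsto_of_tendsto_of_le_of_le tendsto_const_nhds hθ (fun _ => zero_le) hF
    have h2 : Tendsto (fun k => ‖F (ns k) - z‖ ^ 2) atTop (nhds 0) := by
      have := (ENNReal.tendsto_toReal ENNReal.zero_ne_top).comp h1
      simpa [Function.comp_def] using this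
    have h3 : Tendsto (fun k => ‖F (ns k) - z‖) atTop (nhds 0) := by
      have := h2.sqrt
      simpa [sqrt_sq (norm_nonneg _)] using this
    exact (tendsto_iff_norm_sub_tendsto_zero.2 h3).comp hshift
  exact ⟨key (fun r => f (r * cis θ)) _ fun k => by
      rw [add_assoc]; exact le_self_add,
    key (fun r => g (r * cis θ)) _ fun k => by
      rw [add_right_comm]; exact le_add_self,
    key (fun r => h (r * cis θ)) _ fun k => le_add_self⟩

lemma exp_ae_eq (hu : IsBdry f u) (hv : IsBdry (fun z => cexp (f z)) v) :
    v =ᵐ[circ] fun θ => cexp (u θ) := by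
  obtain ⟨ns, -, -, hae⟩ := hu.exists_seq hv hv
  filter_upwards [hae] with θ hθ
  exact tendsto_nhds_unique hθ.2.1 ((Complex.continuous_exp.tendsto _).comp hθ.1)

end IsBdry

lemma IsBdry.congr {f : ℂ → ℂ} {u v : ℝ → ℂ} (hu : IsBdry f u) (hv : Measurable v)
    (hp : Periodic v (2 * π)) (h : u =ᵐ[circ] v) : IsBdry f v := by
  refine ⟨hu.diff, ⟨hv, hp, ?_⟩, ?_⟩
  · refine lt_of_eq_of_lt (lintegral_congr_ae (h.mono fun t ht => ?_)) hu.circL2.fin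
    beta_reduce
    rw [ht]
  · refine hu.tendsto.congr fun r => lintegral_congr_ae (h.mono fun t ht => ?_)
    beta_reduce
    rw [ht]

lemma CircL2.const (c : ℂ) : CircL2 fun _ => c := .of_continuous continuous_const fun _ => rfl

lemma fc_const (c : ℂ) (n : ℤ) : fc (fun _ => c) n = if n = 0 then c else 0 := by
  have := fc_exp 0 n
  simp only [Int.cast_zero, zero_mul, Complex.exp_zero] at this
  have h2 := fc_const_mul c (fun _ => 1) n
  simp only [mul_one] at h2
  rw [h2, this]; simp

lemma fc_conj (u : ℝ → ℂ) (n : ℤ) :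
    fc (fun t => (starRingEnd ℂ) (u t)) n = (starRingEnd ℂ) (fc u (-n)) := by
  rw [fc, fc, map_mul]
  congr 1
  · simp [Complex.conj_ofNat]
  · rw [← intervalIntegral.intervalIntegral_conj]
    refine integral_congr fun t _ => ?_
    simp only [map_mul]
    rw [← Complex.exp_conj]
    simp

lemma CircL2.conj {u : ℝ → ℂ} (hu : CircL2 u) : CircL2 fun t => (starRingEnd ℂ) (u t) := by
  refine ⟨Complex.continuous_conj.measurable.comp hu.meas, fun t => by simp only [hu.per t], ?_⟩
  have : ∀ t, ‖(starRingEnd ℂ) (u t)‖ₑ = ‖u t‖ₑ := fun t => by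
    rw [← ofReal_norm, RCLike.norm_conj, ofReal_norm]
  simpa only [this] using hu.fin

lemma PS.tsum_sq_le {α : ℕ → ℂ} (hα : α 0 = 0) :
    ∑' n : ℕ, ‖α n‖ₑ ^ 2 ≤ ∑' n : ℕ, n * ‖α n‖ₑ ^ 2 := by
  refine ENNReal.tsum_le_tsum fun n => ?_
  rcases Nat.eq_zero_or_pos n with rfl | hn
  · simp [hα]
  · exact le_mul_of_one_le_left' (by exact_mod_cast hn)

/-- Boundary values of `exp f` for `f` with finite Dirichlet integral and `f 0 = 0`. -/
lemma PS.exists_isBdry_exp {α : ℕ → ℂ} {f : ℂ → ℂ} (hf : PS α f) (hα : α 0 = 0) {A : ℝ}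
    (hA : ∑' n : ℕ, n * ‖α n‖ₑ ^ 2 ≤ ofReal A) (hA0 : 0 ≤ A) :
    ∃ p, IsBdry f p ∧ (∀ n, fc p n = zc α n) ∧ IsBdry (fun z => cexp (f z)) (fun t => cexp (p t)) ∧
      ∫⁻ t, ‖cexp (p t) - 1‖ₑ ^ 2 ∂circ ≤ ofReal (2 * π * (exp A - 1)) := by
  obtain ⟨p, hp, hpc⟩ := hf.exists_isBdry
    (((PS.tsum_sq_le hα).trans hA).trans_lt ofReal_lt_top)
  have hexp : PS _ fun z => cexp (f z) := PS.of_differentiableOn hf.differentiableOn.cexp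
  set β : ℕ → ℂ := fun n => (n.factorial : ℂ)⁻¹ * iteratedDeriv n (fun z => cexp (f z)) 0
  have hLM := hf.lebedevMilin hα hexp hA hA0
  obtain ⟨q, hq, hqc⟩ := hexp.exists_isBdry (hLM.trans_lt ofReal_lt_top)
  have hae := hp.exp_ae_eq hq
  have hb : IsBdry (fun z => cexp (f z)) (fun t => cexp (p t)) :=
    hq.congr hp.circL2.meas.cexp (fun t => by simp only [hp.circL2.per t]) hae
  refine ⟨p, hp, hpc, hb, ?_⟩
  have hβ0 : β 0 = 1 := by rw [hexp.coeff_zero, ← hf.coeff_zero, hα, Complex.exp_zero]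
  rw [parseval (hb.circL2.sub (.const 1)).memLp, ofReal_mul two_pi_pos.le]
  refine mul_le_mul_right ?_ _
  have h1 : ∀ n : ℤ, fc (fun t => cexp (p t) - 1) n = zc (fun k => if k = 0 then 0 else β k) n := by
    intro n
    rw [fc_sub hb.circL2.integrable (CircL2.const 1).integrable, fc_const, ← fc_congr hae, hqc]
    cases n with
    | ofNat n =>
      rcases Nat.eq_zero_or_pos n with rfl | hn
      · simp [zc, hβ0]
      · have : (n : ℤ) ≠ 0 := by omega
        simp [zc, hn.ne', β]
    | negSucc n => simp [zc]
  simp only [h1]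
  rw [tsum_zc (fun _ z => ‖z‖ₑ ^ 2) (by simp), tsum_eq_zero_add' ENNReal.summable]
  rw [tsum_eq_zero_add' ENNReal.summable, hβ0] at hLM
  simp only [enorm_one, one_pow] at hLM
  simp only [if_true, enorm_zero, Nat.succ_ne_zero, if_false, ne_eq, OfNat.ofNat_ne_zero,
    not_false_eq_true, zero_pow, zero_add]
  rw [ENNReal.ofReal_sub _ zero_le_one, ofReal_one]
  exact ENNReal.le_sub_of_add_le_left ENNReal.one_ne_top hLM

/-- Exponential integrability of functions of finite Douglas energy. -/
theorem CircL2.lintegral_exp_sub_one_le {u : ℝ → ℂ} (hu : CircL2 u) {A : ℝ} (hA0 : 0 ≤ A)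
    (hA : ∑' n : ℤ, n.natAbs * ‖fc u n‖ₑ ^ 2 ≤ ofReal A) : ∫⁻ t, ‖cexp (u t - fc u 0) - 1‖ₑ ∂circ ≤
      ofReal (2 * π * (exp A - 1 + 2 * √(exp A - 1))) := by
  have hnn : 0 ≤ exp A - 1 := by linarith [add_one_le_exp A]
  set α : ℕ → ℂ := fun n => if n = 0 then 0 else fc u n with hα
  set α' : ℕ → ℂ := fun n => if n = 0 then 0 else (starRingEnd ℂ) (fc u (-n)) with hα'
  have hconj : ∀ z : ℂ, ‖(starRingEnd ℂ) z‖ₑ = ‖z‖ₑ := fun z => by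
    rw [← ofReal_norm, RCLike.norm_conj, ofReal_norm]
  have hαA : ∑' n : ℕ, n * ‖α n‖ₑ ^ 2 ≤ ofReal A := by
    refine le_trans ?_ hA
    calc ∑' n : ℕ, (n : ENNReal) * ‖α n‖ₑ ^ 2 ≤
        ∑' n : ℕ, ((fun n : ℤ => (n.natAbs : ENNReal) * ‖fc u n‖ₑ ^ 2) ((n : ℕ) : ℤ)) := by
          refine ENNReal.tsum_le_tsum fun n => ?_
          rcases Nat.eq_zero_or_pos n with rfl | hn
          · simp
          · simp [hα, hn.ne']
      _ ≤ _ := tsum_comp_le_tsum_of_injective Nat.cast_injective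
        (fun n : ℤ => (n.natAbs : ENNReal) * ‖fc u n‖ₑ ^ 2)
  have hαA' : ∑' n : ℕ, n * ‖α' n‖ₑ ^ 2 ≤ ofReal A := by
    refine le_trans ?_ hA
    calc ∑' n : ℕ, (n : ENNReal) * ‖α' n‖ₑ ^ 2 ≤
        ∑' n : ℕ, ((fun n : ℤ => (n.natAbs : ENNReal) * ‖fc u n‖ₑ ^ 2) (-(n : ℕ) : ℤ)) := by
          refine ENNReal.tsum_le_tsum fun n => ?_
          rcases Nat.eq_zero_or_pos n with rfl | hn
          · simp
          · simp [hα', hn.ne']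
      _ ≤ _ := tsum_comp_le_tsum_of_injective
        (neg_injective.comp Nat.cast_injective)
        (fun n : ℤ => (n.natAbs : ENNReal) * ‖fc u n‖ₑ ^ 2)
  have hps := PS.of_tsum_sq (((PS.tsum_sq_le (α := α) (by simp [hα])).trans hαA).trans_lt
    ofReal_lt_top)
  have hps' := PS.of_tsum_sq (((PS.tsum_sq_le (α := α') (by simp [hα'])).trans hαA').trans_lt
    ofReal_lt_top)
  obtain ⟨p, hp, hpc, hpe, hpI⟩ := hps.exists_isBdry_exp (by simp [hα]) hαA hA0
  obtain ⟨q, hq, hqc, hqe, hqI⟩ := hps'.exists_isBdry_exp (by simp [hα']) hαA' hA0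
  have hae : (fun t => u t - fc u 0) =ᵐ[circ] fun t => p t + (starRingEnd ℂ) (q t) := by
    refine (hu.sub (.const _)).ae_eq_of_fc_eq (hp.circL2.add hq.circL2.conj) fun n => ?_
    rw [fc_sub hu.integrable (CircL2.const _).integrable, fc_add hp.circL2.integrable
      hq.circL2.conj.integrable, fc_conj, hpc, hqc, fc_const]
    rcases lt_trichotomy n 0 with hn | rfl | hn
    · obtain ⟨m, rfl⟩ : ∃ m : ℕ, n = -(m : ℤ) := ⟨n.natAbs, by omega⟩
      have hm : m ≠ 0 := by omega
      rw [neg_neg, zc_natCast, zc_of_notMem_range, if_neg (by omega)]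
      · simp [hα', hm]
      · rintro ⟨k, hk⟩; omega
    · have e1 : zc α 0 = 0 := by simpa [hα] using zc_natCast α 0
      have e2 : zc α' 0 = 0 := by simpa [hα'] using zc_natCast α' 0
      simp [e1, e2]
    · obtain ⟨m, rfl⟩ : ∃ m : ℕ, n = (m : ℤ) := ⟨n.natAbs, by omega⟩
      have hm : m ≠ 0 := by omega
      rw [zc_natCast, zc_of_notMem_range α', if_neg (by omega)]
      · simp [hα, hm]
      · rintro ⟨k, hk⟩; omega
  set X : ℝ → ℂ := fun t => cexp (p t) - 1 with hX
  set Y : ℝ → ℂ := fun t => (starRingEnd ℂ) (cexp (q t) - 1) with hY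
  have hXm : Measurable X := hp.circL2.meas.cexp.sub_const 1
  have hYm : Measurable Y := Complex.continuous_conj.measurable.comp (hq.circL2.meas.cexp.sub_const 1)
  have hYI : ∫⁻ t, ‖Y t‖ₑ ^ 2 ∂circ ≤ ofReal (2 * π * (exp A - 1)) := by
    simpa only [hY, hconj] using hqI
  have hone : ∀ Z : ℝ → ℂ, Measurable Z → ∫⁻ t, ‖Z t‖ₑ ^ 2 ∂circ ≤ ofReal (2 * π * (exp A - 1)) →
      ∫⁻ t, ‖Z t‖ₑ ∂circ ≤ ofReal (2 * π * √(exp A - 1)) := by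
    intro Z hZ hZI
    have h1 := lintegral_sq_le circ hZ.enorm.aemeasurable
    rw [← ENNReal.pow_le_pow_left_iff two_ne_zero]
    refine h1.trans ?_
    have h2 : circ univ = ofReal (2 * π) := by simp [circ]
    rw [h2, ← ofReal_pow (by positivity), mul_pow, sq_sqrt hnn,
      show (2 * π) ^ 2 * (exp A - 1) = 2 * π * (2 * π * (exp A - 1)) by ring,
      ofReal_mul two_pi_pos.le]
    exact mul_le_mul_right hZI _
  have hXY : ∫⁻ t, ‖X t‖ₑ * ‖Y t‖ₑ ∂circ ≤ ofReal (2 * π * (exp A - 1)) := by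
    rw [← ENNReal.pow_le_pow_left_iff two_ne_zero]
    refine (lintegral_mul_sq_le circ hXm.enorm.aemeasurable hYm.enorm.aemeasurable).trans ?_
    rw [sq]
    exact mul_le_mul' hpI hYI
  calc ∫⁻ t, ‖cexp (u t - fc u 0) - 1‖ₑ ∂circ
      ≤ ∫⁻ t, (‖X t‖ₑ * ‖Y t‖ₑ + ‖X t‖ₑ + ‖Y t‖ₑ) ∂circ := by
        refine lintegral_mono_ae ?_
        filter_upwards [hae] with t ht
        have : cexp (u t - fc u 0) - 1 = X t * Y t + X t + Y t := by
          simp only [hX, hY]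
          rw [ht, Complex.exp_add, Complex.exp_conj]
          simp; ring
        rw [this]
        refine (enorm_add_le _ _).trans (add_le_add_left ((enorm_add_le _ _).trans ?_) _)
        rw [enorm_mul]
    _ = (∫⁻ t, ‖X t‖ₑ * ‖Y t‖ₑ ∂circ) + (∫⁻ t, ‖X t‖ₑ ∂circ) + ∫⁻ t, ‖Y t‖ₑ ∂circ := by
        have e1 := lintegral_add_left (μ := circ) (hXm.enorm.mul hYm.enorm) fun t => ‖X t‖ₑ
        have e2 := lintegral_add_left (μ := circ) ((hXm.enorm.mul hYm.enorm).add hXm.enorm) fun t => ‖Y t‖ₑ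
        exact e2.trans (congrArg (· + _) e1)
    _ ≤ ofReal (2 * π * (exp A - 1)) + ofReal (2 * π * √(exp A - 1)) +
        ofReal (2 * π * √(exp A - 1)) :=
        add_le_add (add_le_add hXY (hone X hXm hpI)) (hone Y hYm hYI)
    _ = _ := by
        rw [← ofReal_add (by positivity) (by positivity),
          ← ofReal_add (by positivity) (by positivity)]
        congr 1; ring

lemma CircL2.lintegral_exp_lt_top {u : ℝ → ℂ} (hu : CircL2 u)
    (hA : ∑' n : ℤ, n.natAbs * ‖fc u n‖ₑ ^ 2 < ⊤) : ∫⁻ t, ‖cexp (u t)‖ₑ ∂circ < ⊤ := by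
  have h1 := hu.lintegral_exp_sub_one_le ENNReal.toReal_nonneg
    (ofReal_toReal hA.ne).ge
  calc ∫⁻ t, ‖cexp (u t)‖ₑ ∂circ
      ≤ ∫⁻ t, ‖cexp (fc u 0)‖ₑ * (‖cexp (u t - fc u 0) - 1‖ₑ + 1) ∂circ := by
        refine lintegral_mono fun t => ?_
        have : cexp (u t) = cexp (fc u 0) * ((cexp (u t - fc u 0) - 1) + 1) := by
          rw [sub_add_cancel, ← Complex.exp_add]; congr 1; ring
        beta_reduce
        rw [this, enorm_mul]
        refine mul_le_mul_right ((enorm_add_le _ _).trans ?_) _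
        simp
    _ = ‖cexp (fc u 0)‖ₑ * (∫⁻ t, ‖cexp (u t - fc u 0) - 1‖ₑ ∂circ + circ univ) := by
        rw [lintegral_const_mul']
        · rw [lintegral_add_right _ measurable_const]; simp
        · exact enorm_ne_top
    _ < ⊤ := by
        refine mul_lt_top enorm_lt_top (ENNReal.add_lt_top.2 ⟨h1.trans_lt ofReal_lt_top, ?_⟩)
        simp [circ, ENNReal.mul_lt_top_iff]

lemma CircL2.lintegral_exp_sq_lt_top {u : ℝ → ℂ} (hu : CircL2 u)
    (hA : ∑' n : ℤ, n.natAbs * ‖fc u n‖ₑ ^ 2 < ⊤) : ∫⁻ t, ‖cexp (u t)‖ₑ ^ 2 ∂circ < ⊤ := by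
  have h1 : ∀ n, ‖fc (fun t => 2 * u t) n‖ₑ ^ 2 = 4 * ‖fc u n‖ₑ ^ 2 := fun n => by
    rw [fc_const_mul, enorm_mul, mul_pow]
    congr 1
    rw [← ofReal_norm_sq]; norm_num
  have := (hu.const_mul 2).lintegral_exp_lt_top (by
    simp only [h1, mul_left_comm _ (4 : ENNReal)]
    rw [ENNReal.tsum_mul_left]
    exact mul_lt_top (by simp) hA)
  refine lt_of_eq_of_lt (lintegral_congr fun t => ?_) this
  rw [two_mul, Complex.exp_add, enorm_mul, sq]

lemma norm_exp_sub_exp (s t : ℝ) : ‖cis s - cis t‖ = 2 * |sin ((s - t) / 2)| := by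
  have h : cis s - cis t = cis t * (cexp (I * ((s - t : ℝ) : ℂ)) - 1) := by
    rw [mul_sub, ← Complex.exp_add, mul_one]
    congr 2
    push_cast
    ring
  rw [h, norm_mul, norm_exp_ofReal_mul_I, one_mul, Complex.norm_exp_I_mul_ofReal_sub_one,
    norm_eq_abs, abs_mul, abs_two]

lemma norm_exp_sub_exp_le (s t : ℝ) : ‖cis s - cis t‖ ≤ |s - t| := by
  rw [norm_exp_sub_exp]
  have := abs_sin_le_abs (x := (s - t) / 2)
  rw [abs_div, abs_two] at this
  linarith

lemma norm_exp_sub_exp_le_two (s t : ℝ) : ‖cis s - cis t‖ ≤ 2 := by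
  rw [norm_exp_sub_exp]
  linarith [abs_sin_le_one ((s - t) / 2)]

lemma le_norm_exp_sub_exp {s t : ℝ} (h : |s - t| ≤ π) : 2 / π * |s - t| ≤ ‖cis s - cis t‖ := by
  rw [norm_exp_sub_exp]
  have h1 : 2 / π * (|s - t| / 2) ≤ sin (|s - t| / 2) := mul_le_sin (by positivity) (by linarith)
  have h2 : sin (|s - t| / 2) ≤ |sin ((s - t) / 2)| := by
    rcases abs_cases (s - t) with ⟨h, -⟩ | ⟨h, -⟩
    · rw [h]; exact le_abs_self _
    · rw [h, neg_div, sin_neg]; exact neg_le_abs _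
  linarith

lemma exp_add_int_mul_two_pi (t : ℝ) (k : ℤ) : cexp (((t + k * (2 * π) : ℝ) : ℂ) * I) = cis t :=
  exp_mul_I_eq_iff.2 ⟨k, rfl⟩

lemma exists_int_abs_sub_le_pi (s t : ℝ) : ∃ k : ℤ, |s - (t + k * (2 * π))| ≤ π := by
  obtain ⟨k, hk⟩ := exists_int_add_mem_Ico (s - π) t
  refine ⟨k, abs_le.2 ⟨?_, ?_⟩⟩ <;> linarith [hk.1, hk.2]

/-- A closed curve that is locally chord-arc is chord-arc. -/
theorem exists_chordArc_of_local {w : ℝ → ℂ} (hw : Continuous w)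
    (hp : ∀ θ, w (θ + 2 * π) = w θ) (hi : InjOn w (Ico 0 (2 * π))) {c δ : ℝ} (hc : 0 < c)
    (hδ : 0 < δ) (h : ∀ s t, s ≤ t → t ≤ s + δ → c * (t - s) ≤ ‖w t - w s‖) :
    ∃ c' : ℝ, 0 < c' ∧ ∀ s t : ℝ, c' * ‖cis s - cis t‖ ≤ ‖w s - w t‖ := by
  set K : Set (ℝ × ℝ) := (Icc 0 (2 * π) ×ˢ Icc (-(3 * π)) (3 * π)) ∩
    {x | δ ≤ |x.1 - x.2| ∧ |x.1 - x.2| ≤ π} with hK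
  have hKc : IsCompact K := by
    refine (isCompact_Icc.prod isCompact_Icc).inter_right (IsClosed.inter ?_ ?_)
    · exact isClosed_le continuous_const (continuous_fst.sub continuous_snd).abs
    · exact isClosed_le (continuous_fst.sub continuous_snd).abs continuous_const
  have hpos : ∀ x ∈ K, 0 < ‖w x.1 - w x.2‖ := by
    intro x hx
    rw [norm_pos_iff, sub_ne_zero]
    intro he
    have h1 := le_norm_exp_sub_exp hx.2.2
    rw [(eq_iff_exp_eq hp hi).1 he, sub_self, norm_zero] at h1
    have h2 : 0 < 2 / π * |x.1 - x.2| := mul_pos (by positivity) (hδ.trans_le hx.2.1)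
    linarith
  obtain ⟨μ, hμ, hμK⟩ : ∃ μ > 0, ∀ x ∈ K, μ ≤ ‖w x.1 - w x.2‖ := by
    rcases K.eq_empty_or_nonempty with hE | hE
    · exact ⟨1, one_pos, by simp [hE]⟩
    · obtain ⟨x, hx, hmin⟩ := hKc.exists_isMinOn (f := fun x : ℝ × ℝ => ‖w x.1 - w x.2‖) hE
        (by fun_prop)
      exact ⟨_, hpos x hx, fun y hy => hmin hy⟩
  have hchord := norm_exp_sub_exp_le
  refine ⟨min c (μ / 2), by positivity, fun s t => ?_⟩
  obtain ⟨j, hj⟩ := exists_int_add_mem_Ico 0 s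
  obtain ⟨k, hk⟩ := exists_int_abs_sub_le_pi (s + j * (2 * π)) t
  rw [← exp_add_int_mul_two_pi s j, ← exp_add_int_mul_two_pi t k, ← two_pi_periodic_eq hp s j,
    ← two_pi_periodic_eq hp t k]
  generalize s + j * (2 * π) = s at *
  generalize t + k * (2 * π) = t at *
  have hn := norm_nonneg (cis s - cis t)
  rcases le_total |s - t| δ with hd | hd
  · calc min c (μ / 2) * ‖cis s - cis t‖
        ≤ c * |s - t| := by gcongr; exacts [min_le_left _ _, hchord s t]
      _ ≤ ‖w s - w t‖ := by
        rcases le_total s t with hst | hst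
        · rw [abs_of_nonpos (by linarith)] at hd ⊢
          rw [norm_sub_rev, neg_sub]
          exact h s t hst (by linarith)
        · rw [abs_of_nonneg (by linarith)] at hd ⊢
          exact h t s hst (by linarith)
  · have hx : (s, t) ∈ K := by
      refine ⟨⟨⟨hj.1, by linarith [hj.2]⟩, ?_⟩, hd, hk⟩
      have := abs_le.1 hk
      have h1 := hj.1
      have h2 := hj.2
      constructor <;> simp only [] <;> linarith [pi_pos]
    calc min c (μ / 2) * ‖cis s - cis t‖
        ≤ μ / 2 * 2 := by gcongr; exacts [min_le_right _ _, norm_exp_sub_exp_le_two s t]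
      _ ≤ ‖w s - w t‖ := by linarith [hμK _ hx]

/-- `2 e^{-it} ∂V/∂z̄` at `r e^{it}`, in polar coordinates. -/
noncomputable def polarDbar (V' : ℂ → ℂ →L[ℝ] ℂ) (r t : ℝ) : ℂ :=
  V' (r * cis t) (cis t) + I * V' (r * cis t) (I * cis t)

lemma norm_polarDbar_le (V' : ℂ → ℂ →L[ℝ] ℂ) (r t : ℝ) :
    ‖polarDbar V' r t‖ ≤ 2 * ‖V' (r * cis t)‖ := by
  refine (norm_add_le _ _).trans ?_
  rw [norm_mul, norm_I, one_mul, two_mul]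
  refine add_le_add ((le_opNorm _ _).trans ?_)
    ((le_opNorm _ _).trans ?_)
  · rw [norm_exp_ofReal_mul_I, mul_one]
  · rw [norm_mul, norm_I, norm_exp_ofReal_mul_I, mul_one, mul_one]

section

variable {V : ℂ → ℂ} {V' : ℂ → ℂ →L[ℝ] ℂ}

lemma continuousOn_polar {E : Type*} [TopologicalSpace E] {f : ℂ → E} (hf : ContinuousOn f 𝔻) :
    ContinuousOn (fun x : ℝ × ℝ => f (x.1 * cis x.2))
      (Ico 0 1 ×ˢ univ) :=
  hf.comp (by fun_prop) fun x hx => circle_mem_ball hx.1.1 hx.1.2 _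

lemma continuousOn_polarDbar (hV' : ContinuousOn V' 𝔻) :
    ContinuousOn (fun x : ℝ × ℝ => polarDbar V' x.1 x.2) (Ico 0 1 ×ˢ univ) := by
  have h := continuousOn_polar hV'
  unfold polarDbar
  exact (h.clm_apply (by fun_prop)).add (continuousOn_const.mul (h.clm_apply (by fun_prop)))

lemma continuous_polarDbar (hV' : ContinuousOn V' 𝔻) {r : ℝ} (hr : r ∈ Ico 0 1) :
    Continuous (polarDbar V' r) :=
  (continuousOn_polarDbar hV').comp_continuous (f := fun t : ℝ => (r, t)) (by fun_prop)
    fun t => ⟨hr, trivial⟩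

lemma hasDerivAt_radial (hV : ∀ z ∈ 𝔻, HasFDerivAt V (V' z) z) {r : ℝ} (hr : r ∈ Ico 0 1) (t : ℝ) :
    HasDerivAt (fun r : ℝ => V (r * cis t))
      (V' (r * cis t) (cis t)) r := by
  have h1 : HasDerivAt (fun r : ℝ => (r : ℂ) * cis t)
      (cis t) r := by
    simpa using (ofRealCLM.hasDerivAt (x := r)).mul_const (cis t)
  exact (hV _ (circle_mem_ball hr.1 hr.2 t)).comp_hasDerivAt r h1

lemma hasDerivAt_exp_mul_I (t : ℝ) : HasDerivAt (fun t : ℝ => cis t) (I * cis t) t := by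
  have h1 : HasDerivAt (fun t : ℝ => (t : ℂ) * I) I t := by
    simpa using (ofRealCLM.hasDerivAt (x := t)).mul_const I
  simpa [mul_comm] using h1.cexp

lemma hasDerivAt_angular (hV : ∀ z ∈ 𝔻, HasFDerivAt V (V' z) z) {r : ℝ} (hr : r ∈ Ico 0 1) (t : ℝ) :
    HasDerivAt (fun t : ℝ => V (r * cis t))
      (r * V' (r * cis t) (I * cis t)) t := by
  have h2 : HasDerivAt (fun t : ℝ => (r : ℂ) * cis t)
      (r • (I * cis t)) t := by
    simpa using (hasDerivAt_exp_mul_I t).const_mul (r : ℂ)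
  have h3 := (hV _ (circle_mem_ball hr.1 hr.2 t)).comp_hasDerivAt t h2
  rw [map_smul, real_smul] at h3
  exact h3

lemma integral_polar_eq (hV : ∀ z ∈ 𝔻, HasFDerivAt V (V' z) z)
    (hV' : ContinuousOn V' 𝔻) {ρ : ℝ} (hρ : ρ ∈ Ico 0 1) (h0 : V 0 = 0) :
    ∫ t in (0 : ℝ)..2 * π, V (ρ * cis t) =
      ∫ r in (0 : ℝ)..ρ, ∫ t in (0 : ℝ)..2 * π, polarDbar V' r t := by
  have hcont := continuousOn_polar hV'
  have hc1 : ContinuousOn (fun x : ℝ × ℝ => V' (x.1 * cis x.2)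
      (cis x.2)) (Ico 0 1 ×ˢ univ) := hcont.clm_apply (by fun_prop)
  have hc2 : ContinuousOn (fun x : ℝ × ℝ => V' (x.1 * cis x.2)
      (I * cis x.2)) (Ico 0 1 ×ˢ univ) :=
    hcont.clm_apply (by fun_prop)
  have hsub : Icc 0 ρ ⊆ Ico 0 1 := fun r hr => ⟨hr.1, hr.2.trans_lt hρ.2⟩
  have hrad : ∀ t : ℝ, V (ρ * cis t) = ∫ r in (0 : ℝ)..ρ,
      V' (r * cis t) (cis t) := by
    intro t
    rw [integral_eq_sub_of_hasDerivAt (f := fun r : ℝ => V (r * cis t))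
      (fun r hr => hasDerivAt_radial hV (hsub (by rwa [uIcc_of_le hρ.1] at hr)) t)]
    · simp [h0]
    · refine ContinuousOn.intervalIntegrable ?_
      rw [uIcc_of_le hρ.1]
      exact hc1.comp (f := fun r : ℝ => (r, t)) (by fun_prop) fun r hr => ⟨hsub hr, trivial⟩
  have hang : ∀ r ∈ Ioo (0 : ℝ) 1, ∫ t in (0 : ℝ)..2 * π,
      V' (r * cis t) (I * cis t) = 0 := by
    intro r hr
    have hr' : r ∈ Ico (0 : ℝ) 1 := ⟨hr.1.le, hr.2⟩
    have hcr : Continuous fun t : ℝ => V' (r * cis t)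
      (I * cis t) :=
      hc2.comp_continuous (f := fun t : ℝ => (r, t)) (by fun_prop) fun t => ⟨hr', trivial⟩
    have h1 := integral_eq_sub_of_hasDerivAt (a := 0) (b := 2 * π)
      (fun t _ => hasDerivAt_angular hV hr' t)
      ((continuous_const.mul hcr).intervalIntegrable _ _)
    rw [intervalIntegral.integral_const_mul] at h1
    have h2 : (r : ℂ) ≠ 0 := by exact_mod_cast hr.1.ne'
    have h3 : cexp (((2 * π : ℝ) : ℂ) * I) = cexp (((0 : ℝ) : ℂ) * I) := by
      push_cast; rw [exp_two_pi_mul_I]; simp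
    rw [h3, sub_self] at h1
    exact (mul_eq_zero.1 h1).resolve_left h2
  simp only [hrad]
  rw [integral_of_le two_pi_pos.le, ← intervalIntegral_integral_swap]
  · refine intervalIntegral.integral_congr_ae ?_
    refine Eventually.of_forall fun r hr => ?_
    rw [uIoc_of_le hρ.1] at hr
    have hr' : r ∈ Ioo (0 : ℝ) 1 := ⟨hr.1, hr.2.trans_lt hρ.2⟩
    have hr'' : r ∈ Ico (0 : ℝ) 1 := ⟨hr'.1.le, hr'.2⟩
    unfold polarDbar
    rw [intervalIntegral.integral_add, intervalIntegral.integral_const_mul, hang r hr', mul_zero,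
      add_zero, integral_of_le two_pi_pos.le]
    · exact (hc1.comp_continuous (f := fun t : ℝ => (r, t)) (by fun_prop)
        fun t => ⟨hr'', trivial⟩).intervalIntegrable _ _
    · exact (continuous_const.mul (hc2.comp_continuous (f := fun t : ℝ => (r, t)) (by fun_prop)
        fun t => ⟨hr'', trivial⟩)).intervalIntegrable _ _
  · rw [Measure.prod_restrict, ← Measure.volume_eq_prod]
    refine IntegrableOn.mono_set (t := Icc 0 ρ ×ˢ Icc 0 (2 * π)) ?_ ?_
    · refine ContinuousOn.integrableOn_compact (isCompact_Icc.prod isCompact_Icc) ?_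
      exact hc1.mono (prod_mono hsub (subset_univ _))
    · rw [uIoc_of_le hρ.1]
      exact prod_mono Ioc_subset_Icc_self Ioc_subset_Icc_self

lemma integral_pow_mul_polar_eq (hV : ∀ z ∈ 𝔻, HasFDerivAt V (V' z) z)
    (hV' : ContinuousOn V' 𝔻) {ρ : ℝ} (hρ : ρ ∈ Ico 0 1) (n : ℕ) :
    (ρ : ℂ) ^ (n + 1) * fc (fun t => V (ρ * cis t)) (-(n + 1 : ℕ)) =
      ∫ r in (0 : ℝ)..ρ, (r : ℂ) ^ (n + 1) * fc (polarDbar V' r) (-(n + 1 : ℕ)) := by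
  set W' : ℂ → ℂ →L[ℝ] ℂ := fun z => z ^ (n + 1) • V' z +
    V z • (((n + 1 : ℕ) * z ^ n) • (ContinuousLinearMap.id ℝ ℂ)) with hW'
  have hVc : ContinuousOn V 𝔻 := fun z hz => (hV z hz).continuousAt.continuousWithinAt
  have hpow : ∀ z : ℂ, HasFDerivAt (fun z : ℂ => z ^ (n + 1))
      (((n + 1 : ℕ) * z ^ n) • (ContinuousLinearMap.id ℝ ℂ)) z := by
    intro z
    have := ((hasDerivAt_pow (n + 1) z).hasFDerivAt).restrictScalars ℝ
    have he : (((n + 1 : ℕ) * z ^ n) • (ContinuousLinearMap.id ℝ ℂ)) =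
        ContinuousLinearMap.restrictScalars ℝ
          (toSpanSingleton ℂ (((n + 1 : ℕ) : ℂ) * z ^ (n + 1 - 1))) := by
      ext; simp; ring
    rw [he]
    exact this
  have hW : ∀ z ∈ 𝔻, HasFDerivAt (fun z => z ^ (n + 1) * V z) (W' z) z :=
    fun z hz => (hpow z).mul (hV z hz)
  have hW'c : ContinuousOn W' 𝔻 := by
    refine ContinuousOn.add (ContinuousOn.smul (f := fun z : ℂ => z ^ (n + 1)) (by fun_prop) hV') (hVc.smul ?_)
    exact ContinuousOn.smul (f := fun z : ℂ => ((n + 1 : ℕ) : ℂ) * z ^ n) (by fun_prop)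
      continuousOn_const
  have hD : ∀ r t, polarDbar W' r t = (r : ℂ) ^ (n + 1) *
      (cexp (-(((-(n + 1 : ℕ) : ℤ) : ℂ) * t * I)) * polarDbar V' r t) := by
    intro r t
    have : cexp (-(((-(n + 1 : ℕ) : ℤ) : ℂ) * t * I)) = cis t ^ (n + 1) := by
      rw [← Complex.exp_nat_mul]; congr 1; push_cast; ring
    rw [this]
    simp only [polarDbar, hW', _root_.add_apply, _root_.smul_apply,
      ContinuousLinearMap.id_apply, smul_eq_mul]
    linear_combination (V (r * cis t)) * ((n + 1 : ℕ) : ℂ) *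
      ((r : ℂ) * cis t) ^ n * cis t * Complex.I_sq
  have h := integral_polar_eq hW hW'c hρ (by simp)
  have hl : ∀ t : ℝ, ((ρ : ℂ) * cis t) ^ (n + 1) * V (ρ * cis t) = (ρ : ℂ) ^ (n + 1) *
      (cexp (-(((-(n + 1 : ℕ) : ℤ) : ℂ) * t * I)) * V (ρ * cis t)) := by
    intro t
    have : cexp (-(((-(n + 1 : ℕ) : ℤ) : ℂ) * t * I)) = cis t ^ (n + 1) := by
      rw [← Complex.exp_nat_mul]; congr 1; push_cast; ring
    rw [this]; ring
  simp only [hl, hD, intervalIntegral.integral_const_mul] at h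
  unfold fc
  rw [mul_left_comm, h, ← intervalIntegral.integral_const_mul]
  exact integral_congr fun r _ => by ring

end

section

variable {V : ℂ → ℂ} {V' : ℂ → ℂ →L[ℝ] ℂ}

lemma continuousOn_fc_polarDbar (hV' : ContinuousOn V' 𝔻) (m : ℤ) :
    ContinuousOn (fun r => fc (polarDbar V' r) m) (Ioo 0 1) := by
  have : LocallyCompactSpace (Ioo (0 : ℝ) 1) := isOpen_Ioo.locallyCompactSpace
  rw [continuousOn_iff_continuous_domRestrict]
  have h1 : Continuous (uncurry fun (r : Ioo (0 : ℝ) 1) (t : ℝ) =>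
      cexp (-(m * t * I)) * polarDbar V' r t) := by
    refine Continuous.mul (by fun_prop) ?_
    exact (continuousOn_polarDbar hV').comp_continuous
      (f := fun x : Ioo (0 : ℝ) 1 × ℝ => ((x.1 : ℝ), x.2)) (by fun_prop)
      fun x => ⟨⟨x.1.2.1.le, x.1.2.2⟩, trivial⟩
  have h2 := continuous_parametric_integral_of_continuous (μ := volume) h1
    (isCompact_Icc (a := (0 : ℝ)) (b := 2 * π))
  have h3 : (Ioo 0 1).domRestrict (fun r => fc (polarDbar V' r) m) = fun r : Ioo (0 : ℝ) 1 =>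
      1 / (2 * (π : ℂ)) * ∫ t in Icc 0 (2 * π),
        cexp (-(m * t * I)) * polarDbar V' r t := by
    funext r
    simp only [domRestrict_apply, fc]
    rw [integral_of_le two_pi_pos.le, integral_Icc_eq_integral_Ioc]
  rw [h3]
  exact continuous_const.mul h2

lemma two_mul_fc_sq_le (hV : ∀ z ∈ 𝔻, HasFDerivAt V (V' z) z)
    (hV' : ContinuousOn V' 𝔻) {M : ℝ} (hM : ∀ z ∈ 𝔻, ‖V z‖ ≤ M) {v : ℝ → ℂ}
    (hv : ∀ θ : ℝ, Tendsto (fun r : ℝ => V (r * cis θ))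
      (𝓝[<] 1) (nhds (v θ))) (n : ℕ) : (2 * (n + 1 : ℕ) : ENNReal) * ‖fc v (-(n + 1 : ℕ))‖ₑ ^ 2 ≤
      ∫⁻ r in Ioo (0 : ℝ) 1, ofReal r * ‖fc (polarDbar V' r) (-(n + 1 : ℕ))‖ₑ ^ 2 := by
  set B : ℝ → ℂ := fun r => fc (polarDbar V' r) (-(n + 1 : ℕ)) with hB
  have hBm : AEMeasurable (fun r => ‖B r‖ₑ) (volume.restrict (Ioo 0 1)) :=
    ((continuousOn_fc_polarDbar hV' _).aemeasurable measurableSet_Ioo).enorm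
  have hVc : ContinuousOn V 𝔻 := fun z hz => (hV z hz).continuousAt.continuousWithinAt
  have hev : ∀ᶠ ρ : ℝ in 𝓝[<] 1, ρ ∈ Ico (0 : ℝ) 1 := Ico_mem_nhdsLT one_pos
  have h1 : Tendsto (fun ρ : ℝ => (ρ : ℂ) ^ (n + 1) * fc (fun t => V (ρ * cis t)) (-(n + 1 : ℕ)))
      (𝓝[<] 1) (nhds (1 * fc v (-(n + 1 : ℕ)))) := by
    refine Tendsto.mul ?_ (Tendsto.const_mul _ ?_)
    · have : Continuous fun ρ : ℝ => (ρ : ℂ) ^ (n + 1) := by fun_prop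
      simpa using (this.tendsto 1).mono_left nhdsWithin_le_nhds
    · refine tendsto_integral_filter_of_dominated_convergence (fun _ => M) ?_ ?_
        (by simp) ?_
      · filter_upwards [hev] with ρ hρ
        refine Continuous.aestronglyMeasurable (Continuous.mul (by fun_prop) ?_)
        exact hVc.comp_continuous (f := fun t : ℝ => (ρ : ℂ) * cis t)
          (by fun_prop) fun t => circle_mem_ball hρ.1 hρ.2 t
      · filter_upwards [hev] with ρ hρ
        refine Eventually.of_forall fun t _ => ?_
        rw [norm_mul, norm_exp_neg_mul_I, one_mul]
        exact hM _ (circle_mem_ball hρ.1 hρ.2 t)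
      · exact Eventually.of_forall fun t _ => (hv t).const_mul _
  rw [one_mul] at h1
  set T := ∫⁻ r in Ioo (0 : ℝ) 1, ofReal r * (‖(r : ℂ) ^ n‖ₑ * ‖B r‖ₑ) with hT
  have h2 : ‖fc v (-(n + 1 : ℕ))‖ₑ ≤ T := by
    refine le_of_tendsto h1.enorm ?_
    filter_upwards [hev] with ρ hρ
    rw [integral_pow_mul_polar_eq hV hV' hρ n, integral_of_le hρ.1]
    refine (enorm_integral_le_lintegral_enorm _).trans ?_
    refine (lintegral_mono_set (t := Ioo 0 1) fun r hr => ⟨hr.1, hr.2.trans_lt hρ.2⟩).trans ?_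
    refine (setLIntegral_mono' measurableSet_Ioo fun r hr => ?_)
    rw [enorm_mul, pow_succ, enorm_mul, mul_comm ‖(r : ℂ) ^ n‖ₑ, mul_assoc]
    have : ‖(r : ℂ)‖ₑ = ofReal r := by
      rw [← ofReal_norm, norm_real, norm_of_nonneg hr.1.le]
    rw [this]
  have h3 : T ^ 2 ≤ ofReal (1 / (2 * n + 2)) * ∫⁻ r in Ioo (0 : ℝ) 1, ofReal r * ‖B r‖ₑ ^ 2 := by
    have hs : ∀ r ∈ Ioo (0 : ℝ) 1, ofReal r = ofReal (√r) * ofReal (√r) := fun r hr => by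
      rw [← ofReal_mul (sqrt_nonneg _), mul_self_sqrt hr.1.le]
    have e1 : T = ∫⁻ r in Ioo (0 : ℝ) 1, (ofReal (√r) * ‖(r : ℂ) ^ n‖ₑ) * (ofReal (√r) * ‖B r‖ₑ) :=
      setLIntegral_congr_fun measurableSet_Ioo fun r hr => by simp only [hs r hr]; ring
    have e2 : ∫⁻ r in Ioo (0 : ℝ) 1, (ofReal (√r) * ‖(r : ℂ) ^ n‖ₑ) ^ 2 =
        ofReal (1 / (2 * n + 2)) := by
      rw [← one_mul (ofReal (1 / (2 * n + 2))), ← lintegral_radial]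
      exact setLIntegral_congr_fun measurableSet_Ioo fun r hr => by simp only [hs r hr]; ring
    have e3 : ∫⁻ r in Ioo (0 : ℝ) 1, (ofReal (√r) * ‖B r‖ₑ) ^ 2 =
        ∫⁻ r in Ioo (0 : ℝ) 1, ofReal r * ‖B r‖ₑ ^ 2 :=
      setLIntegral_congr_fun measurableSet_Ioo fun r hr => by simp only [hs r hr]; ring
    rw [e1, ← e2, ← e3]
    refine lintegral_mul_sq_le _ ?_ ?_
    · exact Measurable.aemeasurable (by fun_prop)
    · exact (Measurable.aemeasurable (by fun_prop)).mul hBm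
  have h4 : (2 * (n + 1 : ℕ) : ENNReal) = ofReal (2 * n + 2) := by
    rw [show (2 * n + 2 : ℝ) = ((2 * (n + 1) : ℕ) : ℝ) by push_cast; ring, ofReal_natCast]
    push_cast; ring
  calc _ ≤ ofReal (2 * n + 2) * (ofReal (1 / (2 * n + 2)) *
      ∫⁻ r in Ioo (0 : ℝ) 1, ofReal r * ‖B r‖ₑ ^ 2) := by
        rw [h4]; gcongr; exact (pow_le_pow_left' h2 2).trans h3
    _ = _ := by
        rw [← mul_assoc, ← ofReal_mul (by positivity),
          mul_one_div_cancel (by positivity), ofReal_one, one_mul]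

lemma tsum_neg_fc_le (hV : ∀ z ∈ 𝔻, HasFDerivAt V (V' z) z)
    (hV' : ContinuousOn V' 𝔻) {M : ℝ} (hM : ∀ z ∈ 𝔻, ‖V z‖ ≤ M) {v : ℝ → ℂ}
    (hv : ∀ θ : ℝ, Tendsto (fun r : ℝ => V (r * cis θ))
      (𝓝[<] 1) (nhds (v θ))) :
    ofReal π * ∑' n : ℕ, (n + 1 : ℕ) * ‖fc v (-(n + 1 : ℕ))‖ₑ ^ 2 ≤ ∫⁻ z in 𝔻, ‖V' z‖ₑ ^ 2 := by
  have hpar : ∀ r ∈ Ioo (0 : ℝ) 1,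
      ofReal (2 * π) * ∑' n : ℕ, ‖fc (polarDbar V' r) (-(n + 1 : ℕ))‖ₑ ^ 2 ≤
        4 * ∫⁻ t : ℝ, ‖V' (r * cis t)‖ₑ ^ 2 ∂circ := by
    intro r hr
    have hc := continuous_polarDbar hV' (r := r) ⟨hr.1.le, hr.2⟩
    have h1 := parseval (continuous_memLp_circ hc 2)
    have h2 : ∑' n : ℕ, ‖fc (polarDbar V' r) (-(n + 1 : ℕ))‖ₑ ^ 2 ≤
        ∑' n : ℤ, ‖fc (polarDbar V' r) n‖ₑ ^ 2 := by
      refine tsum_comp_le_tsum_of_injective (f := fun n : ℕ => (-(n + 1 : ℕ) : ℤ)) ?_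
        (fun n : ℤ => ‖fc (polarDbar V' r) n‖ₑ ^ 2)
      intro a b h; simp only [] at h; omega
    calc _ ≤ ∫⁻ t, ‖polarDbar V' r t‖ₑ ^ 2 ∂circ := by rw [h1]; gcongr
      _ ≤ ∫⁻ t : ℝ, 4 * ‖V' (r * cis t)‖ₑ ^ 2 ∂circ := by
        refine lintegral_mono fun t => ?_
        have h3 : ‖polarDbar V' r t‖ₑ ≤ 2 * ‖V' (r * cis t)‖ₑ := by
          rw [← ofReal_norm, ← ofReal_norm,
            show (2 : ENNReal) = ofReal 2 by simp, ← ofReal_mul (by norm_num)]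
          exact ofReal_le_ofReal (norm_polarDbar_le V' r t)
        calc _ ≤ (2 * ‖V' (r * cis t)‖ₑ) ^ 2 := pow_le_pow_left' h3 2
          _ = _ := by ring
      _ = _ := lintegral_const_mul' _ _ (by simp)
  set g : ℂ → ENNReal := (𝔻).indicator fun z => ‖V' z‖ₑ ^ 2 with hg
  have hgm : Measurable g := by
    have h1 : Measurable ((𝔻).indicator fun z => ‖V' z‖) := by
      classical
      exact ContinuousOn.measurable_piecewise hV'.norm continuousOn_const measurableSet_ball
    convert h1.ennreal_ofReal.pow_const 2 using 2 with z
    by_cases hz : z ∈ 𝔻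
    · simp [hg, hz]
    · simp [hg, hz]
  have hI : ∫⁻ z in 𝔻, ‖V' z‖ₑ ^ 2 = ∫⁻ r in Ioo (0 : ℝ) 1, ofReal r *
      ∫⁻ t : ℝ, ‖V' (r * cis t)‖ₑ ^ 2 ∂circ := by
    have h1 : ∫⁻ z in 𝔻, ‖V' z‖ₑ ^ 2 = ∫⁻ z in 𝔻, g z :=
      setLIntegral_congr_fun measurableSet_ball fun z hz => by simp [hg, indicator_of_mem hz]
    rw [h1, lintegral_ball_polar hgm]
    refine setLIntegral_congr_fun measurableSet_Ioo fun r hr => ?_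
    have : ∀ t : ℝ, g (r * cis t) = ‖V' (r * cis t)‖ₑ ^ 2 := fun t =>
      indicator_of_mem (circle_mem_ball hr.1.le hr.2 t) _
    simp only [this]
  have hsum : 2 * ∑' n : ℕ, (n + 1 : ℕ) * ‖fc v (-(n + 1 : ℕ))‖ₑ ^ 2 ≤
      ∫⁻ r in Ioo (0 : ℝ) 1, ofReal r * ∑' n : ℕ, ‖fc (polarDbar V' r) (-(n + 1 : ℕ))‖ₑ ^ 2 := by
    rw [← ENNReal.tsum_mul_left]
    simp only [← ENNReal.tsum_mul_left]
    rw [lintegral_tsum]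
    · refine ENNReal.tsum_le_tsum fun n => ?_
      rw [← mul_assoc]
      exact two_mul_fc_sq_le hV hV' hM hv n
    · intro n
      exact (Measurable.aemeasurable (by fun_prop)).mul
        (((continuousOn_fc_polarDbar hV' _).aemeasurable measurableSet_Ioo).enorm.pow_const 2)
  have h4 : 4 * (ofReal π * ∑' n : ℕ, (n + 1 : ℕ) * ‖fc v (-(n + 1 : ℕ))‖ₑ ^ 2) ≤
      4 * ∫⁻ z in 𝔻, ‖V' z‖ₑ ^ 2 := by
    calc _ = ofReal (2 * π) * (2 * ∑' n : ℕ, (n + 1 : ℕ) * ‖fc v (-(n + 1 : ℕ))‖ₑ ^ 2) := by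
          rw [ofReal_mul (by norm_num), ofReal_ofNat]; ring
      _ ≤ ofReal (2 * π) * ∫⁻ r in Ioo (0 : ℝ) 1, ofReal r *
        ∑' n : ℕ, ‖fc (polarDbar V' r) (-(n + 1 : ℕ))‖ₑ ^ 2 := by gcongr
      _ = ∫⁻ r in Ioo (0 : ℝ) 1, ofReal r * (ofReal (2 * π) *
        ∑' n : ℕ, ‖fc (polarDbar V' r) (-(n + 1 : ℕ))‖ₑ ^ 2) := by
          rw [← lintegral_const_mul' _ _ ofReal_ne_top]
          exact lintegral_congr fun r => by ring
      _ ≤ ∫⁻ r in Ioo (0 : ℝ) 1, ofReal r * (4 * ∫⁻ t : ℝ, ‖V' (r * cis t)‖ₑ ^ 2 ∂circ) :=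
          setLIntegral_mono' measurableSet_Ioo fun r hr => mul_le_mul_right (hpar r hr) _
      _ = _ := by
          rw [hI, ← lintegral_const_mul' _ _ (by simp)]
          exact lintegral_congr fun r => by ring
  exact (ENNReal.mul_le_mul_iff_right (by simp) (by simp)).1 h4

/-- The Douglas integral of boundary values is dominated by the Dirichlet integral of any bounded
`C¹` extension. -/
theorem douglas_le_dirichlet (hV : ∀ z ∈ 𝔻, HasFDerivAt V (V' z) z)
    (hV' : ContinuousOn V' 𝔻) {M : ℝ} (hM : ∀ z ∈ 𝔻, ‖V z‖ ≤ M) {v : ℝ → ℂ}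
    (hv : ∀ θ : ℝ, Tendsto (fun r : ℝ => V (r * cis θ))
      (𝓝[<] 1) (nhds (v θ))) (hvL : CircL2 v) :
    douglas v ≤ ofReal (8 * π) * ∫⁻ z in 𝔻, ‖V' z‖ₑ ^ 2 := by
  have hconj : ∀ z : ℂ, ‖(starRingEnd ℂ) z‖ₑ = ‖z‖ₑ := fun z => by
    rw [← ofReal_norm, ← ofReal_norm, norm_conj]
  set J : ℂ →L[ℝ] ℂ := Complex.conjCLE.toContinuousLinearMap with hJ
  have h1 := tsum_neg_fc_le hV hV' hM hv
  have h2 := tsum_neg_fc_le (V := fun z => (starRingEnd ℂ) (V z)) (V' := fun z => J.comp (V' z))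
    (v := fun t => (starRingEnd ℂ) (v t)) (M := M)
    (fun z hz => (J.hasFDerivAt).comp z (hV z hz))
    (continuousOn_const.clm_comp hV') (fun z hz => by rw [norm_conj]; exact hM z hz)
    (fun θ => (Complex.continuous_conj.tendsto _).comp (hv θ))
  have h3 : ∀ z, ‖J.comp (V' z)‖ₑ ≤ ‖V' z‖ₑ := by
    intro z
    rw [← ofReal_norm, ← ofReal_norm]
    refine ofReal_le_ofReal (ContinuousLinearMap.opNorm_le_bound _ (norm_nonneg _) fun x => ?_)
    calc ‖J.comp (V' z) x‖ = ‖V' z x‖ := norm_conj _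
      _ ≤ _ := le_opNorm _ _
  have h4 : ∀ n : ℕ, ‖fc (fun t => (starRingEnd ℂ) (v t)) (-(n + 1 : ℕ))‖ₑ =
      ‖fc v (n + 1 : ℕ)‖ₑ := fun n => by
    rw [fc_conj, neg_neg, hconj]
  simp only [h4] at h2
  replace h2 := h2.trans (lintegral_mono fun z => pow_le_pow_left' (h3 z) 2)
  have hsplit : ∑' n : ℤ, (n.natAbs : ENNReal) * ‖fc v n‖ₑ ^ 2 =
      ∑' n : ℕ, ((n + 1 : ℕ) : ENNReal) * ‖fc v (n + 1 : ℕ)‖ₑ ^ 2 +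
      ∑' n : ℕ, ((n + 1 : ℕ) : ENNReal) * ‖fc v (-(n + 1 : ℕ))‖ₑ ^ 2 := by
    rw [tsum_of_nat_of_neg_add_one (f := fun n : ℤ => (n.natAbs : ENNReal) * ‖fc v n‖ₑ ^ 2)
      ENNReal.summable ENNReal.summable]
    congr 1
    · rw [tsum_eq_zero_add' ENNReal.summable]
      simp only [Int.natAbs_natCast, Nat.cast_zero, Int.natAbs_zero, zero_mul, zero_add]
  generalize (∫⁻ z in 𝔻, ‖V' z‖ₑ ^ 2) = D at h1 h2 ⊢
  rw [douglas_eq_tsum hvL, hsplit]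
  calc _ = ofReal (4 * π) * (ofReal π *
        ∑' n : ℕ, ((n + 1 : ℕ) : ENNReal) * ‖fc v (n + 1 : ℕ)‖ₑ ^ 2 + ofReal π *
        ∑' n : ℕ, ((n + 1 : ℕ) : ENNReal) * ‖fc v (-(n + 1 : ℕ))‖ₑ ^ 2) := by
        rw [← mul_add, ← mul_assoc, ← ofReal_mul (by positivity)]
        congr 2; ring
    _ ≤ ofReal (4 * π) * (D + D) := by gcongr
    _ = _ := by
        rw [← two_mul D, ← mul_assoc, show (8 * π : ℝ) = 4 * π * 2 by ring,
          ofReal_mul (p := 4 * π) (by positivity), ofReal_ofNat]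

end

lemma hasFDerivAt_integral_of_continuousOn {E : Type*} [NormedAddCommGroup E] [NormedSpace ℝ E]
    [CompleteSpace E] {K : ℂ → ℝ → E} {K' : ℂ → ℝ → ℂ →L[ℝ] E} {Ω : Set ℂ} (hΩ : IsOpen Ω) (a b : ℝ)
    (hK : ContinuousOn (uncurry K) (Ω ×ˢ univ)) (hK' : ContinuousOn (uncurry K') (Ω ×ˢ univ))
    (hd : ∀ p ∈ Ω, ∀ s, HasFDerivAt (fun p => K p s) (K' p s) p) :
    (∀ p ∈ Ω, HasFDerivAt (fun p => ∫ s in Ioc a b, K p s) (∫ s in Ioc a b, K' p s) p) ∧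
    ContinuousOn (fun p => ∫ s in Ioc a b, K' p s) Ω := by
  have hc : ∀ p ∈ Ω, Continuous (K p) := fun p hp =>
    hK.comp_continuous (f := fun s : ℝ => (p, s)) (by fun_prop) fun s => ⟨hp, trivial⟩
  have hc' : ∀ p ∈ Ω, Continuous (K' p) := fun p hp =>
    hK'.comp_continuous (f := fun s : ℝ => (p, s)) (by fun_prop) fun s => ⟨hp, trivial⟩
  constructor
  · intro p hp
    obtain ⟨ε, hε, hball⟩ := nhds_basis_closedBall.mem_iff.1 (hΩ.mem_nhds hp)
    obtain ⟨M, hM⟩ := ((isCompact_closedBall p ε).prod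
      (isCompact_Icc (a := a) (b := b))).bddAbove_image
      (hK'.mono (prod_mono hball (subset_univ _))).norm
    refine hasFDerivAt_integral_of_dominated_of_fderiv_le (bound := fun _ => M)
      (closedBall_mem_nhds p hε) ?_ ?_ ?_ ?_ ?_ ?_
    · filter_upwards [hΩ.mem_nhds hp] with q hq using (hc q hq).aestronglyMeasurable
    · exact (hc p hp).integrableOn_Ioc
    · exact (hc' p hp).aestronglyMeasurable
    · filter_upwards [ae_restrict_mem measurableSet_Ioc] with s hs q hq
      exact hM ⟨(q, s), ⟨hq, Ioc_subset_Icc_self hs⟩, rfl⟩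
    · exact integrable_const M
    · exact Eventually.of_forall fun s q hq => hd q (hball hq) s
  · have : LocallyCompactSpace Ω := hΩ.locallyCompactSpace
    rw [continuousOn_iff_continuous_domRestrict]
    have h1 : Continuous (uncurry fun (p : Ω) (s : ℝ) => K' p s) :=
      hK'.comp_continuous (f := fun x : Ω × ℝ => ((x.1 : ℂ), x.2)) (by fun_prop)
        fun x => ⟨x.1.2, trivial⟩
    have h2 := continuous_parametric_integral_of_continuous (μ := volume) h1
      (isCompact_Icc (a := a) (b := b))
    simp only [integral_Icc_eq_integral_Ioc] at h2
    exact h2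

lemma exists_lintegral_inv_pow_four : ∃ C : NNReal, ∀ (p : ℂ) (ρ : ℝ), 0 < ρ →
      ∫⁻ q : ℂ, ofReal (((‖p - q‖ + ρ) ^ 4)⁻¹) ≤ C * ofReal ((ρ ^ 2)⁻¹) := by
  have hfin : ∫⁻ q : ℂ, ofReal ((1 + ‖q‖) ^ (-(4 : ℝ))) < ⊤ :=
    finite_integral_one_add_norm (by rw [Complex.finrank_real_complex]; norm_num)
  refine ⟨(∫⁻ q : ℂ, ofReal ((1 + ‖q‖) ^ (-(4 : ℝ)))).toNNReal, fun p ρ hρ => ?_⟩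
  rw [ENNReal.coe_toNNReal hfin.ne]
  have hρ0 : (ρ : ℂ) ≠ 0 := by exact_mod_cast hρ.ne'
  have hd : ∀ z : ℂ, HasDerivAt (fun z : ℂ => p + ρ * z) ρ z := fun z => by
    simpa using ((hasDerivAt_id z).const_mul (ρ : ℂ)).const_add p
  have h := lintegral_image_holomorphic (f := fun z : ℂ => p + ρ * z) isOpen_univ
    (fun z _ => (hd z).differentiableAt.differentiableWithinAt)
    (fun x _ y _ h => mul_left_cancel₀ hρ0 (add_left_cancel h))
    (fun q => ofReal (((‖p - q‖ + ρ) ^ 4)⁻¹))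
  have himg : (fun z : ℂ => p + ρ * z) '' univ = univ := by
    rw [image_univ, range_eq_univ]
    intro q
    exact ⟨(q - p) / ρ, by field_simp; ring⟩
  rw [himg] at h
  simp only [Measure.restrict_univ] at h
  rw [h, mul_comm, ← lintegral_const_mul' _ _ ofReal_ne_top]
  refine lintegral_mono fun z => le_of_eq ?_
  simp only []
  rw [(hd z).deriv, ← ofReal_norm_sq, ← ofReal_mul (by positivity),
    ← ofReal_mul (by positivity)]
  congr 1
  have e1 : ‖p - (p + ρ * z)‖ = ρ * ‖z‖ := by
    rw [sub_add_cancel_left, norm_neg, norm_mul, norm_real, norm_of_nonneg hρ.le]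
  rw [e1, norm_real, norm_of_nonneg hρ.le, Real.rpow_neg (by positivity),
    show (1 + ‖z‖) ^ (4 : ℝ) = (1 + ‖z‖) ^ 4 by exact_mod_cast Real.rpow_natCast (1 + ‖z‖) 4]
  have : 1 + ‖z‖ ≠ 0 := by positivity
  have h3 : ρ * ‖z‖ + ρ ≠ 0 := by positivity
  field_simp
  ring

/-- The kernel `|w - p|⁻⁴`. -/
noncomputable def quarticKernel (w p : ℂ) : ℝ := ((‖w - p‖ ^ 2) ^ 2)⁻¹

/-- The derivative of `quarticKernel w` in `p`. -/
noncomputable def quarticKernelDeriv (w p : ℂ) : ℂ →L[ℝ] ℝ :=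
  (4 * ((‖w - p‖ ^ 2) ^ 3)⁻¹) • innerSL ℝ (w - p)

lemma hasFDerivAt_quarticKernel {w p : ℂ} (h : w ≠ p) :
    HasFDerivAt (quarticKernel w) (quarticKernelDeriv w p) p := by
  have h0 : ‖w - p‖ ^ 2 ≠ 0 := by simpa [sub_eq_zero] using h
  have h1 : HasFDerivAt (fun p => ‖w - p‖ ^ 2) (2 • (innerSL ℝ (w - p)).comp
      (-ContinuousLinearMap.id ℝ ℂ)) p :=
    ((hasFDerivAt_id p).const_sub w).norm_sq
  have h2 := (hasDerivAt_inv (pow_ne_zero 2 h0)).comp_hasFDerivAt p (h1.pow 2)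
  refine h2.congr_fderiv ?_
  ext v
  simp only [quarticKernelDeriv, _root_.smul_apply, ContinuousLinearMap.comp_apply, smul_eq_mul,
    _root_.neg_apply, ContinuousLinearMap.id_apply, map_neg, nsmul_eq_mul]
  have h0' : ‖w - p‖ ≠ 0 := by simpa [sub_eq_zero] using h
  push_cast
  generalize inner ℝ (w - p) v = X at *
  simp only [innerSL_apply_apply]
  field_simp
  ring

lemma norm_quarticKernelDeriv {w p : ℂ} :
    ‖quarticKernelDeriv w p‖ = 4 * quarticKernel w p * ‖w - p‖⁻¹ := by
  rw [quarticKernelDeriv, norm_smul, innerSL_apply_norm, norm_mul, norm_inv, norm_pow, norm_pow,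
    norm_norm, quarticKernel]
  rcases eq_or_ne ‖w - p‖ 0 with h | h
  · simp [h]
  · rw [show ‖(4 : ℝ)‖ = 4 by norm_num]
    field_simp

lemma quarticKernel_pos {w p : ℂ} (h : w ≠ p) : 0 < quarticKernel w p := by
  have : 0 < ‖w - p‖ := norm_pos_iff.2 (sub_ne_zero.2 h)
  unfold quarticKernel; positivity

lemma quarticKernel_nonneg (w p : ℂ) : 0 ≤ quarticKernel w p := by
  unfold quarticKernel; positivity

section

variable {w : ℝ → ℂ} {Ω : Set ℂ} {E : Type*} [NormedAddCommGroup E] [NormedSpace ℝ E]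

lemma continuousOn_quarticKernel (hw : Continuous w) (hdis : ∀ s, w s ∉ Ω) :
    ContinuousOn (fun x : ℂ × ℝ => quarticKernel (w x.2) x.1) (Ω ×ˢ univ) := by
  unfold quarticKernel
  refine ContinuousOn.inv₀ (by fun_prop) fun x hx => ?_
  have : w x.2 ≠ x.1 := fun h => hdis x.2 (h ▸ hx.1)
  simpa [sub_eq_zero] using this

lemma continuousOn_quarticKernelDeriv (hw : Continuous w) (hdis : ∀ s, w s ∉ Ω) :
    ContinuousOn (fun x : ℂ × ℝ => quarticKernelDeriv (w x.2) x.1) (Ω ×ˢ univ) := by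
  unfold quarticKernelDeriv
  refine ContinuousOn.smul (f := fun x : ℂ × ℝ => 4 * ((‖w x.2 - x.1‖ ^ 2) ^ 3)⁻¹)
    (continuousOn_const.mul (ContinuousOn.inv₀ (by fun_prop) fun x hx => ?_)) ?_
  · have : w x.2 ≠ x.1 := fun h => hdis x.2 (h ▸ hx.1)
    simpa [sub_eq_zero] using this
  · exact (innerSL ℝ).continuous.comp_continuousOn (by fun_prop)

/-- Total mass of the kernel over the curve. -/
noncomputable def kernelMass (w : ℝ → ℂ) (p : ℂ) : ℝ :=
  ∫ s in Ioc 0 (2 * π), quarticKernel (w s) p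

/-- Weighted average of `u` over the curve `w`, with weight `|w s - p|⁻⁴`. -/
noncomputable def kernelAvg (w : ℝ → ℂ) (u : ℝ → E) (p : ℂ) : E :=
  (kernelMass w p)⁻¹ • ∫ s in Ioc 0 (2 * π), quarticKernel (w s) p • u s

/-- The derivative of `kernelAvg`. -/
noncomputable def kernelAvgDeriv (w : ℝ → ℂ) (u : ℝ → E) (p : ℂ) : ℂ →L[ℝ] E :=
  (kernelMass w p)⁻¹ • ∫ s in Ioc 0 (2 * π),
    (quarticKernelDeriv (w s) p).smulRight (u s - kernelAvg w u p)

lemma continuous_quarticKernel (hw : Continuous w) (hdis : ∀ s, w s ∉ Ω) {p : ℂ} (hp : p ∈ Ω) :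
    Continuous fun s => quarticKernel (w s) p :=
  (continuousOn_quarticKernel hw hdis).comp_continuous (f := fun s : ℝ => (p, s)) (by fun_prop)
    fun s => ⟨hp, trivial⟩

lemma continuous_quarticKernelDeriv (hw : Continuous w) (hdis : ∀ s, w s ∉ Ω) {p : ℂ}
    (hp : p ∈ Ω) : Continuous fun s => quarticKernelDeriv (w s) p :=
  (continuousOn_quarticKernelDeriv hw hdis).comp_continuous (f := fun s : ℝ => (p, s))
    (by fun_prop) fun s => ⟨hp, trivial⟩

lemma ofReal_kernelMass (hw : Continuous w) (hdis : ∀ s, w s ∉ Ω) {p : ℂ} (hp : p ∈ Ω) :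
    ofReal (kernelMass w p) = ∫⁻ s, ofReal (quarticKernel (w s) p) ∂circ :=
  ofReal_integral_eq_lintegral_ofReal (continuous_quarticKernel hw hdis hp).integrableOn_Ioc
    (Eventually.of_forall fun _ => quarticKernel_nonneg _ _)

lemma kernelMass_pos (hw : Continuous w) (hdis : ∀ s, w s ∉ Ω) {p : ℂ} (hp : p ∈ Ω) :
    0 < kernelMass w p := by
  unfold kernelMass
  rw [← integral_of_le two_pi_pos.le]
  exact intervalIntegral_pos_of_pos
    ((continuous_quarticKernel hw hdis hp).intervalIntegrable _ _)
    (fun s => quarticKernel_pos fun h => hdis s (h ▸ hp)) two_pi_pos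

lemma continuous_smulRight : Continuous fun x : (ℂ →L[ℝ] ℝ) × E => x.1.smulRight x.2 :=
  (ContinuousLinearMap.smulRightL ℝ ℂ E).continuous₂

lemma integral_smulRight [CompleteSpace E] {D : ℝ → ℂ →L[ℝ] ℝ} (hD : Continuous D) (x : E) :
    (∫ s in Ioc 0 (2 * π), D s).smulRight x = ∫ s in Ioc 0 (2 * π), (D s).smulRight x := by
  have h1 : Continuous fun s => (D s).smulRight x :=
    continuous_smulRight.comp (hD.prodMk continuous_const)
  ext v
  rw [integral_apply h1.integrableOn_Ioc, smulRight_apply, integral_apply hD.integrableOn_Ioc]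
  simp only [smulRight_apply]
  exact (integral_smul_const (μ := volume.restrict (Ioc 0 (2 * π))) (fun s => D s v) x).symm

lemma kernelAvgDeriv_eq [CompleteSpace E] (hw : Continuous w) (hdis : ∀ s, w s ∉ Ω) {u : ℝ → E}
    (hu : Continuous u) {p : ℂ} (hp : p ∈ Ω) : kernelAvgDeriv w u p = (kernelMass w p)⁻¹ •
      ((∫ s in Ioc 0 (2 * π), (quarticKernelDeriv (w s) p).smulRight (u s)) -
        (∫ s in Ioc 0 (2 * π), quarticKernelDeriv (w s) p).smulRight (kernelAvg w u p)) := by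
  unfold kernelAvgDeriv
  congr 1
  have hc := continuous_quarticKernelDeriv hw hdis hp
  have h1 : Continuous fun s => (quarticKernelDeriv (w s) p).smulRight (u s) :=
    continuous_smulRight.comp (hc.prodMk hu)
  have h2 : Continuous fun s => (quarticKernelDeriv (w s) p).smulRight (kernelAvg w u p) :=
    continuous_smulRight.comp (hc.prodMk continuous_const)
  rw [integral_smulRight hc, ← integral_sub h1.integrableOn_Ioc h2.integrableOn_Ioc]
  refine integral_congr_ae (Eventually.of_forall fun s => ?_)
  ext v
  simp [smul_sub]

lemma hasFDerivAt_kernelMass (hw : Continuous w) (hΩ : IsOpen Ω) (hdis : ∀ s, w s ∉ Ω) :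
    (∀ p ∈ Ω, HasFDerivAt (kernelMass w) (∫ s in Ioc 0 (2 * π), quarticKernelDeriv (w s) p) p) ∧
      ContinuousOn (fun p => ∫ s in Ioc 0 (2 * π), quarticKernelDeriv (w s) p) Ω :=
  hasFDerivAt_integral_of_continuousOn (K := fun p s => quarticKernel (w s) p)
    (K' := fun p s => quarticKernelDeriv (w s) p) hΩ 0 (2 * π)
    (continuousOn_quarticKernel hw hdis) (continuousOn_quarticKernelDeriv hw hdis)
    fun _ hp s => hasFDerivAt_quarticKernel fun h => hdis s (h ▸ hp)

lemma hasFDerivAt_integral_quarticKernel_smul [CompleteSpace E] (hw : Continuous w) (hΩ : IsOpen Ω)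
    (hdis : ∀ s, w s ∉ Ω) {u : ℝ → E} (hu : Continuous u) :
    (∀ p ∈ Ω, HasFDerivAt (fun p => ∫ s in Ioc 0 (2 * π), quarticKernel (w s) p • u s)
        (∫ s in Ioc 0 (2 * π), (quarticKernelDeriv (w s) p).smulRight (u s)) p) ∧ ContinuousOn
        (fun p => ∫ s in Ioc 0 (2 * π), (quarticKernelDeriv (w s) p).smulRight (u s)) Ω := by
  have hk := continuousOn_quarticKernel hw hdis
  have hu2 : ContinuousOn (fun x : ℂ × ℝ => u x.2) (Ω ×ˢ univ) := by fun_prop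
  have h1 : ContinuousOn (fun x : ℂ × ℝ => quarticKernel (w x.2) x.1 • u x.2)
      (Ω ×ˢ univ) := ContinuousOn.smul hk hu2
  have h2 : ContinuousOn (fun x : ℂ × ℝ => (quarticKernelDeriv (w x.2) x.1, u x.2))
      (Ω ×ˢ univ) := (continuousOn_quarticKernelDeriv hw hdis).prodMk hu2
  have h3 : ContinuousOn (fun x : ℂ × ℝ => (quarticKernelDeriv (w x.2) x.1).smulRight (u x.2))
      (Ω ×ˢ univ) := continuous_smulRight.comp_continuousOn h2
  have h4 : ∀ p ∈ Ω, ∀ s, HasFDerivAt (fun p => quarticKernel (w s) p • u s)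
      ((quarticKernelDeriv (w s) p).smulRight (u s)) p := fun p hp s =>
    (hasFDerivAt_quarticKernel fun h : w s = p => hdis s (h ▸ hp)).smul_const (u s)
  exact hasFDerivAt_integral_of_continuousOn hΩ 0 (2 * π) h1 h3 h4

lemma hasFDerivAt_kernelAvg [CompleteSpace E] (hw : Continuous w) (hΩ : IsOpen Ω) (hdis : ∀ s, w s ∉ Ω) {u : ℝ → E}
    (hu : Continuous u) : (∀ p ∈ Ω, HasFDerivAt (kernelAvg w u) (kernelAvgDeriv w u p) p) ∧
      ContinuousOn (kernelAvgDeriv w u) Ω := by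
  obtain ⟨hm, hm'⟩ := hasFDerivAt_kernelMass hw hΩ hdis
  obtain ⟨hN, hN'⟩ := hasFDerivAt_integral_quarticKernel_smul hw hΩ hdis hu
  have hmc : ContinuousOn (kernelMass w) Ω := fun p hp => (hm p hp).continuousAt.continuousWithinAt
  have hNc : ContinuousOn (fun p => ∫ s in Ioc 0 (2 * π), quarticKernel (w s) p • u s) Ω :=
    fun p hp => (hN p hp).continuousAt.continuousWithinAt
  have hinv : ContinuousOn (fun p => (kernelMass w p)⁻¹) Ω :=
    hmc.inv₀ fun p hp => (kernelMass_pos hw hdis hp).ne'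
  have hA : ContinuousOn (kernelAvg w u) Ω := hinv.smul hNc
  refine ⟨fun p hp => ?_, ?_⟩
  · have hp0 := (kernelMass_pos hw hdis hp).ne'
    have h1 : HasFDerivAt (fun p => (kernelMass w p)⁻¹) _ p :=
      (hasDerivAt_inv hp0).comp_hasFDerivAt p (hm p hp)
    refine (h1.smul (hN p hp)).congr_fderiv ?_
    rw [kernelAvgDeriv_eq hw hdis hu hp]
    generalize (∫ s in Ioc 0 (2 * π), (quarticKernelDeriv (w s) p).smulRight (u s)) = P
    generalize (∫ s in Ioc 0 (2 * π), quarticKernelDeriv (w s) p) = Q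
    rw [kernelAvg]
    generalize (∫ s in Ioc 0 (2 * π), quarticKernel (w s) p • u s) = I
    ext v
    simp only [_root_.smul_apply, _root_.add_apply, _root_.sub_apply,
      smulRight_apply, smul_eq_mul, smul_sub, smul_smul]
    rw [sub_eq_add_neg, ← neg_smul]
    congr 2
    field_simp
  · refine ContinuousOn.congr ?_ fun p hp => kernelAvgDeriv_eq hw hdis hu hp
    have h2 : ContinuousOn (fun p => (∫ s in Ioc 0 (2 * π), quarticKernelDeriv (w s) p,
        kernelAvg w u p)) Ω := hm'.prodMk hA
    have h3 : ContinuousOn (fun p => (∫ s in Ioc 0 (2 * π),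
        quarticKernelDeriv (w s) p).smulRight (kernelAvg w u p)) Ω :=
      continuous_smulRight.comp_continuousOn h2
    have h4 := hN'.sub h3
    exact hinv.smul h4

end

lemma lintegral_weight_mul_sq_le {α : Type*} [MeasurableSpace α] (μ : Measure α)
    {k f : α → ENNReal} (hk : Measurable k) (hf : Measurable f) :
    (∫⁻ a, k a * f a ∂μ) ^ 2 ≤ (∫⁻ a, k a ∂μ) * ∫⁻ a, k a * f a ^ 2 ∂μ := by
  have h := lintegral_sq_le (μ.withDensity k) hf.aemeasurable
  rw [lintegral_withDensity_eq_lintegral_mul _ hk hf,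
    lintegral_withDensity_eq_lintegral_mul _ hk (hf.pow_const 2), withDensity_apply _ .univ,
    Measure.restrict_univ] at h
  exact h

section

variable {w : ℝ → ℂ} {Ω : Set ℂ} {E : Type*} [NormedAddCommGroup E] [NormedSpace ℝ E]
  [CompleteSpace E]

lemma kernelAvg_sub (hw : Continuous w) (hdis : ∀ s, w s ∉ Ω) {u : ℝ → E} (hu : Continuous u)
    {p : ℂ} (hp : p ∈ Ω) (x : E) : kernelAvg w u p - x =
      (kernelMass w p)⁻¹ • ∫ s in Ioc 0 (2 * π), quarticKernel (w s) p • (u s - x) := by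
  have hk := continuous_quarticKernel hw hdis hp
  have h1 : Continuous fun s => quarticKernel (w s) p • u s := hk.smul hu
  have h2 : Continuous fun s => quarticKernel (w s) p • x := hk.smul continuous_const
  simp only [smul_sub]
  rw [integral_sub h1.integrableOn_Ioc h2.integrableOn_Ioc, smul_sub, integral_smul_const]
  change _ = kernelAvg w u p - (kernelMass w p)⁻¹ • kernelMass w p • x
  rw [smul_smul, inv_mul_cancel₀ (kernelMass_pos hw hdis hp).ne', one_smul]

lemma norm_kernelAvg_sub_le (hw : Continuous w) (hdis : ∀ s, w s ∉ Ω) {u : ℝ → E}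
    (hu : Continuous u) {p : ℂ} (hp : p ∈ Ω) (x : E) : ‖kernelAvg w u p - x‖ ≤
      (kernelMass w p)⁻¹ * ∫ s in Ioc 0 (2 * π), quarticKernel (w s) p * ‖u s - x‖ := by
  rw [kernelAvg_sub hw hdis hu hp, norm_smul, norm_inv, norm_of_nonneg
    (kernelMass_pos hw hdis hp).le]
  refine mul_le_mul_of_nonneg_left ?_ (inv_nonneg.2 (kernelMass_pos hw hdis hp).le)
  refine (norm_integral_le_integral_norm _).trans_eq ?_
  simp only [norm_smul, norm_of_nonneg (quarticKernel_nonneg _ _)]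

lemma norm_kernelAvg_le (hw : Continuous w) (hdis : ∀ s, w s ∉ Ω) {u : ℝ → E}
    (hu : Continuous u) {M : ℝ} (hM : ∀ s, ‖u s‖ ≤ M) {p : ℂ} (hp : p ∈ Ω) :
    ‖kernelAvg w u p‖ ≤ M := by
  have h := norm_kernelAvg_sub_le hw hdis hu hp 0
  have hk := continuous_quarticKernel hw hdis hp
  have hm := kernelMass_pos hw hdis hp
  simp only [sub_zero] at h
  refine h.trans ?_
  rw [inv_mul_le_iff₀ hm]
  unfold kernelMass
  rw [← integral_mul_const]
  refine setIntegral_mono (hk.mul hu.norm).integrableOn_Ioc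
    (hk.mul continuous_const).integrableOn_Ioc fun s => ?_
  exact mul_le_mul_of_nonneg_left (hM s) (quarticKernel_nonneg _ _)

lemma enorm_kernelAvg_sub_le (hw : Continuous w) (hdis : ∀ s, w s ∉ Ω) {u : ℝ → E}
    (hu : Continuous u) {p : ℂ} (hp : p ∈ Ω) (x : E) : ‖kernelAvg w u p - x‖ₑ ≤
      (ofReal (kernelMass w p))⁻¹ * ∫⁻ s, ofReal (quarticKernel (w s) p) * ‖u s - x‖ₑ ∂circ := by
  have hm := kernelMass_pos hw hdis hp
  rw [kernelAvg_sub hw hdis hu hp, enorm_smul, enorm_eq_ofReal (inv_nonneg.2 hm.le),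
    ofReal_inv_of_pos hm]
  gcongr
  refine (enorm_integral_le_lintegral_enorm _).trans_eq ?_
  simp only [enorm_smul, enorm_eq_ofReal (quarticKernel_nonneg _ _)]

lemma exists_le_kernelMass_mul {L : NNReal} (hw : LipschitzWith L w)
    (hwp : ∀ s, w (s + 2 * π) = w s) (hdis : ∀ s, w s ∉ Ω) (hΩb : IsBounded Ω) :
    ∃ a : ℝ, 0 < a ∧ ∀ p ∈ Ω, ∀ s, a ≤ kernelMass w p * ‖w s - p‖ ^ 3 := by
  have hwb : IsBounded (range w) := (isCompact_range_of_periodic hw.continuous hwp).isBounded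
  obtain ⟨D, hD0, hD⟩ := (hwb.union hΩb).exists_pos_norm_le
  have hδD : ∀ p ∈ Ω, ∀ s, ‖w s - p‖ ≤ 2 * D := fun p hp s =>
    (norm_sub_le _ _).trans (by
      have := hD (w s) (.inl ⟨s, rfl⟩)
      have := hD p (.inr hp)
      linarith)
  set a : ℝ := min 1 (π / (2 * D)) with ha
  have ha0 : 0 < a := lt_min one_pos (by positivity)
  refine ⟨a * ((1 + (L : ℝ)) ^ 4)⁻¹, by positivity, fun p hp s => ?_⟩
  set δ := ‖w s - p‖ with hδ
  have hδ0 : 0 < δ := norm_pos_iff.2 (sub_ne_zero.2 fun h => hdis s (h ▸ hp))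
  have hk := continuous_quarticKernel hw.continuous hdis hp
  have haδ : a * δ ≤ 2 * π := by
    have : a * δ ≤ π / (2 * D) * (2 * D) :=
      mul_le_mul (min_le_right _ _) (hδD p hp s) hδ0.le (by positivity)
    rw [div_mul_cancel₀ _ (by positivity)] at this
    linarith [pi_pos]
  have hm : kernelMass w p = ∫ t in s..s + 2 * π, quarticKernel (w t) p := by
    unfold kernelMass
    rw [← integral_of_le two_pi_pos.le]
    have hper : Periodic (fun t => quarticKernel (w t) p) (2 * π) := fun t => by
      simp only [hwp]
    simpa using hper.intervalIntegral_add_eq 0 s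
  have h1 : ∫ t in s..s + a * δ, quarticKernel (w t) p ≤ kernelMass w p := by
    rw [hm]
    refine intervalIntegral.integral_mono_interval le_rfl (by linarith [mul_pos ha0 hδ0])
      (by linarith) (Eventually.of_forall fun t => quarticKernel_nonneg _ _)
      (hk.intervalIntegrable _ _)
  have h2 : ∫ t in s..s + a * δ, (((1 + L) * δ) ^ 4)⁻¹ ≤
      ∫ t in s..s + a * δ, quarticKernel (w t) p := by
    refine integral_mono_on (by linarith [mul_pos ha0 hδ0]) (by simp)
      (hk.intervalIntegrable _ _) fun t ht => ?_
    have hne : 0 < ‖w t - p‖ := norm_pos_iff.2 (sub_ne_zero.2 fun h => hdis t (h ▸ hp))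
    have h3 : ‖w t - p‖ ≤ (1 + L) * δ := by
      have h4 : ‖w t - w s‖ ≤ L * (a * δ) := by
        refine (hw.norm_sub_le t s).trans ?_
        gcongr
        rw [norm_eq_abs, abs_le]
        constructor <;> linarith [ht.1, ht.2, mul_pos ha0 hδ0]
      have h5 : a * δ ≤ δ := mul_le_of_le_one_left hδ0.le (min_le_left _ _)
      have h6 : (L : ℝ) * (a * δ) ≤ L * δ := by gcongr
      have h7 : ‖w t - p‖ ≤ ‖w t - w s‖ + ‖w s - p‖ := norm_sub_le_norm_sub_add_norm_sub _ _ _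
      linarith
    unfold quarticKernel
    rw [← pow_mul]
    gcongr
  rw [intervalIntegral.integral_const, smul_eq_mul, add_sub_cancel_left] at h2
  calc a * ((1 + (L : ℝ)) ^ 4)⁻¹ = a * δ * (((1 + L) * δ) ^ 4)⁻¹ * δ ^ 3 := by
        rw [mul_pow, mul_inv]; field_simp
    _ ≤ _ := by gcongr; exact h2.trans h1

lemma tendsto_kernelAvg {L : NNReal} (hw : LipschitzWith L w)
    (hwp : ∀ s, w (s + 2 * π) = w s) (hdis : ∀ s, w s ∉ Ω) (hΩb : IsBounded Ω) {c : ℝ} (hc : 0 < c)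
    (hca : ∀ s t : ℝ, c * ‖cis s - cis t‖ ≤ ‖w s - w t‖)
    {u : ℝ → E} (hu : Continuous u) (hup : ∀ s, u (s + 2 * π) = u s) {M : ℝ}
    (hM : ∀ s, ‖u s‖ ≤ M) (s₀ : ℝ) :
    Tendsto (kernelAvg w u) (nhdsWithin (w s₀) Ω) (nhds (u s₀)) := by
  have hM0 : 0 ≤ M := (norm_nonneg _).trans (hM 0)
  obtain ⟨a, ha0, ha⟩ := exists_le_kernelMass_mul hw hwp hdis hΩb
  rw [Metric.tendsto_nhds]
  intro ε hε
  obtain ⟨η, hη, hη'⟩ := continuousAt_iff.1 (hu.continuousAt (x := s₀)) (ε / 2) (half_pos hε)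
  set ρ := 2 * c * η / π with hρ
  have hρ0 : 0 < ρ := by positivity
  have hclose : ∀ s, ‖w s - w s₀‖ < ρ → ‖u s - u s₀‖ ≤ ε / 2 := by
    intro s hs
    obtain ⟨k, hk⟩ := exists_int_abs_sub_le_pi s₀ s
    have h1 := le_norm_exp_sub_exp hk
    have h2 := hca s₀ (s + k * (2 * π))
    rw [two_pi_periodic_eq hwp] at h2
    rw [← Periodic.int_mul (show Periodic u (2 * π) from hup) k s, ← dist_eq_norm]
    refine (hη' ?_).le
    rw [dist_comm, Real.dist_eq]
    rw [norm_sub_rev] at hs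
    push_cast at h1 h2
    have h4 : c * (2 / π * |s₀ - (s + k * (2 * π))|) < 2 * c * η / π :=
      (mul_le_mul_of_nonneg_left h1 hc.le).trans_lt (h2.trans_lt hs)
    have h5 : c * (2 / π * |s₀ - (s + k * (2 * π))|) =
      (2 * c / π) * |s₀ - (s + k * (2 * π))| := by ring
    rw [h5, show 2 * c * η / π = (2 * c / π) * η by ring] at h4
    exact lt_of_mul_lt_mul_left h4 (by positivity)
  have hlim : Tendsto (fun p => 2 * π * (2 * M * (((ρ / 2) ^ 2) ^ 2)⁻¹) / a * ‖w s₀ - p‖ ^ 3)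
      (nhdsWithin (w s₀) Ω) (nhds 0) := by
    have : Continuous fun p => 2 * π * (2 * M * (((ρ / 2) ^ 2) ^ 2)⁻¹) / a * ‖w s₀ - p‖ ^ 3 := by
      fun_prop
    have h := this.tendsto (w s₀)
    simp only [sub_self, norm_zero, ne_eq, OfNat.ofNat_ne_zero, not_false_eq_true, zero_pow,
      mul_zero] at h
    exact h.mono_left nhdsWithin_le_nhds
  filter_upwards [self_mem_nhdsWithin, hlim.eventually (gt_mem_nhds (half_pos hε)),
    mem_nhdsWithin_of_mem_nhds (ball_mem_nhds (w s₀) (half_pos hρ0))] with p hp hp2 hp3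
  rw [dist_eq_norm]
  have hm := kernelMass_pos hw.continuous hdis hp
  have hk := continuous_quarticKernel hw.continuous hdis hp
  refine (norm_kernelAvg_sub_le hw.continuous hdis hu hp _).trans_lt ?_
  have hpt : ∀ s, quarticKernel (w s) p * ‖u s - u s₀‖ ≤
      quarticKernel (w s) p * (ε / 2) + 2 * M * (((ρ / 2) ^ 2) ^ 2)⁻¹ := by
    intro s
    rcases lt_or_ge ‖w s - w s₀‖ ρ with h | h
    · have := mul_le_mul_of_nonneg_left (hclose s h) (quarticKernel_nonneg (w s) p)
      have h9 : 0 ≤ 2 * M * (((ρ / 2) ^ 2) ^ 2)⁻¹ := by positivity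
      linarith
    · have h1 : ρ / 2 ≤ ‖w s - p‖ := by
        have := norm_sub_le_norm_sub_add_norm_sub (w s) p (w s₀)
        rw [mem_ball, dist_eq_norm] at hp3
        linarith
      have h2 : quarticKernel (w s) p ≤ (((ρ / 2) ^ 2) ^ 2)⁻¹ := by
        unfold quarticKernel; gcongr
      have h3 : ‖u s - u s₀‖ ≤ 2 * M := (norm_sub_le _ _).trans (by linarith [hM s, hM s₀])
      have h4 := mul_le_mul h2 h3 (norm_nonneg _) (by positivity)
      have h5 := mul_nonneg (quarticKernel_nonneg (w s) p) (half_pos hε).le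
      linarith
  have hInt : ∫ s in Ioc 0 (2 * π), quarticKernel (w s) p * ‖u s - u s₀‖ ≤
      kernelMass w p * (ε / 2) + 2 * π * (2 * M * (((ρ / 2) ^ 2) ^ 2)⁻¹) := by
    have e : ∫ s in Ioc 0 (2 * π), (quarticKernel (w s) p * (ε / 2) +
        2 * M * (((ρ / 2) ^ 2) ^ 2)⁻¹) =
        kernelMass w p * (ε / 2) + 2 * π * (2 * M * (((ρ / 2) ^ 2) ^ 2)⁻¹) := by
      have hk2 : Continuous fun s => quarticKernel (w s) p * (ε / 2) := hk.mul continuous_const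
      rw [integral_add hk2.integrableOn_Ioc continuous_const.integrableOn_Ioc, integral_mul_const]
      simp [kernelMass, two_pi_pos.le]
    rw [← e]
    have hcont : Continuous fun s => quarticKernel (w s) p * ‖u s - u s₀‖ := by fun_prop
    have hcont2 : Continuous fun s => quarticKernel (w s) p * (ε / 2) +
      2 * M * (((ρ / 2) ^ 2) ^ 2)⁻¹ := by fun_prop
    exact setIntegral_mono hcont.integrableOn_Ioc hcont2.integrableOn_Ioc hpt
  rw [inv_mul_lt_iff₀ hm]
  refine hInt.trans_lt ?_
  have h6 := ha p hp s₀
  have h7 : 2 * π * (2 * M * (((ρ / 2) ^ 2) ^ 2)⁻¹) ≤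
      kernelMass w p * (2 * π * (2 * M * (((ρ / 2) ^ 2) ^ 2)⁻¹) / a * ‖w s₀ - p‖ ^ 3) := by
    have h8 : 0 ≤ 2 * π * (2 * M * (((ρ / 2) ^ 2) ^ 2)⁻¹) / a := by positivity
    have := mul_le_mul_of_nonneg_left h6 h8
    rw [div_mul_cancel₀ _ ha0.ne'] at this
    linarith
  have h10 := mul_lt_mul_of_pos_left hp2 hm
  linarith

end

section

variable {w : ℝ → ℂ} {Ω : Set ℂ} {E : Type*} [NormedAddCommGroup E] [NormedSpace ℝ E]
  [CompleteSpace E]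

lemma enorm_kernelAvgDeriv_le (hw : Continuous w) (hdis : ∀ s, w s ∉ Ω) {u : ℝ → E}
    (hu : Continuous u) {p : ℂ} (hp : p ∈ Ω) {δ : ℝ} (hδ : 0 < δ) (hδw : ∀ s, δ ≤ ‖w s - p‖) :
    ‖kernelAvgDeriv w u p‖ₑ ≤ ofReal (4 / δ) * (ofReal (kernelMass w p))⁻¹ ^ 2 *
      ∫⁻ s, ofReal (quarticKernel (w s) p) *
        ∫⁻ t, ofReal (quarticKernel (w t) p) * ‖u t - u s‖ₑ ∂circ ∂circ := by
  have hm := kernelMass_pos hw hdis hp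
  have hk : Measurable fun s => ofReal (quarticKernel (w s) p) :=
    (continuous_quarticKernel hw hdis hp).measurable.ennreal_ofReal
  set m := ofReal (kernelMass w p)
  rw [kernelAvgDeriv, enorm_smul, enorm_eq_ofReal (inv_nonneg.2 hm.le), ofReal_inv_of_pos hm]
  calc m⁻¹ * ‖∫ s in Ioc 0 (2 * π),
        (quarticKernelDeriv (w s) p).smulRight (u s - kernelAvg w u p)‖ₑ
      ≤ m⁻¹ * ∫⁻ s, ‖(quarticKernelDeriv (w s) p).smulRight (u s - kernelAvg w u p)‖ₑ ∂circ := by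
        gcongr; exact enorm_integral_le_lintegral_enorm _
    _ ≤ m⁻¹ * ∫⁻ s, (ofReal (4 / δ) * ofReal (quarticKernel (w s) p)) * (m⁻¹ *
          ∫⁻ t, ofReal (quarticKernel (w t) p) * ‖u t - u s‖ₑ ∂circ) ∂circ := by
        gcongr with s
        have h1 : ‖(quarticKernelDeriv (w s) p).smulRight (u s - kernelAvg w u p)‖ₑ =
            ofReal ‖quarticKernelDeriv (w s) p‖ * ‖kernelAvg w u p - u s‖ₑ := by
          rw [← ofReal_norm, ContinuousLinearMap.norm_smulRight_apply,
            ofReal_mul (norm_nonneg _), ofReal_norm (u s - kernelAvg w u p),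
            ← enorm_neg, neg_sub]
        rw [h1]
        gcongr
        · rw [← ofReal_mul (by positivity), norm_quarticKernelDeriv]
          refine ofReal_le_ofReal ?_
          have : ‖w s - p‖⁻¹ ≤ δ⁻¹ := by gcongr; exact hδw s
          calc _ ≤ 4 * quarticKernel (w s) p * δ⁻¹ :=
                mul_le_mul_of_nonneg_left this (mul_nonneg (by norm_num) (quarticKernel_nonneg _ _))
            _ = _ := by ring
        · exact enorm_kernelAvg_sub_le hw hdis hu hp _
    _ = _ := by
        have e : ∀ s, (ofReal (4 / δ) * ofReal (quarticKernel (w s) p)) * (m⁻¹ *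
            ∫⁻ t, ofReal (quarticKernel (w t) p) * ‖u t - u s‖ₑ ∂circ) =
            (ofReal (4 / δ) * m⁻¹) * (ofReal (quarticKernel (w s) p) *
            ∫⁻ t, ofReal (quarticKernel (w t) p) * ‖u t - u s‖ₑ ∂circ) := fun s => by ring
        simp only [e]
        rw [lintegral_const_mul' _ _ (mul_ne_top ofReal_ne_top
          (ENNReal.inv_ne_top.2 (by simpa [m] using hm)))]
        ring

lemma enorm_kernelAvgDeriv_sq_le (hw : Continuous w) (hdis : ∀ s, w s ∉ Ω) {u : ℝ → E}
    (hu : Continuous u) {p : ℂ} (hp : p ∈ Ω) {δ : ℝ} (hδ : 0 < δ) (hδw : ∀ s, δ ≤ ‖w s - p‖) :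
    ‖kernelAvgDeriv w u p‖ₑ ^ 2 ≤ ofReal (4 / δ) ^ 2 * (ofReal (kernelMass w p))⁻¹ ^ 2 *
      ∫⁻ s, ofReal (quarticKernel (w s) p) *
        ∫⁻ t, ofReal (quarticKernel (w t) p) * ‖u t - u s‖ₑ ^ 2 ∂circ ∂circ := by
  have hm := kernelMass_pos hw hdis hp
  have hk : Measurable fun s => ofReal (quarticKernel (w s) p) :=
    (continuous_quarticKernel hw hdis hp).measurable.ennreal_ofReal
  have hM := ofReal_kernelMass hw hdis hp
  have h := enorm_kernelAvgDeriv_le hw hdis hu hp hδ hδw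
  have hm0 : ofReal (kernelMass w p) ≠ 0 := by simpa using hm
  set m := ofReal (kernelMass w p)
  have hmeas : ∀ n : ℕ, Measurable fun s => ∫⁻ t, ofReal (quarticKernel (w t) p) *
      ‖u t - u s‖ₑ ^ n ∂circ := fun n => by
    refine Measurable.lintegral_prod_right' (f := fun x : ℝ × ℝ =>
      ofReal (quarticKernel (w x.2) p) * ‖u x.2 - u x.1‖ₑ ^ n) ?_
    refine (hk.comp measurable_snd).mul (Measurable.pow_const ?_ n)
    exact (Continuous.measurable (by fun_prop))
  have hmt : m ≠ ⊤ := ofReal_ne_top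
  have h2 : (∫⁻ s, ofReal (quarticKernel (w s) p) *
        ∫⁻ t, ofReal (quarticKernel (w t) p) * ‖u t - u s‖ₑ ∂circ ∂circ) ^ 2 ≤
      m ^ 2 * ∫⁻ s, ofReal (quarticKernel (w s) p) *
        ∫⁻ t, ofReal (quarticKernel (w t) p) * ‖u t - u s‖ₑ ^ 2 ∂circ ∂circ := by
    refine (lintegral_weight_mul_sq_le _ hk (by simpa using hmeas 1)).trans ?_
    rw [← hM, sq, mul_assoc]
    gcongr
    rw [← lintegral_const_mul' _ _ hmt]
    refine lintegral_mono fun s => ?_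
    calc _ ≤ ofReal (quarticKernel (w s) p) * (m *
          ∫⁻ t, ofReal (quarticKernel (w t) p) * ‖u t - u s‖ₑ ^ 2 ∂circ) := by
          gcongr
          rw [hM]
          exact lintegral_weight_mul_sq_le _ hk (Continuous.measurable (by fun_prop))
      _ = _ := by ring
  calc _ ≤ _ := pow_le_pow_left₀ zero_le h 2
    _ ≤ _ := by
      rw [mul_pow, mul_pow]
      refine mul_le_mul_right h2 _ |>.trans_eq ?_
      have e : m⁻¹ * m = 1 := ENNReal.inv_mul_cancel hm0 hmt
      generalize (∫⁻ s, ofReal (quarticKernel (w s) p) *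
        ∫⁻ t, ofReal (quarticKernel (w t) p) * ‖u t - u s‖ₑ ^ 2 ∂circ ∂circ) = J
      calc _ = ofReal (4 / δ) ^ 2 * (m⁻¹ ^ 2 * (m⁻¹ * m) ^ 2) * J := by ring
        _ = _ := by rw [e, one_pow, mul_one]

lemma pow_four_mul_quarticKernel_mul_le {a b p : ℂ} {δ : ℝ} (hδ : 0 < δ) (ha : δ ≤ ‖a - p‖)
    (hb : δ ≤ ‖b - p‖) : δ ^ 4 * (quarticKernel a p * quarticKernel b p) ≤
      16 * ((‖a - p‖ + ‖a - b‖ / 2) ^ 4)⁻¹ := by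
  have ha0 := hδ.trans_le ha
  have hb0 := hδ.trans_le hb
  have hab : ‖a - b‖ ≤ ‖a - p‖ + ‖b - p‖ := by
    rw [norm_sub_rev b p]; exact norm_sub_le_norm_sub_add_norm_sub _ _ _
  have key : ∀ x y : ℝ, 0 < x → 0 < y → δ ≤ x → ‖a - p‖ + ‖a - b‖ / 2 ≤ 2 * y →
      δ ^ 4 * (((x ^ 2) ^ 2)⁻¹ * ((y ^ 2) ^ 2)⁻¹) ≤ 16 * ((‖a - p‖ + ‖a - b‖ / 2) ^ 4)⁻¹ := by
    intro x y hx hy hδx h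
    have h0 : 0 < ‖a - p‖ + ‖a - b‖ / 2 := by positivity
    have h1 : δ ^ 4 * ((x ^ 2) ^ 2)⁻¹ ≤ 1 := by
      rw [← pow_mul, mul_inv_le_iff₀ (by positivity), one_mul]
      gcongr
    have h2 : ((y ^ 2) ^ 2)⁻¹ ≤ 16 * ((‖a - p‖ + ‖a - b‖ / 2) ^ 4)⁻¹ := by
      calc ((y ^ 2) ^ 2)⁻¹ = 16 * ((2 * y) ^ 4)⁻¹ := by
            rw [mul_pow, mul_inv]; norm_num; ring
        _ ≤ _ := by gcongr
    calc _ = δ ^ 4 * ((x ^ 2) ^ 2)⁻¹ * ((y ^ 2) ^ 2)⁻¹ := by ring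
      _ ≤ 1 * ((y ^ 2) ^ 2)⁻¹ := by gcongr
      _ ≤ _ := by rw [one_mul]; exact h2
  unfold quarticKernel
  rcases le_total ‖a - p‖ ‖b - p‖ with h | h
  · exact key _ _ ha0 hb0 ha (by linarith)
  · rw [mul_comm (((‖a - p‖ ^ 2) ^ 2)⁻¹)]
    exact key _ _ hb0 ha0 hb (by linarith)

lemma exists_enorm_kernelAvgDeriv_sq_le {L : NNReal} (hw : LipschitzWith L w)
    (hwp : ∀ s, w (s + 2 * π) = w s) (hdis : ∀ s, w s ∉ Ω) (hΩb : IsBounded Ω) :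
    ∃ C : NNReal, ∀ u : ℝ → E, Continuous u → ∀ p ∈ Ω, ‖kernelAvgDeriv w u p‖ₑ ^ 2 ≤
      C * ∫⁻ s, ∫⁻ t, ofReal (((‖w s - p‖ + ‖w s - w t‖ / 2) ^ 4)⁻¹) *
        ‖u t - u s‖ₑ ^ 2 ∂circ ∂circ := by
  obtain ⟨a, ha0, ha⟩ := exists_le_kernelMass_mul hw hwp hdis hΩb
  refine ⟨toNNReal (16 * 16 * (a⁻¹) ^ 2), fun u hu p hp => ?_⟩
  obtain ⟨_, ⟨s₀, rfl⟩, hs₀⟩ := (isCompact_range_of_periodic hw.continuous hwp).exists_isMinOn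
    (range_nonempty w) (f := fun q => ‖q - p‖) (by fun_prop)
  have hδw : ∀ s, ‖w s₀ - p‖ ≤ ‖w s - p‖ := fun s => hs₀ ⟨s, rfl⟩
  have hδ : 0 < ‖w s₀ - p‖ := norm_pos_iff.2 (sub_ne_zero.2 fun h => hdis s₀ (h ▸ hp))
  have hm := kernelMass_pos hw.continuous hdis hp
  have ham := ha p hp s₀
  refine (enorm_kernelAvgDeriv_sq_le hw.continuous hdis hu hp hδ hδw).trans ?_
  set δ := ‖w s₀ - p‖
  have h1 : ofReal (4 / δ) ^ 2 * (ofReal (kernelMass w p))⁻¹ ^ 2 ≤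
      ofReal (16 * (a⁻¹) ^ 2) * ofReal (δ ^ 4) := by
    rw [← ofReal_inv_of_pos hm, ← ofReal_pow (by positivity),
      ← ofReal_pow (by positivity), ← ofReal_mul (by positivity),
      ← ofReal_mul (by positivity)]
    refine ofReal_le_ofReal ?_
    have h2 : (kernelMass w p)⁻¹ ≤ a⁻¹ * δ ^ 3 := by
      rw [inv_le_comm₀ hm (by positivity), mul_inv, inv_inv, mul_inv_le_iff₀ (by positivity)]
      exact ham
    calc (4 / δ) ^ 2 * (kernelMass w p)⁻¹ ^ 2 ≤ (4 / δ) ^ 2 * (a⁻¹ * δ ^ 3) ^ 2 := by gcongr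
      _ = _ := by field_simp; ring
  refine (mul_le_mul_left h1 _).trans ?_
  rw [mul_assoc, show ((toNNReal (16 * 16 * (a⁻¹) ^ 2) : NNReal) : ENNReal) =
    ofReal (16 * (a⁻¹) ^ 2) * ofReal 16 by
      rw [← ofReal_mul (by positivity)]; congr 1; ring_nf, mul_assoc]
  refine mul_le_mul_right ?_ _
  rw [← lintegral_const_mul' _ _ ofReal_ne_top, ← lintegral_const_mul' _ _ ofReal_ne_top]
  refine lintegral_mono fun s => ?_
  dsimp only
  rw [← mul_assoc, ← lintegral_const_mul' _ _ ofReal_ne_top, ← lintegral_const_mul' _ _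
    (mul_ne_top ofReal_ne_top ofReal_ne_top)]
  refine lintegral_mono fun t => ?_
  dsimp only
  rw [← mul_assoc, ← mul_assoc]
  refine mul_le_mul_left ?_ _
  rw [← ofReal_mul (by positivity), ← ofReal_mul (mul_nonneg (by positivity)
    (quarticKernel_nonneg _ _)), ← ofReal_mul (by positivity)]
  refine ofReal_le_ofReal ?_
  rw [mul_assoc]
  exact pow_four_mul_quarticKernel_mul_le hδ (hδw s) (hδw t)

end

lemma exists_lintegral_kernelAvgDeriv_sq_le {w : ℝ → ℂ} {Ω : Set ℂ} {L : NNReal}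
    (hw : LipschitzWith L w) (hwp : ∀ s, w (s + 2 * π) = w s) (hΩ : IsOpen Ω)
    (hdis : ∀ s, w s ∉ Ω) (hΩb : IsBounded Ω) {c : ℝ} (hc : 0 < c)
    (hca : ∀ s t : ℝ, c * ‖cis s - cis t‖ ≤ ‖w s - w t‖) :
    ∃ C : NNReal, ∀ u : ℝ → ℂ, Continuous u → (∀ s, u (s + 2 * π) = u s) →
      ∫⁻ p in Ω, ‖kernelAvgDeriv w u p‖ₑ ^ 2 ≤ C * douglas u := by
  obtain ⟨C, hC⟩ := exists_enorm_kernelAvgDeriv_sq_le (E := ℂ) hw hwp hdis hΩb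
  obtain ⟨C', hC'⟩ := exists_lintegral_inv_pow_four
  have hwc := hw.continuous
  refine ⟨C * (C' * toNNReal (4 * (c⁻¹) ^ 2)), fun u hu hup => ?_⟩
  have hmeas : Measurable fun x : (ℂ × ℝ) × ℝ =>
      ofReal (((‖w x.1.2 - x.1.1‖ + ‖w x.1.2 - w x.2‖ / 2) ^ 4)⁻¹) * ‖u x.2 - u x.1.2‖ₑ ^ 2 := by
    refine Measurable.mul (Measurable.ennreal_ofReal (Measurable.inv
      (Continuous.measurable (by fun_prop)))) (Continuous.measurable (by fun_prop))
  calc ∫⁻ p in Ω, ‖kernelAvgDeriv w u p‖ₑ ^ 2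
      ≤ ∫⁻ p in Ω, C * ∫⁻ s, ∫⁻ t, ofReal (((‖w s - p‖ + ‖w s - w t‖ / 2) ^ 4)⁻¹) *
        ‖u t - u s‖ₑ ^ 2 ∂circ ∂circ :=
        setLIntegral_mono' hΩ.measurableSet fun p hp => hC u hu p hp
    _ ≤ ∫⁻ p : ℂ, C * ∫⁻ s, ∫⁻ t, ofReal (((‖w s - p‖ + ‖w s - w t‖ / 2) ^ 4)⁻¹) *
        ‖u t - u s‖ₑ ^ 2 ∂circ ∂circ := setLIntegral_le_lintegral _ _
    _ = C * ∫⁻ s, ∫⁻ t, (∫⁻ p : ℂ, ofReal (((‖w s - p‖ + ‖w s - w t‖ / 2) ^ 4)⁻¹) *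
        ‖u t - u s‖ₑ ^ 2) ∂circ ∂circ := by
      rw [lintegral_const_mul' _ _ ENNReal.coe_ne_top, lintegral_lintegral_swap]
      · congr 1
        refine lintegral_congr fun s => ?_
        rw [lintegral_lintegral_swap]
        have hg : Measurable fun x : ℂ × ℝ => ((x.1, s), x.2) := by fun_prop
        exact (hmeas.comp hg).aemeasurable
      · exact hmeas.lintegral_prod_right'.aemeasurable
    _ ≤ C * ∫⁻ s, ∫⁻ t, (C' * toNNReal (4 * (c⁻¹) ^ 2) : NNReal) *
        ofReal (‖u s - u t‖ ^ 2 / ‖cis s - cis t‖ ^ 2) ∂circ ∂circ := by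
      gcongr with s t
      rw [lintegral_mul_const' _ _ (by simp)]
      have hst := hca s t
      set d := ‖cis s - cis t‖ with hd
      rcases eq_or_lt_of_le (norm_nonneg (w s - w t)) with h0 | h0
      · have h1 : d = 0 := le_antisymm (by
          by_contra! h
          have := mul_pos hc h
          linarith) (norm_nonneg _)
        rw [hd, norm_eq_zero, sub_eq_zero, exp_mul_I_eq_iff] at h1
        obtain ⟨k, hk⟩ := h1
        have : u s = u t := by rw [hk, two_pi_periodic_eq hup]
        simp [this]
      · have hd0 : 0 < d := by
          refine (norm_nonneg _).lt_of_ne' fun h => ?_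
          rw [norm_eq_zero, sub_eq_zero, exp_mul_I_eq_iff] at h
          obtain ⟨k, hk⟩ := h
          rw [hk, two_pi_periodic_eq hwp] at h0
          simp at h0
        refine (mul_le_mul_left (hC' (w s) _ (half_pos h0)) _).trans ?_
        rw [ENNReal.coe_mul, mul_assoc, mul_assoc]
        refine mul_le_mul_right ?_ _
        rw [← enorm_neg, neg_sub, ← ofReal_norm, ← ofReal_pow (norm_nonneg _),
          ← ofReal_mul (by positivity)]
        change _ ≤ ofReal _ * _
        rw [← ofReal_mul (by positivity)]
        refine ofReal_le_ofReal ?_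
        have h3 : ((‖w s - w t‖ / 2) ^ 2)⁻¹ ≤ 4 * c⁻¹ ^ 2 * (d ^ 2)⁻¹ := by
          calc ((‖w s - w t‖ / 2) ^ 2)⁻¹ ≤ ((c * d / 2) ^ 2)⁻¹ := by gcongr
            _ = _ := by field_simp; ring
        calc _ ≤ 4 * c⁻¹ ^ 2 * (d ^ 2)⁻¹ * ‖u s - u t‖ ^ 2 := by gcongr
          _ = _ := by rw [div_eq_mul_inv]; ring
    _ = _ := by
      have e : ∀ s : ℝ, (∫⁻ t, (C' * toNNReal (4 * (c⁻¹) ^ 2) : NNReal) *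
          ofReal (‖u s - u t‖ ^ 2 / ‖cis s -
          cis t‖ ^ 2) ∂circ) = (C' * toNNReal (4 * (c⁻¹) ^ 2) : NNReal) *
          ∫⁻ t, ofReal (‖u s - u t‖ ^ 2 / ‖cis s - cis t‖ ^ 2) ∂circ := fun s =>
        lintegral_const_mul' _ _ ENNReal.coe_ne_top
      simp only [e]
      rw [lintegral_const_mul' _ _ ENNReal.coe_ne_top, ← mul_assoc, ENNReal.coe_mul C, douglas]

theorem exists_douglas_comp_le {F : ℂ → ℂ} (hF : DifferentiableOn ℂ F 𝔻)
    (hinj : InjOn F 𝔻) (hb : IsBounded (F '' 𝔻))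
    {w : ℝ → ℂ} {L : NNReal} (hw : LipschitzWith L w) (hwp : ∀ s, w (s + 2 * π) = w s)
    (hdis : ∀ s, w s ∉ F '' 𝔻) {c : ℝ} (hc : 0 < c) (hca : ∀ s t : ℝ, c * ‖cis s - cis t‖ ≤
      ‖w s - w t‖) {φ : ℝ → ℝ} (hφ : Continuous φ)
    (hφp : (∀ θ, φ (θ + 2 * π) = φ θ + 2 * π) ∨ ∀ θ, φ (θ + 2 * π) = φ θ - 2 * π)
    (hbd : ∀ θ : ℝ, Tendsto (fun r : ℝ => F (r * cis θ))
      (𝓝[<] 1) (nhds (w (φ θ)))) :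
    ∃ C : NNReal, ∀ u : ℝ → ℂ, Continuous u → (∀ s, u (s + 2 * π) = u s) →
      douglas (fun θ => u (φ θ)) ≤ C * douglas u := by
  have hΩ : IsOpen (F '' 𝔻) := isOpen_image_of_conformal hF hinj subset_rfl isOpen_ball
  obtain ⟨C, hC⟩ := exists_lintegral_kernelAvgDeriv_sq_le hw hwp hΩ hdis hb hc hca
  refine ⟨toNNReal (8 * π) * C, fun u hu hup => ?_⟩
  obtain ⟨M, hM⟩ := (isCompact_range_of_periodic hu hup).isBounded.exists_norm_le
  have hM' : ∀ s, ‖u s‖ ≤ M := fun s => hM _ ⟨s, rfl⟩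
  obtain ⟨hD, hDc⟩ := hasFDerivAt_kernelAvg (E := ℂ) hw.continuous hΩ hdis hu
  have hup' : ∀ θ, u (φ (θ + 2 * π)) = u (φ θ) := by
    intro θ
    rcases hφp with h | h
    · rw [h, hup]
    · rw [h]
      have := hup (φ θ - 2 * π)
      rw [sub_add_cancel] at this
      exact this.symm
  have hmem : ∀ z ∈ 𝔻, F z ∈ F '' 𝔻 := fun z hz => ⟨z, hz, rfl⟩
  have hFd : ∀ z ∈ 𝔻, HasDerivAt F (deriv F z) z := fun z hz =>
    (hF.differentiableAt (isOpen_ball.mem_nhds hz)).hasDerivAt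
  have hdF : ContinuousOn (deriv F) 𝔻 := (hF.deriv isOpen_ball).continuousOn
  set G : ℂ → ℂ →L[ℝ] ℂ := fun z => (ContinuousLinearMap.mul ℝ ℂ) (deriv F z) with hG
  have hGc : ContinuousOn G 𝔻 := (ContinuousLinearMap.mul ℝ ℂ).continuous.comp_continuousOn hdF
  have hFG : ∀ z ∈ 𝔻, HasFDerivAt F (G z) z := fun z hz => by
    refine ((hFd z hz).hasFDerivAt.restrictScalars ℝ).congr_fderiv ?_
    ext v
    simp [hG, mul_comm]
  have hGn : ∀ z, ‖G z‖ₑ ≤ ‖deriv F z‖ₑ := fun z => by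
    rw [← ofReal_norm, ← ofReal_norm]
    exact ofReal_le_ofReal (ContinuousLinearMap.opNorm_mul_apply_le ℝ ℂ _)
  have key := douglas_le_dirichlet (V := fun z => kernelAvg w u (F z))
    (V' := fun z => (kernelAvgDeriv w u (F z)).comp (G z)) (v := fun θ => u (φ θ)) (M := M)
    (fun z hz => (hD _ (hmem z hz)).comp z (hFG z hz))
    ((hDc.comp hF.continuousOn hmem).clm_comp hGc)
    (fun z hz => norm_kernelAvg_le hw.continuous hdis hu hM' (hmem z hz))
    (fun θ => ?_) (CircL2.of_continuous (hu.comp hφ) hup')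
  · refine key.trans ?_
    rw [ENNReal.coe_mul, mul_assoc]
    refine mul_le_mul_right (le_trans ?_ (hC u hu hup)) _
    rw [lintegral_image_holomorphic isOpen_ball hF hinj]
    refine setLIntegral_mono' measurableSet_ball fun z hz => ?_
    rw [← mul_pow, mul_comm ‖deriv F z‖ₑ]
    refine pow_le_pow_left₀ zero_le ?_ 2
    calc _ ≤ ‖kernelAvgDeriv w u (F z)‖ₑ * ‖G z‖ₑ := by
          rw [← ofReal_norm, ← ofReal_norm, ← ofReal_norm, ← ofReal_mul (norm_nonneg _)]
          exact ofReal_le_ofReal (ContinuousLinearMap.opNorm_comp_le _ _)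
      _ ≤ _ := mul_le_mul_right (hGn z) _
  · refine (tendsto_kernelAvg hw hwp hdis hb hc hca hu hup hM' (φ θ)).comp
      (tendsto_nhdsWithin_iff.2 ⟨hbd θ, ?_⟩)
    filter_upwards [eventually_mem_Ico_one] with r hr
    exact hmem _ (circle_mem_ball hr.1 hr.2 θ)

lemma Function.Periodic.lintegral_Ioc_le {g : ℝ → ENNReal} (hp : Periodic g (2 * π))
    (a : ℝ) (N : ℕ) {b : ℝ} (hb : b ≤ a + N * (2 * π)) :
    ∫⁻ t in Ioc a b, g t ≤ N * ∫⁻ t, g t ∂circ := by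
  induction N generalizing b with
  | zero =>
    rw [Ioc_eq_empty (by simpa using hb)]; simp
  | succ N ih =>
    have h1 : Ioc a b ⊆ Ioc a (a + N * (2 * π)) ∪
        Ioc (a + N * (2 * π)) (a + N * (2 * π) + 2 * π) := by
      intro t ht
      rcases le_or_gt t (a + N * (2 * π)) with h | h
      · exact .inl ⟨ht.1, h⟩
      · refine .inr ⟨h, ht.2.trans (hb.trans_eq ?_)⟩
        push_cast; ring
    calc _ ≤ ∫⁻ t in Ioc a (a + N * (2 * π)) ∪
        Ioc (a + N * (2 * π)) (a + N * (2 * π) + 2 * π), g t := lintegral_mono_set h1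
      _ ≤ _ := lintegral_union_le _ _ _
      _ ≤ N * ∫⁻ t, g t ∂circ + ∫⁻ t, g t ∂circ := by
        refine add_le_add (ih le_rfl) ?_
        rw [hp.lintegral_Ioc_eq two_pi_pos _ 0, zero_add]
      _ = _ := by push_cast; ring

lemma Function.Periodic.lintegral_Ioc_lt_top {g : ℝ → ENNReal}
    (hp : Periodic g (2 * π)) (hg : ∫⁻ t, g t ∂circ < ⊤) (a b : ℝ) : ∫⁻ t in Ioc a b, g t < ⊤ := by
  obtain ⟨N, hN⟩ := exists_nat_ge ((b - a) / (2 * π))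
  rw [div_le_iff₀ two_pi_pos] at hN
  exact (hp.lintegral_Ioc_le a N (by linarith)).trans_lt
    (mul_lt_top (ENNReal.natCast_lt_top _) hg)

/-- `v` is the `L¹` boundary function of the holomorphic function `f` on the unit disc. -/
structure IsBdryOne (f : ℂ → ℂ) (v : ℝ → ℂ) : Prop where
  diff : DifferentiableOn ℂ f 𝔻
  meas : Measurable v
  per : Periodic v (2 * π)
  fin : ∫⁻ t, ‖v t‖ₑ ∂circ < ⊤
  tendsto : Tendsto
    (fun r : ℝ => ∫⁻ θ : ℝ, ‖f (r * cis θ) - v θ‖ₑ ∂circ)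
    (𝓝[<] 1) (nhds 0)

lemma tendsto_zero_of_sq {α : Type*} {l : Filter α} {x : α → ENNReal}
    (h : Tendsto (fun a => x a ^ 2) l (nhds 0)) : Tendsto x l (nhds 0) := by
  have h1 := (ENNReal.continuous_rpow_const (y := 1 / 2)).tendsto 0 |>.comp h
  rw [ENNReal.zero_rpow_of_pos (by norm_num)] at h1
  refine h1.congr fun a => ?_
  rw [Function.comp_apply, ← ENNReal.rpow_natCast, ← ENNReal.rpow_mul]
  norm_num

lemma circ_univ : circ univ = ofReal (2 * π) := by simp

lemma IsBdry.mul {f g : ℂ → ℂ} {u v : ℝ → ℂ} (hu : IsBdry f u) (hv : IsBdry g v) :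
    IsBdryOne (fun z => f z * g z) fun t => u t * v t := by
  have hmu := hu.circL2.meas
  have hmv := hv.circL2.meas
  refine ⟨hu.diff.mul hv.diff, hmu.mul hmv, fun t => by simp only [hu.circL2.per t, hv.circL2.per t],
    ?_, ?_⟩
  · have h := lintegral_mul_sq_le circ hmu.enorm.aemeasurable hmv.enorm.aemeasurable
    have h2 := h.trans_lt (mul_lt_top hu.circL2.fin hv.circL2.fin)
    simp only [enorm_mul]
    by_contra! h3
    rw [top_le_iff] at h3
    rw [h3] at h2
    simp at h2
  · set U := ∫⁻ t, ‖u t‖ₑ ^ 2 ∂circ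
    set V := ∫⁻ t, ‖v t‖ₑ ^ 2 ∂circ
    set X := fun r : ℝ => ∫⁻ θ : ℝ, ‖f (r * cis θ) - u θ‖ₑ ^ 2 ∂circ
    set Y := fun r : ℝ => ∫⁻ θ : ℝ, ‖g (r * cis θ) - v θ‖ₑ ^ 2 ∂circ
    have hsq : ∀ x y z : ENNReal, (x + y + z) ^ 2 ≤ 4 * (x ^ 2 + y ^ 2 + z ^ 2) := by
      intro x y z
      rcases eq_or_ne x ⊤ with rfl | hx
      · simp
      rcases eq_or_ne y ⊤ with rfl | hy
      · simp
      rcases eq_or_ne z ⊤ with rfl | hz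
      · simp
      lift x to NNReal using hx
      lift y to NNReal using hy
      lift z to NNReal using hz
      norm_cast
      rw [← NNReal.coe_le_coe]
      push_cast
      nlinarith [sq_nonneg ((x : ℝ) - y), sq_nonneg ((y : ℝ) - z), sq_nonneg ((x : ℝ) - z),
        sq_nonneg (x : ℝ), sq_nonneg (y : ℝ), sq_nonneg (z : ℝ)]
    refine tendsto_zero_of_sq ?_
    have hlim : Tendsto (fun r => 4 * (X r * Y r + U * Y r + X r * V))
        (𝓝[<] 1) (nhds 0) := by
      have h1 := ENNReal.Tendsto.mul hu.tendsto (.inr ENNReal.zero_ne_top) hv.tendsto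
        (.inr ENNReal.zero_ne_top)
      have h2 := ENNReal.Tendsto.const_mul (a := U) hv.tendsto (.inr hu.circL2.fin.ne)
      have h3 := ENNReal.Tendsto.mul_const (b := V) hu.tendsto (.inr hv.circL2.fin.ne)
      have h4 := ENNReal.Tendsto.const_mul (a := 4) ((h1.add h2).add h3) (.inr (by simp))
      simpa using h4
    refine tendsto_of_tendsto_of_tendsto_of_le_of_le' tendsto_const_nhds hlim
      (Eventually.of_forall fun _ => zero_le) ?_
    filter_upwards [eventually_mem_Ico_one] with r hr
    have hf := ((hu.continuous_circle hr.1 hr.2).measurable.sub hmu).enorm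
    have hg := ((hv.continuous_circle hr.1 hr.2).measurable.sub hmv).enorm
    have h1 := lintegral_mul_sq_le circ hf.aemeasurable hg.aemeasurable
    have h2 := lintegral_mul_sq_le circ hmu.enorm.aemeasurable hg.aemeasurable
    have h3 := lintegral_mul_sq_le circ hf.aemeasurable hmv.enorm.aemeasurable
    refine le_trans ?_ ((hsq _ _ _).trans (mul_le_mul_right (add_le_add (add_le_add h1 h2) h3) 4))
    refine pow_le_pow_left₀ zero_le ?_ 2
    have hfg : Measurable fun t : ℝ => ‖f (r * cis t) - u t‖ₑ * ‖g (r * cis t) - v t‖ₑ := hf.mul hg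
    have hug : Measurable fun t : ℝ => ‖u t‖ₑ * ‖g (r * cis t) - v t‖ₑ := hmu.enorm.mul hg
    refine (lintegral_mono fun t => ?_).trans_eq
      ((lintegral_add_left (hfg.add hug) fun t => ‖f (r * cis t) - u t‖ₑ *
        ‖v t‖ₑ).trans (congrArg₂ _ (lintegral_add_left hfg _) rfl))
    simp only [Pi.add_apply]
    rw [← enorm_mul, ← enorm_mul, ← enorm_mul]
    set a := f (r * cis t)
    set b := g (r * cis t)
    have e : a * b - u t * v t = (a - u t) * (b - v t) + u t * (b - v t) + (a - u t) * v t := by ring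
    rw [e]
    exact (enorm_add_le _ _).trans (add_le_add_left (enorm_add_le _ _) _)

lemma isBdry_const (c : ℂ) : IsBdry (fun _ => c) fun _ => c :=
  ⟨differentiableOn_const c, .const c, by simp⟩

lemma IsBdry.one {f : ℂ → ℂ} {u : ℝ → ℂ} (hu : IsBdry f u) : IsBdryOne f u := by
  simpa using hu.mul (isBdry_const 1)

namespace IsBdryOne

variable {f : ℂ → ℂ} {v : ℝ → ℂ}

lemma intervalIntegrable (hv : IsBdryOne f v) (a b : ℝ) : IntervalIntegrable v volume a b := by
  have hp : Periodic (fun t => ‖v t‖ₑ) (2 * π) := fun t => by simp only [hv.per t]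
  exact ⟨⟨hv.meas.aestronglyMeasurable, hp.lintegral_Ioc_lt_top hv.fin a b⟩,
    ⟨hv.meas.aestronglyMeasurable, hp.lintegral_Ioc_lt_top hv.fin b a⟩⟩

lemma continuous_circle (hu : IsBdryOne f v) {r : ℝ} (hr0 : 0 ≤ r) (hr1 : r < 1) :
    Continuous fun θ : ℝ => f (r * cis θ) :=
  hu.diff.continuousOn.comp_continuous (by fun_prop) (circle_mem_ball hr0 hr1)

lemma tendsto_Ioc (hv : IsBdryOne f v) (a b : ℝ) : Tendsto
    (fun r : ℝ => ∫⁻ θ in Ioc a b, ‖f (r * cis θ) - v θ‖ₑ)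
    (𝓝[<] 1) (nhds 0) := by
  obtain ⟨N, hN⟩ := exists_nat_ge ((b - a) / (2 * π))
  rw [div_le_iff₀ two_pi_pos] at hN
  have h := ENNReal.Tendsto.const_mul (a := N) hv.tendsto (.inr (ENNReal.natCast_ne_top _))
  rw [mul_zero] at h
  refine tendsto_of_tendsto_of_tendsto_of_le_of_le tendsto_const_nhds h (fun _ => zero_le)
    fun r => ?_
  refine Periodic.lintegral_Ioc_le (fun t => ?_) a N (by linarith)
  simp only [hv.per t, exp_add_two_pi_mul_I]

lemma tendsto_integral_mul (hv : IsBdryOne f v) {a b : ℝ} (hab : a ≤ b) {h : ℝ → ℝ → ℂ}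
    {h₁ : ℝ → ℂ} {M : ℝ} (hc : ∀ᶠ r in 𝓝[<] 1, Continuous (h r))
    (hM : ∀ᶠ r in nhdsWithin (1 : ℝ) (Iio 1), ∀ t, ‖h r t‖ ≤ M)
    (hlim : ∀ t, Tendsto (fun r => h r t) (𝓝[<] 1) (nhds (h₁ t))) :
    Tendsto (fun r : ℝ => ∫ t in a..b, h r t * f (r * cis t))
      (𝓝[<] 1) (nhds (∫ t in a..b, h₁ t * v t)) := by
  have hA : Tendsto (fun r : ℝ => ∫ t in a..b, h r t * v t)
      (𝓝[<] 1) (nhds (∫ t in a..b, h₁ t * v t)) := by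
    refine tendsto_integral_filter_of_dominated_convergence
      (fun t => M * ‖v t‖) ?_ ?_ ((hv.intervalIntegrable a b).norm.const_mul M) ?_
    · filter_upwards [hc] with r hr
      exact (hr.measurable.mul hv.meas).aestronglyMeasurable
    · filter_upwards [hM] with r hr
      refine Eventually.of_forall fun t _ => ?_
      rw [norm_mul]
      gcongr
      exact hr t
    · exact Eventually.of_forall fun t _ => (hlim t).mul_const _
  have hB : Tendsto (fun r : ℝ => ∫ t in a..b, h r t *
      (f (r * cis t) - v t)) (𝓝[<] 1) (nhds 0) := by
    have h1 := ENNReal.Tendsto.const_mul (a := ofReal M) (hv.tendsto_Ioc a b)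
      (.inr ofReal_ne_top)
    rw [mul_zero] at h1
    rw [tendsto_iff_edist_tendsto_0]
    refine tendsto_of_tendsto_of_tendsto_of_le_of_le' tendsto_const_nhds h1
      (Eventually.of_forall fun _ => zero_le) ?_
    filter_upwards [hM] with r hr
    rw [edist_zero_right, integral_of_le hab, ← lintegral_const_mul' _ _ ofReal_ne_top]
    refine (enorm_integral_le_lintegral_enorm _).trans (lintegral_mono fun t => ?_)
    dsimp only
    rw [enorm_mul, ← ofReal_norm (h r t)]
    gcongr
    exact hr t
  have := hA.add hB
  rw [add_zero] at this
  refine this.congr' ?_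
  filter_upwards [hc, eventually_mem_Ico_one] with r hr hr1
  have hf := hv.continuous_circle hr1.1 hr1.2
  rw [← intervalIntegral.integral_add]
  · exact integral_congr fun t _ => by ring
  · exact (hv.intervalIntegrable a b).continuousOn_mul hr.continuousOn
  · exact ((hf.intervalIntegrable a b).sub (hv.intervalIntegrable a b)).continuousOn_mul
      hr.continuousOn

lemma sub_eq_integral {F : ℂ → ℂ} (hF : DifferentiableOn ℂ F 𝔻)
    (hv : IsBdryOne (deriv F) v) {B : ℝ → ℂ} (hB : ∀ θ : ℝ, Tendsto (fun r : ℝ => F (r * cis θ))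
      (𝓝[<] 1) (nhds (B θ))) {x y : ℝ} (hxy : x ≤ y) :
    B y - B x = ∫ t in x..y, I * cis t * v t := by
  have h1 := hv.tendsto_integral_mul hxy (M := 1)
    (h := fun r t => r * (I * cis t))
    (h₁ := fun t => I * cis t)
    (Eventually.of_forall fun r => by fun_prop) ?_ ?_
  · refine tendsto_nhds_unique ((hB y).sub (hB x)) (h1.congr' ?_)
    filter_upwards [eventually_mem_Ico_one] with r hr
    have hd : ∀ t : ℝ, HasDerivAt (fun t : ℝ => F (r * cis t))
        (r * (I * cis t) * deriv F (r * cis t)) t := fun t => by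
      have h2 := (hF.differentiableAt
        (isOpen_ball.mem_nhds (circle_mem_ball hr.1 hr.2 t))).hasDerivAt
      have h3 : HasDerivAt (fun t : ℝ => (r : ℂ) * cis t)
          (r * (cis t * (1 * I))) t :=
        (((ofRealCLM.hasDerivAt (x := t)).mul_const I).cexp).const_mul _
      refine (h2.comp t h3).congr_deriv ?_
      ring
    refine integral_eq_sub_of_hasDerivAt (fun t _ => hd t) ?_
    refine Continuous.intervalIntegrable (Continuous.mul (by fun_prop)
      (hv.continuous_circle hr.1 hr.2)) _ _
  · filter_upwards [eventually_mem_Ico_one] with r hr t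
    simp [norm_exp_ofReal_mul_I, abs_of_nonneg hr.1, hr.2.le]
  · intro t
    have : Tendsto (fun r : ℝ => (r : ℂ) * (I * cis t))
        (nhds 1) (nhds ((1 : ℝ) * (I * cis t))) :=
      (Continuous.tendsto (by fun_prop) _)
    simp only [Complex.ofReal_one, one_mul] at this
    exact this.mono_left nhdsWithin_le_nhds

end IsBdryOne

lemma lintegral_Ioc_add_right (g : ℝ → ENNReal) (a b c : ℝ) :
    ∫⁻ t in Ioc a b, g (t + c) = ∫⁻ t in Ioc (a + c) (b + c), g t := by
  have h := (measurePreserving_add_right volume c).setLIntegral_comp_preimage_emb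
    (measurableEmbedding_addRight c) g (Ioc (a + c) (b + c))
  simpa using h

lemma Function.Periodic.exists_lintegral_Ioc_le {g : ℝ → ENNReal}
    (hp : Periodic g (2 * π)) (hg : ∫⁻ t, g t ∂circ < ⊤) {ε : ENNReal} (hε : ε ≠ 0) :
    ∃ δ : ℝ, 0 < δ ∧ δ ≤ 1 ∧ ∀ x y, y ≤ x + δ → ∫⁻ t in Ioc x y, g t ≤ ε := by
  obtain ⟨δ, hδ, h⟩ := exists_pos_setLIntegral_lt_of_measure_lt
    (hp.lintegral_Ioc_lt_top hg 0 (4 * π)).ne hε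
  obtain ⟨d, hd0, hd⟩ := ENNReal.lt_iff_exists_nnreal_btwn.1 hδ
  have hd0' : (0 : ℝ) < d := by exact_mod_cast hd0
  refine ⟨min d 1, by positivity, min_le_right _ _, fun x y hxy => ?_⟩
  obtain ⟨k, hk⟩ := exists_int_add_mem_Ico 0 x
  have e : ∫⁻ t in Ioc x y, g t = ∫⁻ t in Ioc (x + k * (2 * π)) (y + k * (2 * π)), g t := by
    rw [← lintegral_Ioc_add_right]
    exact lintegral_congr fun t => (hp.int_mul k t).symm
  have hsub : Ioc (x + k * (2 * π)) (y + k * (2 * π)) ⊆ Ioc 0 (4 * π) := by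
    intro t ht
    have := min_le_right (d : ℝ) 1
    have := pi_gt_three
    exact ⟨hk.1.trans_lt ht.1, by linarith [ht.2, hk.2]⟩
  rw [e, ← inter_eq_self_of_subset_left hsub, ← Measure.restrict_restrict measurableSet_Ioc]
  refine (h _ ?_).le
  refine (Measure.restrict_apply_le _ _).trans_lt (lt_of_le_of_lt ?_ hd)
  rw [volume_Ioc, ← ENNReal.ofReal_coe_nnreal]
  refine ofReal_le_ofReal ?_
  have := min_le_left (d : ℝ) 1
  linarith

/-- The kernel of the Douglas energy. -/
noncomputable def douglasKernel (u : ℝ → ℂ) (x y : ℝ) : ENNReal :=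
  ofReal (‖u x - u y‖ ^ 2 / ‖cis x - cis y‖ ^ 2)

lemma measurable_douglasKernel {u : ℝ → ℂ} (hu : Measurable u) :
    Measurable fun p : ℝ × ℝ => douglasKernel u p.1 p.2 := by
  unfold douglasKernel
  fun_prop

lemma exists_douglas_Ioc_le {u : ℝ → ℂ} (hp : Periodic u (2 * π))
    (hu : douglas u < ⊤) {ε : ENNReal} (hε : ε ≠ 0) : ∃ δ : ℝ, 0 < δ ∧ δ ≤ 1 ∧ ∀ x y, y ≤ x + δ →
      ∫⁻ s in Ioc x y, ∫⁻ t in Ioc x y, douglasKernel u s t ≤ ε := by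
  have hK : Periodic (fun s => ∫⁻ t, douglasKernel u s t ∂circ) (2 * π) := fun s => by
    simp only [douglasKernel, hp s, exp_add_two_pi_mul_I]
  obtain ⟨δ, h0, h1, h⟩ := hK.exists_lintegral_Ioc_le hu hε
  refine ⟨δ, h0, h1, fun x y hxy => (lintegral_mono fun s => ?_).trans (h x y hxy)⟩
  have hp2 : Periodic (fun t => douglasKernel u s t) (2 * π) := fun t => by
    simp only [douglasKernel, hp t, exp_add_two_pi_mul_I]
  have := hp2.lintegral_Ioc_le x 1 (b := y) (by have := pi_gt_three; push_cast; linarith)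
  simpa using this

/-- Folding the circle onto the interval `[x, y]`. -/
noncomputable def fold (x y t : ℝ) : ℝ := x + (y - x) * (arccos (cos t) / π)

lemma fold_periodic (x y : ℝ) : Periodic (fold x y) (2 * π) := fun t => by
  simp [fold]

lemma continuous_fold (x y : ℝ) : Continuous (fold x y) := by
  unfold fold
  have : Continuous fun t => arccos (cos t) := continuous_arccos.comp continuous_cos
  fun_prop

lemma lintegral_Ioc_affine {x y : ℝ} (hxy : x < y) (g : ℝ → ENNReal) :
    ∫⁻ t in Ioc 0 π, g (x + (y - x) * (t / π)) = ofReal (π / (y - x)) * ∫⁻ s in Ioc x y, g s := by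
  have hd : ∀ t ∈ Ioc (0 : ℝ) π, HasDerivWithinAt (fun t : ℝ => x + (y - x) * (t / π))
      ((y - x) / π) (Ioc 0 π) t := fun t _ => by
    have := (((hasDerivAt_id t).div_const π).const_mul (y - x)).const_add x
    refine (this.congr_deriv ?_).hasDerivWithinAt
    ring
  have hyx : 0 < y - x := sub_pos.2 hxy
  have hinj : InjOn (fun t : ℝ => x + (y - x) * (t / π)) (Ioc 0 π) := by
    intro s _ t _ h
    have h : x + (y - x) * (s / π) = x + (y - x) * (t / π) := h
    field_simp at h
    exact mul_left_cancel₀ hyx.ne' (add_left_cancel h)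
  have himg : (fun t : ℝ => x + (y - x) * (t / π)) '' Ioc 0 π = Ioc x y := by
    ext s
    constructor
    · rintro ⟨t, ht, rfl⟩
      have h1 : 0 < t / π := div_pos ht.1 pi_pos
      have h2 : t / π ≤ 1 := (div_le_one pi_pos).2 ht.2
      refine ⟨by nlinarith, by nlinarith⟩
    · intro hs
      refine ⟨π * ((s - x) / (y - x)), ⟨mul_pos pi_pos (div_pos (sub_pos.2 hs.1) hyx), ?_⟩, ?_⟩
      · exact mul_le_of_le_one_right pi_pos.le ((div_le_one hyx).2 (by linarith [hs.2]))
      · field_simp; ring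
  have h := lintegral_image_eq_lintegral_abs_deriv_mul measurableSet_Ioc hd hinj g
  rw [himg, abs_of_pos (div_pos hyx pi_pos), lintegral_const_mul' _ _ ofReal_ne_top] at h
  rw [h, ← mul_assoc, ← ofReal_mul (by positivity)]
  have : π / (y - x) * ((y - x) / π) = 1 := by field_simp
  simp [this]

lemma lintegral_fold {x y : ℝ} (hxy : x < y) (g : ℝ → ENNReal) :
    ∫⁻ t, g (fold x y t) ∂circ = ofReal (2 * π / (y - x)) * ∫⁻ s in Ioc x y, g s := by
  have h1 : ∫⁻ t in Ioc 0 π, g (fold x y t) = ofReal (π / (y - x)) * ∫⁻ s in Ioc x y, g s := by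
    rw [← lintegral_Ioc_affine hxy]
    refine setLIntegral_congr_fun measurableSet_Ioc fun t ht => ?_
    simp only [fold]
    rw [arccos_cos ht.1.le ht.2]
  have h2 : ∫⁻ t in Ioc π (2 * π), g (fold x y t) = ∫⁻ t in Ioc 0 π, g (fold x y t) := by
    have hd : ∀ t ∈ Ico (0 : ℝ) π, HasDerivWithinAt (fun t : ℝ => 2 * π - t) (-1)
        (Ico 0 π) t := fun t _ => ((hasDerivAt_id t).const_sub _).hasDerivWithinAt
    have hinj : InjOn (fun t : ℝ => 2 * π - t) (Ico 0 π) := fun s _ t _ h => by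
      simpa using h
    have h := lintegral_image_eq_lintegral_abs_deriv_mul measurableSet_Ico hd hinj
      fun t => g (fold x y t)
    rw [image_const_sub_Ico, sub_zero] at h
    have e : 2 * π - π = π := by ring
    rw [e] at h
    rw [h, setLIntegral_congr (Ico_ae_eq_Ioc (a := (0 : ℝ)) (b := π))]
    refine lintegral_congr fun t => ?_
    simp [fold, cos_two_pi_sub]
  change ∫⁻ t in Ioc 0 (2 * π), g (fold x y t) = _
  rw [← Ioc_union_Ioc_eq_Ioc pi_pos.le (by linarith [pi_pos] : π ≤ 2 * π),
    lintegral_union measurableSet_Ioc (Ioc_disjoint_Ioc_of_le le_rfl), h2, h1, ← two_mul,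
    ← mul_assoc]
  congr 1
  rw [mul_div_assoc, ofReal_mul zero_le_two]
  simp

lemma norm_exp_arccos_cos_le (s t : ℝ) :
    ‖cexp ((arccos (cos s) : ℝ) * I) - cexp ((arccos (cos t) : ℝ) * I)‖ ≤ ‖cis s - cis t‖ := by
  have h : ∀ a b : ℝ, ‖cis a - cis b‖ ^ 2 =
      2 - 2 * (cos a * cos b) - 2 * (sin a * sin b) := fun a b => by
    rw [Complex.sq_norm, normSq_apply]
    simp only [Complex.sub_re, Complex.sub_im, Complex.exp_ofReal_mul_I_re,
      Complex.exp_ofReal_mul_I_im]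
    nlinarith [sin_sq_add_cos_sq a, sin_sq_add_cos_sq b]
  refine le_of_sq_le_sq ?_ (norm_nonneg _)
  have hs : ∀ a : ℝ, sin (arccos (cos a)) = |sin a| := fun a => by
    rw [sin_arccos, ← sin_sq, sqrt_sq_eq_abs]
  rw [h, h, hs, hs, cos_arccos (neg_one_le_cos _) (cos_le_one _),
    cos_arccos (neg_one_le_cos _) (cos_le_one _), ← abs_mul]
  linarith [le_abs_self (sin s * sin t)]

lemma douglasKernel_fold_le {x y : ℝ} (hxy : x < y) (hxy1 : y ≤ x + 1) (u : ℝ → ℂ) (s t : ℝ) :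
    douglasKernel (fun t => u (fold x y t)) s t ≤
      ofReal ((y - x) ^ 2 / 4) * douglasKernel u (fold x y s) (fold x y t) := by
  unfold douglasKernel
  rw [← ofReal_mul (by positivity)]
  refine ofReal_le_ofReal ?_
  dsimp only
  by_cases heq : fold x y s = fold x y t
  · simp [heq]
  have hyx : 0 < y - x := sub_pos.2 hxy
  have hτ : |arccos (cos s) - arccos (cos t)| ≤ π := by
    rw [abs_le]
    constructor <;>
    linarith [arccos_nonneg (cos s), arccos_nonneg (cos t), arccos_le_pi (cos s),
      arccos_le_pi (cos t)]
  have h1 := (le_norm_exp_sub_exp hτ).trans (norm_exp_arccos_cos_le s t)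
  have h2 := norm_exp_sub_exp_le (fold x y s) (fold x y t)
  have h3 : |fold x y s - fold x y t| = (y - x) / π * |arccos (cos s) - arccos (cos t)| := by
    have : fold x y s - fold x y t = (y - x) / π * (arccos (cos s) - arccos (cos t)) := by
      simp only [fold]; ring
    rw [this, abs_mul, abs_of_pos (by positivity)]
  set D := ‖cis s - cis t‖
  set d := ‖cexp (fold x y s * I) - cexp (fold x y t * I)‖
  have h4 : d ≤ (y - x) / 2 * D := by
    calc d ≤ (y - x) / π * |arccos (cos s) - arccos (cos t)| := h2.trans_eq h3
      _ = (y - x) / 2 * (2 / π * |arccos (cos s) - arccos (cos t)|) := by field_simp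
      _ ≤ _ := by gcongr
  rcases (norm_nonneg (cexp (fold x y s * I) - cexp (fold x y t * I))).eq_or_lt with h0 | h0
  · have h5 : |fold x y s - fold x y t| ≤ π := by
      rw [h3]
      calc (y - x) / π * |arccos (cos s) - arccos (cos t)| ≤ (y - x) / π * π := by gcongr
        _ = y - x := by field_simp
        _ ≤ π := by linarith [pi_gt_three]
    have h6 := le_norm_exp_sub_exp h5
    rw [← h0] at h6
    have h7 : 0 < |fold x y s - fold x y t| := abs_pos.2 (sub_ne_zero.2 heq)
    have : 0 < 2 / π * |fold x y s - fold x y t| := by positivity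
    linarith
  have hD : 0 < D := by
    by_contra hD
    have : (y - x) / 2 * D ≤ 0 := mul_nonpos_of_nonneg_of_nonpos (by positivity) (not_lt.1 hD)
    linarith
  have h5 : d ^ 2 ≤ (y - x) ^ 2 / 4 * D ^ 2 := by
    calc d ^ 2 ≤ ((y - x) / 2 * D) ^ 2 := pow_le_pow_left₀ (norm_nonneg _) h4 2
      _ = _ := by ring
  rw [div_le_iff₀ (by positivity), ← mul_div_assoc, div_mul_eq_mul_div, le_div_iff₀ (by positivity)]
  nlinarith [sq_nonneg ‖u (fold x y s) - u (fold x y t)‖]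

theorem exists_local_exp_le {u : ℝ → ℂ} (hu : CircL2 u) (hd : douglas u < ⊤) {η : ℝ} (hη : 0 < η) :
    ∃ δ : ℝ, 0 < δ ∧ δ ≤ 1 ∧ ∀ x y, x < y → y ≤ x + δ → ∃ c : ℂ,
      ∫⁻ t in Ioc x y, ‖cexp (u t - c) - 1‖ₑ ≤ ofReal (η * (y - x)) := by
  obtain ⟨A, hA, hAη⟩ : ∃ A : ℝ, 0 < A ∧ exp A - 1 + 2 * √(exp A - 1) ≤ η := by
    have h : Tendsto (fun A : ℝ => exp A - 1 + 2 * √(exp A - 1)) (𝓝[>] 0)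
        (nhds 0) := by
      have : Continuous fun A : ℝ => exp A - 1 + 2 * √(exp A - 1) := by fun_prop
      simpa using (this.tendsto 0).mono_left nhdsWithin_le_nhds
    obtain ⟨A, h1, h2⟩ := ((h.eventually (ge_mem_nhds hη)).and self_mem_nhdsWithin).exists
    exact ⟨A, h2, h1⟩
  obtain ⟨δ, h0, h1, h⟩ := exists_douglas_Ioc_le hu.per hd
    (ε := ofReal (4 * A)) (by simpa using hA)
  refine ⟨δ, h0, h1, fun x y hxy hxyδ => ?_⟩
  have hyx : 0 < y - x := sub_pos.2 hxy
  set v : ℝ → ℂ := fun t => u (fold x y t) with hv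
  have hfin : ∫⁻ s in Ioc x y, ‖u s‖ₑ ^ 2 < ⊤ := by
    have hp : Periodic (fun t => ‖u t‖ₑ ^ 2) (2 * π) := fun t => by
      simp only [hu.per t]
    exact hp.lintegral_Ioc_lt_top hu.fin x y
  have hvL : CircL2 v := ⟨hu.meas.comp (continuous_fold x y).measurable, fun t => by
      simp only [hv, fold_periodic x y t], by
      rw [hv, lintegral_fold hxy fun s => ‖u s‖ₑ ^ 2]
      exact mul_lt_top ofReal_lt_top hfin⟩
  have hdv : douglas v ≤ ofReal (4 * π ^ 2) * ofReal A := by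
    calc douglas v ≤ ∫⁻ s, ∫⁻ t, ofReal ((y - x) ^ 2 / 4) *
          douglasKernel u (fold x y s) (fold x y t) ∂circ ∂circ :=
          lintegral_mono fun s => lintegral_mono fun t => douglasKernel_fold_le hxy (by linarith) u s t
      _ = ofReal ((y - x) ^ 2 / 4) * (ofReal (2 * π / (y - x)) * (ofReal (2 * π / (y - x)) *
            ∫⁻ s in Ioc x y, ∫⁻ t in Ioc x y, douglasKernel u s t)) := by
          simp_rw [lintegral_const_mul' _ _ ofReal_ne_top]
          rw [lintegral_fold hxy fun s => ∫⁻ t, douglasKernel u s (fold x y t) ∂circ]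
          congr 2
          simp_rw [lintegral_fold hxy]
          rw [lintegral_const_mul' _ _ ofReal_ne_top]
      _ ≤ ofReal ((y - x) ^ 2 / 4) * (ofReal (2 * π / (y - x)) *
          (ofReal (2 * π / (y - x)) * ofReal (4 * A))) := by
          gcongr
          exact h x y hxyδ
      _ = _ := by
          rw [← ofReal_mul (by positivity), ← ofReal_mul (by positivity),
            ← ofReal_mul (by positivity), ← ofReal_mul (by positivity)]
          congr 1
          field_simp
          norm_num
  rw [douglas_eq_tsum hvL] at hdv
  have hA' := (ENNReal.mul_le_mul_iff_right (by simp) ofReal_ne_top).1 hdv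
  have h2 := hvL.lintegral_exp_sub_one_le hA.le hA'
  rw [hv, lintegral_fold hxy fun s => ‖cexp (u s - fc v 0) - 1‖ₑ] at h2
  refine ⟨fc v 0, ?_⟩
  have h3 : ofReal (2 * π * (exp A - 1 + 2 * √(exp A - 1))) ≤
      ofReal (2 * π / (y - x)) * ofReal (η * (y - x)) := by
    rw [← ofReal_mul (by positivity)]
    refine ofReal_le_ofReal ?_
    have : 2 * π / (y - x) * (η * (y - x)) = 2 * π * η := by field_simp
    rw [this]
    gcongr
  exact (ENNReal.mul_le_mul_iff_right (by simp [hyx, pi_pos]) ofReal_ne_top).1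
    (h2.trans h3)

lemma exists_log_of_ne_zero {P : ℂ → ℂ} (hP : DifferentiableOn ℂ P 𝔻)
    (h0 : ∀ z ∈ 𝔻, P z ≠ 0) : ∃ g : ℂ → ℂ, (∀ z ∈ 𝔻, HasDerivAt g (deriv P z / P z) z) ∧
      ∀ z ∈ 𝔻, cexp (g z) = P z := by
  obtain ⟨g, hg0, hg⟩ := ((hP.deriv isOpen_ball).div hP h0).isExactOn_ball.with_val_at 0
    (Complex.log (P 0))
  refine ⟨g, hg, fun z hz => ?_⟩
  have h0m : (0 : ℂ) ∈ 𝔻 := mem_ball_self one_pos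
  have hd : ∀ x ∈ 𝔻, HasDerivAt (fun z => P z * cexp (-g z)) 0 x := fun x hx => by
    have h1 := (hP.differentiableAt (isOpen_ball.mem_nhds hx)).hasDerivAt.mul (hg x hx).neg.cexp
    refine h1.congr_deriv ?_
    have := h0 x hx
    simp only [Pi.neg_apply, Pi.div_apply]
    field_simp
    ring
  have h2 := isOpen_ball.is_const_of_deriv_eq_zero (convex_ball 0 1).isPreconnected
    (fun x hx => (hd x hx).differentiableAt.differentiableWithinAt) (fun x hx => (hd x hx).deriv)
    hz h0m
  simp only [hg0] at h2
  rw [Complex.exp_neg, Complex.exp_neg, Complex.exp_log (h0 0 h0m), mul_inv_cancel₀ (h0 0 h0m)] at h2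
  exact (eq_of_mul_inv_eq_one h2).symm

lemma exists_isBdry_of_lintegral_deriv {g : ℂ → ℂ} (hg : DifferentiableOn ℂ g 𝔻)
    (hfin : ∫⁻ z in 𝔻, ‖deriv g z‖ₑ ^ 2 < ⊤) :
    ∃ u, CircL2 u ∧ ∑' n : ℤ, n.natAbs * ‖fc u n‖ₑ ^ 2 < ⊤ ∧ IsBdry g u ∧
      IsBdry (fun z => cexp (g z)) fun t => cexp (u t) := by
  have hg' : DifferentiableOn ℂ (fun z => g z - g 0) 𝔻 := hg.sub_const _
  have hps := PS.of_differentiableOn hg'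
  set α : ℕ → ℂ := fun n => (n.factorial : ℂ)⁻¹ * iteratedDeriv n (fun z => g z - g 0) 0
  have hα : α 0 = 0 := by simpa using hps.coeff_zero
  have hder : ∫⁻ z in 𝔻, ‖deriv (fun z => g z - g 0) z‖ₑ ^ 2 < ⊤ := by
    simpa only [deriv_sub_const] using hfin
  rw [hps.lintegral_deriv_sq] at hder
  have hA : ∑' n : ℕ, n * ‖α n‖ₑ ^ 2 < ⊤ :=
    (ENNReal.mul_lt_top_iff.1 hder).elim And.right fun h => h.elim
      (fun h => by simp [pi_pos.not_ge] at h) fun h => h ▸ ENNReal.zero_lt_top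
  obtain ⟨p, hp, hpc, hpe, -⟩ := hps.exists_isBdry_exp hα (ofReal_toReal hA.ne).ge
    ENNReal.toReal_nonneg
  have hbd : IsBdry g fun t => p t + g 0 := by
    refine ⟨hg, hp.circL2.add (.const _), hp.tendsto.congr fun r => lintegral_congr fun t => ?_⟩
    congr 2; ring
  refine ⟨fun t => p t + g 0, hbd.circL2, ?_, hbd, ?_⟩
  · have h1 : ∀ n : ℤ, n.natAbs * ‖fc (fun t => p t + g 0) n‖ₑ ^ 2 = n.natAbs * ‖zc α n‖ₑ ^ 2 := by
      intro n
      rw [fc_add hp.circL2.integrable (CircL2.const _).integrable, hpc, fc_const]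
      by_cases hn : n = 0
      · simp [hn]
      · simp [hn]
    simp only [h1]
    rw [tsum_zc (fun n c => n.natAbs * ‖c‖ₑ ^ 2) (by simp)]
    simpa using hA
  · have hc : (fun z => cexp (g z)) = fun z => cexp (g 0) * cexp (g z - g 0) := by
      funext z; rw [← Complex.exp_add]; congr 1; ring
    have hc' : (fun t => cexp (p t + g 0)) = fun t => cexp (g 0) * cexp (p t) := by
      funext z; rw [← Complex.exp_add]; congr 1; ring
    rw [hc, hc']
    refine ⟨hpe.diff.const_mul _, hpe.circL2.const_mul _, ?_⟩
    have := ENNReal.Tendsto.const_mul (a := ‖cexp (g 0)‖ₑ ^ 2) hpe.tendsto (.inr (by simp))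
    rw [mul_zero] at this
    refine this.congr fun r => ?_
    rw [← lintegral_const_mul' _ _ (by simp)]
    refine lintegral_congr fun t => ?_
    rw [← mul_sub, enorm_mul, mul_pow]

lemma IsBdryOne.congr_left {f g : ℂ → ℂ} {v : ℝ → ℂ} (hf : IsBdryOne f v)
    (h : EqOn g f 𝔻) : IsBdryOne g v := by
  refine ⟨hf.diff.congr h, hf.meas, hf.per, hf.fin, hf.tendsto.congr' ?_⟩
  filter_upwards [eventually_mem_Ico_one] with r hr
  refine lintegral_congr fun t => ?_
  rw [h (circle_mem_ball hr.1 hr.2 t)]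

theorem IsBdryOne.exists_local_chordArc {F : ℂ → ℂ} (hF : DifferentiableOn ℂ F 𝔻)
    {u : ℝ → ℂ} (hu : CircL2 u) (hd : douglas u < ⊤)
    (hv : IsBdryOne (deriv F) fun t => cexp (u t)) {B : ℝ → ℂ}
    (hB : ∀ θ : ℝ, Tendsto (fun r : ℝ => F (r * cis θ))
      (𝓝[<] 1) (nhds (B θ))) : ∃ δ : ℝ, 0 < δ ∧ ∀ x y, x ≤ y → y ≤ x + δ →
      1 / 2 * ∫ t in x..y, ‖cexp (u t)‖ ≤ ‖B y - B x‖ := by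
  obtain ⟨δ, h0, h1, h⟩ := exists_local_exp_le hu hd (η := 1 / 8) (by norm_num)
  refine ⟨min δ (1 / 8), by positivity, fun x y hxy hxyδ => ?_⟩
  rcases hxy.eq_or_lt with rfl | hxy'
  · simp
  obtain ⟨c, hc⟩ := h x y hxy' (hxyδ.trans (by gcongr; exact min_le_left _ _))
  have hm : y - x ≤ 1 / 8 := by have := min_le_right δ (1 / 8); linarith
  have hm0 : 0 < y - x := sub_pos.2 hxy'
  set E := cexp c with hE
  have hE0 : 0 < ‖E‖ := norm_pos_iff.2 (Complex.exp_ne_zero c)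
  have hui : IntervalIntegrable (fun t => cexp (u t)) volume x y := hv.intervalIntegrable x y
  have hcI : ∀ a : ℂ, IntervalIntegrable (fun _ => a) volume x y := fun a =>
    intervalIntegrable_const
  have hdi : IntervalIntegrable (fun t => cexp (u t) - E) volume x y := hui.sub (hcI E)
  have hK : ∫ t in x..y, ‖cexp (u t) - E‖ ≤ ‖E‖ * (1 / 8 * (y - x)) := by
    have e : ∀ t, ‖cexp (u t) - E‖ = ‖E‖ * ‖cexp (u t - c) - 1‖ := fun t => by
      rw [← norm_mul, mul_sub, hE, ← Complex.exp_add, add_sub_cancel, mul_one]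
    simp only [e, intervalIntegral.integral_const_mul]
    refine mul_le_mul_of_nonneg_left ?_ hE0.le
    rw [integral_of_le hxy, integral_norm_eq_lintegral_enorm]
    · exact ENNReal.toReal_le_of_le_ofReal (by positivity) hc
    · have := hu.meas
      exact Measurable.aestronglyMeasurable (by fun_prop)
  have hlen : ∫ t in x..y, ‖cexp (u t)‖ ≤ ‖E‖ * (9 / 8 * (y - x)) := by
    calc ∫ t in x..y, ‖cexp (u t)‖ ≤ ∫ t in x..y, (‖cexp (u t) - E‖ + ‖E‖) := by
          refine integral_mono_on hxy hui.norm
            (hdi.norm.add intervalIntegrable_const) fun t _ => ?_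
          simpa using norm_add_le (cexp (u t) - E) E
      _ = (∫ t in x..y, ‖cexp (u t) - E‖) + (y - x) * ‖E‖ := by
          rw [intervalIntegral.integral_add hdi.norm intervalIntegrable_const]
          simp
      _ ≤ ‖E‖ * (1 / 8 * (y - x)) + (y - x) * ‖E‖ := by gcongr
      _ = _ := by ring
  have hmain : ‖(B y - B x) - (y - x : ℝ) * (I * cis x * E)‖ ≤ ‖E‖ * (1 / 4 * (y - x)) := by
    have e1 : (B y - B x) - (y - x : ℝ) * (I * cis x * E) = ∫ t in x..y, (I * cis t * cexp (u t) -
          I * cis x * E) := by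
      rw [hv.sub_eq_integral hF hB hxy, intervalIntegral.integral_sub _ (hcI _)]
      · simp; ring
      · exact hui.continuousOn_mul (by fun_prop)
    rw [e1]
    refine (norm_integral_le_of_norm_le hxy
      (g := fun t => ‖cexp (u t) - E‖ + (y - x) * ‖E‖)
      (Eventually.of_forall fun t ht => ?_)
      (hdi.norm.add intervalIntegrable_const)).trans ?_
    · have e2 : I * cis t * cexp (u t) - I * cis x * E = I * cis t * (cexp (u t) - E) +
          I * (cis t - cis x) * E := by ring
      rw [e2]
      refine (norm_add_le _ _).trans (add_le_add ?_ ?_)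
      · simp [norm_exp_ofReal_mul_I]
      · rw [norm_mul, norm_mul, norm_I, one_mul]
        refine mul_le_mul_of_nonneg_right ((norm_exp_sub_exp_le t x).trans ?_) hE0.le
        rw [abs_of_pos (sub_pos.2 ht.1)]
        linarith [ht.2]
    · rw [intervalIntegral.integral_add hdi.norm intervalIntegrable_const]
      simp only [intervalIntegral.integral_const, smul_eq_mul]
      have : (y - x) * ((y - x) * ‖E‖) ≤ 1 / 8 * ((y - x) * ‖E‖) := by gcongr
      linarith
  have hfin : ‖((y - x : ℝ) : ℂ) * (I * cis x * E)‖ = (y - x) * ‖E‖ := by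
    rw [norm_mul, norm_mul, norm_mul, norm_I, norm_exp_ofReal_mul_I,
      norm_real, norm_of_nonneg hm0.le]
    ring
  have htri := norm_sub_norm_le (((y - x : ℝ) : ℂ) * (I * cis x * E))
    (B y - B x)
  rw [norm_sub_rev (_ * _) (B y - B x), hfin] at htri
  nlinarith [mul_pos hE0 hm0]

lemma ae_hasDerivAt_integral_of_intervalIntegrable {E : Type*} [NormedAddCommGroup E]
    [NormedSpace ℝ E] [CompleteSpace E] {f : ℝ → E} (hf : ∀ x y, IntervalIntegrable f volume x y) :
    ∀ᵐ x, ∀ c, HasDerivAt (fun x => ∫ t in c..x, f t) (f x) x := by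
  refine LocallyIntegrable.ae_hasDerivAt_integral (locallyIntegrable_iff.2 fun K hK => ?_)
  obtain ⟨r, hr⟩ := hK.isBounded.subset_closedBall 0
  refine (hf (-r - 1) r).1.mono_set fun t ht => ?_
  have := hr ht
  rw [mem_closedBall_zero_iff, norm_eq_abs, abs_le] at this
  exact ⟨by linarith, this.2⟩

/-- A circle homeomorphism `φ` (lifted to the line) with density `ρ` and inverse `ψ`. -/
structure Reparam (ρ φ ψ : ℝ → ℝ) : Prop where
  meas : Measurable ρ
  pos : ∀ t, 0 < ρ t
  int : ∀ x y, IntervalIntegrable ρ volume x y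
  sub : ∀ x y, φ y - φ x = ∫ t in x..y, ρ t
  zero : φ 0 = 0
  add : ∀ t, φ (t + 2 * π) = φ t + 2 * π
  left_inv : ∀ t, ψ (φ t) = t
  right_inv : ∀ s, φ (ψ s) = s

namespace Reparam

variable {ρ φ ψ : ℝ → ℝ}

lemma strictMono (h : Reparam ρ φ ψ) : StrictMono φ := fun x y hxy => by
  have h1 := intervalIntegral_pos_of_pos (h.int x y) h.pos hxy
  have := h.sub x y
  linarith

lemma eq_integral (h : Reparam ρ φ ψ) : φ = fun x => ∫ t in (0 : ℝ)..x, ρ t := by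
  funext x
  rw [← h.sub 0 x, h.zero, sub_zero]

lemma continuous (h : Reparam ρ φ ψ) : Continuous φ := by
  rw [h.eq_integral]
  exact continuous_primitive h.int 0

lemma strictMono_inv (h : Reparam ρ φ ψ) : StrictMono ψ := fun x y hxy => by
  rw [← h.strictMono.lt_iff_lt, h.right_inv, h.right_inv]; exact hxy

lemma continuous_inv (h : Reparam ρ φ ψ) : Continuous ψ :=
  h.strictMono_inv.monotone.continuous_of_surjective fun t => ⟨φ t, h.left_inv t⟩

lemma add_inv (h : Reparam ρ φ ψ) (s : ℝ) : ψ (s + 2 * π) = ψ s + 2 * π := by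
  rw [← h.strictMono.injective.eq_iff, h.right_inv, h.add, h.right_inv]

lemma zero_inv (h : Reparam ρ φ ψ) : ψ 0 = 0 := by
  rw [← h.strictMono.injective.eq_iff, h.right_inv, h.zero]

lemma two_pi (h : Reparam ρ φ ψ) : φ (2 * π) = 2 * π := by
  have := h.add 0
  rwa [zero_add, h.zero, zero_add] at this

lemma two_pi_inv (h : Reparam ρ φ ψ) : ψ (2 * π) = 2 * π := by
  have := h.add_inv 0
  rwa [zero_add, h.zero_inv, zero_add] at this

lemma preimage_Ioc (h : Reparam ρ φ ψ) (a b : ℝ) : ψ ⁻¹' Ioc a b = Ioc (φ a) (φ b) := by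
  ext s
  simp only [mem_preimage, mem_Ioc]
  rw [← h.strictMono.lt_iff_lt, ← h.strictMono.le_iff_le, h.right_inv]

lemma map_volume (h : Reparam ρ φ ψ) :
    Measure.map ψ volume = volume.withDensity fun t => ofReal (ρ t) := by
  have key : ∀ ⦃a b : ℝ⦄, a < b → Measure.map ψ volume (Ioc a b) = ofReal (φ b - φ a) := by
    intro a b _
    rw [Measure.map_apply h.continuous_inv.measurable measurableSet_Ioc, h.preimage_Ioc, volume_Ioc]
  refine Measure.ext_of_Ioc' _ _ (fun a b hab => by rw [key hab]; exact ofReal_ne_top)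
    fun a b hab => ?_
  rw [key hab, withDensity_apply _ measurableSet_Ioc, h.sub,
    integral_of_le hab.le, ofReal_integral_eq_lintegral_ofReal (h.int a b).1
    (Eventually.of_forall fun t => (h.pos t).le)]

lemma map_circ (h : Reparam ρ φ ψ) :
    Measure.map ψ circ = circ.withDensity fun t => ofReal (ρ t) := by
  have h1 : circ = volume.restrict (ψ ⁻¹' Ioc 0 (2 * π)) := by
    rw [h.preimage_Ioc, h.zero, h.two_pi]
  rw [h1, ← Measure.restrict_map h.continuous_inv.measurable measurableSet_Ioc, h.map_volume,
    restrict_withDensity measurableSet_Ioc, h.preimage_Ioc, h.zero, h.two_pi]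

lemma ae_comp (h : Reparam ρ φ ψ) {p : ℝ → Prop} (hp : ∀ᵐ t, p t) : ∀ᵐ s, p (ψ s) := by
  refine ae_of_ae_map h.continuous_inv.aemeasurable ?_
  rw [h.map_volume]
  exact (withDensity_absolutelyContinuous _ _).ae_le hp

lemma lintegral_comp (h : Reparam ρ φ ψ) {g : ℝ → ENNReal} (hg : Measurable g) :
    ∫⁻ s, g (ψ s) ∂circ = ∫⁻ t, ofReal (ρ t) * g t ∂circ := by
  rw [← lintegral_map hg h.continuous_inv.measurable, h.map_circ,
    lintegral_withDensity_eq_lintegral_mul _ h.meas.ennreal_ofReal hg]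
  rfl

lemma integral_comp (h : Reparam ρ φ ψ) {g : ℝ → ℂ} (hg : Measurable g) :
    ∫ s in (0 : ℝ)..2 * π, g (ψ s) = ∫ t in (0 : ℝ)..2 * π, ρ t * g t := by
  rw [integral_of_le two_pi_pos.le, integral_of_le two_pi_pos.le]
  change ∫ s, g (ψ s) ∂circ = ∫ t, ρ t * g t ∂circ
  rw [← integral_map h.continuous_inv.aemeasurable hg.aestronglyMeasurable, h.map_circ,
    integral_withDensity_eq_integral_toReal_smul h.meas.ennreal_ofReal
      (Eventually.of_forall fun t => ofReal_lt_top)]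
  refine integral_congr_ae (Eventually.of_forall fun t => ?_)
  dsimp only
  rw [ENNReal.toReal_ofReal (h.pos t).le, real_smul]

lemma ae_hasDerivAt (h : Reparam ρ φ ψ) : ∀ᵐ t, HasDerivAt φ (ρ t) t := by
  filter_upwards [ae_hasDerivAt_integral_of_intervalIntegrable h.int] with t ht
  rw [h.eq_integral]
  exact ht 0

end Reparam

lemma surjective_of_add {φ : ℝ → ℝ} (hφ : Continuous φ) (h : ∀ θ, φ (θ + 2 * π) = φ θ + 2 * π) :
    Surjective φ := fun s => by
  have hp : Periodic (fun t => φ t - t) (2 * π) := fun t => by simp only [h]; ring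
  obtain ⟨k, hk⟩ := exists_nat_ge (|s - φ 0| / (2 * π))
  rw [div_le_iff₀ two_pi_pos, abs_le] at hk
  have h1 := hp.int_mul k 0
  have h2 := hp.int_mul (-k) 0
  push_cast at h1 h2
  exact mem_range_of_exists_le_of_exists_ge hφ ⟨0 + -k * (2 * π), by linarith [hk.1]⟩
    ⟨0 + k * (2 * π), by linarith [hk.2]⟩

theorem exists_reparam {ρ : ℝ → ℝ} (hm : Measurable ρ) (hpos : ∀ t, 0 < ρ t)
    (hp : Periodic ρ (2 * π)) (hi : ∀ x y, IntervalIntegrable ρ volume x y)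
    (h2 : ∫ t in (0 : ℝ)..2 * π, ρ t = 2 * π) : ∃ φ ψ, Reparam ρ φ ψ := by
  set φ : ℝ → ℝ := fun x => ∫ t in (0 : ℝ)..x, ρ t with hφ
  have hsub : ∀ x y, φ y - φ x = ∫ t in x..y, ρ t := fun x y =>
    integral_interval_sub_left (hi _ _) (hi _ _)
  have hadd : ∀ t, φ (t + 2 * π) = φ t + 2 * π := fun t => by
    have h3 := hp.intervalIntegral_add_eq t 0
    rw [zero_add, h2, ← hsub] at h3
    linarith
  have hmono : StrictMono φ := fun x y hxy => by
    have h1 := intervalIntegral_pos_of_pos (hi x y) hpos hxy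
    have := hsub x y
    linarith
  have hc : Continuous φ := continuous_primitive hi 0
  have hsurj := surjective_of_add hc hadd
  exact ⟨φ, Function.surjInv hsurj, hm, hpos, hi, hsub, by simp [hφ], hadd,
    Function.leftInverse_surjInv ⟨hmono.injective, hsurj⟩, Function.rightInverse_surjInv hsurj⟩

lemma AbsolutelyContinuousOnInterval.of_dist_le {X Y : Type*} [PseudoMetricSpace X]
    [PseudoMetricSpace Y] {f : ℝ → X} {g : ℝ → Y} {a b : ℝ}
    (hg : AbsolutelyContinuousOnInterval g a b) (h : ∀ x y, dist (f x) (f y) ≤ dist (g x) (g y)) :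
    AbsolutelyContinuousOnInterval f a b := by
  rw [absolutelyContinuousOnInterval_iff] at hg ⊢
  intro ε hε
  obtain ⟨δ, hδ, H⟩ := hg ε hε
  exact ⟨δ, hδ, fun E hE hE' => (sum_le_sum fun i _ => h _ _).trans_lt (H E hE hE')⟩

/-- The fundamental theorem of calculus for a vector-valued function whose increments are
dominated by those of an integral. -/
theorem sub_eq_integral_of_ae_hasDerivAt {E : Type*} [NormedAddCommGroup E] [NormedSpace ℝ E]
    [CompleteSpace E] {k k' : ℝ → E} {σ : ℝ → ℝ}
    (hk' : ∀ x y, IntervalIntegrable k' volume x y) (hσ : ∀ x y, IntervalIntegrable σ volume x y)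
    (hle : ∀ x y, x ≤ y → ‖k y - k x‖ ≤ ∫ t in x..y, σ t)
    (hd : ∀ᵐ x, HasDerivAt k (k' x) x) (a b : ℝ) : k b - k a = ∫ t in a..b, k' t := by
  have hτ : ∀ x y, IntervalIntegrable (fun t => σ t + ‖k' t‖) volume x y := fun x y =>
    (hσ x y).add (hk' x y).norm
  have hg := (hτ a b).absolutelyContinuousOnInterval_intervalIntegral (left_mem_uIcc)
  have key : ∀ x y, x ≤ y → ‖(k y - ∫ t in a..y, k' t) - (k x - ∫ t in a..x, k' t)‖ ≤
      (∫ t in a..y, (σ t + ‖k' t‖)) - ∫ t in a..x, (σ t + ‖k' t‖) := by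
    intro x y hxy
    rw [sub_sub_sub_comm, integral_interval_sub_left (hk' _ _) (hk' _ _),
      integral_interval_sub_left (hτ _ _) (hτ _ _),
      intervalIntegral.integral_add (hσ _ _) (hk' _ _).norm]
    exact (norm_sub_le _ _).trans (add_le_add (hle x y hxy)
      (intervalIntegral.norm_integral_le_integral_norm hxy))
  have hf : AbsolutelyContinuousOnInterval (fun x => k x - ∫ t in a..x, k' t) a b := by
    refine hg.of_dist_le fun x y => ?_
    rcases le_total x y with hxy | hxy
    · rw [dist_comm, dist_comm (∫ t in a..x, _), dist_eq_norm, Real.dist_eq]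
      exact (key x y hxy).trans (le_abs_self _)
    · rw [dist_eq_norm, Real.dist_eq]
      exact (key y x hxy).trans (le_abs_self _)
  obtain ⟨C, hC⟩ := hf.const_of_ae_hasDerivAt_zero (by
    filter_upwards [hd, ae_hasDerivAt_integral_of_intervalIntegrable hk'] with x h1 h2 _
    have h3 := h1.sub (h2 a)
    rwa [sub_self] at h3)
  have h1 := hC a left_mem_uIcc
  have h2 := hC b right_mem_uIcc
  simp only [integral_same, sub_zero] at h1
  rw [h1, ← h2]
  abel

lemma four_mul_conj_mul (z w : ℂ) : 4 * (star z * w) = ((‖z + w‖ ^ 2 : ℝ) : ℂ) -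
    ((‖z - w‖ ^ 2 : ℝ) : ℂ) - I * ((‖z + I * w‖ ^ 2 : ℝ) : ℂ) +
    I * ((‖z - I * w‖ ^ 2 : ℝ) : ℂ) := by
  simp only [Complex.sq_norm, normSq_apply]
  apply Complex.ext <;> simp <;> ring

theorem hasSum_conj_fc_mul_fc {u v : ℝ → ℂ} (hu : MemLp u 2 circ) (hv : MemLp v 2 circ) :
    HasSum (fun n => star (fc u n) * fc v n) ((((2 * π)⁻¹ : ℝ) : ℂ) * ∫ t, star (u t) * v t ∂circ) := by
  have hs : ∀ c : ℂ, HasSum (fun n => ((‖fc u n + c * fc v n‖ ^ 2 : ℝ) : ℂ))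
      ((((2 * π)⁻¹ : ℝ) : ℂ) * ∫ t, ((‖u t + c * v t‖ ^ 2 : ℝ) : ℂ) ∂circ) := by
    intro c
    have h1 : MemLp (fun t => u t + c * v t) 2 circ := hu.add (hv.const_mul c)
    have h2 := (parseval_hasSum h1).mapL ofRealCLM
    simp only [Complex.ofRealCLM_apply, Complex.ofReal_mul] at h2
    rw [integral_complex_ofReal]
    convert! h2 using 1
    ext n
    rw [fc_add hu.integrable_circ (hv.const_mul c).integrable_circ, fc_const_mul]
  have hi : ∀ c : ℂ, Integrable (fun t => ((‖u t + c * v t‖ ^ 2 : ℝ) : ℂ)) circ := fun c =>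
    ((memLp_two_iff_integrable_sq_norm (hu.add (hv.const_mul c)).aestronglyMeasurable).1
      (hu.add (hv.const_mul c))).ofReal
  have h := ((((hs 1).sub (hs (-1))).sub ((hs I).mul_left I)).add
    ((hs (-I)).mul_left I)).mul_left (1 / 4)
  have e1 : ∀ z w : ℂ, star z * w = 1 / 4 * (((‖z + 1 * w‖ ^ 2 : ℝ) : ℂ) -
      ((‖z + (-1) * w‖ ^ 2 : ℝ) : ℂ) - I * ((‖z + I * w‖ ^ 2 : ℝ) : ℂ) +
      I * ((‖z + (-I) * w‖ ^ 2 : ℝ) : ℂ)) := by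
    intro z w
    rw [one_mul, neg_one_mul, neg_mul, ← sub_eq_add_neg, ← sub_eq_add_neg, ← four_mul_conj_mul]
    ring
  simp only [← e1] at h
  convert! h using 1
  simp only [e1]
  have h3 : Integrable (fun t => ((‖u t + 1 * v t‖ ^ 2 : ℝ) : ℂ) -
      ((‖u t + (-1) * v t‖ ^ 2 : ℝ) : ℂ)) circ := (hi 1).sub (hi (-1))
  have h4 : Integrable (fun t => I * ((‖u t + I * v t‖ ^ 2 : ℝ) : ℂ)) circ := (hi I).const_mul _
  have h5 : Integrable (fun t => I * ((‖u t + (-I) * v t‖ ^ 2 : ℝ) : ℂ)) circ :=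
    (hi (-I)).const_mul _
  have h6 : Integrable (fun t => ((‖u t + 1 * v t‖ ^ 2 : ℝ) : ℂ) -
      ((‖u t + (-1) * v t‖ ^ 2 : ℝ) : ℂ) - I * ((‖u t + I * v t‖ ^ 2 : ℝ) : ℂ)) circ := h3.sub h4
  rw [integral_const_mul, integral_add h6 h5, integral_sub h3 h4,
    integral_sub (hi 1) (hi (-1)), integral_const_mul, integral_const_mul]
  ring

lemma exists_bound_of_periodic {f : ℝ → ℂ} (hc : Continuous f) (hp : Periodic f (2 * π)) :
    ∃ M, 0 ≤ M ∧ ∀ t, ‖f t‖ ≤ M := by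
  obtain ⟨M, hM⟩ := (hp.compact_of_continuous two_pi_pos.ne' hc).isBounded.exists_norm_le
  exact ⟨M, (norm_nonneg _).trans (hM _ (mem_range_self 0)), fun t => hM _ (mem_range_self t)⟩

lemma norm_exp_int_sub_le (n : ℤ) (x y : ℝ) :
    ‖cexp (-(n * y * I)) - cexp (-(n * x * I))‖ ≤ |(n : ℝ)| * |y - x| := by
  have h := norm_exp_sub_exp_le (-(n * y)) (-(n * x))
  rw [abs_sub_comm] at h
  rw [← abs_mul]
  convert! h using 2
  · push_cast
    rw [neg_mul, neg_mul]
  · ring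

lemma Reparam.fc_deriv {ρ φ ψ : ℝ → ℝ} (h : Reparam ρ φ ψ) {v v' : ℝ → ℂ}
    (hv : ∀ s, HasDerivAt v (v' s) s) (hv' : Continuous v') (hp : Periodic v (2 * π))
    (hp' : Periodic v' (2 * π)) (n : ℤ) :
    fc (fun t => ρ t * v' (φ t)) n = I * n * fc (fun t => v (φ t)) n := by
  have hvc : Continuous v := continuous_iff_continuousAt.2 fun s => (hv s).continuousAt
  have hφ := h.continuous
  obtain ⟨M, hM0, hM⟩ := exists_bound_of_periodic hvc hp
  obtain ⟨M', hM0', hM'⟩ := exists_bound_of_periodic hv' hp'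
  have hlip : ∀ x y, x ≤ y → ‖v y - v x‖ ≤ M' * (y - x) := by
    intro x y hxy
    have := Convex.norm_image_sub_le_of_norm_hasDerivWithin_le (f := v) (f' := v') (s := univ)
      (fun s _ => (hv s).hasDerivWithinAt) (fun s _ => hM' s) convex_univ (mem_univ x)
      (mem_univ y)
    rwa [norm_eq_abs, abs_of_nonneg (sub_nonneg.2 hxy)] at this
  have hi1 : ∀ x y, IntervalIntegrable
      (fun t : ℝ => cexp (-(n * t * I)) * (ρ t * v' (φ t))) volume x y := by
    intro x y
    have h1 : IntervalIntegrable (fun t => (ρ t : ℂ)) volume x y :=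
      ⟨(h.int x y).1.ofReal, (h.int x y).2.ofReal⟩
    have h2 : IntervalIntegrable (fun t => (ρ t : ℂ) * v' (φ t)) volume x y :=
      h1.mul_continuousOn (hv'.comp hφ).continuousOn
    exact h2.continuousOn_mul (by fun_prop)
  have hi2 : ∀ x y, IntervalIntegrable
      (fun t : ℝ => cexp (-(n * t * I)) * v (φ t)) volume x y := fun x y =>
    Continuous.intervalIntegrable (by fun_prop) _ _
  have hd : ∀ t : ℝ, HasDerivAt (fun t : ℝ => cexp (-(n * t * I)))
      (-(I * n) * cexp (-(n * t * I))) t := by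
    intro t
    have h1 : HasDerivAt (fun t : ℝ => -((n : ℂ) * t * I)) (-(n * 1 * I)) t :=
      (((hasDerivAt_id t).ofReal_comp.const_mul (n : ℂ)).mul_const I).neg
    convert! h1.cexp using 1
    ring
  have key := sub_eq_integral_of_ae_hasDerivAt
    (k := fun t : ℝ => cexp (-(n * t * I)) * v (φ t))
    (k' := fun t : ℝ => cexp (-(n * t * I)) * (ρ t * v' (φ t)) -
      I * n * (cexp (-(n * t * I)) * v (φ t)))
    (σ := fun t => M' * ρ t + |(n : ℝ)| * M)
    (fun x y => (hi1 x y).sub ((hi2 x y).const_mul _))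
    (fun x y => ((h.int x y).const_mul M').add intervalIntegrable_const) (by
      intro x y hxy
      have e : cexp (-(n * y * I)) * v (φ y) - cexp (-(n * x * I)) * v (φ x) =
          cexp (-(n * y * I)) * (v (φ y) - v (φ x)) +
          (cexp (-(n * y * I)) - cexp (-(n * x * I))) * v (φ x) := by
        ring
      rw [e, intervalIntegral.integral_add ((h.int x y).const_mul M') intervalIntegrable_const,
        intervalIntegral.integral_const_mul, ← h.sub, intervalIntegral.integral_const, smul_eq_mul]
      refine (norm_add_le _ _).trans (add_le_add ?_ ?_)
      · rw [norm_mul, norm_exp_neg_mul_I, one_mul]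
        exact hlip _ _ (h.strictMono.monotone hxy)
      · rw [norm_mul]
        have h1 := norm_exp_int_sub_le n x y
        rw [abs_of_nonneg (sub_nonneg.2 hxy)] at h1
        calc _ ≤ |(n : ℝ)| * (y - x) * M := mul_le_mul h1 (hM _) (norm_nonneg _)
              (mul_nonneg (abs_nonneg _) (sub_nonneg.2 hxy))
          _ = _ := by ring) (by
      filter_upwards [h.ae_hasDerivAt] with t ht
      have h1 : HasDerivAt (fun t => v (φ t)) (ρ t * v' (φ t)) t := by
        have := (hv (φ t)).scomp t ht
        rwa [real_smul] at this
      convert! (hd t).mul h1 using 1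
      ring) 0 (2 * π)
  have hz : cexp (-(n * ((2 * π : ℝ) : ℂ) * I)) = 1 := by
    rw [Complex.exp_eq_one_iff]
    exact ⟨-n, by push_cast; ring⟩
  rw [hz, h.two_pi, h.zero, intervalIntegral.integral_sub (hi1 _ _) ((hi2 _ _).const_mul _),
    intervalIntegral.integral_const_mul] at key
  have hv2 : v (2 * π) = v 0 := by have := hp 0; rwa [zero_add] at this
  simp only [Complex.ofReal_zero, mul_zero, zero_mul, neg_zero, Complex.exp_zero, hv2, sub_self]
    at key
  rw [fc, fc, sub_eq_zero.1 key.symm]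
  ring

lemma tsum_natAbs_mul_sq_le (a b : ℤ → ℂ) :
    (∑' n : ℤ, (n.natAbs : ENNReal) * (‖a n‖ₑ * ‖b n‖ₑ)) ^ 2 ≤
      (∑' n : ℤ, (n.natAbs : ENNReal) * ‖a n‖ₑ ^ 2) *
        ∑' n : ℤ, (n.natAbs : ENNReal) * ‖b n‖ₑ ^ 2 := by
  have hq : ∀ n : ℤ, (n.natAbs : ENNReal) =
      ofReal (√(n.natAbs : ℝ)) * ofReal (√(n.natAbs : ℝ)) := by
    intro n
    rw [← ofReal_mul (sqrt_nonneg _), mul_self_sqrt (Nat.cast_nonneg _), ofReal_natCast]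
  have h := lintegral_mul_sq_le (Measure.count : Measure ℤ)
    (f := fun n => ofReal (√(n.natAbs : ℝ)) * ‖a n‖ₑ)
    (g := fun n => ofReal (√(n.natAbs : ℝ)) * ‖b n‖ₑ)
    (measurable_of_countable _).aemeasurable (measurable_of_countable _).aemeasurable
  simp only [lintegral_count] at h
  convert! h using 2
  · refine tsum_congr fun n => ?_
    rw [hq]; ring
  · refine tsum_congr fun n => ?_
    rw [hq]; ring
  · refine tsum_congr fun n => ?_
    rw [hq]; ring

lemma Reparam.enorm_integral_sq_le {ρ φ ψ : ℝ → ℝ} (h : Reparam ρ φ ψ)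
    (hρ : ∫⁻ t, ‖(ρ t : ℂ)‖ₑ ^ 2 ∂circ < ⊤) {a : ℝ → ℂ} (ha : CircL2 a) {v v' : ℝ → ℂ}
    (hv : ∀ s, HasDerivAt v (v' s) s) (hv' : Continuous v') (hp : Periodic v (2 * π))
    (hp' : Periodic v' (2 * π)) :
    ofReal (4 * π ^ 2) * ‖∫ t, star (a t) * (ρ t * v' (φ t)) ∂circ‖ₑ ^ 2 ≤
      douglas a * douglas fun t => v (φ t) := by
  have hvc : Continuous v := continuous_iff_continuousAt.2 fun s => (hv s).continuousAt
  have hφ := h.continuous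
  obtain ⟨M', hM0', hM'⟩ := exists_bound_of_periodic hv' hp'
  have hm : MemLp (fun t => (ρ t : ℂ)) 2 circ :=
    (memLp_two_iff_lintegral (measurable_ofReal.comp h.meas).aestronglyMeasurable).2 hρ
  have hf : MemLp (fun t => (ρ t : ℂ) * v' (φ t)) 2 circ := by
    have hs : AEStronglyMeasurable (fun t => v' (φ t)) circ := (hv'.comp hφ).aestronglyMeasurable
    refine MemLp.of_le_mul (g := fun t => (ρ t : ℂ)) (c := M') hm (hm.1.mul hs)
      (Eventually.of_forall fun t => ?_)
    rw [norm_mul, mul_comm]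
    exact mul_le_mul_of_nonneg_right (hM' _) (norm_nonneg _)
  have hvL : CircL2 fun t => v (φ t) := CircL2.of_continuous (by fun_prop) fun t => by
    simp only [h.add, hp (φ t)]
  have hs := hasSum_conj_fc_mul_fc ha.memLp hf
  have h2 : ‖∫ t, star (a t) * (ρ t * v' (φ t)) ∂circ‖ₑ ≤ ofReal (2 * π) *
      ∑' n : ℤ, (n.natAbs : ENNReal) * (‖fc a n‖ₑ * ‖fc (fun t => v (φ t)) n‖ₑ) := by
    have e : ∫ t, star (a t) * (ρ t * v' (φ t)) ∂circ = ((2 * π : ℝ) : ℂ) *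
        ∑' n : ℤ, star (fc a n) * fc (fun t => (ρ t : ℂ) * v' (φ t)) n := by
      rw [hs.tsum_eq, ← mul_assoc, ← Complex.ofReal_mul, mul_inv_cancel₀ two_pi_pos.ne',
        Complex.ofReal_one, one_mul]
    rw [e, enorm_mul]
    have e2 : ‖((2 * π : ℝ) : ℂ)‖ₑ = ofReal (2 * π) := by
      rw [← ofReal_norm, norm_real, norm_of_nonneg two_pi_pos.le]
    rw [e2]
    refine mul_le_mul_right (enorm_tsum_le_tsum_enorm.trans (ENNReal.tsum_le_tsum fun n => ?_)) _
    rw [h.fc_deriv hv hv' hp hp', enorm_mul, enorm_mul, enorm_mul]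
    have e3 : ‖(n : ℂ)‖ₑ = n.natAbs := by
      rw [← ofReal_norm, Complex.norm_intCast, ← Int.cast_abs, ← Int.natCast_natAbs, Int.cast_natCast,
        ofReal_natCast]
    have e4 : ‖I‖ₑ = 1 := by rw [← ofReal_norm, norm_I, ofReal_one]
    have e5 : ‖star (fc a n)‖ₑ = ‖fc a n‖ₑ := by rw [← ofReal_norm, norm_star, ofReal_norm]
    rw [e3, e4, e5, one_mul]
    exact le_of_eq (by ring)
  rw [douglas_eq_tsum ha, douglas_eq_tsum hvL]
  have e6 : ofReal (4 * π ^ 2) = ofReal (2 * π) ^ 2 := by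
    rw [← ofReal_pow two_pi_pos.le]; congr 1; ring
  calc _ ≤ ofReal (4 * π ^ 2) * (ofReal (2 * π) *
      ∑' n : ℤ, (n.natAbs : ENNReal) * (‖fc a n‖ₑ * ‖fc (fun t => v (φ t)) n‖ₑ)) ^ 2 :=
        mul_le_mul_right (pow_le_pow_left₀ zero_le h2 2) _
    _ = ofReal (4 * π ^ 2) * ofReal (4 * π ^ 2) *
      (∑' n : ℤ, (n.natAbs : ENNReal) * (‖fc a n‖ₑ * ‖fc (fun t => v (φ t)) n‖ₑ)) ^ 2 := by
        rw [e6]; ring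
    _ ≤ ofReal (4 * π ^ 2) * ofReal (4 * π ^ 2) *
      ((∑' n : ℤ, (n.natAbs : ENNReal) * ‖fc a n‖ₑ ^ 2) *
        ∑' n : ℤ, (n.natAbs : ENNReal) * ‖fc (fun t => v (φ t)) n‖ₑ ^ 2) :=
        mul_le_mul_right (tsum_natAbs_mul_sq_le _ _) _
    _ = _ := by ring

lemma sq_le_exp_add_exp_neg (x : ℝ) : x ^ 2 ≤ exp x + exp (-x) := by
  have key : ∀ y : ℝ, 0 ≤ y → y ^ 2 ≤ exp y := by
    intro y hy
    have h1 := Real.quadratic_le_exp_of_nonneg (x := y / 2) (by positivity)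
    have h2 : y ≤ exp (y / 2) := by nlinarith [sq_nonneg (y / 2 - 1)]
    have h3 : exp y = exp (y / 2) ^ 2 := by rw [← Real.exp_nat_mul]; congr 1; push_cast; ring
    rw [h3]
    exact pow_le_pow_left₀ hy h2 2
  rcases le_total 0 x with h | h
  · linarith [key x h, exp_pos (-x)]
  · have := key (-x) (by linarith)
    rw [neg_sq] at this
    linarith [exp_pos x]

lemma CircL2.tsum_lt_top {u : ℝ → ℂ} (hu : CircL2 u) (hd : douglas u < ⊤) :
    ∑' n : ℤ, (n.natAbs : ENNReal) * ‖fc u n‖ₑ ^ 2 < ⊤ := by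
  rw [douglas_eq_tsum hu] at hd
  exact ENNReal.lt_top_of_mul_ne_top_right hd.ne
    (ofReal_pos.2 (by have := pi_pos; positivity)).ne'

lemma CircL2.douglas_lt_top {u : ℝ → ℂ} (hu : CircL2 u)
    (hd : ∑' n : ℤ, (n.natAbs : ENNReal) * ‖fc u n‖ₑ ^ 2 < ⊤) : douglas u < ⊤ := by
  rw [douglas_eq_tsum hu]
  exact mul_lt_top ofReal_lt_top hd

lemma Reparam.circL2_comp_inv {ρ φ ψ : ℝ → ℝ} (h : Reparam ρ φ ψ)
    (hρ : ∫⁻ t, ‖(ρ t : ℂ)‖ₑ ^ 2 ∂circ < ⊤) {G : ℝ → ℝ} (hG : CircL2 fun t => (G t : ℂ))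
    (hd : douglas (fun t => (G t : ℂ)) < ⊤) : CircL2 fun s => (G (ψ s) : ℂ) := by
  have hGm : Measurable G := by
    have := Complex.measurable_re.comp hG.meas
    exact this
  have hpos := hG.tsum_lt_top hd
  have hneg : ∑' n : ℤ, (n.natAbs : ENNReal) * ‖fc (fun t => -(G t : ℂ)) n‖ₑ ^ 2 < ⊤ := by
    simpa only [fc_neg, enorm_neg] using hpos
  have hGn : CircL2 fun t => -(G t : ℂ) := by simpa using hG.const_mul (-1)
  have h1 := hG.lintegral_exp_sq_lt_top hpos
  have h2 := hGn.lintegral_exp_sq_lt_top hneg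
  have hρm : Measurable fun t => (ρ t : ℂ) := measurable_ofReal.comp h.meas
  have key : ∀ e : ℝ → ℂ, Measurable e → ∫⁻ t, ‖e t‖ₑ ^ 2 ∂circ < ⊤ →
      ∫⁻ t, ‖(ρ t : ℂ)‖ₑ * ‖e t‖ₑ ∂circ < ⊤ := by
    intro e hem he
    have := lintegral_mul_sq_le circ hρm.enorm.aemeasurable hem.enorm.aemeasurable
    have h3 := this.trans_lt (mul_lt_top hρ he)
    exact lt_of_not_ge fun h4 => by
      rw [top_le_iff.1 h4] at h3
      simp at h3
  refine ⟨(measurable_ofReal.comp hGm).comp h.continuous_inv.measurable, fun s => ?_, ?_⟩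
  · rw [h.add_inv]; exact hG.per (ψ s)
  · rw [h.lintegral_comp (g := fun t => ‖(G t : ℂ)‖ₑ ^ 2) (hG.meas.enorm.pow_const 2)]
    have hle : ∀ t, ofReal (ρ t) * ‖(G t : ℂ)‖ₑ ^ 2 ≤
        ‖(ρ t : ℂ)‖ₑ * ‖cexp (G t)‖ₑ + ‖(ρ t : ℂ)‖ₑ * ‖cexp (-(G t : ℂ))‖ₑ := by
      intro t
      rw [← mul_add, ← ofReal_norm (ρ t : ℂ), norm_real, norm_of_nonneg (h.pos t).le,
        ← ofReal_norm_sq, norm_real, norm_eq_abs, sq_abs]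
      refine mul_le_mul_right ?_ _
      rw [← ofReal_norm, ← ofReal_norm, ← Complex.ofReal_neg, Complex.norm_exp_ofReal,
        Complex.norm_exp_ofReal, ← ofReal_add (exp_pos _).le (exp_pos _).le]
      refine ofReal_le_ofReal ?_
      exact sq_le_exp_add_exp_neg _
    refine (lintegral_mono hle).trans_lt ?_
    have hm1 : Measurable fun t => ‖(ρ t : ℂ)‖ₑ * ‖cexp (G t)‖ₑ :=
      hρm.enorm.mul (Complex.measurable_exp.comp hG.meas).enorm
    rw [lintegral_add_left hm1]
    exact ENNReal.add_lt_top.2 ⟨key _ (Complex.measurable_exp.comp hG.meas) h1,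
      key _ (Complex.measurable_exp.comp hGn.meas) h2⟩

lemma fc_sum_exp_neg (S : Finset ℤ) (c : ℤ → ℂ) (m : ℤ) :
    fc (fun t => ∑ n ∈ S, c n * cexp (-(n * t * I))) m = if -m ∈ S then c (-m) else 0 := by
  have h1 : fc (fun t => ∑ n ∈ S, c n * cexp (-(n * t * I))) m =
      ∑ n ∈ S, c n * fc (fun t => cexp (((-n : ℤ) : ℂ) * t * I)) m := by
    simp only [← fc_const_mul]
    simp only [fc, mul_sum]
    rw [intervalIntegral.integral_finsetSum fun n _ => Continuous.intervalIntegrable (by fun_prop) _ _,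
      mul_sum]
    refine sum_congr rfl fun n _ => ?_
    congr 2
    ext t
    push_cast
    rw [neg_mul, neg_mul]
  rw [h1]
  simp only [fc_exp, mul_ite, mul_one, mul_zero]
  rw [← Finset.sum_ite_eq' S (-m) c]
  refine sum_congr rfl fun n _ => ?_
  congr 1
  rw [eq_iff_iff]
  constructor <;> rintro h <;> omega

theorem Reparam.douglas_comp_inv_le {ρ φ ψ : ℝ → ℝ} (h : Reparam ρ φ ψ)
    (hρ : ∫⁻ t, ‖(ρ t : ℂ)‖ₑ ^ 2 ∂circ < ⊤) {G : ℝ → ℝ} (hG : CircL2 fun t => (G t : ℂ))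
    (hb : CircL2 fun s => (G (ψ s) : ℂ)) {C : NNReal}
    (hC : ∀ u : ℝ → ℂ, Continuous u → (∀ s, u (s + 2 * π) = u s) →
      douglas (fun θ => u (φ θ)) ≤ C * douglas u) :
    douglas (fun s => (G (ψ s) : ℂ)) ≤ C * douglas fun t => (G t : ℂ) := by
  set a : ℤ → ℂ := fc fun s => (G (ψ s) : ℂ) with ha
  rw [douglas_eq_tsum hb, ← ENNReal.tsum_mul_left, ENNReal.tsum_eq_iSup_sum]
  refine iSup_le fun S => ?_
  rw [← mul_sum]
  set T : ENNReal := ∑ n ∈ S, (n.natAbs : ENNReal) * ‖a n‖ₑ ^ 2 with hT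
  have hTtop : T ≠ ⊤ := ENNReal.sum_ne_top.2 fun n _ =>
    mul_ne_top (ENNReal.natCast_ne_top _) (ENNReal.pow_ne_top enorm_ne_top)
  rcases eq_or_ne T 0 with hT0 | hT0
  · rw [hT0, mul_zero]; exact zero_le
  set v : ℝ → ℂ := fun s => ∑ n ∈ S, (I * n.sign * star (a n)) * cexp (-(n * s * I)) with hv
  set v' : ℝ → ℂ := fun s => ∑ n ∈ S, ((n.natAbs : ℂ) * star (a n)) * cexp (-(n * s * I)) with hv'
  have hvp : Periodic v (2 * π) := fun s => by simp only [hv, exp_neg_int_mul_add_two_pi]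
  have hvp' : Periodic v' (2 * π) := fun s => by simp only [hv', exp_neg_int_mul_add_two_pi]
  have hvc : Continuous v := by fun_prop
  have hvc' : Continuous v' := by fun_prop
  have hvd : ∀ s, HasDerivAt v (v' s) s := by
    intro s
    refine HasDerivAt.fun_sum fun n _ => ?_
    have h1 : HasDerivAt (fun t : ℝ => -((n : ℂ) * t * I)) (-(n * 1 * I)) s :=
      (((hasDerivAt_id s).ofReal_comp.const_mul (n : ℂ)).mul_const I).neg
    convert! h1.cexp.const_mul (I * n.sign * star (a n)) using 1
    have h2 : ((n.natAbs : ℕ) : ℂ) = (n.sign : ℂ) * n := by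
      rw [← Int.cast_mul, Int.sign_mul_self_eq_natAbs, Int.cast_natCast]
    rw [h2]
    linear_combination ((n.sign : ℂ) * star (a n) * n * cexp (-(n * s * I))) * Complex.I_mul_I
  have hInt : ∫ t, star (G t : ℂ) * (ρ t * v' (φ t)) ∂circ =
      2 * π * ∑ n ∈ S, (n.natAbs : ℂ) * (star (a n) * a n) := by
    have hGm : Measurable fun t => (G t : ℂ) := hG.meas
    have h1 := h.integral_comp (g := fun t => (G t : ℂ) * v' (φ t))
      (hGm.mul (hvc'.comp h.continuous).measurable)
    rw [integral_of_le two_pi_pos.le, integral_of_le two_pi_pos.le] at h1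
    have h2 : ∫ t, star (G t : ℂ) * (ρ t * v' (φ t)) ∂circ =
        ∫ t in Ioc 0 (2 * π), (ρ t : ℂ) * ((G t : ℂ) * v' (φ t)) := by
      refine integral_congr_ae (Eventually.of_forall fun t => ?_)
      have : star (G t : ℂ) = G t := conj_ofReal _
      simp only [this]
      ring
    rw [h2, ← h1]
    simp only [h.right_inv]
    rw [← integral_of_le two_pi_pos.le]
    have h3 : ∀ n : ℤ, ∫ s in (0 : ℝ)..2 * π, cexp (-(n * s * I)) * (G (ψ s) : ℂ) =
        2 * π * a n := by
      intro n
      rw [ha, fc]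
      have : (π : ℂ) ≠ 0 := by exact_mod_cast pi_ne_zero
      rw [one_div, mul_inv_cancel_left₀ (mul_ne_zero two_ne_zero this)]
    have h4 : ∀ s : ℝ, (G (ψ s) : ℂ) * v' s = ∑ n ∈ S, ((n.natAbs : ℂ) * star (a n)) *
        (cexp (-(n * s * I)) * (G (ψ s) : ℂ)) := by
      intro s
      rw [hv', mul_sum]
      exact sum_congr rfl fun n _ => by ring
    simp only [h4]
    rw [intervalIntegral.integral_finsetSum fun n _ => (hb.integrable.exp_mul_circ n).const_mul _,
      mul_sum]
    refine sum_congr rfl fun n _ => ?_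
    rw [intervalIntegral.integral_const_mul, h3]
    ring
  have hnorm : ‖∫ t, star (G t : ℂ) * (ρ t * v' (φ t)) ∂circ‖ₑ = ofReal (2 * π) * T := by
    have e : (2 * π * ∑ n ∈ S, (n.natAbs : ℂ) * (star (a n) * a n) : ℂ) =
        ((2 * π * ∑ n ∈ S, (n.natAbs : ℝ) * ‖a n‖ ^ 2 : ℝ) : ℂ) := by
      push_cast
      congr 1
      refine sum_congr rfl fun n _ => ?_
      congr 1
      rw [← Complex.ofReal_pow, ← normSq_eq_norm_sq, Complex.normSq_eq_conj_mul_self]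
      rfl
    have hnn : ∀ n ∈ S, (0 : ℝ) ≤ (n.natAbs : ℝ) * ‖a n‖ ^ 2 := fun n _ => by positivity
    rw [hInt, e, ← ofReal_norm, norm_real, norm_of_nonneg
      (mul_nonneg two_pi_pos.le (Finset.sum_nonneg hnn)), ofReal_mul two_pi_pos.le,
      ofReal_sum_of_nonneg hnn]
    congr 1
    refine sum_congr rfl fun n _ => ?_
    rw [ofReal_mul (Nat.cast_nonneg _), ofReal_natCast, ofReal_norm_sq]
  have hdv : douglas v ≤ ofReal (4 * π ^ 2) * T := by
    rw [douglas_eq_tsum (CircL2.of_continuous hvc hvp)]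
    refine mul_le_mul_right ?_ _
    simp only [hv, fc_sum_exp_neg]
    rw [← (Equiv.neg ℤ).tsum_eq, tsum_eq_sum (s := S)]
    · refine sum_le_sum fun n hn => ?_
      simp only [Equiv.neg_apply, neg_neg, hn, if_true, Int.natAbs_neg]
      refine mul_le_mul_right (pow_le_pow_left₀ zero_le ?_ 2) _
      rw [← ofReal_norm, ← ofReal_norm]
      refine ofReal_le_ofReal ?_
      rw [norm_mul, norm_mul, norm_I, norm_star, one_mul, Complex.norm_intCast]
      refine mul_le_of_le_one_left (norm_nonneg _) ?_
      rcases lt_trichotomy n 0 with h | h | h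
      · rw [Int.sign_eq_neg_one_of_neg h]; simp
      · rw [h]; simp
      · rw [Int.sign_eq_one_of_pos h]; simp
    · intro n hn
      simp [hn]
  have hmain := h.enorm_integral_sq_le hρ hG hvd hvc' hvp hvp'
  rw [hnorm] at hmain
  have h1 := hmain.trans (mul_le_mul_right ((hC v hvc hvp).trans (mul_le_mul_right hdv _)) _)
  have e6 : ofReal (4 * π ^ 2) = ofReal (2 * π) ^ 2 := by
    rw [← ofReal_pow two_pi_pos.le]; congr 1; ring
  have hK0 : ofReal (4 * π ^ 2) * T ≠ 0 :=
    mul_ne_zero (ofReal_pos.2 (by have := pi_pos; positivity)).ne' hT0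
  have hKt : ofReal (4 * π ^ 2) * T ≠ ⊤ := mul_ne_top ofReal_ne_top hTtop
  refine (ENNReal.mul_le_mul_iff_right hK0 hKt).1 ?_
  calc _ = ofReal (4 * π ^ 2) * (ofReal (2 * π) * T) ^ 2 := by rw [e6]; ring
    _ ≤ _ := h1
    _ = _ := by ring

lemma CircL2.douglas_add_lt_top {u v : ℝ → ℂ} (hu : CircL2 u) (hv : CircL2 v)
    (hdu : douglas u < ⊤) (hdv : douglas v < ⊤) : douglas (fun t => u t + v t) < ⊤ := by
  refine (hu.add hv).douglas_lt_top ?_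
  have hle : ∀ n : ℤ, (n.natAbs : ENNReal) * ‖fc (fun t => u t + v t) n‖ₑ ^ 2 ≤
      2 * ((n.natAbs : ENNReal) * ‖fc u n‖ₑ ^ 2) + 2 * ((n.natAbs : ENNReal) * ‖fc v n‖ₑ ^ 2) := by
    intro n
    rw [fc_add hu.integrable hv.integrable]
    have h1 : ‖fc u n + fc v n‖ₑ ^ 2 ≤ 2 * ‖fc u n‖ₑ ^ 2 + 2 * ‖fc v n‖ₑ ^ 2 := by
      simp only [← ofReal_norm_sq]
      rw [show (2 : ENNReal) = ofReal 2 by simp, ← ofReal_mul two_pos.le,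
        ← ofReal_mul two_pos.le, ← ofReal_add (by positivity) (by positivity)]
      refine ofReal_le_ofReal ?_
      have h2 := norm_add_le (fc u n) (fc v n)
      nlinarith [sq_nonneg (‖fc u n‖ - ‖fc v n‖), norm_nonneg (fc u n + fc v n)]
    calc _ ≤ (n.natAbs : ENNReal) * (2 * ‖fc u n‖ₑ ^ 2 + 2 * ‖fc v n‖ₑ ^ 2) := mul_le_mul_right h1 _
      _ = _ := by ring
  refine (ENNReal.tsum_le_tsum hle).trans_lt ?_
  rw [ENNReal.tsum_add, ENNReal.tsum_mul_left, ENNReal.tsum_mul_left]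
  exact ENNReal.add_lt_top.2 ⟨mul_lt_top (by simp) (hu.tsum_lt_top hdu),
    mul_lt_top (by simp) (hv.tsum_lt_top hdv)⟩

lemma exists_forall_abs_sub_le {φ : ℝ → ℝ} (hφ : Continuous φ)
    (hadd : ∀ t, φ (t + 2 * π) = φ t + 2 * π) {ε : ℝ} (hε : 0 < ε) :
    ∃ δ > 0, ∀ x y, |x - y| ≤ δ → |φ x - φ y| ≤ ε := by
  have hτp : Periodic (fun t => φ t - t) (2 * π) := fun t => by
    simp only [hadd]; ring
  have hu := (isCompact_Icc (a := (-1 : ℝ)) (b := 2 * π + 1)).uniformContinuousOn_of_continuous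
    hφ.continuousOn
  rw [Metric.uniformContinuousOn_iff] at hu
  obtain ⟨δ, hδ, H⟩ := hu ε hε
  refine ⟨min (δ / 2) 1, by positivity, fun x y hxy => ?_⟩
  obtain ⟨k, hk⟩ := exists_int_add_mem_Ico 0 x
  rw [zero_add] at hk
  have h1 := hxy.trans (min_le_left _ _)
  have h2 := abs_le.1 (hxy.trans (min_le_right _ _))
  have h3 := H (x + k * (2 * π)) ⟨by linarith [hk.1], by linarith [hk.2]⟩ (y + k * (2 * π))
    ⟨by linarith [hk.1, h2.2], by linarith [hk.2, h2.1]⟩ (by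
      rw [Real.dist_eq, add_sub_add_right_eq_sub]; linarith)
  have hx := hτp.int_mul k x
  have hy := hτp.int_mul k y
  rw [Real.dist_eq] at h3
  rw [show φ x - φ y = φ (x + k * (2 * π)) - φ (y + k * (2 * π)) by linarith]
  exact h3.le

lemma exists_sq_sub_le {φ : ℝ → ℝ} (hφ : Continuous φ)
    (hadd : ∀ t, φ (t + 2 * π) = φ t + 2 * π) : ∃ C, 0 ≤ C ∧ ∀ x y : ℝ,
      ((φ x - x) - (φ y - y)) ^ 2 ≤ C * (‖cis x - cis y‖ ^ 2 +
          ‖cexp (φ x * I) - cexp (φ y * I)‖ ^ 2) := by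
  have hpi := pi_pos
  have hτp : Periodic (fun t => φ t - t) (2 * π) := fun t => by
    simp only [hadd]; ring
  obtain ⟨M, hM0, hM⟩ := exists_bound_of_periodic (f := fun t => ((φ t - t : ℝ) : ℂ))
    (by fun_prop) (fun t => by simp only [hadd]; congr 1; ring)
  simp only [norm_real, norm_eq_abs] at hM
  obtain ⟨δ, hδ, H⟩ := exists_forall_abs_sub_le hφ hadd pi_pos
  refine ⟨π ^ 2 / 2 + M ^ 2 * π ^ 2 / δ ^ 2, by positivity, fun x y => ?_⟩
  obtain ⟨k, hk⟩ := exists_int_abs_sub_le_pi x y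
  have hy := hτp.int_mul k y
  have e1 := exp_add_int_mul_two_pi y k
  have e2 := exp_add_int_mul_two_pi (φ y) k
  rw [show φ y + k * (2 * π) = φ (y + k * (2 * π)) by linarith] at e2
  rw [← e1, ← e2, ← hy]
  generalize y + k * (2 * π) = y' at hk
  have h1 := le_norm_exp_sub_exp hk
  set c1 := ‖cis x - cis y'‖
  set c2 := ‖cexp (φ x * I) - cexp (φ y' * I)‖ with hc2
  have hc10 : 0 ≤ c1 := norm_nonneg _
  have hc20 : 0 ≤ c2 := norm_nonneg _
  by_cases hd : |x - y'| ≤ δ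
  · have h2 := le_norm_exp_sub_exp (H x y' hd)
    rw [← hc2] at h2
    have h3 : |(φ x - x) - (φ y' - y')| ≤ π / 2 * (c1 + c2) := by
      have h4 : |(φ x - x) - (φ y' - y')| ≤ |φ x - φ y'| + |x - y'| := by
        rw [show (φ x - x) - (φ y' - y') = (φ x - φ y') - (x - y') by ring]
        exact abs_sub _ _
      have h5 : |φ x - φ y'| + |x - y'| = π / 2 * (2 / π * |x - y'| + 2 / π * |φ x - φ y'|) := by
        field_simp; ring
      rw [h5] at h4
      exact h4.trans (mul_le_mul_of_nonneg_left (add_le_add h1 h2) (by positivity))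
    rw [← sq_abs]
    calc _ ≤ (π / 2 * (c1 + c2)) ^ 2 := pow_le_pow_left₀ (abs_nonneg _) h3 2
      _ ≤ π ^ 2 / 2 * (c1 ^ 2 + c2 ^ 2) := by
        rw [mul_pow]
        nlinarith [mul_nonneg (sq_nonneg π) (sq_nonneg (c1 - c2))]
      _ ≤ _ := mul_le_mul_of_nonneg_right (le_add_of_nonneg_right (by positivity)) (by positivity)
  · push Not at hd
    have h3 : |(φ x - x) - (φ y' - y')| ≤ 2 * M := (abs_sub _ _).trans (by linarith [hM x, hM y'])
    have h4 : 2 * δ ≤ π * c1 := by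
      have : 2 / π * δ ≤ c1 := (mul_le_mul_of_nonneg_left hd.le (by positivity)).trans h1
      rw [div_mul_eq_mul_div, div_le_iff₀ hpi] at this
      linarith
    rw [← sq_abs]
    have h5 : (2 * δ) ^ 2 ≤ (π * c1) ^ 2 := pow_le_pow_left₀ (by positivity) h4 2
    calc _ ≤ (2 * M) ^ 2 := pow_le_pow_left₀ (abs_nonneg _) h3 2
      _ = M ^ 2 / δ ^ 2 * (2 * δ) ^ 2 := by field_simp
      _ ≤ M ^ 2 / δ ^ 2 * (π * c1) ^ 2 := mul_le_mul_of_nonneg_left h5 (by positivity)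
      _ = M ^ 2 * π ^ 2 / δ ^ 2 * c1 ^ 2 := by ring
      _ ≤ _ := mul_le_mul (le_add_of_nonneg_left (by positivity))
        (le_add_of_nonneg_right (sq_nonneg _)) (sq_nonneg _) (by positivity)

lemma douglas_exp_lt_top : douglas (fun s => cis s) < ⊤ := by
  have hle : douglas (fun s => cis s) ≤ ∫⁻ _, ∫⁻ _, 1 ∂circ ∂circ := by
    refine lintegral_mono fun x => lintegral_mono fun y => ?_
    rw [← ofReal_one]
    exact ofReal_le_ofReal (div_self_le_one _)
  refine hle.trans_lt ?_
  rw [lintegral_const, lintegral_const, circ_univ]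
  exact mul_lt_top (mul_lt_top (by simp) ofReal_lt_top)
    ofReal_lt_top

theorem douglas_sub_id_lt_top {φ : ℝ → ℝ} (hφ : Continuous φ)
    (hadd : ∀ t, φ (t + 2 * π) = φ t + 2 * π) {C : NNReal}
    (hC : ∀ u : ℝ → ℂ, Continuous u → (∀ s, u (s + 2 * π) = u s) →
      douglas (fun θ => u (φ θ)) ≤ C * douglas u) :
    douglas (fun θ => ((φ θ - θ : ℝ) : ℂ)) < ⊤ := by
  have h1 : douglas (fun θ => cexp (φ θ * I)) < ⊤ :=
    (hC (fun s => cis s) (by fun_prop) exp_add_two_pi_mul_I).trans_lt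
      (mul_lt_top ENNReal.coe_lt_top douglas_exp_lt_top)
  obtain ⟨D, hD0, hD⟩ := exists_sq_sub_le hφ hadd
  have hle : ∀ x y : ℝ, ofReal (‖((φ x - x : ℝ) : ℂ) - ((φ y - y : ℝ) : ℂ)‖ ^ 2 /
      ‖cis x - cis y‖ ^ 2) ≤ ofReal D * 1 + ofReal D *
        douglasKernel (fun θ => cexp (φ θ * I)) x y := by
    intro x y
    rw [douglasKernel, mul_one, ← ofReal_mul hD0, ← ofReal_add hD0 (by positivity),
      ← Complex.ofReal_sub, norm_real, norm_eq_abs, sq_abs]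
    refine ofReal_le_ofReal ?_
    have h2 := hD x y
    rcases eq_or_ne (‖cis x - cis y‖ ^ 2) 0 with h | h
    · rw [h, div_zero, div_zero, mul_zero, add_zero]; exact hD0
    · have h0 := lt_of_le_of_ne (sq_nonneg _) h.symm
      rw [div_le_iff₀ h0, add_mul, mul_assoc, div_mul_cancel₀ _ h]
      linarith
  have hm : Measurable fun θ : ℝ => cexp (φ θ * I) := by fun_prop
  have hk := measurable_douglasKernel hm
  refine (lintegral_mono fun x => lintegral_mono fun y => hle x y).trans_lt ?_
  have h3 : ∀ x, ∫⁻ y, (ofReal D * 1 + ofReal D *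
        douglasKernel (fun θ => cexp (φ θ * I)) x y) ∂circ = ofReal D * ofReal (2 * π) + ofReal D *
        ∫⁻ y, douglasKernel (fun θ => cexp (φ θ * I)) x y ∂circ := by
    intro x
    rw [lintegral_add_left measurable_const, lintegral_const, circ_univ, mul_one,
      lintegral_const_mul' _ _ ofReal_ne_top]
  simp only [h3]
  rw [lintegral_add_left measurable_const, lintegral_const, circ_univ,
    lintegral_const_mul' _ _ ofReal_ne_top]
  exact ENNReal.add_lt_top.2 ⟨mul_lt_top (mul_lt_top ofReal_lt_top
    ofReal_lt_top) ofReal_lt_top, mul_lt_top ofReal_lt_top h1⟩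

lemma tendsto_radial {E F : ℂ → ℂ} (hE : ContinuousOn E (closedBall 0 1))
    (hEF : EqOn E F 𝔻) (θ : ℝ) : Tendsto (fun r : ℝ => F (r * cis θ))
      (𝓝[<] 1) (nhds (E (cis θ))) := by
  have hmem : cis θ ∈ closedBall (0 : ℂ) 1 := by
    rw [mem_closedBall_zero_iff, norm_exp_ofReal_mul_I]
  have h1 : Tendsto (fun r : ℝ => (r : ℂ) * cis θ)
      (𝓝[<] 1) (nhdsWithin (cis θ) (closedBall 0 1)) := by
    refine tendsto_nhdsWithin_iff.2 ⟨?_, ?_⟩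
    · have : Continuous fun r : ℝ => (r : ℂ) * cis θ := by fun_prop
      have h2 := this.tendsto 1
      rw [Complex.ofReal_one, one_mul] at h2
      exact h2.mono_left nhdsWithin_le_nhds
    · filter_upwards [eventually_mem_Ico_one] with r hr
      exact ball_subset_closedBall (circle_mem_ball hr.1 hr.2 θ)
  refine ((hE _ hmem).tendsto.comp h1).congr' ?_
  filter_upwards [eventually_mem_Ico_one] with r hr
  exact hEF (circle_mem_ball hr.1 hr.2 θ)

lemma circleIntegral_deriv_div_sub {F : ℂ → ℂ} (hF : DifferentiableOn ℂ F 𝔻)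
    (hinj : InjOn F 𝔻) {z₀ : ℂ} {r : ℝ} (hr : ‖z₀‖ < r) (hr1 : r < 1) :
    (∮ z in C(0, r), deriv F z / (F z - F z₀)) = 2 * π * I := by
  have hr0 : 0 < r := (norm_nonneg _).trans_lt hr
  have hz₀ : z₀ ∈ 𝔻 := mem_ball_zero_iff.2 (hr.trans hr1)
  have hsub : closedBall (0 : ℂ) r ⊆ 𝔻 := closedBall_subset_ball hr1
  set P := dslope F z₀ with hP
  have hPd : DifferentiableOn ℂ P 𝔻 :=
    (Complex.differentiableOn_dslope (isOpen_ball.mem_nhds hz₀)).2 hF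
  have hP0 : ∀ z ∈ 𝔻, P z ≠ 0 := by
    intro z hz
    by_cases h : z = z₀
    · rw [hP, h, dslope_same]; exact deriv_ne_zero_of_conformal hF hinj hz₀
    · rw [hP, dslope_of_ne _ h, slope_def_field]
      exact div_ne_zero (sub_ne_zero.2 fun he => h (hinj hz hz₀ he)) (sub_ne_zero.2 h)
  have hfac : ∀ z, F z - F z₀ = (z - z₀) * P z := fun z => by
    rw [hP, ← smul_eq_mul, sub_smul_dslope]
  have hdF : ∀ z ∈ 𝔻, deriv F z = P z + (z - z₀) * deriv P z := by
    intro z hz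
    have h1 : F = fun z => F z₀ + (z - z₀) * P z := by
      ext z; rw [← hfac]; ring
    have h2 := (hPd.differentiableAt (isOpen_ball.mem_nhds hz)).hasDerivAt
    have h3 : HasDerivAt (fun z => F z₀ + (z - z₀) * P z) (1 * P z + (z - z₀) * deriv P z) z :=
      (((hasDerivAt_id z).sub_const z₀).mul h2).const_add _
    rw [h1, h3.deriv, one_mul]
  have hcl : DifferentiableOn ℂ (fun z => deriv P z / P z) 𝔻 := (hPd.deriv isOpen_ball).div hPd hP0
  have hne : ∀ z ∈ sphere (0 : ℂ) r, z - z₀ ≠ 0 := by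
    intro z hz h
    rw [mem_sphere_zero_iff_norm, sub_eq_zero.1 h] at hz
    exact hr.ne hz
  have h1 : (∮ z in C(0, r), deriv F z / (F z - F z₀)) =
      ∮ z in C(0, r), ((z - z₀)⁻¹ + deriv P z / P z) := by
    refine circleIntegral.integral_congr hr0.le fun z hz => ?_
    have hzb := hsub (sphere_subset_closedBall hz)
    have := hne z hz
    have := hP0 z hzb
    change deriv F z / (F z - F z₀) = _
    rw [hfac, hdF z hzb]
    field_simp
  have hi1 : CircleIntegrable (fun z => (z - z₀)⁻¹) 0 r := by
    refine ContinuousOn.circleIntegrable hr0.le (ContinuousOn.inv₀ (by fun_prop) hne)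
  have hi2 : CircleIntegrable (fun z => deriv P z / P z) 0 r := ContinuousOn.circleIntegrable hr0.le
      (hcl.continuousOn.mono (sphere_subset_closedBall.trans hsub))
  rw [h1, circleIntegral.integral_add hi1 hi2,
    circleIntegral.integral_sub_inv_of_mem_ball (mem_ball_zero_iff.2 hr),
    Complex.circleIntegral_eq_zero_of_differentiable_on_off_countable hr0.le countable_empty
      (hcl.continuousOn.mono hsub) fun z hz => hcl.differentiableAt
        (isOpen_ball.mem_nhds (hsub (ball_subset_closedBall hz.1))), add_zero]

theorem IsBdryOne.integral_div_sub {E F : ℂ → ℂ} (hF : DifferentiableOn ℂ F 𝔻)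
    (hinj : InjOn F 𝔻) (hE : ContinuousOn E (closedBall 0 1))
    (hEF : EqOn E F 𝔻) {v : ℝ → ℂ} (hv : IsBdryOne (deriv F) v) {z₀ : ℂ}
    (hz₀ : z₀ ∈ 𝔻) (hne : ∀ θ : ℝ, E (cis θ) ≠ F z₀) : ∫ t in (0 : ℝ)..2 * π, I * cis t /
      (E (cis t) - F z₀) * v t = 2 * π * I := by
  have hz1 : ‖z₀‖ < 1 := mem_ball_zero_iff.1 hz₀
  set r₀ := (1 + ‖z₀‖) / 2 with hr₀
  have hr₀0 : ‖z₀‖ < r₀ := by rw [hr₀]; linarith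
  have hr₀1 : r₀ < 1 := by rw [hr₀]; linarith
  have hr₀p : 0 < r₀ := (norm_nonneg _).trans_lt hr₀0
  have hK : IsCompact (closedBall (0 : ℂ) 1 \ ball 0 r₀) :=
    (isCompact_closedBall 0 1).diff isOpen_ball
  obtain ⟨ε, hε, hεK⟩ : ∃ ε > 0, ∀ z ∈ closedBall (0 : ℂ) 1 \ ball 0 r₀, ε ≤ ‖E z - F z₀‖ := by
    obtain ⟨x, hx, hmin⟩ := hK.exists_isMinOn (f := fun z => ‖E z - F z₀‖)
      ⟨1, by simp, by simpa using hr₀1.le⟩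
      ((hE.mono sdiff_subset).sub continuousOn_const).norm
    refine ⟨_, norm_pos_iff.2 (sub_ne_zero.2 ?_), fun z hz => hmin hz⟩
    rcases (mem_closedBall_zero_iff.1 hx.1).eq_or_lt with h | h
    · have := hne x.arg
      have h2 := norm_mul_exp_arg_mul_I x
      rw [h, Complex.ofReal_one, one_mul] at h2
      rwa [h2] at this
    · have hxb : x ∈ 𝔻 := mem_ball_zero_iff.2 h
      rw [hEF hxb]
      intro he
      have h2 := hinj hxb hz₀ he
      exact hx.2 (mem_ball_zero_iff.2 (h2 ▸ hr₀0))
  have hev : ∀ᶠ r in nhdsWithin (1 : ℝ) (Iio 1), r₀ ≤ r ∧ r < 1 := by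
    filter_upwards [Ico_mem_nhdsLT hr₀1] with r hr using hr
  have hlow : ∀ r : ℝ, r₀ ≤ r → r < 1 → ∀ t : ℝ, ε ≤ ‖F (r * cis t) - F z₀‖ := by
    intro r h1 h2 t
    have hb := circle_mem_ball (hr₀p.le.trans h1) h2 t
    rw [← hEF hb]
    refine hεK _ ⟨ball_subset_closedBall hb, fun h3 => ?_⟩
    rw [mem_ball_zero_iff, norm_mul, norm_exp_ofReal_mul_I, mul_one, norm_real,
      norm_of_nonneg (hr₀p.le.trans h1)] at h3
    linarith
  have h1 := hv.tendsto_integral_mul two_pi_pos.le (M := 1 / ε)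
    (h := fun r t => r * (I * cis t) / (F (r * cis t) - F z₀))
    (h₁ := fun t => I * cis t / (E (cis t) - F z₀)) ?_ ?_ ?_
  · refine tendsto_nhds_unique h1 (tendsto_const_nhds.congr' ?_)
    filter_upwards [hev] with r hr
    rw [← circleIntegral_deriv_div_sub hF hinj (hr₀0.trans_le hr.1) hr.2, circleIntegral]
    refine integral_congr fun t _ => ?_
    simp only [deriv_circleMap, circleMap, zero_add, smul_eq_mul]
    ring
  · filter_upwards [hev] with r hr
    have hc : Continuous fun t : ℝ => F (r * cis t) :=
      hF.continuousOn.comp_continuous (by fun_prop) (circle_mem_ball (hr₀p.le.trans hr.1) hr.2)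
    refine Continuous.div (by fun_prop) (hc.sub continuous_const) fun t h => ?_
    have := hlow r hr.1 hr.2 t
    rw [h, norm_zero] at this
    linarith
  · filter_upwards [hev] with r hr t
    rw [norm_div, norm_mul, norm_mul, norm_I, norm_exp_ofReal_mul_I, mul_one, mul_one,
      norm_real, norm_of_nonneg (hr₀p.le.trans hr.1)]
    exact div_le_div₀ zero_le_one hr.2.le hε (hlow r hr.1 hr.2 t)
  · intro t
    have hr : Tendsto (fun r : ℝ => (r : ℂ) * (I * cis t))
        (𝓝[<] 1) (nhds (I * cis t)) := by
      have : Continuous fun r : ℝ => (r : ℂ) * (I * cis t) := by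
        fun_prop
      have h2 := this.tendsto 1
      rw [Complex.ofReal_one, one_mul] at h2
      exact h2.mono_left nhdsWithin_le_nhds
    exact hr.div ((tendsto_radial hE hEF t).sub_const _) (sub_ne_zero.2 (hne t))

lemma exists_arclength_reparam {F : ℂ → ℂ} (hF : DifferentiableOn ℂ F 𝔻) {u : ℝ → ℂ} (hu : CircL2 u)
    (hv : IsBdryOne (deriv F) fun t => cexp (u t)) {B : ℝ → ℂ}
    (hB : ∀ θ : ℝ, Tendsto (fun r : ℝ => F (r * cis θ))
      (𝓝[<] 1) (nhds (B θ))) :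
    ∃ l : ℝ, 0 < l ∧ ∃ φ ψ : ℝ → ℝ, Reparam (fun t => ‖cexp (u t)‖ / l) φ ψ ∧
      LipschitzWith l.toNNReal (fun s => B (ψ s)) ∧
      ∀ᵐ s : ℝ, HasDerivAt (fun s => B (ψ s)) (l * I * cis s *
        cexp ((((u (ψ s)).im + (ψ s - s) : ℝ) : ℂ) * I)) s := by
  set ω : ℝ → ℝ := fun t => ‖cexp (u t)‖ with hω
  have hωi : ∀ x y, IntervalIntegrable ω volume x y := fun x y => (hv.intervalIntegrable x y).norm
  have hω0 : ∀ t, 0 < ω t := fun t => norm_pos_iff.2 (Complex.exp_ne_zero _)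
  have hL : 0 < ∫ t in (0 : ℝ)..2 * π, ω t := intervalIntegral_pos_of_pos (hωi _ _) hω0 two_pi_pos
  set l := (∫ t in (0 : ℝ)..2 * π, ω t) / (2 * π) with hl
  have hl0 : 0 < l := div_pos hL two_pi_pos
  obtain ⟨φ, ψ, h⟩ := exists_reparam (ρ := fun t => ω t / l) (hv.meas.norm.div_const l)
    (fun t => div_pos (hω0 t) hl0)
    (fun t => by simp only [hω]; rw [hu.per t]) (fun x y => (hωi x y).div_const l) (by
      rw [intervalIntegral.integral_div, hl]; field_simp)
  have hInt : ∀ x y, ∫ t in x..y, ω t = l * (φ y - φ x) := fun x y => by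
    rw [h.sub, intervalIntegral.integral_div]; field_simp
  have hsub : ∀ x y, x ≤ y → ‖B y - B x‖ ≤ l * (φ y - φ x) := fun x y hxy => by
    rw [hv.sub_eq_integral hF hB hxy, ← hInt]
    refine norm_integral_le_of_norm_le hxy (.of_forall fun t _ => ?_) (hωi x y)
    simp [hω, norm_exp_ofReal_mul_I]
  refine ⟨l, hl0, φ, ψ, h, LipschitzWith.of_dist_le_mul fun s t => ?_, ?_⟩
  · rw [coe_toNNReal _ hl0.le]
    wlog hst : t ≤ s generalizing s t
    · rw [dist_comm, dist_comm s]; exact this t s (not_le.1 hst).le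
    have := hsub (ψ t) (ψ s) (h.strictMono_inv.monotone hst)
    rwa [h.right_inv, h.right_inv, ← dist_eq_norm, ← abs_of_nonneg (sub_nonneg.2 hst),
      ← Real.dist_eq] at this
  · have hvi : ∀ x y, IntervalIntegrable
        (fun t : ℝ => I * cis t * cexp (u t)) volume x y :=
      fun x y => (hv.intervalIntegrable x y).continuousOn_mul (by fun_prop)
    have hBd : ∀ᵐ t : ℝ, HasDerivAt B
        (I * cis t * cexp (u t)) t := by
      filter_upwards [ae_hasDerivAt_integral_of_intervalIntegrable hvi] with t ht
      refine ((ht (t - 1)).const_add (B (t - 1))).congr_of_eventuallyEq ?_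
      filter_upwards [lt_mem_nhds (sub_one_lt t)] with x hx
      rw [← hv.sub_eq_integral hF hB hx.le]; ring
    filter_upwards [h.ae_comp hBd, h.ae_comp h.ae_hasDerivAt] with s hs1 hs2
    have hψ : HasDerivAt ψ (ω (ψ s) / l)⁻¹ s :=
      hs2.of_local_left_inverse h.continuous_inv.continuousAt (h.pos _).ne'
        (.of_forall h.right_inv)
    refine (hs1.scomp s hψ).congr_deriv ?_
    have e1 : cexp (u (ψ s)) = ω (ψ s) * cexp ((u (ψ s)).im * I) := by
      rw [hω]; simp only [norm_exp, Complex.ofReal_exp]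
      rw [← Complex.exp_add, Complex.re_add_im]
    have e2 : cis s * cexp ((((u (ψ s)).im + (ψ s - s) : ℝ) : ℂ) * I) =
        cexp (ψ s * I) * cexp ((u (ψ s)).im * I) := by
      rw [← Complex.exp_add, ← Complex.exp_add]; congr 1; push_cast; ring
    rw [mul_assoc ((l : ℂ) * I), e2, e1, real_smul]
    have := Complex.ofReal_ne_zero.2 (hω0 (ψ s)).ne'
    push_cast
    field_simp

lemma sobolevSeminorm_half (u : ℝ → ℂ) : sobolevSeminorm (1 / 2) u = douglas u := by
  unfold sobolevSeminorm douglas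
  norm_num

lemma CircL2.im {u : ℝ → ℂ} (hu : CircL2 u) : CircL2 fun t => ((u t).im : ℂ) where
  meas := measurable_ofReal.comp (Complex.measurable_im.comp hu.meas)
  per t := by simp only [hu.per t]
  fin := (lintegral_mono fun t => by
    gcongr
    rw [enorm_le_iff_norm_le, norm_real]
    exact Complex.abs_im_le_norm _).trans_lt hu.fin

lemma douglas_mono {u v : ℝ → ℂ} (h : ∀ x y, ‖u x - u y‖ ≤ ‖v x - v y‖) : douglas u ≤ douglas v :=
  lintegral_mono fun x => lintegral_mono fun y => by
    gcongr
    exact h x y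

theorem exists_arclength_of_lintegral_lt_top {F : ℂ → ℂ} (hF : DifferentiableOn ℂ F 𝔻)
    (hinj : InjOn F 𝔻) (hbd : IsBounded (F '' 𝔻)) {E : ℂ → ℂ}
    (hE : ContinuousOn E (closedBall 0 1)) (hEF : EqOn E F 𝔻)
    (hEi : InjOn (fun θ : ℝ => E (cis θ)) (Ico 0 (2 * π)))
    (hdis : ∀ θ : ℝ, E (cis θ) ∉ F '' 𝔻)
    (hfin : ∫⁻ z in 𝔻, ofReal (‖deriv (deriv F) z / deriv F z‖ ^ 2) < ⊤) :
    ∃ l : ℝ, 0 < l ∧ ∃ w : ℝ → ℂ, ∃ b : ℝ → ℝ, LipschitzWith l.toNNReal w ∧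
      (∀ θ, w (θ + 2 * π) = w θ) ∧ InjOn w (Ico 0 (2 * π)) ∧
      range w = range (fun θ : ℝ => E (cis θ)) ∧ Measurable b ∧ (∀ θ, b (θ + 2 * π) = b θ) ∧
      (∀ᵐ θ : ℝ, HasDerivAt w (l * I * cis θ * cexp ((b θ : ℂ) * I)) θ) ∧
      (∀ z ∈ F '' 𝔻, ∫ θ in (0 : ℝ)..(2 * π), (l * I * cis θ *
          cexp ((b θ : ℂ) * I)) / (w θ - z) = 2 * (π : ℂ) * I) ∧
      douglas (fun θ => (b θ : ℂ)) < ⊤ := by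
  have hF' : DifferentiableOn ℂ (deriv F) 𝔻 := hF.deriv isOpen_ball
  obtain ⟨g, hg, hexp⟩ := exists_log_of_ne_zero hF' fun z hz => deriv_ne_zero_of_conformal hF hinj hz
  obtain ⟨u, hu, hs, -, hbe⟩ := exists_isBdry_of_lintegral_deriv
    (fun z hz => (hg z hz).differentiableAt.differentiableWithinAt) (by
      refine (setLIntegral_congr_fun measurableSet_ball fun z hz => ?_).trans_lt hfin
      rw [(hg z hz).deriv, ofReal_norm_sq])
  have hv : IsBdryOne (deriv F) fun t => cexp (u t) :=
    hbe.one.congr_left fun z hz => (hexp z hz).symm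
  have hd := hu.douglas_lt_top hs
  set B : ℝ → ℂ := fun θ => E (cis θ) with hBdef
  have hB := tendsto_radial hE hEF
  have hBp : ∀ θ, B (θ + 2 * π) = B θ := fun θ => by simp only [B, exp_add_two_pi_mul_I]
  have hBc : Continuous B := hE.comp_continuous (by fun_prop) fun θ => by
    rw [mem_closedBall_zero_iff, norm_exp_ofReal_mul_I]
  obtain ⟨l, hl, φ, ψ, h, hlip, hder⟩ := exists_arclength_reparam hF hu hv hB
  have hwp : ∀ s, B (ψ (s + 2 * π)) = B (ψ s) := fun s => by rw [h.add_inv, hBp]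
  have hwi : InjOn (fun s => B (ψ s)) (Ico 0 (2 * π)) := by
    have hmaps : ∀ s ∈ Ico 0 (2 * π), ψ s ∈ Ico 0 (2 * π) := fun s hs =>
      ⟨h.zero_inv ▸ h.strictMono_inv.monotone hs.1, by
        have := h.strictMono_inv hs.2; rwa [h.two_pi_inv] at this⟩
    exact fun s hs t ht hst => h.strictMono_inv.injective (hEi (hmaps s hs) (hmaps t ht) hst)
  obtain ⟨δ, hδ, hloc⟩ := hv.exists_local_chordArc hF hu hd hB
  obtain ⟨δ', hδ', hψ⟩ := exists_forall_abs_sub_le h.continuous_inv h.add_inv hδ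
  obtain ⟨c, hc, hca⟩ := exists_chordArc_of_local hlip.continuous hwp hwi (half_pos hl) hδ'
    fun s t hst hts => by
      have h1 := hloc (ψ s) (ψ t) (h.strictMono_inv.monotone hst) (by
        have := (abs_le.1 (hψ t s (by rw [abs_le]; constructor <;> linarith))).2
        linarith)
      have h2 := h.sub (ψ s) (ψ t)
      rw [h.right_inv, h.right_inv, intervalIntegral.integral_div, eq_div_iff hl.ne'] at h2
      refine le_trans (le_of_eq ?_) h1
      rw [← h2]; ring
  obtain ⟨C, hC⟩ := exists_douglas_comp_le hF hinj hbd hlip hwp (fun s => hdis (ψ s)) hc hca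
    h.continuous (.inl h.add) (fun θ => by simpa only [h.left_inv] using hB θ)
  have hρ : ∫⁻ t, ‖((‖cexp (u t)‖ / l : ℝ) : ℂ)‖ₑ ^ 2 ∂circ < ⊤ := by
    have h1 : ∀ t, ‖((‖cexp (u t)‖ / l : ℝ) : ℂ)‖ₑ ^ 2 =
        ‖(l : ℂ)⁻¹‖ₑ ^ 2 * ‖cexp (u t)‖ₑ ^ 2 := fun t => by
      rw [← mul_pow, ← enorm_mul, ← enorm_norm]
      congr 1
      rw [← enorm_norm (_ * _)]
      congr 1
      rw [norm_real, norm_mul, norm_inv, norm_real, norm_div, norm_norm]; ring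
    simp_rw [h1]
    rw [lintegral_const_mul' _ _ (by finiteness)]
    exact mul_lt_top (by finiteness) (hu.lintegral_exp_sq_lt_top hs)
  have hφc := h.continuous
  have hGid : CircL2 fun t => ((t - φ t : ℝ) : ℂ) := .of_continuous (by fun_prop) fun t => by
    simp only [h.add]; push_cast; ring
  set G : ℝ → ℝ := fun t => (u t).im + (t - φ t) with hGdef
  have hGe : (fun t => (G t : ℂ)) = fun t => ((u t).im : ℂ) + ((t - φ t : ℝ) : ℂ) := by
    funext t; simp only [G]; push_cast; ring
  have hG : CircL2 fun t => (G t : ℂ) := hGe ▸ hu.im.add hGid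
  have hGd : douglas (fun t => (G t : ℂ)) < ⊤ := by
    rw [hGe]
    refine hu.im.douglas_add_lt_top hGid ((douglas_mono fun x y => ?_).trans_lt hd)
      ((douglas_mono fun x y => ?_).trans_lt (douglas_sub_id_lt_top hφc h.add hC))
    · rw [← Complex.ofReal_sub, ← Complex.sub_im, norm_real]
      exact Complex.abs_im_le_norm _
    · rw [← norm_neg]
      refine le_of_eq (congr_arg _ ?_)
      push_cast; ring
  have hb := h.circL2_comp_inv hρ hG hGd
  have hGψ : ∀ s, (u (ψ s)).im + (ψ s - s) = G (ψ s) := fun s => by simp only [G, h.right_inv]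
  refine ⟨l, hl, fun s => B (ψ s), fun s => G (ψ s), hlip, hwp, hwi,
    Surjective.range_comp (fun t => ⟨φ t, h.left_inv t⟩) B, ?_, ?_, ?_, ?_,
    (h.douglas_comp_inv_le hρ hG hb hC).trans_lt (mul_lt_top (by finiteness) hGd)⟩
  · exact Complex.measurable_re.comp hb.meas
  · exact fun θ => by simpa using congr_arg Complex.re (hb.per θ)
  · simpa only [hGψ] using hder
  · rintro _ ⟨z, hz, rfl⟩
    have hne : ∀ θ, B θ ≠ F z := fun θ hθ => hdis θ ⟨z, hz, hθ.symm⟩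
    rw [← hv.integral_div_sub hF hinj hE hEF hz hne]
    have hm := hG.meas
    refine (integral_congr fun s _ => ?_).trans
      ((h.integral_comp (g := fun t : ℝ => l * I * cexp (φ t * I) *
        cexp ((G t : ℂ) * I) / (B t - F z)) (by fun_prop)).trans ?_)
    · simp only [h.right_inv]
    refine integral_congr fun t _ => ?_
    have e1 : cexp (u t) = ‖cexp (u t)‖ * cexp ((u t).im * I) := by
      rw [norm_exp, Complex.ofReal_exp, ← Complex.exp_add, Complex.re_add_im]
    have e2 : cexp (φ t * I) * cexp ((G t : ℂ) * I) = cis t * cexp ((u t).im * I) := by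
      rw [← Complex.exp_add, ← Complex.exp_add]; congr 1; simp only [G]; push_cast; ring
    have h0 := sub_ne_zero.2 (hne t)
    have hl0 : (l : ℂ) ≠ 0 := Complex.ofReal_ne_zero.2 hl.ne'
    change _ = I * cis t / (B t - F z) * _
    rw [mul_assoc ((l : ℂ) * I), e2]
    conv_rhs => rw [e1]
    push_cast
    field_simp

/-- `w` is a simple closed curve of constant speed `l` whose tangent has angle
`θ + π / 2 + b θ`, with `b` of finite Douglas energy. -/
structure TangentAngle (l : ℝ) (w : ℝ → ℂ) (b : ℝ → ℝ) : Prop where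
  pos : 0 < l
  lip : LipschitzWith l.toNNReal w
  per : ∀ θ, w (θ + 2 * π) = w θ
  inj : InjOn w (Ico 0 (2 * π))
  meas : Measurable b
  perAngle : ∀ θ, b (θ + 2 * π) = b θ
  hasDerivAt : ∀ᵐ θ : ℝ, HasDerivAt w (l * I * cis θ * cexp ((b θ : ℂ) * I)) θ
  douglas_lt_top : douglas (fun θ => (b θ : ℂ)) < ⊤

namespace TangentAngle

variable {l : ℝ} {w : ℝ → ℂ} {b : ℝ → ℝ}

lemma norm_sub_le (h : TangentAngle l w b) (s t : ℝ) : ‖w t - w s‖ ≤ l * |t - s| := by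
  have := h.lip.dist_le_mul t s
  rwa [coe_toNNReal _ h.pos.le, dist_eq_norm, Real.dist_eq] at this

lemma measurable_deriv (h : TangentAngle l w b) : Measurable fun θ : ℝ =>
    l * I * cis θ * cexp ((b θ : ℂ) * I) := by
  have := h.meas
  fun_prop

lemma intervalIntegrable (h : TangentAngle l w b) (x y : ℝ) : IntervalIntegrable (fun θ : ℝ =>
    l * I * cis θ * cexp ((b θ : ℂ) * I))
    volume x y := by
  refine (intervalIntegrable_const (c := l)).mono_fun h.measurable_deriv.aestronglyMeasurable
    (.of_forall fun t => ?_)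
  simp [norm_exp_ofReal_mul_I]

lemma sub_eq_integral (h : TangentAngle l w b) (s t : ℝ) : w t - w s = ∫ θ in s..t,
    l * I * cis θ * cexp ((b θ : ℂ) * I) :=
  sub_eq_integral_of_ae_hasDerivAt h.intervalIntegrable
    (fun _ _ => intervalIntegrable_const (c := l)) (fun x y hxy => by
      rw [intervalIntegral.integral_const, smul_eq_mul, mul_comm,
        ← abs_of_nonneg (sub_nonneg.2 hxy)]
      exact h.norm_sub_le x y) h.hasDerivAt s t

lemma exists_chordArc (h : TangentAngle l w b) : ∃ c : ℝ, 0 < c ∧ ∀ s t : ℝ,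
    c * ‖cis s - cis t‖ ≤ ‖w s - w t‖ := by
  obtain ⟨δ, h0, h1, hδ⟩ := exists_douglas_Ioc_le (u := fun θ => (b θ : ℂ))
    (fun t => by simp only [h.perAngle]) h.douglas_lt_top (ε := ofReal (1 / 32)) (by simp)
  refine exists_chordArc_of_local h.lip.continuous h.per h.inj (half_pos h.pos)
    (lt_min h0 (by norm_num : (0 : ℝ) < 1 / 8)) fun s t hst hts => ?_
  rcases hst.eq_or_lt with rfl | hst'
  · simp
  have hm := h.meas
  set v : ℝ → ℂ := fun θ => cexp ((θ + b θ : ℝ) * I) with hv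
  have hvm : Measurable v := by fun_prop
  have hvn : ∀ x, ‖v x‖ = 1 := fun x => norm_exp_ofReal_mul_I _
  have hvi : IntervalIntegrable v volume s t :=
    (intervalIntegrable_const (c := (1 : ℝ))).mono_fun hvm.aestronglyMeasurable
      (.of_forall fun x => by simp [hvn])
  have hw : ‖w t - w s‖ = l * ‖∫ θ in s..t, v θ‖ := by
    have : l * ‖∫ θ in s..t, v θ‖ = ‖(l * I : ℂ) * ∫ θ in s..t, v θ‖ := by
      simp [abs_of_pos h.pos]
    rw [h.sub_eq_integral, this, ← intervalIntegral.integral_const_mul]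
    congr 2 with x
    rw [hv, mul_assoc, ← Complex.exp_add]
    push_cast; ring_nf
  set T := t - s with hT
  have hT0 : 0 < T := sub_pos.2 hst'
  have hT8 : T ≤ 1 / 8 := by have := min_le_right δ (1 / 8); linarith
  suffices T / 2 ≤ ‖∫ θ in s..t, v θ‖ by rw [hw]; nlinarith [h.pos]
  by_contra! hlt
  have hvol : (volume.restrict (Ioc s t)) univ = ofReal T := by simp [T]
  have hlow : ∀ x, ofReal (T / 4) ≤ ∫⁻ y in Ioc s t, ‖v y - v x‖ₑ ^ 2 := fun x => by
    have h2 : T / 2 ≤ ‖∫ y in s..t, (v y - v x)‖ := by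
      rw [intervalIntegral.integral_sub hvi (by simp), intervalIntegral.integral_const]
      have := norm_sub_norm_le ((t - s) • v x) (∫ y in s..t, v y)
      rw [norm_smul, hvn, norm_sub_rev (_ • _), norm_of_nonneg hT0.le] at this
      linarith
    have h3 : ofReal (T / 2) ≤ ∫⁻ y in Ioc s t, ‖v y - v x‖ₑ := by
      rw [integral_of_le hst] at h2
      refine (ofReal_le_ofReal h2).trans ?_
      rw [ofReal_norm]
      exact enorm_integral_le_lintegral_enorm _
    have h4 := (pow_le_pow_left₀ zero_le h3 2).trans
      (lintegral_sq_le _ (hvm.sub_const (v x)).enorm.aemeasurable)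
    rw [hvol, ← ofReal_pow (by positivity),
      show (T / 2) ^ 2 = T * (T / 4) by ring, ofReal_mul hT0.le] at h4
    exact (ENNReal.mul_le_mul_iff_right (by simpa using hT0) ofReal_ne_top).1 h4
  have hpt : ∀ x ∈ Ioc s t, ∀ y ∈ Ioc s t, ‖v y - v x‖ₑ ^ 2 ≤
      ofReal (2 * T ^ 2) * (1 + douglasKernel (fun θ => (b θ : ℂ)) x y) := by
    intro x hx y hy
    have hxy : |x - y| ≤ T := by rw [abs_le]; constructor <;> linarith [hx.1, hx.2, hy.1, hy.2]
    rw [← ofReal_norm_sq, douglasKernel, ← ofReal_one,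
      ← ofReal_add zero_le_one (by positivity), ← ofReal_mul (by positivity)]
    refine ofReal_le_ofReal ?_
    have k1 := norm_exp_sub_exp_le (x + b x) (y + b y)
    rw [norm_sub_rev] at k1
    have k2 : |x + b x - (y + b y)| ≤ |x - y| + |b x - b y| := by
      rw [show x + b x - (y + b y) = (x - y) + (b x - b y) by ring]; exact abs_add_le _ _
    rw [← Complex.ofReal_sub, norm_real, norm_eq_abs]
    have k3 := norm_exp_sub_exp_le x y
    have k4 : |b x - b y| ≤ T * (|b x - b y| / ‖cis x - cis y‖) := by
      rcases (norm_nonneg (cis x - cis y)).eq_or_lt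
        with h0 | h0
      · have := le_norm_exp_sub_exp (s := x) (t := y) (by linarith [pi_gt_three])
        rw [← h0] at this
        have : |x - y| ≤ 0 := nonpos_of_mul_nonpos_right this (by positivity)
        rw [sub_eq_zero.1 (abs_nonpos_iff.1 this)]; simp
      · rw [mul_div_assoc', le_div_iff₀ h0, mul_comm]
        gcongr
        exact k3.trans hxy
    rw [← div_pow]
    calc ‖v y - v x‖ ^ 2 ≤ (T + T * (|b x - b y| / ‖cis x - cis y‖)) ^ 2 := by
          gcongr; exact k1.trans (k2.trans (add_le_add hxy k4))
      _ ≤ _ := by nlinarith [mul_nonneg (sq_nonneg T) (sq_nonneg (1 - |b x - b y| /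
        ‖cis x - cis y‖))]
  have hup : ∫⁻ x in Ioc s t, ∫⁻ y in Ioc s t, ‖v y - v x‖ₑ ^ 2 ≤
      ofReal (2 * T ^ 2) * (ofReal (T ^ 2) + ofReal (1 / 32)) := by
    have hK := measurable_douglasKernel (u := fun θ => (b θ : ℂ)) (by fun_prop)
    calc _ ≤ ∫⁻ x in Ioc s t, ∫⁻ y in Ioc s t, ofReal (2 * T ^ 2) *
          (1 + douglasKernel (fun θ => (b θ : ℂ)) x y) :=
          setLIntegral_mono' measurableSet_Ioc fun x hx =>
            setLIntegral_mono' measurableSet_Ioc fun y hy => hpt x hx y hy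
      _ = ofReal (2 * T ^ 2) * (ofReal T * ofReal T +
          ∫⁻ x in Ioc s t, ∫⁻ y in Ioc s t, douglasKernel (fun θ => (b θ : ℂ)) x y) := by
          simp_rw [lintegral_const_mul' _ _ ofReal_ne_top, lintegral_add_left measurable_const]
          simp [T]
      _ ≤ _ := by
          gcongr
          · rw [← ofReal_mul hT0.le, sq]
          · exact hδ s t (hts.trans (by gcongr; exact min_le_left _ _))
  have hfin := (lintegral_mono (μ := volume.restrict (Ioc s t)) hlow).trans hup
  rw [lintegral_const, hvol, ← ofReal_mul (by positivity),
    ← ofReal_add (by positivity) (by norm_num), ← ofReal_mul (by positivity),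
    ofReal_le_ofReal_iff (by positivity)] at hfin
  have h5 : T ^ 2 ≤ 1 / 64 := by nlinarith
  have h6 : 0 < T ^ 2 := by positivity
  nlinarith [mul_le_mul_of_nonneg_left h5 h6.le]

end TangentAngle

lemma TangentAngle.boundedTurning {l : ℝ} {w : ℝ → ℂ} {b : ℝ → ℝ} (h : TangentAngle l w b) :
    ∃ C : ℝ, 0 < C ∧ ∀ s t : ℝ, s ≤ t → t ≤ s + 2 * π →
      min (diam (w '' Icc s t)) (diam (w '' Icc t (s + 2 * π))) ≤ C * ‖w s - w t‖ := by
  obtain ⟨c, hc, hca⟩ := h.exists_chordArc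
  have hl := h.pos
  have hdiam : ∀ x y, x ≤ y → diam (w '' Icc x y) ≤ l * (y - x) := fun x y hxy => by
    refine diam_le_of_forall_dist_le (mul_nonneg hl.le (sub_nonneg.2 hxy)) ?_
    rintro _ ⟨s, hs, rfl⟩ _ ⟨t, ht, rfl⟩
    rw [dist_eq_norm]
    refine (h.norm_sub_le t s).trans ?_
    gcongr
    rw [abs_le]; constructor <;> linarith [hs.1, hs.2, ht.1, ht.2]
  have hshort : ∀ x y, x ≤ y → y - x ≤ π →
      diam (w '' Icc x y) ≤ l * (π / 2) / c * ‖w x - w y‖ := fun x y hxy hπ => by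
    have h1 := le_norm_exp_sub_exp (s := x) (t := y) (by rw [abs_sub_comm, abs_of_nonneg] <;> linarith)
    rw [abs_sub_comm, abs_of_nonneg (sub_nonneg.2 hxy)] at h1
    have h2 := (mul_le_mul_of_nonneg_left h1 hc.le).trans (hca x y)
    calc _ ≤ l * (y - x) := hdiam x y hxy
      _ = l * (π / 2) / c * (c * (2 / π * (y - x))) := by have := pi_ne_zero; field_simp
      _ ≤ _ := by gcongr
  refine ⟨l * (π / 2) / c, by positivity, fun s t hst hts => ?_⟩
  rcases le_total (t - s) π with h1 | h1
  · exact (min_le_left _ _).trans (hshort s t hst h1)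
  · refine (min_le_right _ _).trans ((hshort t _ hts (by linarith)).trans_eq ?_)
    rw [h.per, norm_sub_rev]

lemma sum_norm_sub_le {F E : ℂ → ℂ} (hF : DifferentiableOn ℂ F 𝔻)
    (hE : ContinuousOn E (closedBall 0 1)) (hEF : EqOn E F 𝔻) {κ : ℝ → ℝ} {L : ℝ}
    (hκ : ∀ x y : ℝ, x ≤ y → ‖E (cis y) - E (cis x)‖ ≤ κ y - κ x)
    (hL : ∀ x, κ (x + 2 * π) = κ x + L) {n : ℕ} {a : ℝ} (ha : 0 ≤ a) (hn : n * a = 2 * π)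
    {ζ : ℂ} (hζ : ζ ∈ 𝔻) : ∑ j ∈ Finset.range n, ‖F (ζ * cexp (((j + 1 : ℕ) * a : ℝ) * I)) -
      F (ζ * cexp ((j * a : ℝ) * I))‖ ≤ L := by
  have hnorm : ∀ (z : ℂ) (t : ℝ), ‖z * cis t‖ = ‖z‖ := fun z t => by
    rw [norm_mul, norm_exp_ofReal_mul_I, mul_one]
  have hrot : ∀ t : ℝ, DiffContOnCl ℂ (fun z => E (z * cis t)) 𝔻 := fun t => by
      refine ⟨(hF.congr hEF).comp (by fun_prop) fun z hz => ?_, ?_⟩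
      · rwa [mem_ball_zero_iff, hnorm, ← mem_ball_zero_iff]
      · rw [closure_ball _ one_ne_zero]
        refine hE.comp (by fun_prop) fun z hz => ?_
        rwa [mem_closedBall_zero_iff, hnorm, ← mem_closedBall_zero_iff]
  set d : ℕ → ℂ → ℂ := fun j z => E (z * cexp (((j + 1 : ℕ) * a : ℝ) * I)) -
      E (z * cexp ((j * a : ℝ) * I)) with hd
  set c : ℕ → ℂ := fun j => (starRingEnd ℂ) (d j ζ) / ‖d j ζ‖ with hc
  have hcn : ∀ j, ‖c j‖ ≤ 1 := fun j => by
    simp only [c, norm_div, RCLike.norm_conj, norm_real, norm_norm]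
    exact div_self_le_one _
  have hcd : ∀ j, c j * d j ζ = ‖d j ζ‖ := fun j => by
    simp only [c]
    rw [div_mul_eq_mul_div, mul_comm, mul_conj, normSq_eq_norm_sq]
    push_cast
    rw [sq, mul_self_div_self]
  have hsum : DiffContOnCl ℂ (fun z => ∑ j ∈ Finset.range n, c j * d j z) 𝔻 := by
    have hj : ∀ j, DiffContOnCl ℂ (fun z => c j * d j z) 𝔻 := fun j =>
      ((hrot _).sub (hrot _)).const_smul (c j)
    exact ⟨DifferentiableOn.fun_sum fun j _ => (hj j).1, continuousOn_finsetSum _ fun j _ => (hj j).2⟩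
  have hmax := Complex.norm_le_of_forall_mem_frontier_norm_le (C := L) isBounded_ball hsum
    (fun z hz => by
      rw [frontier_ball _ one_ne_zero, mem_sphere_zero_iff_norm] at hz
      obtain ⟨τ, rfl⟩ : ∃ τ : ℝ, z = cis τ :=
        ⟨z.arg, by simpa [hz] using (norm_mul_exp_arg_mul_I z).symm⟩
      calc _ ≤ ∑ j ∈ Finset.range n, (κ (τ + (j + 1 : ℕ) * a) - κ (τ + j * a)) := by
            refine norm_sum_le_of_le _ fun j _ => ?_
            rw [norm_mul]
            refine (mul_le_of_le_one_left (norm_nonneg _) (hcn j)).trans ?_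
            refine le_trans (le_of_eq ?_) (hκ (τ + j * a) (τ + (j + 1 : ℕ) * a) (by
              push_cast; linarith))
            simp only [d]
            rw [← Complex.exp_add, ← Complex.exp_add]
            push_cast
            ring_nf
        _ = L := by
            rw [Finset.sum_range_sub fun j : ℕ => κ (τ + j * a), hn, hL]; simp)
    (subset_closure hζ)
  rw [sum_congr rfl fun j _ => hcd j, ← Complex.ofReal_sum, norm_real] at hmax
  refine le_trans (sum_le_sum fun j _ => le_of_eq ?_) ((le_abs_self _).trans hmax)
  simp only [d]
  rw [hEF, hEF] <;> rwa [mem_ball_zero_iff, hnorm, ← mem_ball_zero_iff]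

lemma lintegral_deriv_circle_le {F E : ℂ → ℂ} (hF : DifferentiableOn ℂ F 𝔻)
    (hE : ContinuousOn E (closedBall 0 1)) (hEF : EqOn E F 𝔻) {κ : ℝ → ℝ} {L : ℝ}
    (hκ : ∀ x y : ℝ, x ≤ y → ‖E (cis y) - E (cis x)‖ ≤ κ y - κ x)
    (hL : ∀ x, κ (x + 2 * π) = κ x + L) {r : ℝ} (hr0 : 0 ≤ r) (hr1 : r < 1) :
    ∫⁻ t : ℝ, ofReal r * ‖deriv F (r * cis t)‖ₑ ∂circ ≤ ofReal L := by
  set k : ℝ → ℂ := fun t => F (r * cis t) with hk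
  have hkc : Continuous k := hF.continuousOn.comp_continuous (by fun_prop) fun t =>
    circle_mem_ball hr0 hr1 t
  have hk' : ∀ t : ℝ, HasDerivAt k (deriv F (r * cis t) * (r * (cis t * I))) t := fun t =>
    ((hF.differentiableAt (isOpen_ball.mem_nhds (circle_mem_ball hr0 hr1 t))).hasDerivAt).comp t
      ((((hasDerivAt_id t).ofReal_comp.mul_const I).cexp.const_mul (r : ℂ)).congr_deriv
        (by simp))
  set a : ℕ → ℝ := fun n => 2 * π / (n + 1) with ha
  have ha0 : ∀ n, 0 < a n := fun n => by positivity
  have hat : Tendsto a atTop (nhds 0) := by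
    simpa using (tendsto_one_div_add_atTop_nhds_zero_nat (𝕜 := ℝ)).const_mul (2 * π) |>.congr
      fun n => by simp [a, div_eq_mul_inv]
  have hbound : ∀ n, ∫⁻ t, ‖(a n)⁻¹ • (k (t + a n) - k t)‖ₑ ∂circ ≤ ofReal L := fun n => by
    have hm : ∀ s, Measurable fun t => ‖k (t + s + a n) - k (t + s)‖ₑ := fun s => by fun_prop
    have h1 : ∀ s, ∫⁻ t, ‖k (t + s + a n) - k (t + s)‖ₑ ∂circ = ∫⁻ t, ‖k (t + a n) - k t‖ₑ ∂circ :=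
      fun s => lintegral_shift (g := fun t => ‖k (t + a n) - k t‖ₑ) (fun t => by
        simp only [k, add_right_comm t (2 * π), exp_add_two_pi_mul_I]) s
    have h2 : ∀ t, ∑ j ∈ Finset.range (n + 1), ‖k (t + j * a n + a n) - k (t + j * a n)‖ₑ ≤
        ofReal L := fun t => by
      have := sum_norm_sub_le hF hE hEF hκ hL (n := n + 1) (ha0 n).le
        (by simp only [a]; push_cast; field_simp) (circle_mem_ball hr0 hr1 t)
      refine le_trans (le_of_eq ?_) (ofReal_le_ofReal this)
      rw [ofReal_sum_of_nonneg fun _ _ => norm_nonneg _]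
      refine sum_congr rfl fun j _ => ?_
      rw [ofReal_norm]
      simp only [k, mul_assoc, ← Complex.exp_add]
      push_cast
      ring_nf
    have h3 := lintegral_mono (μ := circ) h2
    rw [lintegral_finsetSum _ fun j _ => hm _, lintegral_const, circ_univ] at h3
    simp only [h1, Finset.sum_const, Finset.card_range, nsmul_eq_mul] at h3
    simp only [enorm_smul]
    rw [lintegral_const_mul' _ _ (by finiteness)]
    have h4 : ‖(a n)⁻¹‖ₑ = ((n + 1 : ℕ) : ENNReal) * (ofReal (2 * π))⁻¹ := by
      rw [Real.enorm_of_nonneg (by positivity), ← ofReal_inv_of_pos two_pi_pos,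
        ← ofReal_natCast, ← ofReal_mul (by positivity)]
      congr 1; simp only [a]; push_cast; field_simp
    rw [h4, mul_right_comm, ← ENNReal.div_eq_inv_mul.trans (mul_comm _ _),
      ENNReal.div_le_iff (by simp [pi_pos]) ofReal_ne_top]
    exact h3
  have hlim : ∀ t : ℝ, Tendsto (fun n => ‖(a n)⁻¹ • (k (t + a n) - k t)‖ₑ) atTop
      (nhds (ofReal r * ‖deriv F (r * cis t)‖ₑ)) := fun t => by
    have := ((hk' t).tendsto_slope_zero.comp (tendsto_nhdsWithin_iff.2
      ⟨hat, .of_forall fun n => (ha0 n).ne'⟩)).enorm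
    convert! this using 2
    rw [enorm_mul, enorm_mul, enorm_mul, mul_comm]
    congr 1
    rw [← ofReal_norm (cexp _), norm_exp_ofReal_mul_I, ← ofReal_norm (r : ℂ),
      norm_real, norm_of_nonneg hr0, ← ofReal_norm I]
    simp
  calc _ = ∫⁻ t, liminf (fun n => ‖(a n)⁻¹ • (k (t + a n) - k t)‖ₑ) atTop ∂circ :=
        lintegral_congr fun t => (hlim t).liminf_eq.symm
    _ ≤ liminf (fun n => ∫⁻ t, ‖(a n)⁻¹ • (k (t + a n) - k t)‖ₑ ∂circ) atTop :=
        lintegral_liminf_le fun n => by fun_prop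
    _ ≤ _ := Filter.liminf_le_of_le (by isBoundedDefault) fun x hx =>
        (hx.exists.choose_spec).trans (hbound _)

lemma PS.tsum_sq_lt_top {a : ℕ → ℂ} {f : ℂ → ℂ} (h : PS a f) {M : ENNReal} (hM : M < ⊤)
    (hfM : ∀ᶠ r : ℝ in 𝓝[<] 1, ∫⁻ θ : ℝ, ‖f (r * cis θ)‖ₑ ^ 2 ∂circ ≤ M) :
    ∑' n, ‖a n‖ₑ ^ 2 < ⊤ := by
  have hle : ofReal (2 * π) * ∑' n, ‖a n‖ₑ ^ 2 ≤ M := by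
    rw [← ENNReal.tsum_mul_left]
    refine ENNReal.tsum_le_of_sum_range_le fun N => ?_
    have ht : Tendsto (fun r : ℝ => ∑ n ∈ Finset.range N,
        ofReal (2 * π) * ‖a n * (r : ℂ) ^ n‖ₑ ^ 2) (𝓝[<] 1)
        (nhds (∑ n ∈ Finset.range N, ofReal (2 * π) * ‖a n‖ₑ ^ 2)) := by
      refine tendsto_finsetSum _ fun n _ => ENNReal.Tendsto.const_mul ?_ (.inr ofReal_ne_top)
      have : Continuous fun r : ℝ => ‖a n * (r : ℂ) ^ n‖ₑ ^ 2 := by fun_prop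
      simpa using (this.tendsto 1).mono_left nhdsWithin_le_nhds
    refine le_of_tendsto ht ?_
    filter_upwards [hfM, eventually_mem_Ico_one] with r hr hr1
    rw [h.lintegral_circle hr1.1 hr1.2] at hr
    rw [← mul_sum]
    exact (mul_le_mul_right (ENNReal.sum_le_tsum _) _).trans hr
  exact ENNReal.lt_top_of_mul_ne_top_right (hle.trans_lt hM).ne (by simp [pi_pos])

/-- A zero-free holomorphic function with square-integrable boundary values does not vanish
almost everywhere on the circle. -/
lemma IsBdry.exp_ne_zero {g : ℂ → ℂ} (hg : DifferentiableOn ℂ g 𝔻) {s : ℝ → ℂ}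
    (hs : IsBdry (fun z => cexp (g z / 2)) s) {M : ENNReal} (hM : M < ⊤)
    (hgM : ∀ᶠ r : ℝ in 𝓝[<] 1, ∫⁻ θ : ℝ, ‖cexp (g (r * cis θ) / 2)‖ₑ ^ 2 ∂circ ≤ M) :
    ∀ᵐ t ∂circ, s t ≠ 0 := by
  obtain ⟨ns, hns, hns1, hae⟩ := hs.exists_seq hs hs
  set G : ℕ → ℝ → ℂ := fun k t => g (ns k * cis t) with hG
  have hGc : ∀ k, Continuous (G k) := fun k => hg.continuousOn.comp_continuous (by fun_prop)
    fun t => circle_mem_ball (hns1 k).1 (hns1 k).2 t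
  have hsq : ∀ k t, ‖cexp (G k t / 2)‖ ^ 2 = exp (G k t).re := fun k t => by
    rw [← norm_pow, ← Complex.exp_nat_mul, norm_exp]
    congr 2; push_cast; ring
  set q : ℕ → ℝ → ENNReal := fun k t => ofReal (exp (G k t).re - (G k t).re) with hq
  have hmean : ∀ k, ∫ t, (G k t).re ∂circ = 2 * π * (g 0).re := fun k => by
    have h1 := (PS.of_differentiableOn hg).fc_circle (hns1 k).1 (hns1 k).2 0
    have h2 := (PS.of_differentiableOn hg).coeff_zero
    have h3 := zc_natCast (fun n : ℕ => ((n.factorial : ℂ)⁻¹ * iteratedDeriv n g 0) * (ns k : ℂ) ^ n) 0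
    beta_reduce at h2
    rw [Nat.cast_zero, pow_zero, mul_one, h2] at h3
    rw [h3, fc, integral_of_le two_pi_pos.le] at h1
    simp only [Int.cast_zero, zero_mul, neg_zero, Complex.exp_zero, one_mul] at h1
    have h4 : ∫ t, G k t ∂circ = (2 * π : ℝ) * g 0 := by
      rw [← h1]; push_cast; field_simp; rfl
    have h5 := integral_re (continuous_memLp_circ (hGc k) 2).integrable_circ
    simp only [RCLike.re_to_complex] at h5
    rw [h5, h4, Complex.re_ofReal_mul]
  have hbd : ∀ᶠ k in atTop, ∫⁻ t, q k t ∂circ ≤ ofReal (M.toReal - 2 * π * (g 0).re) := by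
    filter_upwards [hns.eventually hgM] with k hk
    have hi1 : Integrable (fun t => exp (G k t).re) circ := Continuous.integrableOn_Ioc
      (Real.continuous_exp.comp (Complex.continuous_re.comp (hGc k)))
    have hi2 : Integrable (fun t => (G k t).re) circ :=
      (continuous_memLp_circ (hGc k) 2).integrable_circ.re
    refine (ofReal_integral_eq_lintegral_ofReal (hi1.sub hi2) (.of_forall fun t => by
      have := add_one_le_exp (G k t).re
      simp only [Pi.zero_apply, Pi.sub_apply]; linarith)).symm.trans_le
      (ofReal_le_ofReal ?_)
    simp only [Pi.sub_apply]
    rw [integral_sub hi1 hi2, hmean]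
    refine sub_le_sub_right ?_ _
    rw [integral_eq_lintegral_of_nonneg_ae (.of_forall fun t => (exp_pos _).le)
      hi1.aestronglyMeasurable]
    refine ENNReal.toReal_mono hM.ne ((lintegral_congr fun t => ?_).trans_le hk)
    rw [← hsq, ofReal_norm_sq]
  have hfin : ∫⁻ t, liminf (fun k => q k t) atTop ∂circ < ⊤ :=
    (lintegral_liminf_le fun k => by fun_prop).trans_lt
      ((Filter.liminf_le_of_frequently_le' hbd.frequently).trans_lt ofReal_lt_top)
  filter_upwards [hae, ae_lt_top (.liminf fun k => by fun_prop) hfin.ne] with t ht hlt h0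
  refine hlt.ne (Tendsto.liminf_eq ?_)
  have h1 : Tendsto (fun k => exp (G k t).re) atTop (nhds 0) := by
    have := ht.1.norm.pow 2
    rw [h0, norm_zero, zero_pow two_ne_zero] at this
    exact this.congr fun k => hsq k t
  have h2 : Tendsto (fun k => (G k t).re) atTop atBot := tendsto_exp_comp_nhds_zero.1 h1
  refine ENNReal.tendsto_ofReal_nhds_top.2 ?_
  exact h1.add_atTop (Filter.tendsto_neg_atBot_atTop.comp h2)

lemma exists_sqrt_deriv {F E : ℂ → ℂ} (hF : DifferentiableOn ℂ F 𝔻)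
    (hinj : InjOn F 𝔻) (hE : ContinuousOn E (closedBall 0 1)) (hEF : EqOn E F 𝔻) {κ : ℝ → ℝ} {L : ℝ}
    (hκ : ∀ x y : ℝ, x ≤ y → ‖E (cis y) - E (cis x)‖ ≤ κ y - κ x)
    (hL : ∀ x, κ (x + 2 * π) = κ x + L) : ∃ (g : ℂ → ℂ) (s : ℝ → ℂ),
      (∀ z ∈ 𝔻, HasDerivAt g (deriv (deriv F) z / deriv F z) z) ∧
      (∀ z ∈ 𝔻, cexp (g z) = deriv F z) ∧
      IsBdry (fun z => cexp (g z / 2)) s ∧ (∀ᵐ t ∂circ, s t ≠ 0) ∧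
      IsBdryOne (deriv F) fun t => s t * s t := by
  obtain ⟨g, hg, hexp⟩ := exists_log_of_ne_zero (hF.deriv isOpen_ball)
    fun z hz => deriv_ne_zero_of_conformal hF hinj hz
  have hgd : DifferentiableOn ℂ g 𝔻 := fun z hz =>
    (hg z hz).differentiableAt.differentiableWithinAt
  have hsq : ∀ z ∈ 𝔻, cexp (g z / 2) * cexp (g z / 2) = deriv F z :=
    fun z hz => by rw [← Complex.exp_add, add_halves, hexp z hz]
  have hM : ∀ᶠ r : ℝ in 𝓝[<] 1,
      ∫⁻ θ : ℝ, ‖cexp (g (r * cis θ) / 2)‖ₑ ^ 2 ∂circ ≤ 2 * ofReal L := by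
    filter_upwards [eventually_mem_Ico_one, Ico_mem_nhdsLT (show (1 / 2 : ℝ) < 1 by norm_num)]
      with r hr hr2
    have h1 := lintegral_deriv_circle_le hF hE hEF hκ hL hr.1 hr.2
    rw [lintegral_const_mul' _ _ ofReal_ne_top] at h1
    have h2 : 1 ≤ 2 * ofReal r := by
      rw [← ofReal_ofNat, ← ofReal_mul zero_le_two, ENNReal.one_le_ofReal]
      linarith [hr2.1]
    refine le_trans ?_ (mul_le_mul_right h1 2)
    rw [← mul_assoc]
    refine le_trans (lintegral_congr fun θ => ?_).le (le_mul_of_one_le_left' h2)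
    rw [sq, ← enorm_mul, hsq _ (circle_mem_ball hr.1 hr.2 θ)]
  have hMt : 2 * ofReal L < ⊤ := by finiteness
  obtain ⟨s, hs, -⟩ := (PS.of_differentiableOn (hgd.div_const 2).cexp).exists_isBdry
    ((PS.of_differentiableOn (hgd.div_const 2).cexp).tsum_sq_lt_top hMt hM)
  exact ⟨g, s, hg, hexp, hs, hs.exp_ne_zero hgd hMt hM,
    (hs.mul hs).congr_left fun z hz => (hsq z hz).symm⟩

lemma eq_mul_exp_integral_div {k v : ℝ → ℂ} {K C : NNReal} (hk : LipschitzWith K k)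
    (h0 : ∀ x, k x ≠ 0) (hd : ∀ᵐ x, HasDerivAt k (v x) x)
    (hv : ∀ x y, IntervalIntegrable (fun t => v t / k t) volume x y)
    (hC : ∀ x, ‖v x / k x‖ ≤ C) (b : ℝ) :
    k b = k 0 * cexp (∫ t in 0..b, v t / k t) := by
  set Λ : ℝ → ℂ := fun x => ∫ t in 0..x, v t / k t with hΛ
  have hΛl : LipschitzWith C Λ := LipschitzWith.of_dist_le_mul fun x y => by
    rw [dist_eq_norm, Real.dist_eq, integral_interval_sub_left (hv _ _) (hv _ _)]
    exact intervalIntegral.norm_integral_le_of_norm_le_const fun t _ => hC t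
  have hexp : LocallyLipschitz fun x => cexp (-Λ x) :=
    (by fun_prop : ContDiff ℝ 1 fun z : ℂ => cexp (-z)).locallyLipschitz.comp hΛl.locallyLipschitz
  obtain ⟨K', hK'⟩ := hexp.locallyLipschitzOn.exists_lipschitzOnWith_of_compact
    (isCompact_uIcc (a := (0 : ℝ)) (b := b))
  have hac := (hk.lipschitzOnWith (s := uIcc 0 b)).absolutelyContinuousOnInterval.smul
    hK'.absolutelyContinuousOnInterval
  obtain ⟨c, hc⟩ := hac.const_of_ae_hasDerivAt_zero (by
    filter_upwards [hd, ae_hasDerivAt_integral_of_intervalIntegrable hv] with x h1 h2 _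
    refine (h1.mul (h2 0).neg.cexp).congr_deriv ?_
    have := h0 x
    field_simp
    ring)
  have h1 := (hc b right_mem_uIcc).trans (hc 0 left_mem_uIcc).symm
  simp only [Pi.smul_apply', smul_eq_mul, hΛ, integral_same, neg_zero,
    Complex.exp_zero, mul_one] at h1
  rw [← h1, mul_assoc, ← Complex.exp_add, neg_add_cancel, Complex.exp_zero, mul_one]

/-- A continuous logarithm of the increments of a conformal map along the closed disc. -/
lemma exists_log_sub {F E : ℂ → ℂ} (hF : DifferentiableOn ℂ F 𝔻)
    (hinj : InjOn F 𝔻) (hE : ContinuousOn E (closedBall 0 1))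
    (hEF : EqOn E F 𝔻) (hne : ∀ θ : ℝ, E (cis θ) ≠ F 0) :
    ∃ D : ℂ → ℂ, Continuous D ∧ ∀ θ : ℝ, E (cis θ) - F 0 = cis θ * cexp (D (cis θ)) := by
  have h0 : (0 : ℂ) ∈ 𝔻 := mem_ball_self one_pos
  have hE0 : E =ᶠ[nhds 0] F := hEF.eventuallyEq_of_mem (isOpen_ball.mem_nhds h0)
  have hdc : ContinuousOn (dslope E 0) (closedBall 0 1) :=
    (continuousOn_dslope (closedBall_mem_nhds _ one_pos)).2
      ⟨hE, (hF.differentiableAt (isOpen_ball.mem_nhds h0)).congr_of_eventuallyEq hE0⟩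
  have hd0 : ∀ z ∈ closedBall (0 : ℂ) 1, dslope E 0 z ≠ 0 := fun z hz => by
    rcases eq_or_ne z 0 with rfl | hz0
    · rw [dslope_same, hE0.deriv_eq]
      exact deriv_ne_zero_of_conformal hF hinj h0
    · rw [dslope_of_ne _ hz0, slope_def_field, sub_zero, hEF h0]
      refine div_ne_zero (sub_ne_zero.2 ?_) hz0
      rcases (mem_closedBall_zero_iff.1 hz).lt_or_eq with h | h
      · have hz1 := mem_ball_zero_iff.2 h
        rw [hEF hz1]
        exact fun h => hz0 (hinj hz1 h0 h)
      · have := norm_mul_exp_arg_mul_I z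
        rw [h, Complex.ofReal_one, one_mul] at this
        exact this ▸ hne z.arg
  set p : ℂ → ℂ := fun z => z / (max 1 ‖z‖ : ℝ) with hp
  have hm : ∀ z : ℂ, 0 < max 1 ‖z‖ := fun z => lt_max_of_lt_left one_pos
  have hpm : ∀ z, p z ∈ closedBall (0 : ℂ) 1 := fun z => by
    rw [mem_closedBall_zero_iff, norm_div, norm_real, norm_of_nonneg (hm z).le]
    exact div_le_one_of_le₀ (le_max_right _ _) (hm z).le
  have hpc : Continuous p := continuous_id.div (by fun_prop) fun z => by
    exact_mod_cast (hm z).ne'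
  obtain ⟨D, hD, hDe⟩ := hasLog_univ (hdc.comp_continuous hpc hpm) fun z => hd0 _ (hpm z)
  refine ⟨D, continuousOn_univ.1 hD, fun θ => ?_⟩
  have hp1 : p (cis θ) = cis θ := by
    simp [p, norm_exp_ofReal_mul_I]
  have := hDe (cis θ) trivial
  rw [this, Function.comp_apply, hp1, dslope_of_ne _ (Complex.exp_ne_zero _), slope_def_field, sub_zero, hEF h0,
    mul_div_cancel₀ _ (Complex.exp_ne_zero _)]

/-- A boundary parametrization of a conformal map traverses a positively oriented curve
in the positive direction. -/
lemma TangentAngle.reparam_add {l : ℝ} {w : ℝ → ℂ} {b : ℝ → ℝ} (h : TangentAngle l w b)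
    {F E : ℂ → ℂ} (hF : DifferentiableOn ℂ F 𝔻)
    (hinj : InjOn F 𝔻) (hE : ContinuousOn E (closedBall 0 1))
    (hEF : EqOn E F 𝔻) (hne : ∀ s : ℝ, w s ≠ F 0) (hwind : ∫ θ in (0 : ℝ)..(2 * π), (l * I * cis θ *
      cexp ((b θ : ℂ) * I)) / (w θ - F 0) = 2 * π * I)
    {φ : ℝ → ℝ} (hφ : Continuous φ) (hEφ : ∀ θ : ℝ, E (cis θ) = w (φ θ))
    (hadd : (∀ θ, φ (θ + 2 * π) = φ θ + 2 * π) ∨ ∀ θ, φ (θ + 2 * π) = φ θ - 2 * π) :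
    ∀ θ, φ (θ + 2 * π) = φ θ + 2 * π := by
  refine hadd.resolve_right fun hneg => ?_
  set v : ℝ → ℂ := fun θ => l * I * cis θ * cexp ((b θ : ℂ) * I) with hv
  have hvn : ∀ θ, ‖v θ‖ = l := fun θ => by
    simp [hv, norm_exp_ofReal_mul_I, abs_of_pos h.pos]
  have hwc : Continuous fun θ => w θ - F 0 := h.lip.continuous.sub continuous_const
  have hw0 : ∀ θ, w θ - F 0 ≠ 0 := fun θ => sub_ne_zero.2 (hne θ)
  obtain ⟨C, hC⟩ := (isCompact_range_of_periodic (γ := fun θ => (w θ - F 0)⁻¹)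
    (hwc.inv₀ hw0) fun θ => by simp only [h.per θ]).isBounded.exists_norm_le
  have hvi : ∀ x y, IntervalIntegrable (fun t => v t / (w t - F 0)) volume x y := fun x y =>
    (h.intervalIntegrable x y).mul_continuousOn (hwc.inv₀ hw0).continuousOn
  have hexp := eq_mul_exp_integral_div (v := v) (C := (l * C).toNNReal)
    (h.lip.sub (LipschitzWith.const (F 0))) hw0
    (h.hasDerivAt.mono fun x hx => hx.sub_const _) hvi fun x => by
      rw [div_eq_mul_inv, norm_mul, hvn]
      exact (mul_le_mul_of_nonneg_left (hC _ ⟨x, rfl⟩) h.pos.le).trans (le_coe_toNNReal _)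
  obtain ⟨D, hD, hDe⟩ := exists_log_sub hF hinj hE hEF fun θ => hEφ θ ▸ hne _
  have hΛ : Continuous fun y => ∫ t in 0..y, v t / (w t - F 0) := continuous_primitive hvi 0
  have h1 := isPreconnected_univ.eq_of_exp_eq (c := w 0 - F 0)
    (d := fun θ : ℝ => θ * I + D (cis θ) - ∫ t in 0..φ θ, v t / (w t - F 0))
    (((by fun_prop : Continuous fun θ : ℝ => θ * I + D (cis θ)).sub
      (hΛ.comp hφ)).continuousOn) (fun θ _ => by
      have h2 := hexp (φ θ)
      rw [Complex.exp_sub, Complex.exp_add, ← hDe, hEφ, h2, mul_div_assoc,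
        div_self (Complex.exp_ne_zero _), mul_one]) (mem_univ (0 + 2 * π)) (mem_univ 0)
  beta_reduce at h1
  rw [exp_add_two_pi_mul_I, hneg] at h1
  have h3 : (∫ t in 0..φ 0 - 2 * π, v t / (w t - F 0)) + 2 * π * I =
      ∫ t in 0..φ 0, v t / (w t - F 0) := by
    have hp : Periodic (fun t => v t / (w t - F 0)) (2 * π) := fun t => by
      simp only [hv, h.per t, h.perAngle t, exp_add_two_pi_mul_I]
    have := hp.intervalIntegral_add_eq (φ 0 - 2 * π) 0
    rw [sub_add_cancel, zero_add, hwind] at this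
    rw [← this, intervalIntegral.integral_add_adjacent_intervals (hvi _ _) (hvi _ _)]
  rw [← h3] at h1
  have h4 : (4 * π : ℂ) * I = 0 := by
    push_cast at h1
    linear_combination h1
  simp [pi_ne_zero] at h4

lemma ae_of_ae_circ {p : ℝ → Prop} (hp : ∀ t, p (t + 2 * π) ↔ p t) (h : ∀ᵐ t ∂circ, p t) :
    ∀ᵐ t : ℝ, p t := by
  refine (isAddFundamentalDomain_Ioc two_pi_pos 0 volume).measure_zero_of_invariant {t | ¬p t} ?_ ?_
  · rintro ⟨g, k, rfl⟩
    have : ∀ t, p (t + k * (2 * π)) ↔ p t := fun t => by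
      have hP : Periodic p (2 * π) := fun t => propext (hp t)
      exact iff_of_eq (hP.int_mul k t)
    ext t
    rw [mem_vadd_set_iff_neg_vadd_mem]
    have := this (t + (-k : ℤ) * (2 * π))
    change ¬p (-(k • (2 * π)) + t) ↔ ¬p t
    rw [show -(k • (2 * π)) + t = t + (-k : ℤ) * (2 * π) by
      push_cast [zsmul_eq_mul]; ring, ← this]
    push_cast; ring_nf
  · rw [zero_add]
    rwa [ae_iff, Measure.restrict_apply₀' measurableSet_Ioc.nullMeasurableSet] at h

section

variable {l : ℝ} {w : ℝ → ℂ} {b φ : ℝ → ℝ} {v : ℝ → ℂ}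

lemma hasDerivAt_comp_of_sub_eq_integral (hv : ∀ x y, IntervalIntegrable v volume x y)
    (hw : ∀ x y, x ≤ y → w (φ y) - w (φ x) = ∫ t in x..y, I * cis t * v t) :
    ∀ᵐ t : ℝ, HasDerivAt (fun t => w (φ t)) (I * cis t * v t) t := by
  have hvi : ∀ x y, IntervalIntegrable
      (fun t : ℝ => I * cis t * v t) volume x y :=
    fun x y => (hv x y).continuousOn_mul (by fun_prop)
  filter_upwards [ae_hasDerivAt_integral_of_intervalIntegrable hvi] with t ht
  refine ((ht (t - 1)).const_add (w (φ (t - 1)))).congr_of_eventuallyEq ?_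
  filter_upwards [lt_mem_nhds (sub_one_lt t)] with x hx
  rw [← hw _ _ hx.le]; ring

lemma TangentAngle.ae_deriv_ne_zero (h : TangentAngle l w b)
    (hv : ∀ x y, IntervalIntegrable v volume x y) (hv0 : ∀ᵐ t, v t ≠ 0)
    (hw : ∀ x y, x ≤ y → w (φ y) - w (φ x) = ∫ t in x..y, I * cis t * v t)
    (hφ : StrictMono φ) : ∀ᵐ t, DifferentiableAt ℝ φ t ∧ deriv φ t ≠ 0 := by
  filter_upwards [hasDerivAt_comp_of_sub_eq_integral hv hw, hφ.monotone.ae_differentiableAt, hv0]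
    with t h1 h2 h3
  refine ⟨h2, fun h4 => h3 ?_⟩
  have h5 : HasDerivAt φ 0 t := h4 ▸ h2.hasDerivAt
  have h6 : HasDerivAt (fun t => w (φ t)) 0 t := by
    rw [hasDerivAt_iff_isLittleO] at h5 ⊢
    refine Asymptotics.IsBigO.trans_isLittleO (.of_bound l (.of_forall fun x => ?_)) h5
    simpa using h.norm_sub_le (φ t) (φ x)
  simpa using h1.unique h6

lemma ae_comp_of_deriv_ne_zero (hφ : StrictMono φ)
    (hd : ∀ᵐ t, DifferentiableAt ℝ φ t ∧ deriv φ t ≠ 0) {p : ℝ → Prop} (hp : ∀ᵐ t, p t) :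
    ∀ᵐ t, p (φ t) := by
  obtain ⟨N, hN, hNm, hN0⟩ := exists_measurable_superset_of_null (ae_iff.1 hp)
  set A := φ ⁻¹' N ∩ {t | DifferentiableAt ℝ φ t} with hA
  have hAm : MeasurableSet A :=
    (hφ.monotone.measurable hNm).inter (measurableSet_of_differentiableAt ℝ φ)
  have key := lintegral_image_eq_lintegral_abs_deriv_mul (f' := deriv φ) hAm
    (fun x hx => (hx.2 : DifferentiableAt ℝ φ x).hasDerivAt.hasDerivWithinAt)
    hφ.injective.injOn fun _ => 1
  have hz : volume (φ '' A) = 0 := measure_mono_null (image_subset_iff.2 inter_subset_left) hN0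
  simp only [lintegral_one, Measure.restrict_apply_univ, hz, mul_one] at key
  have h0 := (lintegral_eq_zero_iff (by fun_prop)).1 key.symm
  rw [EventuallyEq, ae_restrict_iff' hAm] at h0
  filter_upwards [h0, hd] with t h1 h2
  by_contra h3
  have := h1 ⟨hN h3, h2.1⟩
  simp [h2.2] at this

lemma TangentAngle.ae_eq_norm_mul_exp (h : TangentAngle l w b)
    (hv : ∀ x y, IntervalIntegrable v volume x y) (hv0 : ∀ᵐ t, v t ≠ 0)
    (hw : ∀ x y, x ≤ y → w (φ y) - w (φ x) = ∫ t in x..y, I * cis t * v t) (hφ : StrictMono φ) :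
    ∀ᵐ t, v t = ‖v t‖ * cexp ((b (φ t) + (φ t - t) : ℝ) * I) := by
  have hd := h.ae_deriv_ne_zero hv hv0 hw hφ
  filter_upwards [hd, hasDerivAt_comp_of_sub_eq_integral hv hw,
    ae_comp_of_deriv_ne_zero hφ hd h.hasDerivAt] with t h1 h2 h3
  have e := h2.unique (h3.scomp t h1.1.hasDerivAt)
  have hφ0 : 0 ≤ deriv φ t := hφ.monotone.deriv_nonneg
  have e2 : v t = ((deriv φ t * l : ℝ) : ℂ) * cexp ((b (φ t) + (φ t - t) : ℝ) * I) := by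
    refine mul_left_cancel₀ (mul_ne_zero I_ne_zero (Complex.exp_ne_zero (t * I))) ?_
    rw [e, real_smul]
    have : cexp ((φ t : ℂ) * I) * cexp ((b (φ t) : ℂ) * I) =
        cis t * cexp ((b (φ t) + (φ t - t) : ℝ) * I) := by
      rw [← Complex.exp_add, ← Complex.exp_add]; congr 1; push_cast; ring
    push_cast at this ⊢
    linear_combination (deriv φ t * l * I : ℂ) * this
  have e3 : ‖v t‖ = deriv φ t * l := by
    rw [e2, norm_mul, norm_exp_ofReal_mul_I, mul_one, norm_real, norm_eq_abs,
      abs_of_nonneg (mul_nonneg hφ0 h.pos.le)]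
  rw [e3]; exact e2

end

lemma CircL2.of_douglas_lt_top {u : ℝ → ℂ} (hm : Measurable u) (hp : Periodic u (2 * π))
    (hd : douglas u < ⊤) : CircL2 u := by
  refine ⟨hm, hp, ?_⟩
  have hK := measurable_douglasKernel hm
  have h1 : ∀ᵐ x ∂circ, ∫⁻ y, douglasKernel u x y ∂circ < ⊤ :=
    ae_lt_top hK.lintegral_prod_right' hd.ne
  have : (ae circ).NeBot := ae_neBot.2 fun h => by
    have := congr_arg (fun μ => μ univ) h
    simp [pi_pos.not_ge] at this
  obtain ⟨x, hx⟩ := h1.exists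
  have h2 : ∀ y, ‖u y‖ₑ ^ 2 ≤ 2 * ‖u x‖ₑ ^ 2 + 8 * douglasKernel u x y := fun y => by
    have h3 : ‖u x - u y‖ ^ 2 ≤ 4 * (‖u x - u y‖ ^ 2 / ‖cis x - cis y‖ ^ 2) := by
      rcases eq_or_ne (cis x) (cis y) with h | h
      · obtain ⟨k, rfl⟩ := exp_mul_I_eq_iff.1 h
        rw [(hp.int_mul k y : _)]; simp
      · have h4 := norm_pos_iff.2 (sub_ne_zero.2 h)
        have h5 := norm_exp_sub_exp_le_two x y
        rw [← mul_div_assoc, le_div_iff₀ (by positivity)]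
        rw [mul_comm 4]
        gcongr
        nlinarith
    rw [douglasKernel, ← ofReal_norm_sq, ← ofReal_norm_sq,
      ← ofReal_ofNat 2, ← ofReal_ofNat 8, ← ofReal_mul (by norm_num),
      ← ofReal_mul (by norm_num), ← ofReal_add (by positivity) (by positivity)]
    refine ofReal_le_ofReal ?_
    have h6 : ‖u y‖ ≤ ‖u x‖ + ‖u x - u y‖ := by
      have := norm_sub_le (u x) (u x - u y); simpa using this
    nlinarith [norm_nonneg (u y), sq_nonneg (‖u x‖ - ‖u x - u y‖), norm_nonneg (u x),
      norm_nonneg (u x - u y)]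
  refine (lintegral_mono h2).trans_lt ?_
  rw [lintegral_add_left measurable_const, lintegral_const, lintegral_const_mul' _ _ (by finiteness)]
  simp only [circ_univ]
  finiteness

lemma CircL2.exists_seq_tendsto_ae {u : ℝ → ℂ} (hu : CircL2 u) : ∃ v : ℕ → ℝ → ℂ,
    (∀ k, Continuous (v k)) ∧ (∀ k s, v k (s + 2 * π) = v k s) ∧ (∀ k, douglas (v k) ≤ douglas u) ∧
    ∀ᵐ t : ℝ, Tendsto (fun k => v k t) atTop (nhds (u t)) := by
  set p : Finset ℤ → ℝ → ℂ := fun S t => ∑ n ∈ S, fc u (-n) * cexp (-(n * t * I))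
  have hpc : ∀ S, Continuous (p S) := fun S => by fun_prop
  have hpp : ∀ S, Periodic (p S) (2 * π) := fun S s => by
    simp only [p, exp_neg_int_mul_add_two_pi]
  have hpu : ∀ S, CircL2 (p S) := fun S => .of_continuous (hpc S) (hpp S)
  have hfc : ∀ S m, fc (p S) m = if -m ∈ S then fc u m else 0 := fun S m => by
    rw [fc_sum_exp_neg, neg_neg]
  have hsum : ∑' n, ‖fc u (-n)‖ₑ ^ 2 ≠ ⊤ := fun h => by
    have := parseval hu.memLp
    rw [← (Equiv.neg ℤ).tsum_eq] at this
    simp only [Equiv.neg_apply] at this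
    rw [h, ENNReal.mul_top (ofReal_pos.2 two_pi_pos).ne'] at this
    exact hu.fin.ne this
  have h0 : Tendsto (fun S => ∫⁻ t, ‖u t - p S t‖ₑ ^ 2 ∂circ) atTop (nhds 0) := by
    have := ENNReal.Tendsto.const_mul (a := ofReal (2 * π))
      (ENNReal.tendsto_tsum_compl_atTop_zero hsum) (.inr ofReal_ne_top)
    rw [mul_zero] at this
    refine this.congr fun S => ?_
    rw [parseval (hu.sub (hpu S)).memLp, ← (Equiv.neg ℤ).tsum_eq fun n => ‖fc _ n‖ₑ ^ 2]
    congr 1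
    refine (tsum_subtype {n | n ∉ S} fun n => ‖fc u (-n)‖ₑ ^ 2).trans (tsum_congr fun n => ?_)
    rw [Equiv.neg_apply, fc_sub hu.integrable (hpu S).integrable, hfc, neg_neg]
    by_cases hn : n ∈ S <;> simp [hn]
  obtain ⟨S, -, hS⟩ := exists_seq_tendsto_zero_ae
    (.of_forall fun S => ((hu.sub (hpu S)).meas.enorm.pow_const 2)) h0
  refine ⟨fun k => p (S k), fun k => hpc _, fun k => hpp _, fun k => ?_,
    ae_of_ae_circ (fun t => by simp only [hpp _ t, hu.per t]) ?_⟩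
  · rw [douglas_eq_tsum hu, douglas_eq_tsum (hpu _)]
    refine mul_le_mul_right (ENNReal.tsum_le_tsum fun n => ?_) _
    rw [hfc]
    split_ifs <;> simp
  · filter_upwards [hS] with t ht
    rw [tendsto_iff_edist_tendsto_0]
    refine (tendsto_zero_of_sq ht).congr fun k => ?_
    rw [edist_comm, edist_eq_enorm_sub]

lemma lintegral_lintegral_le_of_tendsto {μ : Measure ℝ} [SFinite μ] {K : ℕ → ℝ → ℝ → ENNReal}
    {k : ℝ → ℝ → ENNReal} {A : ENNReal} (hm : ∀ n, Measurable fun p : ℝ × ℝ => K n p.1 p.2)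
    (hk : ∀ᵐ x ∂μ, ∀ᵐ y ∂μ, Tendsto (fun n => K n x y) atTop (nhds (k x y)))
    (hA : ∀ n, ∫⁻ x, ∫⁻ y, K n x y ∂μ ∂μ ≤ A) : ∫⁻ x, ∫⁻ y, k x y ∂μ ∂μ ≤ A := by
  refine (lintegral_mono_ae ?_).trans
    ((lintegral_liminf_le fun n => (hm n).lintegral_prod_right').trans
      (Filter.liminf_le_of_frequently_le' (Frequently.of_forall (f := atTop) hA)))
  filter_upwards [hk] with x hx
  refine (lintegral_mono_ae ?_).trans
    (lintegral_liminf_le fun n => (hm n).comp measurable_prodMk_left)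
  filter_upwards [hx] with y hy
  exact (Tendsto.liminf_eq hy).ge

lemma CircL2.douglas_comp_le {u : ℝ → ℂ} (hu : CircL2 u) {φ : ℝ → ℝ} (hφ : Continuous φ)
    (hφ0 : ∀ p : ℝ → Prop, (∀ᵐ t, p t) → ∀ᵐ t, p (φ t)) {C : NNReal}
    (hC : ∀ u : ℝ → ℂ, Continuous u → (∀ s, u (s + 2 * π) = u s) →
      douglas (fun θ => u (φ θ)) ≤ C * douglas u) :
    douglas (fun θ => u (φ θ)) ≤ C * douglas u := by
  obtain ⟨v, hvc, hvp, hvd, hv⟩ := hu.exists_seq_tendsto_ae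
  have hae := ae_restrict_of_ae (s := Ioc 0 (2 * π)) (hφ0 _ hv)
  refine lintegral_lintegral_le_of_tendsto
    (K := fun k => douglasKernel fun θ => v k (φ θ))
    (fun k => measurable_douglasKernel ((hvc k).comp hφ).measurable) ?_
    fun k => (hC _ (hvc k) (hvp k)).trans (mul_le_mul_right (hvd k) _)
  filter_upwards [hae] with x hx
  filter_upwards [hae] with y hy
  exact (ENNReal.continuous_ofReal.tendsto _).comp (((hx.sub hy).norm.pow 2).div_const _)

lemma IsBdryOne.fc_eq_zc {f : ℂ → ℂ} {v : ℝ → ℂ} (hv : IsBdryOne f v) {a : ℕ → ℂ} (h : PS a f)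
    (n : ℤ) : fc v n = zc a n := by
  have h1 := (hv.tendsto_integral_mul two_pi_pos.le (M := 1)
    (h := fun _ t => cexp (-(n * t * I)))
    (h₁ := fun t => cexp (-(n * t * I))) (.of_forall fun r => by fun_prop)
    (.of_forall fun r t => by simp [norm_exp]) fun t => tendsto_const_nhds).const_mul
    (1 / (2 * π) : ℂ)
  have h2 : Tendsto (fun r : ℝ => zc (fun k => a k * r ^ k) n)
      (𝓝[<] 1) (nhds (zc a n)) := by
    obtain ⟨k, rfl⟩ | hn := em (n ∈ range ((↑) : ℕ → ℤ))
    · refine tendsto_nhdsWithin_of_tendsto_nhds ?_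
      simp only [zc_natCast]
      exact (Continuous.tendsto' (by fun_prop) _ _ (by simp))
    · simp only [zc_of_notMem_range _ hn]
      exact tendsto_const_nhds
  refine tendsto_nhds_unique h1 (h2.congr' ?_)
  filter_upwards [eventually_mem_Ico_one] with r hr
  exact (h.fc_circle hr.1 hr.2 n).symm

/-- A holomorphic function whose boundary values lie on a line through the origin is constant. -/
lemma IsBdryOne.eq_const {f : ℂ → ℂ} {v : ℝ → ℂ} (hv : IsBdryOne f v) {d : ℂ} (hd : d ≠ 0)
    (h : ∀ᵐ t ∂circ, (starRingEnd ℂ) (v t) = d * v t) : ∀ z ∈ 𝔻, f z = f 0 := by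
  have hps := PS.of_differentiableOn hv.diff
  set a : ℕ → ℂ := fun n => (n.factorial : ℂ)⁻¹ * iteratedDeriv n f 0
  have ha : ∀ n : ℕ, n ≠ 0 → a n = 0 := fun n hn => by
    have h1 := fc_congr h (n : ℤ)
    rw [fc_conj, fc_const_mul, hv.fc_eq_zc hps, hv.fc_eq_zc hps, zc_natCast,
      zc_of_notMem_range a (by rintro ⟨m, hm⟩; omega), map_zero] at h1
    simpa [hd] using h1.symm
  intro z hz
  rw [← hps.coeff_zero]
  refine (hps z hz).unique ?_
  convert! hasSum_single (f := fun n => a n * z ^ n) 0 fun n hn => by simp [ha n hn] using 1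
  simp

lemma lintegral_deriv_lt_top_of_angle {F g : ℂ → ℂ} {s : ℝ → ℂ} {H : ℝ → ℝ}
    (hg : ∀ z ∈ 𝔻, HasDerivAt g (deriv (deriv F) z / deriv F z) z)
    (hs : IsBdry (fun z => cexp (g z / 2)) s)
    (hH : CircL2 fun t => (H t : ℂ)) (hHd : douglas (fun t => (H t : ℂ)) < ⊤)
    (hsH : ∀ᵐ t ∂circ, s t * s t = ‖s t * s t‖ * cexp (H t * I)) :
    ∫⁻ z in 𝔻, ofReal (‖deriv (deriv F) z / deriv F z‖ ^ 2) < ⊤ := by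
  set h : ℤ → ℂ := fc fun t => (H t : ℂ) with hh
  set α : ℕ → ℂ := fun n => if n = 0 then 0 else -I * h n with hα
  have hconj : ∀ n, (starRingEnd ℂ) (h (-n)) = h n := fun n => by
    rw [hh, ← fc_conj]; simp only [conj_ofReal]
  have hA : ∑' n : ℕ, n * ‖α n‖ₑ ^ 2 < ⊤ := by
    refine lt_of_le_of_lt ?_ (hH.tsum_lt_top hHd)
    refine le_trans (ENNReal.tsum_le_tsum fun n => ?_)
      (tsum_comp_le_tsum_of_injective Nat.cast_injective
        fun n : ℤ => (n.natAbs : ENNReal) * ‖h n‖ₑ ^ 2)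
    by_cases hn : n = 0
    · simp [hn]
    · simp [hα, hn, enorm_mul, ← ofReal_norm I]
  have hps := PS.of_tsum_sq ((PS.tsum_sq_le (by simp [hα])).trans_lt hA)
  obtain ⟨p, hp, hpc, hpe, -⟩ := hps.exists_isBdry_exp (by simp [hα])
    (ofReal_toReal hA.ne).ge ENNReal.toReal_nonneg
  set f : ℂ → ℂ := fun z => ∑' n, α n * z ^ n
  have him : (fun t => p t - (starRingEnd ℂ) (p t)) =ᵐ[circ]
      fun t => -I * (H t - h 0) := by
    refine (hp.circL2.sub hp.circL2.conj).ae_eq_of_fc_eq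
      ((hH.sub (.const _)).const_mul _) fun n => ?_
    rw [fc_sub hp.circL2.integrable hp.circL2.conj.integrable, fc_conj, fc_const_mul,
      fc_sub hH.integrable (CircL2.const _).integrable, hpc, hpc, fc_const]
    rcases lt_trichotomy n 0 with hn | rfl | hn
    · obtain ⟨k, hk⟩ := Int.eq_ofNat_of_zero_le (neg_pos.2 hn).le
      rw [zc_of_notMem_range α (by rintro ⟨m, hm⟩; omega), hk, zc_natCast]
      have : k ≠ 0 := by omega
      simp only [hα, this, if_false, hn.ne, map_mul, map_neg, Complex.conj_I, ← hk, hconj]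
      change _ = -I * (h n - 0)
      ring
    · have : zc α 0 = 0 := zc_natCast α 0
      rw [neg_zero, this]
      simp [← hh]
    · obtain ⟨k, rfl⟩ := Int.eq_ofNat_of_zero_le hn.le
      rw [zc_of_notMem_range α (n := -(k : ℤ)) (by rintro ⟨m, hm⟩; omega), zc_natCast]
      have : k ≠ 0 := by omega
      simp [hα, this, ← hh]
  have hq := hs.mul hpe
  have hconst := hq.eq_const (d := cexp (-(h 0 * I))) (Complex.exp_ne_zero _) (by
    filter_upwards [him, hsH] with t h1 h2
    set y := s t * cexp (p t) with hy
    have e1 : y * y = ‖y‖ ^ 2 * cexp (h 0 * I) := by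
      have e2 : ‖y‖ = ‖s t‖ * ‖cexp (p t)‖ := by rw [hy, norm_mul]
      have e3 : ((‖cexp (p t)‖ ^ 2 : ℝ) : ℂ) = cexp (p t + (starRingEnd ℂ) (p t)) := by
        rw [← normSq_eq_norm_sq, ← mul_conj, ← Complex.exp_conj, Complex.exp_add]
      calc y * y = s t * s t * cexp (p t + p t) := by rw [hy, Complex.exp_add]; ring
        _ = ‖s t‖ ^ 2 * (cexp (H t * I) * cexp (p t + p t)) := by
            rw [h2, norm_mul]; push_cast; ring
        _ = ‖s t‖ ^ 2 * (cexp (p t + (starRingEnd ℂ) (p t)) * cexp (h 0 * I)) := by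
            rw [← Complex.exp_add, ← Complex.exp_add]
            congr 2
            linear_combination h1
        _ = _ := by rw [← e3, e2]; push_cast; ring
    rcases eq_or_ne y 0 with h0 | h0
    · simp [h0]
    refine mul_left_cancel₀ h0 ?_
    rw [mul_conj, normSq_eq_norm_sq, mul_left_comm, e1, Complex.exp_neg]
    push_cast
    field_simp)
  have hfd : ∀ z ∈ 𝔻, DifferentiableAt ℂ f z := fun z hz =>
    hps.differentiableOn.differentiableAt (isOpen_ball.mem_nhds hz)
  have hder : ∀ z ∈ 𝔻, deriv (deriv F) z / deriv F z = -2 * deriv f z := by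
    intro z hz
    have h1 := ((hg z hz).div_const 2).cexp.mul (hfd z hz).hasDerivAt.cexp
    have h2 : HasDerivAt (fun z => cexp (g z / 2) * cexp (f z)) 0 z :=
      (hasDerivAt_const z _).congr_of_eventuallyEq (EqOn.eventuallyEq_of_mem
        (fun z hz => hconst z hz) (isOpen_ball.mem_nhds hz))
    have h3 := h1.unique h2
    have h4 := mul_ne_zero (Complex.exp_ne_zero (g z / 2)) (Complex.exp_ne_zero (f z))
    refine mul_left_cancel₀ h4 ?_
    linear_combination 2 * h3
  calc _ = ∫⁻ z in 𝔻, 4 * ‖deriv f z‖ₑ ^ 2 := by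
        refine setLIntegral_congr_fun measurableSet_ball fun z hz => ?_
        rw [hder z hz, ofReal_norm_sq, enorm_mul, mul_pow, enorm_neg, ← ofReal_norm]
        norm_num
    _ < ⊤ := by
        rw [lintegral_const_mul' _ _ (by finiteness), hps.lintegral_deriv_sq]
        finiteness

theorem TangentAngle.lintegral_lt_top {l : ℝ} {w : ℝ → ℂ} {b : ℝ → ℝ} (h : TangentAngle l w b)
    {F : ℂ → ℂ} (hF : DifferentiableOn ℂ F 𝔻) (hinj : InjOn F 𝔻)
    (hb : IsBounded (F '' 𝔻)) (hfr : frontier (F '' 𝔻) ⊆ range w)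
    (hdisj : Disjoint (F '' 𝔻) (range w)) (hwind : ∫ θ in (0 : ℝ)..(2 * π), (l * I * cis θ *
      cexp ((b θ : ℂ) * I)) / (w θ - F 0) = 2 * π * I) :
    ∫⁻ z in 𝔻, ofReal (‖deriv (deriv F) z / deriv F z‖ ^ 2) < ⊤ := by
  have hdis : ∀ s, w s ∉ F '' 𝔻 := fun s hs => disjoint_left.1 hdisj hs ⟨s, rfl⟩
  obtain ⟨E, hE, hEF, -, φ, hφ, hEφ, hφi, hadd⟩ := exists_boundary_lift h.lip.continuous h.per h.inj
    h.boundedTurning hF hinj hb hfr hdisj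
  have hadd' := h.reparam_add hF hinj hE hEF
    (fun s hs => hdis s ⟨0, mem_ball_self one_pos, hs.symm⟩) hwind hφ hEφ hadd
  have hmono : StrictMono φ := hφ.strictMono_of_inj hφi |>.resolve_right fun ha => by
    have h1 := hadd' 0
    have h2 := ha (show (0 : ℝ) < 0 + 2 * π by have := pi_pos; linarith)
    have := pi_pos
    linarith
  obtain ⟨g, s, hg, -, hs, hs0, hv⟩ := exists_sqrt_deriv hF hinj hE hEF (κ := fun x => l * φ x)
    (L := l * (2 * π)) (fun x y hxy => by
      rw [hEφ, hEφ, ← mul_sub, ← abs_of_nonneg (sub_nonneg.2 (hmono.monotone hxy))]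
      exact h.norm_sub_le _ _) fun x => by rw [hadd', mul_add]
  have hbd : ∀ θ : ℝ, Tendsto (fun r : ℝ => F (r * cis θ))
      (𝓝[<] 1) (nhds (w (φ θ))) := fun θ => hEφ θ ▸ tendsto_radial hE hEF θ
  have hw : ∀ x y, x ≤ y → w (φ y) - w (φ x) = ∫ t in x..y, I * cis t * (s t * s t) :=
    fun x y hxy => hv.sub_eq_integral hF hbd hxy
  have hv0 : ∀ᵐ t, s t * s t ≠ 0 := by
    refine ae_of_ae_circ (fun t => by rw [hs.circL2.per t]) ?_
    filter_upwards [hs0] with t ht using mul_ne_zero ht ht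
  obtain ⟨c, hc, hca⟩ := h.exists_chordArc
  obtain ⟨C, hC⟩ := exists_douglas_comp_le hF hinj hb h.lip h.per hdis hc hca hφ hadd hbd
  have hbm := measurable_ofReal.comp h.meas
  have hbL := CircL2.of_douglas_lt_top hbm (fun θ => congr_arg Complex.ofReal (h.perAngle θ))
    h.douglas_lt_top
  have hdφ := (hbL.douglas_comp_le hφ (fun p => ae_comp_of_deriv_ne_zero hmono
    (h.ae_deriv_ne_zero hv.intervalIntegrable hv0 hw hmono)) hC).trans_lt
      (mul_lt_top ENNReal.coe_lt_top h.douglas_lt_top)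
  have hbφ := CircL2.of_douglas_lt_top (hbm.comp hφ.measurable) (fun θ => by
    simp only [Function.comp_apply, hadd', h.perAngle]) hdφ
  have hid : CircL2 fun θ => ((φ θ - θ : ℝ) : ℂ) := .of_continuous (by fun_prop) fun θ => by
    rw [hadd']; push_cast; ring
  have hH := hbφ.add hid
  have hHd := hbφ.douglas_add_lt_top hid hdφ (douglas_sub_id_lt_top hφ hadd' hC)
  refine lintegral_deriv_lt_top_of_angle (H := fun t => b (φ t) + (φ t - t)) hg hs ?_ ?_
    (ae_restrict_of_ae (h.ae_eq_norm_mul_exp hv.intervalIntegrable hv0 hw hmono))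
  · simpa only [Complex.ofReal_add] using! hH
  · simpa only [Complex.ofReal_add] using! hHd

end

theorem wp_quasicircle_iff_tangent_angle_in_Hhalf
    -- the Jordan curve `Γ = range γ`, parametrized `2π`-periodically and injectively
    (γ : ℝ → ℂ) (hγc : Continuous γ) (hγp : ∀ θ, γ (θ + 2 * π) = γ θ)
    (hγi : Set.InjOn γ (Set.Ico 0 (2 * π)))
    -- `Γ` is a quasicircle: Ahlfors' bounded turning condition
    (hqc : ∃ C : ℝ, 0 < C ∧ ∀ s t : ℝ, s ≤ t → t ≤ s + 2 * π →
      min (Metric.diam (γ '' Set.Icc s t)) (Metric.diam (γ '' Set.Icc t (s + 2 * π)))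
        ≤ C * ‖γ s - γ t‖)
    -- interior `Ω` and exterior `Ωstar`
    (Ω Ωstar : Set ℂ)
    (hΩo : IsOpen Ω) (hΩconn : IsConnected Ω) (hΩso : IsOpen Ωstar)
    (hΩsconn : IsConnected Ωstar) (hdisj : Disjoint Ω Ωstar)
    (hunion : Ω ∪ Ωstar = (Set.range γ)ᶜ)
    (hΩbdd : Bornology.IsBounded Ω) (hΩsunbdd : ¬ Bornology.IsBounded Ωstar)
    -- the interior Riemann map `F : 𝔻 → Ω`
    (F : ℂ → ℂ) (hF : DifferentiableOn ℂ F (ball (0 : ℂ) 1))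
    (hFbij : Set.BijOn F (ball (0 : ℂ) 1) Ω) :
    (∫⁻ z in ball (0 : ℂ) 1,
        ENNReal.ofReal (‖deriv (deriv F) z / deriv F z‖ ^ 2)) < ⊤ ↔
      ∃ ℓ : ℝ, 0 < ℓ ∧ ∃ w : ℝ → ℂ, ∃ b : ℝ → ℝ,
        -- `w` is a (constant-speed) arclength parametrization of `Γ`, of total length `ℓ`
        LipschitzWith (Real.toNNReal (ℓ / (2 * π))) w ∧
        (∀ θ, w (θ + 2 * π) = w θ) ∧
        Set.InjOn w (Set.Ico 0 (2 * π)) ∧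
        Set.range w = Set.range γ ∧
        -- `b` is `2π`-periodic and measurable
        Measurable b ∧ (∀ θ, b (θ + 2 * π) = b θ) ∧
        -- `w'(θ) = (ℓ/2π)·i·e^{iθ}·e^{i b(θ)}` for a.e. `θ`
        (∀ᵐ θ : ℝ, HasDerivAt w
          (((ℓ / (2 * π) : ℝ) : ℂ) * Complex.I * Complex.exp (θ * Complex.I) *
            Complex.exp ((b θ : ℂ) * Complex.I)) θ) ∧
        -- `w` is positively oriented: winding number `1` around points of `Ω`
        (∀ z ∈ Ω, ∫ θ in (0 : ℝ)..(2 * π),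
            (((ℓ / (2 * π) : ℝ) : ℂ) * Complex.I * Complex.exp (θ * Complex.I) *
              Complex.exp ((b θ : ℂ) * Complex.I)) / (w θ - z)
          = 2 * (π : ℂ) * Complex.I) ∧
        -- `b` has finite `Ḣ^{1/2}(S¹)` seminorm
        sobolevSeminorm (1 / 2) (fun θ => (b θ : ℂ)) < ⊤ := by
  have hinj := hFbij.injOn
  have himg : F '' ball 0 1 = Ω := hFbij.image_eq
  have hdΓ : Disjoint Ω (Set.range γ) := by
    rw [← Set.subset_compl_iff_disjoint_right, ← hunion]
    exact Set.subset_union_left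
  have hfr : frontier Ω ⊆ Set.range γ := fun z hz => by
    by_contra hzΓ
    rw [hΩo.frontier_eq] at hz
    have hz' : z ∈ Ω ∪ Ωstar := hunion ▸ hzΓ
    exact (hdisj.symm.closure_right hΩso).le_bot ⟨hz'.resolve_left hz.2, hz.1⟩
  have e : ∀ u : ℝ → ℂ, sobolevSeminorm (1 / 2) u = douglas u := sobolevSeminorm_half
  constructor
  · intro hfin
    obtain ⟨E, hE, hEF, hEi, φ, hφ, hEφ, -, hadd⟩ := exists_boundary_lift hγc hγp hγi hqc hF hinj
      (himg ▸ hΩbdd) (himg ▸ hfr) (himg ▸ hdΓ)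
    have hr : Set.range (fun θ : ℝ => E (Complex.exp (θ * Complex.I))) = Set.range γ := by
      simp only [hEφ]
      refine Function.Surjective.range_comp ?_ γ
      rcases hadd with h | h
      · exact surjective_of_add hφ h
      · intro y
        obtain ⟨x, hx⟩ := surjective_of_add hφ.neg (fun θ => by simp only [Pi.neg_apply, h]; ring) (-y)
        exact ⟨x, neg_injective hx⟩
    obtain ⟨l, hl, w, b, h⟩ := exists_arclength_of_lintegral_lt_top hF hinj (himg ▸ hΩbdd) hE hEF hEi
      (fun θ hθ => Set.disjoint_left.1 hdΓ (himg ▸ hθ) (hEφ θ ▸ ⟨φ θ, rfl⟩)) hfin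
    refine ⟨l * (2 * π), mul_pos hl two_pi_pos, w, b, ?_⟩
    rw [mul_div_cancel_right₀ _ two_pi_pos.ne', e]
    rwa [hr, himg] at h
  · rintro ⟨ℓ, hℓ, w, b, hlip, hper, hwi, hr, hbm, hbp, hder, hwind, hsob⟩
    have h : TangentAngle (ℓ / (2 * π)) w b :=
      ⟨div_pos hℓ two_pi_pos, hlip, hper, hwi, hbm, hbp, hder, e _ ▸ hsob⟩
    exact h.lintegral_lt_top hF hinj (himg ▸ hΩbdd) (himg ▸ hr ▸ hfr) (himg ▸ hr ▸ hdΓ)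
      (hwind _ (himg ▸ Set.mem_image_of_mem F (mem_ball_self one_pos)))
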